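/- Up to isomorphism, there exists exactly one congruence function field with exact field of constants 𝔽₂ having genus 4 and class number 1. -/

import Mathlib

set_option synthInstance.maxHeartbeats 1000000
set_option maxHeartbeats 1000000

open scoped Classical

noncomputable section

namespace CFF

variable (F : Type*) [Field F]

/-- `K` is a (congruence) function field in one variable over `F`: a finitely
generated field extension of transcendence degree one. -/
def IsFunctionField (K : Type*) [Field K] [Algebra F K] : Prop :=
  ∃ x : K, Transcendental F x ∧
    FiniteDimensional (IntermediateField.adjoin F {x}) K

/-- The exact field of constants of `K` is `F`: every element of `K` algebraic
over `F` already lies in `F`. -/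
def HasExactConstants (K : Type*) [Field K] [Algebra F K] : Prop :=
  ∀ a : K, IsAlgebraic F a → a ∈ (algebraMap F K).range

variable (K : Type*) [Field K] [Algebra F K]

/-- A place of the function field `K/F`: a proper valuation subring of `K`
containing the constants. -/
def IsPlace (O : ValuationSubring K) : Prop :=
  O ≠ ⊤ ∧ ∀ c : F, algebraMap F K c ∈ O

/-- The type of places (prime divisors) of `K/F`. -/
def Place := {O : ValuationSubring K // IsPlace F K O}

variable {K}

/-- `𝔪`-adic order of an element of a valuation subring. -/
def ordAux (O : ValuationSubring K) (x : O) : ℕ :=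
  sSup {n : ℕ | x ∈ IsLocalRing.maximalIdeal O ^ n}

/-- The order (normalized valuation) of `f ∈ K` at a valuation subring `O`. -/
def ordAt (O : ValuationSubring K) (f : K) : ℤ :=
  if h : f ∈ O then (ordAux O ⟨f, h⟩ : ℤ)
  else -(ordAux O ⟨f⁻¹, (O.mem_or_inv_mem f).resolve_left h⟩ : ℤ)

/-- The constants embed into (the valuation ring of) any place. -/
def constHom (p : Place F K) : F →+* p.1 :=
  (algebraMap F K).codRestrict p.1.toSubring fun c => p.2.2 c

/-- The map from the constants to the residue field of a place. -/
def residueHom (p : Place F K) : F →+* IsLocalRing.ResidueField p.1 :=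
  (IsLocalRing.residue (p.1 : ValuationSubring K)).comp (constHom F p)

/-- The degree of a place: the dimension of its residue field over the
constants. -/
def placeDegree (p : Place F K) : ℕ :=
  letI := (residueHom F p).toAlgebra
  Module.finrank F (IsLocalRing.ResidueField p.1)

variable (K)

/-- The group of divisors of `K/F`. -/
abbrev Divisor := Place F K →₀ ℤ

/-- The degree homomorphism on divisors. -/
def degHom : Divisor F K →+ ℤ :=
  Finsupp.liftAddHom fun p => AddMonoidHom.mulRight (placeDegree F p : ℤ)

variable {K}

/-- The Riemann-Roch space `L(D)` of a divisor `D` (the span coincides with the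
set of `f` with `div f ≥ -D`, which is an `F`-subspace). -/
def RRspace (D : Divisor F K) : Submodule F K :=
  Submodule.span F {f : K | ∀ p : Place F K, 0 ≤ D p + ordAt p.1 f}

/-- `ℓ(D)`, the dimension of the Riemann-Roch space of `D`. -/
def ell (D : Divisor F K) : ℕ := Module.finrank F (RRspace F D)

variable (K)

/-- The genus of `K/F`, via Riemann's theorem: `g = max_D (deg D + 1 - ℓ(D))`. -/
def genus : ℕ :=
  sSup {g : ℕ | ∃ D : Divisor F K, (g : ℤ) = degHom F K D + 1 - ell F D}

/-- The subgroup of divisors of degree zero. -/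
def zeroDivisors : AddSubgroup (Divisor F K) := (degHom F K).ker

/-- The subgroup of principal divisors. -/
def principalDivisors : AddSubgroup (Divisor F K) :=
  AddSubgroup.closure
    {D : Divisor F K | ∃ f : K, f ≠ 0 ∧ ∀ p : Place F K, D p = ordAt p.1 f}

/-- The group of divisor classes of degree zero of `K/F`. -/
def ClassGroup0 :=
  zeroDivisors F K ⧸ (principalDivisors F K).addSubgroupOf (zeroDivisors F K)

instance : AddGroup (ClassGroup0 F K) := by
  unfold ClassGroup0; infer_instance

/-- The class number of `K/F`: the order of the group of divisor classes of
degree zero. -/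
def classNumber : ℕ := Nat.card (ClassGroup0 F K)

section Extension

variable {k L : Type*} [Field k] [Field L] [Algebra F k] [Algebra F L] [Algebra k L]

/-- A place `P` of `L` lies over the place `p` of `k`. -/
def LiesOver (P : Place F L) (p : Place F k) : Prop :=
  P.1.comap (algebraMap k L) = p.1

variable (L)

/-- `p` is inert in `L/k`: there is a unique place of `L` above `p`, and its
degree is `[L:k] · deg p` (i.e. the residue degree is `[L:k]`, so `e = 1`). -/
def IsInert (p : Place F k) : Prop :=
  ∃ P : Place F L, LiesOver F P p ∧
    placeDegree F P = Module.finrank k L * placeDegree F p ∧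
    ∀ P' : Place F L, LiesOver F P' p → P' = P

/-- `p` splits completely in `L/k`: there are `[L:k]` places above `p`, each of
the same degree as `p`. -/
def SplitsCompletely (p : Place F k) : Prop :=
  Nat.card {P : Place F L // LiesOver F P p} = Module.finrank k L ∧
    ∀ P : Place F L, LiesOver F P p → placeDegree F P = placeDegree F p

/-- `p` is totally ramified in `L/k`: there is a unique place above `p`, of the
same degree (so `f = 1` and `e = [L:k]`). -/
def IsTotallyRamified (p : Place F k) : Prop :=
  ∃ P : Place F L, LiesOver F P p ∧ placeDegree F P = placeDegree F p ∧
    ∀ P' : Place F L, LiesOver F P' p → P' = P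

/-- `p` is unramified in `L/k`: at every place above `p` the orders of elements
of `k` are preserved (`e = 1`). -/
def IsUnramifiedAt (p : Place F k) : Prop :=
  ∀ P : Place F L, LiesOver F P p →
    ∀ x : k, ordAt P.1 (algebraMap k L x) = ordAt p.1 x

end Extension

section Rational

/-- The finite place of `𝔽₂(T)` corresponding to an irreducible polynomial `P`:
the place contains all polynomials and `P` lies in its maximal ideal. -/
def IsFinitePlaceOf (p : Place (ZMod 2) (RatFunc (ZMod 2)))
    (P : Polynomial (ZMod 2)) : Prop :=
  (∀ g : Polynomial (ZMod 2), algebraMap (Polynomial (ZMod 2)) (RatFunc (ZMod 2)) g ∈ p.1) ∧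
    (algebraMap (Polynomial (ZMod 2)) (RatFunc (ZMod 2)) P)⁻¹ ∉ p.1

/-- The infinite place `𝔭_∞` of `𝔽₂(T)`: the place where `T` has a pole. -/
def IsInfinitePlace (p : Place (ZMod 2) (RatFunc (ZMod 2))) : Prop :=
  RatFunc.X ∉ p.1

end Rational

end CFF

set_option linter.unusedSectionVars false

namespace CFF

local notation "F₂" => ZMod 2

local notation "ℕ³" => ℕ × ℕ × ℕ

local notation "deg₂" => placeDegree (F := F₂)

local notation "N(" t "," s ")" => s ^ 2 + t * s + t ^ 2

open Finsupp (single single_eq_same single_eq_of_ne single_apply)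
open IsLocalRing (ResidueField residue)
open Module (finrank)

section Finiteness

open Polynomial IntermediateField
open scoped IntermediateField.algebraAdjoinAdjoin

variable {F K : Type*} [Field F] [Field K] [Algebra F K]

/-- A function field is finite over the subfield generated by any transcendental element. -/
lemma IsFunctionField.finiteDimensional_adjoin (h : IsFunctionField F K) {x : K}
    (hx : Transcendental F x) : FiniteDimensional F⟮x⟯ K := by
  obtain ⟨t, -, hf⟩ := h
  have e1 : Algebra.EssFiniteType F F⟮t⟯ :=
    essFiniteType_iff.2 (fg_adjoin_of_finite (Set.finite_singleton t))
  have e2 : Algebra.EssFiniteType F K := Algebra.EssFiniteType.comp F F⟮t⟯ K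
  have e3 : Algebra.EssFiniteType F⟮x⟯ K := Algebra.EssFiniteType.of_comp F F⟮x⟯ K
  have a1 : Algebra.IsAlgebraic (Algebra.adjoin F {t}) K :=
    Algebra.IsAlgebraic.trans (Algebra.adjoin F {t}) F⟮t⟯ K
  have htr := Algebra.IsAlgebraic.trdeg_le_cardinalMk F {t} (A := K)
  have hx1 : AlgebraicIndependent F (fun _ : Unit => x) :=
    algebraicIndependent_unique_type_iff.2 hx
  have hb := hx1.isTranscendenceBasis_of_lift_trdeg_le_of_finite (by simpa using htr)
  have hal := hb.isAlgebraic
  have hr : Set.range (fun _ : Unit => x) = {x} := by simp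
  rw [hr] at hal
  have : Algebra.IsAlgebraic F⟮x⟯ K :=
    ⟨fun a => (hal.isAlgebraic a).extendScalars
      (FaithfulSMul.algebraMap_injective (Algebra.adjoin F {x}) F⟮x⟯)⟩
  exact Algebra.finite_of_essFiniteType_of_isAlgebraic

/-- Linear independence over the polynomial ring generated by `x`. -/
def PolyIndep (F : Type*) [Field F] {K : Type*} [Field K] [Algebra F K] (x : K)
    {ι : Type*} [Fintype ι] (f : ι → K) : Prop :=
  ∀ r : ι → F[X], ∑ i, aeval x (r i) * f i = 0 → ∀ i, r i = 0

lemma polyIndep_iff {x : K} (hx : Transcendental F x) {ι : Type*} [Fintype ι] (f : ι → K) :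
    PolyIndep F x f ↔ LinearIndependent F⟮x⟯ f := by
  rw [← LinearIndependent.iff_fractionRing (Algebra.adjoin F {x}) F⟮x⟯,
    Fintype.linearIndependent_iff]
  have hm : ∀ r : F[X], aeval x r ∈ Algebra.adjoin F {x} := fun r => aeval_mem_adjoin_singleton F x
  constructor
  · intro h g hg i
    have : ∀ j, ∃ r : F[X], aeval x r = (g j : K) := fun j =>
      (Algebra.adjoin_singleton_eq_range_aeval F x).le (g j).2
    choose r hr using this
    have h2 := h r (by simp only [hr]; exact hg) i
    apply Subtype.ext
    rw [← hr i, h2]; simp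
  · intro h r hr i
    have := h (fun j => ⟨aeval x (r j), hm _⟩) hr i
    have := congrArg Subtype.val this
    exact (injective_iff_map_eq_zero _).1 (transcendental_iff_injective.1 hx) _ this

lemma PolyIndep.card_le (h : IsFunctionField F K) {x : K} (hx : Transcendental F x)
    {ι : Type*} [Fintype ι] {f : ι → K} (hf : PolyIndep F x f) :
    Fintype.card ι ≤ finrank F⟮x⟯ K := by
  have := h.finiteDimensional_adjoin hx
  exact ((polyIndep_iff hx f).1 hf).fintype_card_le_finrank

lemma exists_polyIndep (h : IsFunctionField F K) {x : K} (hx : Transcendental F x) :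
    ∃ f : Fin (finrank F⟮x⟯ K) → K, PolyIndep F x f := by
  have := h.finiteDimensional_adjoin hx
  exact ⟨_, (polyIndep_iff hx _).2 (Module.finBasis F⟮x⟯ K).linearIndependent⟩

/-- A family is independent over `F[x]` as soon as every relation has all constant coefficients
zero. -/
lemma polyIndep_of_coeff_zero {x : K} (hx : x ≠ 0) {ι : Type*} [Fintype ι] {f : ι → K}
    (h : ∀ r : ι → F[X], ∑ i, aeval x (r i) * f i = 0 → ∀ i, (r i).coeff 0 = 0) :
    PolyIndep F x f := by
  have key : ∀ n : ℕ, ∀ r : ι → F[X], ∑ i, aeval x (r i) * f i = 0 →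
      ∀ i, (r i).coeff n = 0 := by
    intro n
    induction n with
    | zero => exact h
    | succ n ih =>
      intro r hr i
      have h0 := h r hr
      have hd : ∀ i, r i = X * (r i).divX := fun i => by
        conv_lhs => rw [← X_mul_divX_add (r i), h0 i]
        simp
      have := ih (fun i => (r i).divX) (by
        apply mul_left_cancel₀ hx
        rw [mul_zero, ← hr, Finset.mul_sum]
        refine Finset.sum_congr rfl fun i _ => ?_
        conv_rhs => rw [hd i]
        simp [mul_assoc]) i
      simpa [coeff_divX] using this
  intro r hr i
  ext n
  simpa using key n r hr i

end Finiteness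

section Orders

open Polynomial IntermediateField

variable {F K : Type*} [Field F] [Field K] [Algebra F K]

lemma Place.val_const (p : Place F K) {c : F} (hc : c ≠ 0) :
    p.1.valuation (algebraMap F K c) = 1 := by
  apply le_antisymm
  · exact (p.1.valuation_le_one_iff _).2 (p.2.2 c)
  · have h := (p.1.valuation_le_one_iff _).2 (p.2.2 c⁻¹)
    rw [map_inv₀, map_inv₀] at h
    have h0 : 0 < p.1.valuation (algebraMap F K c) := by
      rw [Valuation.pos_iff]; simpa using hc
    exact (inv_le_one₀ h0).1 h

lemma Place.val_const_le (p : Place F K) (c : F) : p.1.valuation (algebraMap F K c) ≤ 1 :=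
  (p.1.valuation_le_one_iff _).2 (p.2.2 c)

lemma Place.val_aeval_le (p : Place F K) {x : K} (hx : p.1.valuation x ≤ 1) (r : F[X]) :
    p.1.valuation (aeval x r) ≤ 1 := by
  rw [aeval_eq_sum_range]
  refine Valuation.map_sum_le _ fun i _ => ?_
  rw [Algebra.smul_def, map_mul, map_pow]
  exact mul_le_one' (p.val_const_le _) (pow_le_one' hx i)

lemma Place.val_aeval_eq (p : Place F K) {x : K} (hx : p.1.valuation x < 1) {r : F[X]}
    (hr : r.coeff 0 ≠ 0) : p.1.valuation (aeval x r) = 1 := by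
  rw [← X_mul_divX_add r]
  simp only [map_add, map_mul, aeval_X, aeval_C]
  rw [Valuation.map_add_eq_of_lt_right, p.val_const hr]
  rw [p.val_const hr, map_mul]
  exact mul_lt_one_of_lt_of_le hx (p.val_aeval_le hx.le _)

lemma Place.transcendental (p : Place F K) {x : K} (hx0 : x ≠ 0) (hx : p.1.valuation x < 1) :
    Transcendental F x := by
  rw [transcendental_iff]
  intro r hr
  ext n
  have key : ∀ n : ℕ, ∀ r : F[X], aeval x r = 0 → r.coeff n = 0 := by
    intro n
    induction n with
    | zero =>
      intro r hr
      by_contra h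
      have := p.val_aeval_eq hx h
      simp [hr] at this
    | succ n ih =>
      intro r hr
      have h0 : r.coeff 0 = 0 := by
        by_contra h
        have := p.val_aeval_eq hx h
        simp [hr] at this
      rw [← coeff_divX]
      apply ih
      apply mul_left_cancel₀ hx0
      rw [mul_zero, ← hr]
      conv_rhs => rw [← X_mul_divX_add r, h0]
      simp
  simpa using key n r hr

lemma Place.polyIndep_chain (p : Place F K) {x : K} (hx0 : x ≠ 0) (hx : p.1.valuation x < 1)
    {n : ℕ} {y : Fin n → K} (hmono : ∀ i j, i < j → p.1.valuation (y i) < p.1.valuation (y j))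
    (hxy : ∀ i, p.1.valuation x ≤ p.1.valuation (y i)) (hy : ∀ i, p.1.valuation (y i) < 1) :
    PolyIndep F x y := by
  apply polyIndep_of_coeff_zero hx0
  intro r hr
  by_contra! hne
  have hv0 : 0 < p.1.valuation x := by rw [Valuation.pos_iff]; exact hx0
  obtain ⟨j, hj, hmax⟩ := (Finset.univ.filter fun i => (r i).coeff 0 ≠ 0).exists_max_image id
    (by obtain ⟨i, hi⟩ := hne; exact ⟨i, by simp [hi]⟩)
  simp only [Finset.mem_filter, Finset.mem_univ, true_and, id] at hj hmax
  rw [← Finset.add_sum_erase _ _ (Finset.mem_univ j)] at hr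
  have h1 : p.1.valuation (aeval x (r j) * y j) = p.1.valuation (y j) := by
    rw [map_mul, p.val_aeval_eq hx hj, one_mul]
  have h2 : p.1.valuation (∑ i ∈ Finset.univ.erase j, aeval x (r i) * y i)
      < p.1.valuation (y j) := by
    apply Valuation.map_sum_lt' _ (hv0.trans_le (hxy j))
    intro i hi
    rw [map_mul]
    rcases lt_or_gt_of_ne (Finset.ne_of_mem_erase hi) with h | h
    · exact (mul_le_of_le_one_left' (p.val_aeval_le hx.le _)).trans_lt (hmono _ _ h)
    · have h0 : (r i).coeff 0 = 0 := by
        by_contra h0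
        exact absurd (hmax i h0) (not_le.2 h)
      have : aeval x (r i) = x * aeval x (r i).divX := by
        conv_lhs => rw [← X_mul_divX_add (r i), h0]
        simp
      rw [this, map_mul]
      calc _ ≤ p.1.valuation x * p.1.valuation (y i) :=
            mul_le_mul_left (mul_le_of_le_one_right' (p.val_aeval_le hx.le _)) _
        _ < p.1.valuation x := mul_lt_of_lt_one_right hv0 (hy i)
        _ ≤ _ := hxy j
  rw [eq_neg_of_add_eq_zero_left hr, Valuation.map_neg] at h1
  exact absurd h1 h2.ne

/-- There is no infinite ascending chain of values below one. -/
lemma Place.not_chain (h : IsFunctionField F K) (p : Place F K) (y : ℕ → K)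
    (hy0 : y 0 ≠ 0) (hy : ∀ i, p.1.valuation (y i) < 1) (n : ℕ)
    (hn : Transcendental F (y 0) → finrank F⟮y 0⟯ K < n) :
    ¬ ∀ i, i + 1 < n → p.1.valuation (y i) < p.1.valuation (y (i + 1)) := by
  intro hm
  have ht := p.transcendental hy0 (hy 0)
  have hmono : ∀ i j, i < j → j < n → p.1.valuation (y i) < p.1.valuation (y j) := by
    intro i j hij
    induction hij with
    | refl => exact hm i
    | step hk ih => exact fun hlt => (ih (by omega)).trans (hm _ hlt)
  have := (p.polyIndep_chain (y := fun i : Fin n => y i) hy0 (hy 0)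
    (fun i j hij => hmono i j hij j.2) (fun i => by
      rcases Nat.eq_zero_or_pos i with h0 | h0
      · rw [h0]
      · exact (hmono 0 i h0 i.2).le) (fun i => hy i)).card_le h ht
  rw [Fintype.card_fin] at this
  exact absurd (hn ht) (not_lt.2 this)

lemma Place.exists_val_max (h : IsFunctionField F K) (p : Place F K) :
    ∃ π : K, π ≠ 0 ∧ p.1.valuation π < 1 ∧
      ∀ y : K, p.1.valuation y < 1 → p.1.valuation y ≤ p.1.valuation π := by
  by_contra! hc
  obtain ⟨z, hz⟩ : ∃ z, z ∉ p.1 := by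
    by_contra! hz
    exact p.2.1 (by ext z; simp [hz z])
  have hz0 : z ≠ 0 := by rintro rfl; exact hz (zero_mem _)
  have hx : p.1.valuation z⁻¹ < 1 := by
    rw [← p.1.valuation_le_one_iff, not_le] at hz
    rw [map_inv₀]
    exact inv_lt_one_of_one_lt₀ hz
  let S := {y : K // y ≠ 0 ∧ p.1.valuation y < 1}
  have : ∀ y : S, ∃ y' : S, p.1.valuation y.1 < p.1.valuation y'.1 := fun y => by
    obtain ⟨y', h1, h2⟩ := hc y.1 y.2.1 y.2.2
    exact ⟨⟨y', by rintro rfl; simp at h2, h1⟩, h2⟩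
  choose s hs using this
  let y : ℕ → S := fun n => s^[n] ⟨z⁻¹, inv_ne_zero hz0, hx⟩
  refine p.not_chain h (fun n => (y n).1) (y 0).2.1 (fun i => (y i).2.2) _
    (fun _ => Nat.lt_succ_self _) fun i _ => ?_
  simp only [y, Function.iterate_succ_apply']
  exact hs _

/-- A place is discrete. -/
lemma Place.exists_uniformizer (h : IsFunctionField F K) (p : Place F K) :
    ∃ π : K, π ≠ 0 ∧ p.1.valuation π < 1 ∧
      ∀ f : K, f ≠ 0 → ∃ n : ℤ, p.1.valuation f = p.1.valuation π ^ n := by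
  obtain ⟨π, h0, h1, hmax⟩ := p.exists_val_max h
  refine ⟨π, h0, h1, ?_⟩
  have hπ : 0 < p.1.valuation π := by rw [Valuation.pos_iff]; exact h0
  have key : ∀ f : K, f ≠ 0 → p.1.valuation f < 1 → ∃ n : ℕ, p.1.valuation f = p.1.valuation π ^ n := by
    intro f hf hf1
    have hf0 : 0 < p.1.valuation f := by rw [Valuation.pos_iff]; exact hf
    obtain ⟨n, hn⟩ : ∃ n : ℕ, p.1.valuation π ^ (n + 1) < p.1.valuation f := by
      by_contra! hc
      set N := finrank F⟮f * π⟯ K with hN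
      have hlt : ∀ k, p.1.valuation (π ^ (k + 1)) < 1 := fun k => by
        rw [map_pow]; exact pow_lt_one₀ zero_le h1 (by omega)
      refine p.not_chain h (fun i => if i = 0 then f * π else π ^ (N + 5 - i + 1)) (by simp [hf, h0])
        (fun i => ?_) (N + 1) (fun _ => by simp [hN]) fun i hi => ?_
      · split_ifs
        · rw [map_mul]; exact mul_lt_one_of_lt_of_le hf1 h1.le
        · exact hlt _
      · rw [if_neg (by omega : ¬ (i + 1 = 0))]
        split_ifs with hi0
        · rw [map_mul, map_pow]
          exact (mul_lt_of_lt_one_right hf0 h1).trans_le (hc _)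
        · rw [map_pow, map_pow]
          exact pow_lt_pow_right_of_lt_one₀ hπ h1 (by omega)
    have hex : ∃ n : ℕ, p.1.valuation π ^ (n + 1) < p.1.valuation f := ⟨n, hn⟩
    refine ⟨Nat.find hex, ?_⟩
    have h3 := Nat.find_spec hex
    have h4 : p.1.valuation f ≤ p.1.valuation π ^ (Nat.find hex) := by
      rcases Nat.eq_zero_or_pos (Nat.find hex) with h5 | h5
      · rw [h5, pow_zero]; exact hf1.le
      · have := Nat.find_min hex (m := Nat.find hex - 1) (by omega)
        rw [not_lt, Nat.sub_add_cancel h5] at this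
        exact this
    refine le_antisymm h4 ?_
    by_contra! h6
    have h7 := hmax (f / π ^ (Nat.find hex)) (by
      rw [map_div₀, map_pow]
      exact (div_lt_one₀ (pow_pos hπ _)).2 h6)
    rw [map_div₀, map_pow, div_le_iff₀ (pow_pos hπ _), ← pow_succ'] at h7
    exact absurd h3 (not_lt.2 h7)
  intro f hf
  rcases lt_trichotomy (p.1.valuation f) 1 with h2 | h2 | h2
  · obtain ⟨n, hn⟩ := key f hf h2
    exact ⟨n, by simpa using hn⟩
  · exact ⟨0, by simpa using h2⟩
  · obtain ⟨n, hn⟩ := key f⁻¹ (inv_ne_zero hf) (by rw [map_inv₀]; exact inv_lt_one_of_one_lt₀ h2)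
    refine ⟨-n, ?_⟩
    rw [map_inv₀] at hn
    rw [zpow_neg, zpow_natCast, ← hn, inv_inv]

end Orders

section Orders

variable {F K : Type*} [Field F] [Field K] [Algebra F K]

/-- The order of a function at a place. -/
def Place.ord (p : Place F K) (f : K) : ℤ := ordAt p.1 f

lemma ordAt_zero (O : ValuationSubring K) : ordAt O 0 = 0 := by
  have : (⟨0, zero_mem O⟩ : O) = 0 := rfl
  rw [ordAt, dif_pos (zero_mem O), ordAux, this]
  simp

lemma Place.ord_zero (p : Place F K) : p.ord 0 = 0 := ordAt_zero _

lemma ordAux_eq {O : ValuationSubring K} {π : K} (h0 : π ≠ 0) (h1 : O.valuation π < 1)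
    (hπ : ∀ f : K, f ≠ 0 → ∃ n : ℤ, O.valuation f = O.valuation π ^ n) {x : K} (hx : x ∈ O)
    {k : ℕ} (hk : O.valuation x = O.valuation π ^ k) : ordAux O ⟨x, hx⟩ = k := by
  have hπ0 : 0 < O.valuation π := by rw [Valuation.pos_iff]; exact h0
  have hπO : π ∈ O := (O.valuation_le_one_iff _).1 h1.le
  have hdvd : ∀ (n : ℕ) (y : O), (⟨π, hπO⟩ : O) ^ n ∣ y ↔ O.valuation y.1 ≤ O.valuation π ^ n := by
    intro n y
    constructor
    · rintro ⟨z, rfl⟩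
      have : (((⟨π, hπO⟩ : O) ^ n * z : O) : K) = π ^ n * z := rfl
      rw [this, map_mul, map_pow]
      exact mul_le_of_le_one_right' ((O.valuation_le_one_iff _).2 z.2)
    · intro hy
      refine ⟨⟨y / π ^ n, (O.valuation_le_one_iff _).1 ?_⟩, Subtype.ext ?_⟩
      · rw [map_div₀, map_pow]
        exact div_le_one_of_le₀ hy zero_le
      · change (y : K) = π ^ n * (y / π ^ n)
        field_simp
  have hmax : IsLocalRing.maximalIdeal O = Ideal.span {(⟨π, hπO⟩ : O)} := by
    ext y
    rw [ValuationSubring.valuation_lt_one_iff, Ideal.mem_span_singleton, ← pow_one (⟨π, hπO⟩ : O),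
      hdvd, pow_one]
    constructor
    · intro hy
      by_cases hy0 : (y : K) = 0
      · rw [hy0]; simp
      obtain ⟨n, hn⟩ := hπ y hy0
      rw [hn] at hy ⊢
      have : 0 < n := by
        by_contra! hn0
        obtain ⟨m, rfl⟩ : ∃ m : ℕ, n = -m := ⟨n.natAbs, by omega⟩
        rw [zpow_neg, zpow_natCast] at hy
        exact absurd hy (not_lt.2 ((one_le_inv₀ (pow_pos hπ0 _)).2 (pow_le_one₀ zero_le h1.le)))
      obtain ⟨m, rfl⟩ : ∃ m : ℕ, n = (m + 1 : ℕ) := ⟨n.natAbs - 1, by omega⟩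
      rw [zpow_natCast, pow_succ]
      exact mul_le_of_le_one_left' (pow_le_one₀ zero_le h1.le)
    · exact fun hy => hy.trans_lt h1
  have hset : {n : ℕ | (⟨x, hx⟩ : O) ∈ IsLocalRing.maximalIdeal O ^ n} = Set.Iic k := by
    ext n
    rw [Set.mem_ofPred_eq, hmax, Ideal.span_singleton_pow, Ideal.mem_span_singleton, hdvd, hk]
    exact pow_le_pow_iff_right_of_lt_one₀ hπ0 h1
  rw [ordAux, hset, csSup_Iic]

variable [hF : Fact (IsFunctionField F K)]

lemma Place.exists_ord_spec (p : Place F K) :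
    ∃ π : K, π ≠ 0 ∧ p.1.valuation π < 1 ∧
      ∀ f : K, f ≠ 0 → p.1.valuation f = p.1.valuation π ^ p.ord f := by
  obtain ⟨π, h0, h1, h⟩ := p.exists_uniformizer hF.out
  refine ⟨π, h0, h1, fun f hf => ?_⟩
  have hπ0 : 0 < p.1.valuation π := by rw [Valuation.pos_iff]; exact h0
  obtain ⟨n, hn⟩ := h f hf
  have hneg : ∀ m : ℕ, p.1.valuation π ^ (-(m + 1 : ℕ) : ℤ) > 1 := fun m => by
    rw [zpow_neg, zpow_natCast]
    exact (one_lt_inv₀ (pow_pos hπ0 _)).2 (pow_lt_one₀ zero_le h1 (by omega))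
  rw [ord, ordAt]
  split_ifs with hO
  · have h2 := (p.1.valuation_le_one_iff _).2 hO
    obtain ⟨m, rfl⟩ : ∃ m : ℕ, n = m := by
      refine ⟨n.natAbs, ?_⟩
      by_contra hne
      rw [hn, show n = -((n.natAbs - 1 + 1 : ℕ) : ℤ) by omega] at h2
      exact absurd h2 (not_le.2 (hneg _))
    rw [zpow_natCast] at hn
    rw [ordAux_eq h0 h1 h hO hn, hn, zpow_natCast]
  · have h2 := hO
    rw [← p.1.valuation_le_one_iff, hn] at h2
    obtain ⟨m, rfl⟩ : ∃ m : ℕ, n = -m := by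
      refine ⟨n.natAbs, ?_⟩
      by_contra hne
      apply h2
      obtain ⟨m, rfl⟩ : ∃ m : ℕ, n = m := ⟨n.natAbs, by omega⟩
      rw [zpow_natCast]
      exact pow_le_one₀ zero_le h1.le
    have h3 : p.1.valuation f⁻¹ = p.1.valuation π ^ m := by
      rw [map_inv₀, hn, zpow_neg, inv_inv, zpow_natCast]
    rw [ordAux_eq h0 h1 h _ h3, hn]

lemma Place.ord_eq_iff (p : Place F K) {f g : K} (hf : f ≠ 0) (hg : g ≠ 0) :
    p.ord f ≤ p.ord g ↔ p.1.valuation g ≤ p.1.valuation f := by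
  obtain ⟨π, h0, h1, h⟩ := p.exists_ord_spec
  have hπ0 : 0 < p.1.valuation π := by rw [Valuation.pos_iff]; exact h0
  rw [h f hf, h g hg]
  exact (zpow_le_zpow_iff_right_of_lt_one₀ hπ0 h1).symm

lemma Place.ord_mul (p : Place F K) {f g : K} (hf : f ≠ 0) (hg : g ≠ 0) :
    p.ord (f * g) = p.ord f + p.ord g := by
  obtain ⟨π, h0, h1, h⟩ := p.exists_ord_spec
  have hπ0 : 0 < p.1.valuation π := by rw [Valuation.pos_iff]; exact h0
  have h2 := h (f * g) (mul_ne_zero hf hg)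
  rw [map_mul, h f hf, h g hg, ← zpow_add₀ hπ0.ne'] at h2
  exact (zpow_right_injective₀ hπ0 h1.ne h2).symm

lemma Place.ord_one (p : Place F K) : p.ord (1 : K) = 0 := by
  have := p.ord_mul (one_ne_zero (α := K)) one_ne_zero
  rw [mul_one] at this; omega

lemma Place.ord_inv (p : Place F K) (f : K) : p.ord f⁻¹ = - p.ord f := by
  by_cases hf : f = 0
  · simp [hf, p.ord_zero]
  have := p.ord_mul hf (inv_ne_zero hf)
  rw [mul_inv_cancel₀ hf, p.ord_one] at this; omega

lemma Place.ord_div (p : Place F K) {f g : K} (hf : f ≠ 0) (hg : g ≠ 0) :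
    p.ord (f / g) = p.ord f - p.ord g := by
  rw [div_eq_mul_inv, p.ord_mul hf (inv_ne_zero hg), p.ord_inv, sub_eq_add_neg]

lemma Place.ord_pow (p : Place F K) (f : K) (n : ℕ) : p.ord (f ^ n) = n * p.ord f := by
  by_cases hf : f = 0
  · subst hf
    rcases n with _ | n
    · simp [p.ord_one]
    · simp [p.ord_zero]
  induction n with
  | zero => simp [p.ord_one]
  | succ n ih => rw [pow_succ, p.ord_mul (pow_ne_zero _ hf) hf, ih]; push_cast; ring

lemma Place.ord_zpow (p : Place F K) (f : K) (n : ℤ) : p.ord (f ^ n) = n * p.ord f := by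
  rcases n with n | n
  · simpa using p.ord_pow f n
  · rw [zpow_negSucc, p.ord_inv, p.ord_pow, Int.negSucc_eq]; push_cast; ring

lemma Place.ord_const (p : Place F K) (c : F) : p.ord (algebraMap F K c) = 0 := by
  by_cases hc : c = 0
  · simp [hc, p.ord_zero]
  have hc' : algebraMap F K c ≠ 0 := by simpa using hc
  have h := p.val_const hc
  apply le_antisymm
  · rw [← p.ord_one, p.ord_eq_iff hc' one_ne_zero, h, map_one]
  · rw [← p.ord_one, p.ord_eq_iff one_ne_zero hc', h, map_one]

lemma Place.ord_neg (p : Place F K) (f : K) : p.ord (-f) = p.ord f := by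
  by_cases hf : f = 0
  · simp [hf]
  rw [← neg_one_mul, p.ord_mul (by simp) hf]
  have := p.ord_const (-1)
  simp only [map_neg, map_one] at this
  rw [this, zero_add]

lemma Place.mem_iff (p : Place F K) {f : K} : f ∈ p.1 ↔ 0 ≤ p.ord f := by
  by_cases hf : f = 0
  · simp [hf, p.ord_zero, zero_mem]
  rw [← p.1.valuation_le_one_iff, ← p.ord_one, p.ord_eq_iff one_ne_zero hf, map_one]

lemma Place.val_lt_one_iff (p : Place F K) {f : K} (hf : f ≠ 0) :
    p.1.valuation f < 1 ↔ 0 < p.ord f := by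
  rw [← map_one p.1.valuation, ← not_le, ← p.ord_eq_iff hf one_ne_zero, not_le, p.ord_one]

lemma Place.le_ord_add (p : Place F K) {f g : K} (hfg : f + g ≠ 0) {n : ℤ}
    (hf : f ≠ 0 → n ≤ p.ord f) (hg : g ≠ 0 → n ≤ p.ord g) : n ≤ p.ord (f + g) := by
  by_cases hf0 : f = 0
  · subst hf0; rw [zero_add] at *; exact hg hfg
  by_cases hg0 : g = 0
  · subst hg0; rw [add_zero] at *; exact hf hfg
  rcases le_total (p.ord f) (p.ord g) with h | h
  · refine (hf hf0).trans ((p.ord_eq_iff hf0 hfg).2 ?_)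
    exact (Valuation.map_add_le _ le_rfl ((p.ord_eq_iff hf0 hg0).1 h))
  · refine (hg hg0).trans ((p.ord_eq_iff hg0 hfg).2 ?_)
    exact (Valuation.map_add_le _ ((p.ord_eq_iff hg0 hf0).1 h) le_rfl)

/-- Functions of order at least `n` at `p`. -/
def Place.V (p : Place F K) (n : ℤ) : Submodule F K where
  carrier := {f | f ≠ 0 → n ≤ p.ord f}
  add_mem' := fun ha hb hab => p.le_ord_add hab ha hb
  zero_mem' := fun h => absurd rfl h
  smul_mem' := fun c f hf hcf => by
    rw [Algebra.smul_def] at hcf ⊢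
    rw [p.ord_mul (left_ne_zero_of_mul hcf) (right_ne_zero_of_mul hcf), p.ord_const, zero_add]
    exact hf (right_ne_zero_of_mul hcf)

lemma Place.mem_V (p : Place F K) {n : ℤ} {f : K} : f ∈ p.V n ↔ (f ≠ 0 → n ≤ p.ord f) := Iff.rfl

lemma Place.mem_V' (p : Place F K) {n : ℤ} {f : K} (hf : f ≠ 0) : f ∈ p.V n ↔ n ≤ p.ord f :=
  ⟨fun h => h hf, fun h _ => h⟩

lemma Place.V_anti (p : Place F K) {m n : ℤ} (h : m ≤ n) : p.V n ≤ p.V m :=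
  fun _ hf h0 => h.trans (hf h0)

lemma Place.mul_mem_V (p : Place F K) {m n : ℤ} {f g : K} (hf : f ∈ p.V m) (hg : g ∈ p.V n) :
    f * g ∈ p.V (m + n) := fun h => by
  rw [p.ord_mul (left_ne_zero_of_mul h) (right_ne_zero_of_mul h)]
  exact add_le_add (hf (left_ne_zero_of_mul h)) (hg (right_ne_zero_of_mul h))

lemma Place.mul_mem_V_iff (p : Place F K) {n : ℤ} {f g : K} (hf : f ≠ 0) :
    f * g ∈ p.V n ↔ g ∈ p.V (n - p.ord f) := by
  by_cases hg : g = 0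
  · simp [hg]
  rw [p.mem_V' (mul_ne_zero hf hg), p.mem_V' hg, p.ord_mul hf hg, sub_le_iff_le_add']

lemma Place.mem_V_zero (p : Place F K) {f : K} : f ∈ p.V 0 ↔ f ∈ p.1 := by
  by_cases hf : f = 0
  · simp [hf, zero_mem]
  rw [p.mem_V' hf, p.mem_iff]

lemma Place.pow_mem_V (p : Place F K) {m : ℤ} {f : K} (hf : f ∈ p.V m) (n : ℕ) :
    f ^ n ∈ p.V (n * m) := by
  intro h
  rw [p.ord_pow]
  rcases Nat.eq_zero_or_pos n with rfl | hn
  · simp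
  · exact mul_le_mul_of_nonneg_left (hf (by rintro rfl; simp [hn.ne'] at h)) (by positivity)

lemma Place.const_mem_V (p : Place F K) (c : F) : algebraMap F K c ∈ p.V 0 := fun _ => by
  rw [p.ord_const]

lemma Place.one_mem_V (p : Place F K) : (1 : K) ∈ p.V 0 := fun _ => by rw [p.ord_one]

lemma Place.ord_add_eq_left (p : Place F K) {f g : K} (hf : f ≠ 0) (hg : g ∈ p.V (p.ord f + 1)) :
    f + g ≠ 0 ∧ p.ord (f + g) = p.ord f := by
  have h0 : f + g ≠ 0 := by
    intro h
    rw [eq_neg_of_add_eq_zero_right h] at hg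
    have := hg (by simpa using hf)
    rw [p.ord_neg] at this; omega
  refine ⟨h0, le_antisymm ?_ (p.le_ord_add h0 (fun _ => le_rfl) fun h => by
    have := hg h; omega)⟩
  by_contra! hlt
  have : f ∈ p.V (p.ord f + 1) := by
    have h1 : f + g ∈ p.V (p.ord f + 1) := fun _ => hlt
    simpa using (p.V (p.ord f + 1)).sub_mem h1 hg
  have := this hf
  omega

lemma Place.exists_ord_eq_one (p : Place F K) : ∃ π : K, π ≠ 0 ∧ p.ord π = 1 := by
  obtain ⟨π, h0, h1, h⟩ := p.exists_ord_spec
  have hπ0 : 0 < p.1.valuation π := by rw [Valuation.pos_iff]; exact h0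
  refine ⟨π, h0, ?_⟩
  have := h π h0
  conv_lhs at this => rw [← zpow_one (p.1.valuation π)]
  exact (zpow_right_injective₀ hπ0 h1.ne this).symm

lemma Place.exists_ord_eq (p : Place F K) (n : ℤ) : ∃ π : K, π ≠ 0 ∧ p.ord π = n := by
  obtain ⟨π, h0, h1⟩ := p.exists_ord_eq_one
  exact ⟨π ^ n, zpow_ne_zero _ h0, by rw [p.ord_zpow, h1, mul_one]⟩

lemma Place.ext_of_le {p q : Place F K} (h : ∀ f, f ∈ p.1 → f ∈ q.1) : p = q := by
  apply Subtype.ext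
  refine le_antisymm h fun f hf => ?_
  by_contra hfp
  apply q.2.1
  ext g
  refine iff_of_true ?_ (ValuationSubring.mem_top g)
  have hf0 : f ≠ 0 := by rintro rfl; exact hfp (zero_mem _)
  by_cases hg : g = 0
  · rw [hg]; exact zero_mem _
  have hneg : p.ord f < 0 := by rwa [p.mem_iff, not_le] at hfp
  set n := (p.ord g).natAbs
  have : g / f ^ n ∈ q.1 := h _ (by
    rw [p.mem_iff, p.ord_div hg (pow_ne_zero _ hf0), p.ord_pow]
    nlinarith [(by omega : - (p.ord g) ≤ n), (by omega : (0 : ℤ) ≤ n)])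
  have h2 := mul_mem this (pow_mem hf n)
  rwa [div_mul_cancel₀ _ (pow_ne_zero _ hf0)] at h2

end Orders

section RelDim

variable {F K : Type*} [Field F] [AddCommGroup K] [Module F K]

/-- `B ≤ A` and `A / B` has finite dimension `n`. -/
structure RelDim (A B : Submodule F K) (n : ℕ) : Prop where
  le : B ≤ A
  fin : FiniteDimensional F (A.map B.mkQ)
  eq : finrank F (A.map B.mkQ) = n

lemma RelDim.refl (A : Submodule F K) : RelDim A A 0 := by
  have : A.map A.mkQ = ⊥ := by
    rw [← LinearMap.le_ker_iff_map]; simp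
  refine ⟨le_rfl, ?_, ?_⟩ <;> rw [this]
  · infer_instance
  · simp

lemma RelDim.unique {A B : Submodule F K} {m n : ℕ} (h : RelDim A B m) (h' : RelDim A B n) :
    m = n := h.eq.symm.trans h'.eq

/-- The map between the quotients of a chain of submodules. -/
lemma RelDim.trans {A B C : Submodule F K} {m n : ℕ} (h : RelDim A B m) (h' : RelDim B C n) :
    RelDim A C (m + n) := by
  have hCB := h'.le
  let f : (A.map C.mkQ) →ₗ[F] (K ⧸ B) := (Submodule.factor hCB).domRestrict _
  have hr : LinearMap.range f = A.map B.mkQ := by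
    rw [LinearMap.range_domRestrict, ← Submodule.map_comp]
    rfl
  have hk : (LinearMap.ker f).map (A.map C.mkQ).subtype = B.map C.mkQ := by
    rw [LinearMap.ker_domRestrict, Submodule.map_comap_subtype]
    ext z
    constructor
    · rintro ⟨-, hz⟩
      obtain ⟨z, rfl⟩ := C.mkQ_surjective z
      refine ⟨z, ?_, rfl⟩
      simpa using hz
    · rintro ⟨z, hz, rfl⟩
      refine ⟨⟨z, h.le hz, rfl⟩, ?_⟩
      simpa using hz
  have e1 : LinearMap.ker f ≃ₗ[F] B.map C.mkQ :=
    (Submodule.equivMapOfInjective _ (A.map C.mkQ).injective_subtype _).trans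
      (LinearEquiv.ofEq _ _ hk)
  have f1 := h.fin
  have f2 := h'.fin
  have f3 : FiniteDimensional F (LinearMap.range f) := by rw [hr]; exact f1
  have f4 : FiniteDimensional F (LinearMap.ker f) := Module.Finite.equiv e1.symm
  have f5 : FiniteDimensional F (A.map C.mkQ) := by
    have : FiniteDimensional F ((A.map C.mkQ) ⧸ LinearMap.ker f) :=
      Module.Finite.equiv f.quotKerEquivRange.symm
    exact Module.Finite.of_submodule_quotient (LinearMap.ker f)
  refine ⟨h'.le.trans h.le, f5, ?_⟩
  have := f.finrank_range_add_finrank_ker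
  rw [hr, h.eq, e1.finrank_eq, h'.eq] at this
  exact this.symm

lemma relDim_of_inf {A B : Submodule F K} {n : ℕ} (h : RelDim (A ⊔ B) B n) :
    RelDim A (A ⊓ B) n := by
  have e0 : (A ⊔ B).map B.mkQ = A.map B.mkQ := by
    rw [Submodule.map_sup]
    have : B.map B.mkQ = ⊥ := by rw [← LinearMap.le_ker_iff_map]; simp
    rw [this, sup_bot_eq]
  let f : (A.map (A ⊓ B).mkQ) →ₗ[F] (K ⧸ B) :=
    (Submodule.factor (inf_le_right : A ⊓ B ≤ B)).domRestrict _
  have hr : LinearMap.range f = A.map B.mkQ := by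
    rw [LinearMap.range_domRestrict, ← Submodule.map_comp]
    rfl
  have hk : LinearMap.ker f = ⊥ := by
    rw [LinearMap.ker_eq_bot']
    rintro ⟨z, z, hz, rfl⟩ h0
    have : z ∈ B := by simpa [f] using h0
    apply Subtype.ext
    simpa using (⟨hz, this⟩ : z ∈ A ∧ z ∈ B)
  let e : (A.map (A ⊓ B).mkQ) ≃ₗ[F] A.map B.mkQ :=
    (LinearEquiv.ofInjective f (LinearMap.ker_eq_bot.1 hk)).trans (LinearEquiv.ofEq _ _ hr)
  have f1 := h.fin
  rw [e0] at f1
  refine ⟨inf_le_left, Module.Finite.equiv e.symm, ?_⟩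
  rw [e.finrank_eq, ← e0, h.eq]

lemma relDim_sup_of_inf {A B : Submodule F K} {n : ℕ} (h : RelDim A (A ⊓ B) n) :
    RelDim (A ⊔ B) B n := by
  have e0 : (A ⊔ B).map B.mkQ = A.map B.mkQ := by
    rw [Submodule.map_sup]
    have : B.map B.mkQ = ⊥ := by rw [← LinearMap.le_ker_iff_map]; simp
    rw [this, sup_bot_eq]
  have f0 := h.fin
  have hf : FiniteDimensional F ((A ⊔ B).map B.mkQ) := by
    have : A.map B.mkQ = (A.map (A ⊓ B).mkQ).map (Submodule.factor (inf_le_right : A ⊓ B ≤ B)) := by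
      rw [← Submodule.map_comp]; rfl
    rw [e0, this]
    infer_instance
  have h1 : RelDim (A ⊔ B) B _ := ⟨le_sup_right, hf, rfl⟩
  rwa [(relDim_of_inf h1).unique h] at h1

lemma RelDim.map {A B : Submodule F K} {n : ℕ} (h : RelDim A B n) (e : K ≃ₗ[F] K) :
    RelDim (A.map e.toLinearMap) (B.map e.toLinearMap) n := by
  let e' : (K ⧸ B) ≃ₗ[F] (K ⧸ B.map e.toLinearMap) := Submodule.Quotient.equiv _ _ e rfl
  have : (A.map e.toLinearMap).map (B.map e.toLinearMap).mkQ = (A.map B.mkQ).map e'.toLinearMap := by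
    rw [← Submodule.map_comp, ← Submodule.map_comp]
    rfl
  have f := h.fin
  refine ⟨Submodule.map_mono h.le, ?_, ?_⟩
  · rw [this]; infer_instance
  · rw [this, LinearEquiv.finrank_map_eq, h.eq]

lemma RelDim.exists_le {A B C : Submodule F K} {n : ℕ} (h : RelDim A C n) (h1 : C ≤ B)
    (h2 : B ≤ A) : ∃ m, RelDim B C m ∧ RelDim A B (n - m) ∧ m ≤ n := by
  have f := h.fin
  have f1 : FiniteDimensional F (B.map C.mkQ) :=
    Submodule.finiteDimensional_of_le (Submodule.map_mono h2)
  have r1 : RelDim B C _ := ⟨h1, f1, rfl⟩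
  have hf : FiniteDimensional F (A.map B.mkQ) := by
    have : A.map B.mkQ = (A.map C.mkQ).map (Submodule.factor h1) := by
      rw [← Submodule.map_comp]; rfl
    rw [this]
    infer_instance
  have r2 : RelDim A B _ := ⟨h2, hf, rfl⟩
  have := (r2.trans r1).unique h
  refine ⟨_, r1, ?_, by omega⟩
  rwa [← this, Nat.add_sub_cancel_right]

lemma RelDim.eq_of_zero {A B : Submodule F K} (h : RelDim A B 0) : A = B := by
  have f := h.fin
  have := Submodule.finrank_eq_zero.1 h.eq
  rw [← LinearMap.le_ker_iff_map, Submodule.ker_mkQ] at this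
  exact le_antisymm this h.le

/-- Elements independent modulo `B` in `A`. -/
lemma relDim_of_bound {A B : Submodule F K} (h : B ≤ A) (N : ℕ)
    (hN : ∀ (m : ℕ) (f : Fin m → K), (∀ i, f i ∈ A) →
      (∀ c : Fin m → F, ∑ i, c i • f i ∈ B → ∀ i, c i = 0) → m ≤ N) :
    ∃ n ≤ N, RelDim A B n := by
  have hr : Module.rank F (A.map B.mkQ) ≤ N := by
    apply rank_le
    intro s hs
    have : ∀ i : s, ∃ f ∈ A, B.mkQ f = i.1 := fun i => i.1.2
    choose f hf1 hf2 using this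
    let e := s.equivFin
    refine hN s.card (fun i => f (e.symm i)) (fun i => hf1 _) fun c hc i => ?_
    have h0 : ∑ i : s, c (e i) • (i : A.map B.mkQ) = 0 := by
      apply Subtype.ext
      have := (Submodule.Quotient.mk_eq_zero B).2 hc
      rw [← Submodule.mkQ_apply, map_sum] at this
      simp only [map_smul, hf2] at this
      rw [← e.symm.sum_comp]
      simpa using this
    have := (Fintype.linearIndependent_iff.1 hs) _ h0 (e.symm i)
    simpa using this
  have hf : FiniteDimensional F (A.map B.mkQ) :=
    Module.rank_lt_aleph0_iff.1 (hr.trans_lt (Cardinal.natCast_lt_aleph0))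
  exact ⟨_, Module.finrank_le_of_rank_le hr, h, hf, rfl⟩

lemma relDim_bot {A : Submodule F K} [FiniteDimensional F A] :
    RelDim A ⊥ (finrank F A) := by
  let e := Submodule.quotEquivOfEqBot (⊥ : Submodule F K) rfl
  have : A = (A.map (⊥ : Submodule F K).mkQ).map e.toLinearMap := by
    rw [← Submodule.map_comp]
    exact (Submodule.map_id A).symm
  refine ⟨bot_le, inferInstance, ?_⟩
  conv_rhs => rw [this]
  rw [LinearEquiv.finrank_map_eq]

lemma RelDim.finrank_of_bot {A : Submodule F K} {n : ℕ} (h : RelDim A ⊥ n) :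
    FiniteDimensional F A ∧ finrank F A = n := by
  let e := Submodule.quotEquivOfEqBot (⊥ : Submodule F K) rfl
  have : A = (A.map (⊥ : Submodule F K).mkQ).map e.toLinearMap := by
    rw [← Submodule.map_comp]
    exact (Submodule.map_id A).symm
  have hf := h.fin
  have hfd : FiniteDimensional F A := by rw [this]; infer_instance
  exact ⟨hfd, relDim_bot.unique h⟩

lemma relDim_of_surjective {A B : Submodule F K} {M : Type*} [AddCommGroup M] [Module F M]
    (φ : A →ₗ[F] M) (hφ : Function.Surjective φ) (hk : ∀ a : A, φ a = 0 ↔ (a : K) ∈ B) :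
    Nonempty (A.map B.mkQ ≃ₗ[F] M) := by
  let ψ : A →ₗ[F] A.map B.mkQ := B.mkQ.submoduleMap A
  have hψ : Function.Surjective ψ := B.mkQ.submoduleMap_surjective A
  have : LinearMap.ker φ = LinearMap.ker ψ := by
    ext a
    rw [LinearMap.mem_ker, LinearMap.mem_ker, hk, ← Submodule.Quotient.mk_eq_zero]
    constructor
    · intro h; exact Subtype.ext h
    · intro h; exact congrArg Subtype.val h
  exact ⟨(ψ.quotKerEquivOfSurjective hψ).symm.trans
    ((Submodule.quotEquivOfEq _ _ this.symm).trans (φ.quotKerEquivOfSurjective hφ))⟩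

end RelDim

section Approximation

open Polynomial IntermediateField

variable {F K : Type*} [Field F] [Field K] [Algebra F K] [hF : Fact (IsFunctionField F K)]

lemma exists_ord_pos_neg {p q : Place F K} (hpq : p ≠ q) :
    ∃ w : K, w ≠ 0 ∧ 0 < p.ord w ∧ q.ord w < 0 := by
  obtain ⟨a, ha1, ha2⟩ : ∃ a, a ∈ p.1 ∧ a ∉ q.1 := by
    by_contra! h; exact hpq (Place.ext_of_le h)
  obtain ⟨b, hb1, hb2⟩ : ∃ b, b ∈ q.1 ∧ b ∉ p.1 := by
    by_contra! h; exact hpq (Place.ext_of_le h).symm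
  have ha0 : a ≠ 0 := by rintro rfl; exact ha2 (zero_mem _)
  have hb0 : b ≠ 0 := by rintro rfl; exact hb2 (zero_mem _)
  rw [Place.mem_iff] at ha1 ha2 hb1 hb2
  refine ⟨a / b, div_ne_zero ha0 hb0, ?_, ?_⟩ <;> rw [Place.ord_div _ ha0 hb0] <;> omega

lemma exists_ord_pos_forall_neg (p : Place F K) (s : Finset (Place F K)) (hp : p ∉ s) :
    ∃ w : K, w ≠ 0 ∧ 0 < p.ord w ∧ ∀ q ∈ s, q.ord w < 0 := by
  induction s using Finset.induction_on with
  | empty =>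
    obtain ⟨w, h0, h1⟩ := p.exists_ord_eq_one
    exact ⟨w, h0, by omega, by simp⟩
  | insert r s hr ih =>
    rw [Finset.mem_insert, not_or] at hp
    obtain ⟨w, hw0, hwp, hws⟩ := ih hp.2
    by_cases hwr : r.ord w < 0
    · exact ⟨w, hw0, hwp, fun q hq => (Finset.mem_insert.1 hq).elim (fun h => h ▸ hwr) (hws q)⟩
    obtain ⟨u, hu0, hup, hur⟩ := exists_ord_pos_neg hp.1
    set N : ℕ := 1 + ∑ q ∈ s, (q.ord w).natAbs with hN
    have hNq : ∀ q ∈ s, (q.ord w).natAbs < N := fun q hq => by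
      have := Finset.single_le_sum (f := fun q : Place F K => (q.ord w).natAbs)
        (fun _ _ => Nat.zero_le _) hq
      omega
    have hN1 : (1 : ℤ) ≤ N := by omega
    have huN : u ^ N ≠ 0 := pow_ne_zero _ hu0
    have hr' : u ^ N + w ≠ 0 ∧ r.ord (u ^ N + w) = r.ord (u ^ N) :=
      r.ord_add_eq_left huN (fun _ => by rw [r.ord_pow]; nlinarith)
    refine ⟨u ^ N + w, hr'.1, ?_, fun q hq => ?_⟩
    · exact p.le_ord_add (n := 1) hr'.1 (fun _ => by rw [p.ord_pow]; nlinarith) (fun _ => hwp)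
    · rcases Finset.mem_insert.1 hq with rfl | hq
      · rw [hr'.2, q.ord_pow]; nlinarith
      · have h1 := hws q hq
        have h2 := hNq q hq
        rcases lt_or_ge (q.ord u) 0 with h3 | h3
        · rw [(q.ord_add_eq_left huN (fun _ => by rw [q.ord_pow]; nlinarith [abs_of_neg h1,
            (by omega : -(q.ord w) < (N : ℤ))])).2, q.ord_pow]
          nlinarith
        · rw [add_comm, (q.ord_add_eq_left hw0 (fun _ => by rw [q.ord_pow]; nlinarith)).2]
          exact h1

lemma exists_near_one (p : Place F K) (s : Finset (Place F K)) (hp : p ∉ s) (n : ℤ) :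
    ∃ e : K, e - 1 ∈ p.V n ∧ ∀ q ∈ s, e ∈ q.V n := by
  obtain ⟨w, hw0, hwp, hws⟩ := exists_ord_pos_forall_neg p s hp
  set N : ℕ := n.toNat + 1 with hN
  have hnN : n ≤ N := by omega
  have hN1 : (1 : ℤ) ≤ N := by omega
  have hp1 := p.ord_add_eq_left (one_ne_zero (α := K)) (g := w ^ N) (fun _ => by
    rw [p.ord_pow, p.ord_one]; nlinarith)
  have h0 := hp1.1
  refine ⟨(1 + w ^ N)⁻¹, ?_, fun q hq _ => ?_⟩
  · have : (1 + w ^ N)⁻¹ - 1 = -(w ^ N * (1 + w ^ N)⁻¹) := by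
      field_simp; ring
    rw [this]
    refine (p.V n).neg_mem fun _ => ?_
    rw [p.ord_mul (pow_ne_zero _ hw0) (inv_ne_zero h0), p.ord_inv, hp1.2, p.ord_pow, p.ord_one]
    nlinarith
  · have h1 := hws q hq
    rw [q.ord_inv, add_comm, (q.ord_add_eq_left (pow_ne_zero _ hw0) (fun _ => by
      rw [q.ord_pow, q.ord_one]; nlinarith)).2, q.ord_pow]
    nlinarith

lemma weak_approximation (s : Finset (Place F K)) (f : Place F K → K) (n : ℤ) :
    ∃ g : K, ∀ p ∈ s, g - f p ∈ p.V n := by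
  set m : ℤ := n + ∑ p ∈ s, ∑ q ∈ s, ((p.ord (f q)).natAbs : ℤ) with hm
  have hmn : ∀ p ∈ s, ∀ q ∈ s, n ≤ m + p.ord (f q) := fun p hp q hq => by
    have h1 := Finset.single_le_sum (f := fun q => ((p.ord (f q)).natAbs : ℤ))
        (fun _ _ => by positivity) hq
    have h2 := Finset.single_le_sum (f := fun p : Place F K => ∑ q ∈ s, ((p.ord (f q)).natAbs : ℤ))
        (fun _ _ => by positivity) hp
    omega
  have := fun p : Place F K => exists_near_one p (s.erase p) (by simp) m
  choose e he1 he2 using this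
  refine ⟨∑ p ∈ s, e p * f p, fun p hp => ?_⟩
  have hV : ∀ q ∈ s, ∀ a ∈ p.V m, a * f q ∈ p.V n := fun q hq a ha =>
    p.V_anti (hmn p hp q hq) (p.mul_mem_V ha fun _ => le_rfl)
  rw [← Finset.add_sum_erase _ _ hp]
  have : e p * f p + ∑ q ∈ s.erase p, e q * f q - f p =
      (e p - 1) * f p + ∑ q ∈ s.erase p, e q * f q := by ring
  rw [this]
  refine add_mem (hV p hp _ (he1 p)) (sum_mem fun q hq => ?_)
  exact hV q (Finset.mem_of_mem_erase hq) _
    (he2 q p (Finset.mem_erase.2 ⟨(Finset.ne_of_mem_erase hq).symm, hp⟩))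

/-- Functions whose order is bounded below at the places of a finite set. -/
def VS (s : Finset (Place F K)) (a : Place F K → ℤ) : Submodule F K := ⨅ p ∈ s, p.V (a p)

lemma mem_VS {s : Finset (Place F K)} {a : Place F K → ℤ} {f : K} :
    f ∈ VS s a ↔ ∀ p ∈ s, f ∈ p.V (a p) := by simp [VS, Submodule.mem_iInf]

lemma exists_relDim_VS (s : Finset (Place F K)) {x : K} (hx0 : x ≠ 0)
    (hs : ∀ p ∈ s, 0 ≤ p.ord x) (hx : Transcendental F x) :
    ∃ n ≤ finrank F⟮x⟯ K, RelDim (VS s fun _ => 0) (VS s fun p => p.ord x) n := by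
  have hpoly : ∀ p ∈ s, ∀ r : F[X], aeval x r ∈ p.V 0 := fun p hp r => by
    rw [p.mem_V_zero, ← p.1.valuation_le_one_iff]
    apply p.val_aeval_le
    rw [p.1.valuation_le_one_iff, p.mem_iff]
    exact hs p hp
  apply relDim_of_bound
  · intro f hf
    rw [mem_VS] at hf ⊢
    exact fun p hp => p.V_anti (hs p hp) (hf p hp)
  intro m f hf hc
  have : PolyIndep F x f := by
    apply polyIndep_of_coeff_zero hx0
    intro r hr
    apply hc
    have hsum : ∑ i, (r i).coeff 0 • f i = x * (-∑ i, aeval x (r i).divX * f i) := by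
      rw [mul_neg, eq_neg_iff_add_eq_zero, Finset.mul_sum, ← Finset.sum_add_distrib, ← hr]
      refine Finset.sum_congr rfl fun i _ => ?_
      have : aeval x (r i) = x * aeval x (r i).divX + algebraMap F K ((r i).coeff 0) := by
        conv_lhs => rw [← X_mul_divX_add (r i)]
        simp only [map_add, map_mul, aeval_X, aeval_C]
      rw [this, Algebra.smul_def]
      ring
    rw [hsum, mem_VS]
    intro p hp
    rw [p.mul_mem_V_iff hx0, sub_self]
    refine neg_mem (sum_mem fun i _ => ?_)
    simpa using p.mul_mem_V (hpoly p hp _) ((mem_VS.1 (hf i)) p hp)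
  simpa using this.card_le hF.out hx

lemma Place.residue_eq_zero_iff (p : Place F K) (f : p.1) :
    residue p.1 f = 0 ↔ (f : K) ∈ p.V 1 := by
  rw [IsLocalRing.residue_eq_zero_iff, ValuationSubring.valuation_lt_one_iff]
  by_cases hf : (f : K) = 0
  · simp [hf]
  rw [p.val_lt_one_iff hf, p.mem_V' hf]
  rfl

lemma Place.relDim_zero_one (p : Place F K) : RelDim (p.V 0) (p.V 1) (placeDegree F p) := by
  obtain ⟨x, hx0, hx⟩ := p.exists_ord_eq_one
  obtain ⟨n, -, hn⟩ := exists_relDim_VS {p} hx0 (by simp [hx])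
    (p.transcendental hx0 ((p.val_lt_one_iff hx0).2 (by omega)))
  have e1 : VS {p} (fun _ => 0) = p.V 0 := by ext; simp [mem_VS]
  have e2 : VS {p} (fun p => p.ord x) = p.V 1 := by ext; simp [mem_VS, hx]
  rw [e1, e2] at hn
  let _ := (residueHom F p).toAlgebra
  let φ : p.V 0 →ₗ[F] ResidueField p.1 :=
    { toFun := fun f => residue p.1 ⟨f, p.mem_V_zero.1 f.2⟩
      map_add' := fun f g => by rw [← map_add]; rfl
      map_smul' := fun c f => by
        rw [Algebra.smul_def]
        change _ = residueHom F p c * _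
        rw [residueHom, RingHom.comp_apply, ← map_mul]
        congr 1
        apply Subtype.ext
        exact Algebra.smul_def c (f : K) }
  obtain ⟨e⟩ := relDim_of_surjective φ (fun y => by
    obtain ⟨f, rfl⟩ := IsLocalRing.residue_surjective y
    exact ⟨⟨f, p.mem_V_zero.2 f.2⟩, rfl⟩) (fun a => p.residue_eq_zero_iff _)
  have : n = placeDegree F p := by rw [← hn.eq, e.finrank_eq]; rfl
  rwa [this] at hn

/-- Multiplication by a nonzero element. -/
def mulEquiv (F : Type*) {K : Type*} [Field F] [Field K] [Algebra F K] {x : K} (hx : x ≠ 0) :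
    K ≃ₗ[F] K where
  toFun := fun f => x * f
  invFun := fun f => x⁻¹ * f
  left_inv := fun f => by field_simp
  right_inv := fun f => by field_simp
  map_add' := mul_add x
  map_smul' := fun c f => by simp

lemma mem_map_mulEquiv {x : K} (hx : x ≠ 0) {A : Submodule F K} {f : K} :
    f ∈ A.map (mulEquiv F hx).toLinearMap ↔ x⁻¹ * f ∈ A := by
  constructor
  · rintro ⟨g, hg, rfl⟩
    have : x⁻¹ * (x * g) = g := by field_simp
    change x⁻¹ * (x * g) ∈ A
    rwa [this]
  · intro h
    refine ⟨x⁻¹ * f, h, ?_⟩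
    change x * (x⁻¹ * f) = f
    field_simp

lemma Place.map_mulEquiv_V (p : Place F K) {x : K} (hx : x ≠ 0) (m : ℤ) :
    (p.V m).map (mulEquiv F hx).toLinearMap = p.V (m + p.ord x) := by
  ext f
  rw [mem_map_mulEquiv, p.mul_mem_V_iff (inv_ne_zero hx), p.ord_inv, sub_neg_eq_add]

lemma Place.relDim_succ (p : Place F K) (n : ℤ) :
    RelDim (p.V n) (p.V (n + 1)) (placeDegree F p) := by
  obtain ⟨x, hx0, hx⟩ := p.exists_ord_eq n
  have := p.relDim_zero_one.map (mulEquiv F hx0)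
  rwa [p.map_mulEquiv_V, p.map_mulEquiv_V, hx, zero_add, add_comm 1 n] at this

lemma Place.relDim_add (p : Place F K) (n : ℤ) (m : ℕ) :
    RelDim (p.V n) (p.V (n + m)) (m * placeDegree F p) := by
  induction m with
  | zero => simpa using RelDim.refl _
  | succ m ih =>
    have := ih.trans (p.relDim_succ (n + m))
    rw [← Nat.succ_mul] at this
    simpa [add_assoc] using this

lemma Place.one_le_degree (p : Place F K) : 1 ≤ placeDegree F p := by
  by_contra! h
  have h0 := p.relDim_zero_one
  rw [Nat.lt_one_iff.1 h] at h0
  have h1 : (1 : K) ∈ p.V 1 := h0.eq_of_zero ▸ p.one_mem_V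
  have := h1 one_ne_zero
  rw [p.ord_one] at this
  omega

lemma VS_relDim_single (s : Finset (Place F K)) (a : Place F K → ℤ) {q : Place F K} (hq : q ∈ s)
    (m : ℕ) : RelDim (VS s a) (VS s (Function.update a q (a q + m))) (m * placeDegree F q) := by
  have h1 : VS s a ⊓ q.V (a q + m) = VS s (Function.update a q (a q + m)) := by
    ext f
    rw [Submodule.mem_inf, mem_VS, mem_VS]
    constructor
    · rintro ⟨h1, h2⟩ p hp
      by_cases hpq : p = q
      · subst hpq; simpa using h2
      · simpa [hpq] using h1 p hp
    · intro h
      have h2 : f ∈ q.V (a q + m) := by simpa using h q hq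
      refine ⟨fun p hp => ?_, h2⟩
      by_cases hpq : p = q
      · subst hpq; exact p.V_anti (by omega) h2
      · simpa [hpq] using h p hp
  have h2 : VS s a ⊔ q.V (a q + m) = q.V (a q) := by
    apply le_antisymm
    · exact sup_le (fun f hf => mem_VS.1 hf q hq) (q.V_anti (by omega))
    · intro f hf
      obtain ⟨g, hg⟩ := weak_approximation s (fun p => if p = q then f else 0)
        (∑ p ∈ s, |a p| + m)
      have hle : ∀ p ∈ s, a p + m ≤ ∑ p ∈ s, |a p| + m := fun p hp => by
        have h3 := Finset.single_le_sum (f := fun p => |a p|) (fun _ _ => abs_nonneg _) hp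
        have h4 := le_abs_self (a p)
        have h3' : |a p| ≤ ∑ p ∈ s, |a p| := h3
        omega
      have hgq : g - f ∈ q.V (a q + m) := by
        have := hg q hq
        rw [if_pos rfl] at this
        exact q.V_anti (hle q hq) this
      refine Submodule.mem_sup.2 ⟨g, mem_VS.2 fun p hp => ?_, f - g, ?_, by ring⟩
      · by_cases hpq : p = q
        · subst hpq
          simpa using add_mem (p.V_anti (by omega) hgq) hf
        · have := hg p hp
          rw [if_neg hpq, sub_zero] at this
          exact p.V_anti (by have := hle p hp; omega) this
      · rw [← neg_sub]; exact neg_mem hgq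
  have h3 : RelDim (VS s a ⊔ q.V (a q + m)) (q.V (a q + m)) (m * placeDegree F q) := by
    rw [h2]; exact q.relDim_add _ _
  have := relDim_of_inf h3
  rwa [h1] at this

lemma VS_relDim (s : Finset (Place F K)) (a : Place F K → ℤ) (c : Place F K → ℕ) :
    RelDim (VS s a) (VS s fun p => a p + c p) (∑ p ∈ s, c p * placeDegree F p) := by
  have key : ∀ t ⊆ s, RelDim (VS s a) (VS s fun p => if p ∈ t then a p + c p else a p)
      (∑ p ∈ t, c p * placeDegree F p) := by
    intro t
    induction t using Finset.induction_on with
    | empty => intro _; simpa using RelDim.refl _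
    | insert q t hq ih =>
      intro hts
      have h1 := ih (fun x hx => hts (Finset.mem_insert_of_mem hx))
      have h2 := h1.trans (VS_relDim_single s _ (hts (Finset.mem_insert_self q t)) (c q))
      rw [Finset.sum_insert hq, add_comm]
      convert h2 using 2
      ext p
      by_cases hpq : p = q
      · subst hpq; simp [hq]
      · simp [hpq]
  have := key s subset_rfl
  convert this using 1
  apply le_antisymm <;> intro f hf <;> rw [mem_VS] at hf ⊢ <;> intro p hp <;>
    simpa [hp] using hf p hp

lemma sum_ord_le (s : Finset (Place F K)) {x : K} (hx : Transcendental F x)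
    (hs : ∀ p ∈ s, 0 ≤ p.ord x) :
    ∑ p ∈ s, p.ord x * placeDegree F p ≤ finrank F⟮x⟯ K := by
  have hx0 : x ≠ 0 := by rintro rfl; exact hx isAlgebraic_zero
  obtain ⟨n, hn, h⟩ := exists_relDim_VS s hx0 hs hx
  have h2 := VS_relDim s (fun _ => 0) (fun p => (p.ord x).toNat)
  have e : VS s (fun p => 0 + ((p.ord x).toNat : ℤ)) = VS s fun p => p.ord x := by
    apply le_antisymm <;> intro f hf <;> rw [mem_VS] at hf ⊢ <;> intro p hp <;>
      simpa [Int.toNat_of_nonneg (hs p hp)] using hf p hp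
  rw [e] at h2
  have h3 := h.unique h2
  have h4 : (∑ p ∈ s, p.ord x * placeDegree F p) = (n : ℤ) := by
    rw [h3]; push_cast
    refine Finset.sum_congr rfl fun p hp => ?_
    rw [Int.toNat_of_nonneg (hs p hp)]
  omega

end Approximation

open Polynomial IntermediateField

section Divisors

variable {F K : Type*} [Field F] [Field K] [Algebra F K]

lemma exists_place_of_ideal (A : Subring K) (hA : ∀ c : F, algebraMap F K c ∈ A) (I : Ideal A)
    (hI : I ≠ ⊤) (h0 : I ≠ ⊥) :
    ∃ p : Place F K, (∀ a ∈ A, a ∈ p.1) ∧ ∀ a ∈ I, p.1.valuation (a : K) < 1 := by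
  obtain ⟨B, hAB, hIB⟩ := Ideal.image_subset_nonunits_valuationSubring I hI
  have hval : ∀ a ∈ I, B.valuation (a : K) < 1 := fun a ha =>
    (B.valuation_lt_one_iff ⟨a, hAB a.2⟩).1 (by
      have := hIB ⟨a, ha, rfl⟩
      rw [SetLike.mem_coe, ValuationSubring.mem_nonunits_iff] at this
      exact (B.valuation_lt_one_iff ⟨a, hAB a.2⟩).2 this)
  obtain ⟨a, ha, ha0⟩ := Submodule.exists_mem_ne_zero_of_ne_bot h0
  refine ⟨⟨B, fun h => ?_, fun c => hAB (hA c)⟩, fun a ha => hAB ha, hval⟩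
  have h1 := hval a ha
  have ha0' : (a : K) ≠ 0 := fun h => ha0 (Subtype.ext h)
  have h2 : B.valuation (a : K)⁻¹ ≤ 1 := (B.valuation_le_one_iff _).2 (h ▸ trivial)
  have h3 : B.valuation (a : K) * B.valuation (a : K)⁻¹ = 1 := by
    rw [← map_mul, mul_inv_cancel₀ ha0', map_one]
  have h4 : B.valuation (a : K) * B.valuation (a : K)⁻¹ < 1 :=
    mul_lt_one_of_lt_of_le h1 h2
  exact absurd h3 h4.ne

lemma exists_zero_of_transcendental {x : K} (hx : Transcendental F x) :
    ∃ p : Place F K, p.1.valuation x < 1 := by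
  let A : Subring K := (Algebra.adjoin F {x}).toSubring
  have hxA : x ∈ A := Algebra.subset_adjoin rfl
  let x' : A := ⟨x, hxA⟩
  obtain ⟨p, -, hp⟩ := exists_place_of_ideal (F := F) A
    (fun c => (Algebra.adjoin F {x}).algebraMap_mem c) (Ideal.span {x'}) (by
      rw [Ne, Ideal.span_singleton_eq_top]
      intro hu
      obtain ⟨y, hy⟩ := hu.exists_right_inv
      have hyA : (y : K) ∈ Algebra.adjoin F {x} := y.2
      rw [Algebra.adjoin_singleton_eq_range_aeval] at hyA
      obtain ⟨r, hr⟩ := hyA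
      have h1 : x * (y : K) = 1 := congrArg Subtype.val hy
      apply hx
      refine ⟨X * r - 1, fun h => ?_, ?_⟩
      · have := congrArg (Polynomial.coeff · 0) h
        simp at this
      · have hr' : aeval x r = (y : K) := hr
        simp [hr', h1]) (by
      rw [Ne, Ideal.span_singleton_eq_bot]
      intro h
      have : x = 0 := congrArg Subtype.val h
      exact hx (this ▸ isAlgebraic_zero))
  exact ⟨p, hp x' (Ideal.mem_span_singleton_self x')⟩

lemma transcendental_inv {x : K} (hx : Transcendental F x) : Transcendental F x⁻¹ := by
  intro h; exact hx (by simpa using h.inv)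

variable [hF : Fact (IsFunctionField F K)]

lemma exists_pole_of_transcendental {x : K} (hx : Transcendental F x) :
    ∃ p : Place F K, p.ord x < 0 := by
  obtain ⟨p, hp⟩ := exists_zero_of_transcendental (transcendental_inv hx)
  refine ⟨p, ?_⟩
  have hx0 : x ≠ 0 := by rintro rfl; exact hx isAlgebraic_zero
  rw [p.val_lt_one_iff (inv_ne_zero hx0), p.ord_inv] at hp
  omega

lemma Place.ord_eq_zero_of_isAlgebraic (p : Place F K) {x : K} (hx : IsAlgebraic F x) :
    p.ord x = 0 := by
  by_cases hx0 : x = 0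
  · rw [hx0, p.ord_zero]
  rcases lt_trichotomy (p.ord x) 0 with h | h | h
  · exact absurd hx.inv (p.transcendental (inv_ne_zero hx0)
      ((p.val_lt_one_iff (inv_ne_zero hx0)).2 (by rw [p.ord_inv]; omega)))
  · exact h
  · exact absurd hx (p.transcendental hx0 ((p.val_lt_one_iff hx0).2 h))

lemma finite_ord_pos (x : K) : {p : Place F K | 0 < p.ord x}.Finite := by
  by_cases hx : Transcendental F x
  · by_contra hinf
    obtain ⟨t, ht, hc⟩ := Set.Infinite.exists_subset_card_eq hinf (finrank F⟮x⟯ K + 1)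
    have h1 := sum_ord_le t hx fun p hp => (ht hp).le
    have h2 : ∑ p ∈ t, (1 : ℤ) ≤ ∑ p ∈ t, p.ord x * placeDegree F p := by
      refine Finset.sum_le_sum fun p hp => ?_
      have h3 : 0 < p.ord x := ht hp
      have h4 := p.one_le_degree
      nlinarith
    simp only [Finset.sum_const, hc, nsmul_eq_mul, mul_one] at h2
    push_cast at h2; omega
  · convert Set.finite_empty
    ext p
    simp [p.ord_eq_zero_of_isAlgebraic (not_not.1 hx)]

lemma finite_ord_ne_zero (x : K) : {p : Place F K | p.ord x ≠ 0}.Finite := by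
  refine ((finite_ord_pos (F := F) x).union (finite_ord_pos (F := F) x⁻¹)).subset fun p hp => ?_
  have hp : p.ord x ≠ 0 := hp
  rcases lt_or_gt_of_ne hp with h | h
  · right; change 0 < p.ord x⁻¹; rw [p.ord_inv]; omega
  · left; exact h

/-- The divisor of a function (zero for the zero function). -/
def dv (x : K) : Divisor F K := Finsupp.ofSupportFinite (fun p => p.ord x) (finite_ord_ne_zero x)

@[simp] lemma dv_apply (x : K) (p : Place F K) : dv x p = p.ord x := rfl

lemma dv_mul {x y : K} (hx : x ≠ 0) (hy : y ≠ 0) : (dv (x * y) : Divisor F K) = dv x + dv y := by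
  ext p; simp [p.ord_mul hx hy]

lemma dv_inv (x : K) : (dv x⁻¹ : Divisor F K) = - dv x := by
  ext p; simp [p.ord_inv]

lemma dv_one : (dv (1 : K) : Divisor F K) = 0 := by
  ext p; simp [p.ord_one]

lemma degHom_eq_sum (D : Divisor F K) (s : Finset (Place F K)) (hs : D.support ⊆ s) :
    degHom F K D = ∑ p ∈ s, D p * placeDegree F p := by
  rw [degHom, Finsupp.liftAddHom_apply, Finsupp.sum_of_support_subset _ hs]
  · rfl
  · simp

lemma degHom_single (p : Place F K) (n : ℤ) :
    degHom F K (single p n) = n * placeDegree F p := by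
  rw [degHom_eq_sum _ {p} Finsupp.support_single_subset]; simp

lemma degHom_nonneg {D : Divisor F K} (hD : 0 ≤ D) : 0 ≤ degHom F K D := by
  rw [degHom_eq_sum D _ subset_rfl]
  exact Finset.sum_nonneg fun p _ => mul_nonneg (hD p) (by positivity)

lemma degHom_mono {D E : Divisor F K} (h : D ≤ E) : degHom F K D ≤ degHom F K E := by
  have := degHom_nonneg (sub_nonneg.2 h)
  rw [map_sub] at this; omega

lemma eq_zero_of_degHom_eq_zero {D : Divisor F K} (hD : 0 ≤ D) (h : degHom F K D = 0) : D = 0 := by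
  rw [degHom_eq_sum D _ subset_rfl, Finset.sum_eq_zero_iff_of_nonneg
    fun p _ => mul_nonneg (hD p) (by positivity)] at h
  ext p
  by_contra hp
  have h1 := h p (Finsupp.mem_support_iff.2 hp)
  have := p.one_le_degree
  rcases mul_eq_zero.1 h1 with h2 | h2
  · exact hp h2
  · omega

/-- The Riemann-Roch space as an intersection of local conditions. -/
def L (D : Divisor F K) : Submodule F K := ⨅ p : Place F K, p.V (-D p)

lemma mem_L {D : Divisor F K} {f : K} : f ∈ L D ↔ ∀ p : Place F K, f ∈ p.V (-D p) := by
  simp [L, Submodule.mem_iInf]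

lemma mem_L' {D : Divisor F K} {f : K} (hf : f ≠ 0) : f ∈ L D ↔ 0 ≤ D + dv f := by
  rw [mem_L, Finsupp.le_def]
  refine forall_congr' fun p => ?_
  rw [p.mem_V' hf]
  simp only [Finsupp.coe_zero, Pi.zero_apply, Finsupp.coe_add, Pi.add_apply, dv_apply]
  omega

lemma L_mono {D E : Divisor F K} (h : D ≤ E) : L D ≤ L E := fun f hf =>
  mem_L.2 fun p => p.V_anti (by have := h p; omega) (mem_L.1 hf p)

lemma RRspace_eq (D : Divisor F K) : RRspace F D = L D := by
  apply le_antisymm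
  · rw [RRspace, Submodule.span_le]
    intro f hf
    by_cases h0 : f = 0
    · rw [h0]; exact zero_mem _
    · exact (mem_L' h0).2 hf
  · intro f hf
    by_cases h0 : f = 0
    · rw [h0]; exact zero_mem _
    · exact Submodule.subset_span ((mem_L' h0).1 hf)

lemma ell_eq (D : Divisor F K) : ell F D = finrank F (L D) := by rw [ell, RRspace_eq]

lemma mul_mem_L {D E : Divisor F K} {f g : K} (hf : f ∈ L D) (hg : g ∈ L E) :
    f * g ∈ L (D + E) := mem_L.2 fun p => by
  have := p.mul_mem_V (mem_L.1 hf p) (mem_L.1 hg p)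
  rwa [← neg_add] at this

lemma one_mem_L {D : Divisor F K} (h : 0 ≤ D) : (1 : K) ∈ L D :=
  (mem_L' one_ne_zero).2 (by rwa [dv_one, add_zero])

lemma L_map_mul (D : Divisor F K) {f : K} (hf : f ≠ 0) :
    (L D).map (mulEquiv F hf).toLinearMap = L (D - dv f) := by
  ext g
  rw [mem_map_mulEquiv, mem_L, mem_L]
  refine forall_congr' fun p => ?_
  rw [p.mul_mem_V_iff (inv_ne_zero hf), p.ord_inv]
  simp only [Finsupp.coe_sub, Pi.sub_apply, dv_apply]
  rw [show -D p - -p.ord f = -(D p - p.ord f) by ring]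

lemma ell_sub_dv (D : Divisor F K) {f : K} (hf : f ≠ 0) : ell F (D - dv f) = ell F D := by
  rw [ell_eq, ell_eq, ← L_map_mul D hf]
  exact LinearEquiv.finrank_map_eq (mulEquiv F hf) (L D)

lemma L_relDim_single (D : Divisor F K) (p : Place F K) (n : ℕ) :
    ∃ m ≤ n * placeDegree F p, RelDim (L (D + single p (n : ℤ))) (L D) m := by
  have h1 : L (D + single p (n : ℤ)) ⊓ p.V (-D p) = L D := by
    apply le_antisymm
    · rintro f ⟨hf1, hf2⟩
      refine mem_L.2 fun q => ?_
      by_cases hq : q = p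
      · subst hq; exact hf2
      · have := mem_L.1 hf1 q
        simpa [single_apply, Ne.symm hq] using this
    · refine le_inf (L_mono ?_) fun f hf => mem_L.1 hf p
      simp
  have h2 : RelDim (p.V (-D p - n)) (p.V (-D p)) (n * placeDegree F p) := by
    simpa using p.relDim_add (-D p - n) n
  obtain ⟨m, hm, -, hmn⟩ := h2.exists_le
    (B := L (D + single p (n : ℤ)) ⊔ p.V (-D p)) le_sup_right
    (sup_le (fun f hf => by
      have := mem_L.1 hf p
      simp only [Finsupp.coe_add, Pi.add_apply, single_eq_same] at this
      rwa [show -(D p + (n : ℤ)) = -D p - n by ring] at this) (p.V_anti (by omega)))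
  have := relDim_of_inf hm
  rw [h1] at this
  exact ⟨m, hmn, this⟩

lemma L_relDim {D E : Divisor F K} (h : D ≤ E) :
    ∃ m : ℕ, (m : ℤ) ≤ degHom F K E - degHom F K D ∧ RelDim (L E) (L D) m := by
  have key : ∀ t : Finset (Place F K), ∀ D : Divisor F K, D ≤ E → (E - D).support ⊆ t →
      ∃ m : ℕ, (m : ℤ) ≤ degHom F K E - degHom F K D ∧ RelDim (L E) (L D) m := by
    intro t
    induction t using Finset.induction_on with
    | empty =>
      intro D hD hs
      have : E - D = 0 := by simpa using hs
      rw [sub_eq_zero] at this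
      subst this
      exact ⟨0, by simp, RelDim.refl _⟩
    | insert p t hp ih =>
      intro D hD hs
      have hpD : 0 ≤ E p - D p := sub_nonneg.2 (hD p)
      set n := (E p - D p).toNat with hn
      have hnn : (n : ℤ) = E p - D p := Int.toNat_of_nonneg hpD
      obtain ⟨m1, hm1, hr1⟩ := L_relDim_single D p n
      obtain ⟨m2, hm2, hr2⟩ := ih (D + single p (n : ℤ)) (fun q => by
          by_cases hq : q = p
          · subst hq; simp [hnn]
          · simpa [single_apply, Ne.symm hq] using hD q) (fun q hq => by
          have hqp : q ≠ p := by
            rintro rfl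
            simp [hnn] at hq
          have : q ∈ (E - D).support := by
            simpa [single_apply, Ne.symm hqp] using hq
          exact Finset.mem_of_mem_insert_of_ne (hs this) hqp)
      refine ⟨m2 + m1, ?_, hr2.trans hr1⟩
      rw [map_add, degHom_single] at hm2
      push_cast
      have : (m1 : ℤ) ≤ n * placeDegree F p := by exact_mod_cast hm1
      omega
  exact key _ D h subset_rfl

lemma finiteDimensional_L_zero : FiniteDimensional F (L (0 : Divisor F K)) := by
  obtain ⟨x, hx, -⟩ := hF.out
  obtain ⟨p, -⟩ := exists_zero_of_transcendental hx
  have h : L (-single p 1 : Divisor F K) = ⊥ := by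
    rw [Submodule.eq_bot_iff]
    intro f hf
    by_contra h0
    have hq : ∀ q : Place F K, 0 ≤ -single p 1 q + q.ord f := fun q => (mem_L' h0).1 hf q
    have hp := hq p
    rw [single_eq_same] at hp
    obtain ⟨q, hq0⟩ := exists_pole_of_transcendental (F := F) (x := f) fun ha => by
      have := p.ord_eq_zero_of_isAlgebraic ha
      omega
    have h1 := hq q
    have h2 : (0 : ℤ) ≤ single p 1 q := by
      rw [single_apply]; split_ifs <;> norm_num
    omega
  obtain ⟨m, -, hm⟩ := L_relDim (D := -single p 1) (E := (0 : Divisor F K))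
    (neg_nonpos.2 (Finsupp.single_nonneg.2 zero_le_one))
  rw [h] at hm
  exact hm.finrank_of_bot.1

instance finiteDimensional_L (D : Divisor F K) : FiniteDimensional F (L D) := by
  obtain ⟨m, -, hm⟩ := L_relDim (le_sup_right : (0 : Divisor F K) ≤ D ⊔ 0)
  have h0 : FiniteDimensional F (L (0 : Divisor F K)) := finiteDimensional_L_zero
  have := (hm.trans relDim_bot).finrank_of_bot.1
  exact Submodule.finiteDimensional_of_le (L_mono (le_sup_left : D ≤ D ⊔ 0))

lemma L_relDim_ell {D E : Divisor F K} (h : D ≤ E) : RelDim (L E) (L D) (ell F E - ell F D) ∧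
    ell F D ≤ ell F E := by
  obtain ⟨m, -, hm⟩ := L_relDim h
  have h1 := (hm.trans relDim_bot).finrank_of_bot.2
  rw [ell_eq, ell_eq, h1]
  exact ⟨by simpa using hm, by omega⟩

lemma ell_mono {D E : Divisor F K} (h : D ≤ E) : ell F D ≤ ell F E := (L_relDim_ell h).2

lemma ell_le_add {D E : Divisor F K} (h : D ≤ E) :
    (ell F E : ℤ) ≤ ell F D + degHom F K E - degHom F K D := by
  obtain ⟨m, hm0, hm⟩ := L_relDim h
  have h1 := (hm.trans relDim_bot).finrank_of_bot.2
  rw [ell_eq E, h1, ell_eq D]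
  push_cast; omega

lemma finrank_le_degHom_poles {x : K} (hx : Transcendental F x) :
    (finrank F⟮x⟯ K : ℤ) ≤ degHom F K (-dv x ⊔ 0) := by
  have hx0 : x ≠ 0 := by rintro rfl; exact hx isAlgebraic_zero
  obtain ⟨f, hf⟩ := exists_polyIndep hF.out hx
  generalize finrank F⟮x⟯ K = n at f hf ⊢
  set B : Divisor F K := -dv x ⊔ 0 with hB
  set Q : Divisor F K := ∑ i, (-dv (f i) ⊔ 0) with hQd
  have hC0 : ∀ i, -dv (f i) ≤ Q := fun i =>
    le_sup_left.trans (Finset.single_le_sum (f := fun i => (-dv (f i) ⊔ 0 : Divisor F K))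
      (fun i _ => le_sup_right) (Finset.mem_univ i))
  have hC00 : 0 ≤ Q := Finset.sum_nonneg fun i _ => le_sup_right
  have hfC : ∀ i, f i ∈ L Q := fun i => by
    by_cases h : f i = 0
    · rw [h]; exact zero_mem _
    · rw [mem_L' h]
      have := hC0 i
      rwa [neg_le_iff_add_nonneg] at this
  have hxB : ∀ k j : ℕ, j ≤ k → x ^ j ∈ L (k • B) := by
    intro k j hj
    rw [mem_L' (pow_ne_zero _ hx0), Finsupp.le_def]
    intro p
    have h1 : -p.ord x ≤ B p := le_max_left (-p.ord x) 0
    have h2 : 0 ≤ B p := le_max_right (-p.ord x) 0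
    rw [Finsupp.add_apply, Finsupp.smul_apply, nsmul_eq_mul, dv_apply, p.ord_pow]
    change (0 : ℤ) ≤ _
    have h3 : (j : ℤ) ≤ k := by exact_mod_cast hj
    nlinarith
  have key : ∀ k : ℕ, ((k + 1) * n : ℤ) ≤ k * degHom F K B + degHom F K Q + ell F (0 : Divisor F K) := by
    intro k
    have h1 : LinearIndependent F (fun ij : Fin (k + 1) × Fin n =>
        (⟨x ^ (ij.1 : ℕ) * f ij.2, mul_mem_L (hxB k ij.1 (by omega)) (hfC ij.2)⟩ :
          L (k • B + Q))) := by
      rw [Fintype.linearIndependent_iff]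
      intro c hc ij
      have hc' := congrArg Subtype.val hc
      simp only [AddSubmonoidClass.coe_finsetSum, Submodule.coe_smul, ZeroMemClass.coe_zero,
        Fintype.sum_prod_type_right] at hc'
      have h2 := hf (fun i => ∑ j : Fin (k + 1), C (c (j, i)) * X ^ (j : ℕ)) (by
        rw [← hc']
        refine Finset.sum_congr rfl fun i _ => ?_
        rw [map_sum, Finset.sum_mul]
        refine Finset.sum_congr rfl fun j _ => ?_
        simp [Algebra.smul_def, mul_assoc]) ij.2
      have h3 := congrArg (Polynomial.coeff · (ij.1 : ℕ)) h2
      simp only [finsetSum_coeff, coeff_C_mul, coeff_X_pow, coeff_zero] at h3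
      rw [Finset.sum_eq_single ij.1] at h3
      · simpa using h3
      · intro b _ hb
        rw [if_neg (fun h => hb (Fin.ext h.symm)), mul_zero]
      · simp
    have h2 := h1.fintype_card_le_finrank
    rw [← ell_eq, Fintype.card_prod, Fintype.card_fin, Fintype.card_fin] at h2
    have h3 := ell_le_add (E := k • B + Q) (add_nonneg (nsmul_nonneg le_sup_right _) hC00)
    rw [map_zero, map_add, map_nsmul, nsmul_eq_mul] at h3
    have h4 : (((k + 1) * n : ℕ) : ℤ) ≤ ell F (k • B + Q) := by exact_mod_cast h2
    push_cast at h4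
    linarith
  by_contra! hlt
  have h1 := key (degHom F K Q + ell F (0 : Divisor F K)).toNat
  have h2 : 0 ≤ degHom F K Q := degHom_nonneg hC00
  rw [Int.toNat_of_nonneg (by omega)] at h1
  have h3 : 0 ≤ degHom F K B := degHom_nonneg le_sup_right
  nlinarith

lemma degHom_zeros_le {x : K} (hx : Transcendental F x) :
    degHom F K (dv x ⊔ 0) ≤ finrank F⟮x⟯ K := by
  have hsub : (dv x ⊔ 0 : Divisor F K).support ⊆ (finite_ord_pos (F := F) x).toFinset := by
    intro p hp
    rw [Finsupp.mem_support_iff] at hp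
    simp only [Set.Finite.mem_toFinset, Set.mem_ofPred_eq]
    by_contra! h
    exact hp (by simpa using h)
  rw [degHom_eq_sum _ _ hsub]
  refine le_trans (le_of_eq ?_) (sum_ord_le (finite_ord_pos (F := F) x).toFinset hx
    fun p hp => ?_)
  · refine Finset.sum_congr rfl fun p hp => ?_
    rw [Set.Finite.mem_toFinset] at hp
    have : 0 < p.ord x := hp
    simp [max_eq_left this.le]
  · rw [Set.Finite.mem_toFinset] at hp
    exact le_of_lt hp

lemma adjoin_inv (x : K) : F⟮x⁻¹⟯ = F⟮x⟯ := by
  apply le_antisymm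
  · rw [adjoin_simple_le_iff]; exact inv_mem (mem_adjoin_simple_self F x)
  · rw [adjoin_simple_le_iff]
    simpa using inv_mem (mem_adjoin_simple_self F x⁻¹)

lemma degHom_zeros {x : K} (hx : Transcendental F x) :
    degHom F K (dv x ⊔ 0) = finrank F⟮x⟯ K := by
  apply le_antisymm (degHom_zeros_le hx)
  have := finrank_le_degHom_poles (transcendental_inv hx)
  rwa [dv_inv, neg_neg, adjoin_inv] at this

lemma degHom_poles {x : K} (hx : Transcendental F x) :
    degHom F K (-dv x ⊔ 0) = finrank F⟮x⟯ K := by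
  have := degHom_zeros (transcendental_inv hx)
  rwa [dv_inv, adjoin_inv] at this

lemma degHom_dv (x : K) : degHom F K (dv x) = 0 := by
  by_cases hx : Transcendental F x
  · have h : (dv x : Divisor F K) = (dv x ⊔ 0) - (-dv x ⊔ 0) := by
      ext p
      simp only [Finsupp.coe_sub, Pi.sub_apply, Finsupp.sup_apply, dv_apply, Finsupp.coe_neg,
        Pi.neg_apply, Finsupp.coe_zero, Pi.zero_apply]
      omega
    rw [h, map_sub, degHom_zeros hx, degHom_poles hx, sub_self]
  · have : (dv x : Divisor F K) = 0 := by
      ext p; exact p.ord_eq_zero_of_isAlgebraic (not_not.1 hx)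
    rw [this, map_zero]

lemma degHom_nonneg_of_mem_L {D : Divisor F K} {f : K} (hf : f ∈ L D) (h0 : f ≠ 0) :
    0 ≤ degHom F K D := by
  have := degHom_nonneg ((mem_L' h0).1 hf)
  rwa [map_add, degHom_dv, add_zero] at this

lemma ell_eq_zero {D : Divisor F K} (h : degHom F K D < 0) : ell F D = 0 := by
  rw [ell_eq, Submodule.finrank_eq_zero, Submodule.eq_bot_iff]
  intro f hf
  by_contra h0
  have := degHom_nonneg_of_mem_L hf h0
  omega

variable [hC : Fact (HasExactConstants F K)]

lemma mem_const_of_ord_nonneg {f : K} (hf : ∀ p : Place F K, 0 ≤ p.ord f) :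
    ∃ c : F, algebraMap F K c = f := by
  refine hC.out f ?_
  by_contra h
  obtain ⟨p, hp⟩ := exists_pole_of_transcendental (F := F) h
  exact absurd (hf p) (by omega)

lemma L_zero : L (0 : Divisor F K) = Submodule.span F {1} := by
  apply le_antisymm
  · intro f hf
    by_cases h0 : f = 0
    · rw [h0]; exact zero_mem _
    rw [mem_L' h0, zero_add] at hf
    obtain ⟨c, rfl⟩ := mem_const_of_ord_nonneg (F := F) hf
    rw [Submodule.mem_span_singleton]
    exact ⟨c, by rw [Algebra.smul_def, mul_one]⟩
  · rw [Submodule.span_singleton_le_iff_mem]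
    exact one_mem_L le_rfl

lemma ell_zero : ell F (0 : Divisor F K) = 1 := by
  rw [ell_eq, L_zero]
  exact finrank_span_singleton one_ne_zero

lemma ell_le_of_nonneg {D : Divisor F K} (h : 0 ≤ D) : (ell F D : ℤ) ≤ degHom F K D + 1 := by
  have := ell_le_add h
  rw [ell_zero, map_zero] at this
  push_cast at this; omega

end Divisors

section RiemannRoch

variable {F K : Type*} [Field F] [Field K] [Algebra F K] [hF : Fact (IsFunctionField F K)]

/-- Functions satisfying the local conditions of `D` away from `S`. -/
def LAway (S : Place F K) (D : Divisor F K) : Submodule F K :=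
  ⨅ p : Place F K, ⨅ _ : p ≠ S, p.V (-D p)

lemma mem_LAway {S : Place F K} {D : Divisor F K} {f : K} :
    f ∈ LAway S D ↔ ∀ p, p ≠ S → f ∈ p.V (-D p) := by simp [LAway, Submodule.mem_iInf]

/-- The sum of the functions regular away from `S` and those regular at `S`. -/
def Lam (S : Place F K) (D : Divisor F K) : Submodule F K := LAway S D ⊔ S.V (-D S)

lemma LAway_mono {S : Place F K} {D E : Divisor F K} (h : D ≤ E) : LAway S D ≤ LAway S E :=
  fun _ hf => mem_LAway.2 fun p hp => p.V_anti (neg_le_neg (h p)) (mem_LAway.1 hf p hp)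

lemma Lam_mono {S : Place F K} {D E : Divisor F K} (h : D ≤ E) : Lam S D ≤ Lam S E :=
  sup_le_sup (LAway_mono h) (S.V_anti (neg_le_neg (h S)))

lemma LAway_inf_V (S : Place F K) (D : Divisor F K) (n : ℤ) :
    LAway S D ⊓ S.V (-D S - n) = L (D + single S n) := by
  ext f
  rw [Submodule.mem_inf, mem_LAway, mem_L]
  constructor
  · rintro ⟨h1, h2⟩ p
    by_cases hp : p = S
    · subst hp
      rwa [Finsupp.add_apply, single_eq_same, neg_add']
    · rw [Finsupp.add_apply, single_eq_of_ne hp, add_zero]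
      exact h1 p hp
  · intro h
    constructor
    · intro p hp
      have := h p
      rwa [Finsupp.add_apply, single_eq_of_ne hp, add_zero] at this
    · have := h S
      rwa [Finsupp.add_apply, single_eq_same, neg_add'] at this

lemma exists_single_of_mem_LAway {S : Place F K} {D : Divisor F K} {f : K} (hf : f ∈ LAway S D) :
    ∃ n0 : ℕ, ∀ n : ℕ, n0 ≤ n → f ∈ L (D + single S (n : ℤ)) := by
  refine ⟨(-D S - S.ord f).toNat, fun n hn => ?_⟩
  rw [← LAway_inf_V]
  exact ⟨hf, fun _ => by omega⟩

lemma mul_mem_Lam {S : Place F K} {D : Divisor F K} {x f : K} (hx : x ≠ 0)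
    (hf : f ∈ Lam S (D + dv x)) : x * f ∈ Lam S D := by
  obtain ⟨a, ha, b, hb, rfl⟩ := Submodule.mem_sup.1 hf
  rw [mul_add]
  refine add_mem (Submodule.mem_sup_left (mem_LAway.2 fun p hp => ?_)) (Submodule.mem_sup_right ?_)
  · have := mem_LAway.1 ha p hp
    rw [p.mul_mem_V_iff hx]
    rwa [Finsupp.add_apply, dv_apply, neg_add'] at this
  · rw [S.mul_mem_V_iff hx]
    rwa [Finsupp.add_apply, dv_apply, neg_add'] at hb

/-- Linear functionals vanishing on `Lam S D`, a model of the differentials. -/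
def Omega (S : Place F K) (D : Divisor F K) : Submodule F (Module.Dual F K) :=
  (Lam S D).dualAnnihilator

lemma mem_Omega {S : Place F K} {D : Divisor F K} {ω : Module.Dual F K} :
    ω ∈ Omega S D ↔ ∀ f ∈ Lam S D, ω f = 0 := Submodule.mem_dualAnnihilator ω

lemma Omega_anti {S : Place F K} {D E : Divisor F K} (h : D ≤ E) : Omega S E ≤ Omega S D :=
  fun _ hω => mem_Omega.2 fun f hf => mem_Omega.1 hω f (Lam_mono h hf)

/-- Multiplication of a functional by a function. -/
def smulDual (ω : Module.Dual F K) : K →ₗ[F] Module.Dual F K :=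
  LinearMap.mk₂ F (fun x f => ω (x * f)) (by simp [add_mul]) (by simp) (by simp [mul_add]) (by simp)

@[simp] lemma smulDual_apply (ω : Module.Dual F K) (x f : K) : smulDual ω x f = ω (x * f) := rfl

lemma smulDual_mem_Omega {S : Place F K} {D : Divisor F K} {ω : Module.Dual F K}
    (hω : ω ∈ Omega S D) {x : K} (hx : x ≠ 0) : smulDual ω x ∈ Omega S (D + dv x) :=
  mem_Omega.2 fun _ hf => mem_Omega.1 hω _ (mul_mem_Lam hx hf)

lemma smulDual_mem_Omega' {S : Place F K} {D E : Divisor F K} {ω : Module.Dual F K}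
    (hω : ω ∈ Omega S D) {x : K} (hx : x ∈ L (D - E)) : smulDual ω x ∈ Omega S E := by
  by_cases h0 : x = 0
  · subst h0; rw [map_zero]; exact zero_mem _
  · refine Omega_anti ?_ (smulDual_mem_Omega hω h0)
    rw [mem_L' h0] at hx
    rw [← sub_nonneg]
    convert hx using 1
    abel

lemma eq_zero_of_smulDual_eq_zero {ω : Module.Dual F K} {x : K} (hx : x ≠ 0)
    (h : smulDual ω x = 0) : ω = 0 := by
  ext f
  have := LinearMap.congr_fun h (x⁻¹ * f)
  rwa [smulDual_apply, mul_inv_cancel_left₀ hx] at this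

lemma exists_place : Nonempty (Place F K) := by
  obtain ⟨x, hx, -⟩ := hF.out
  exact ⟨(exists_pole_of_transcendental (F := F) hx).choose⟩

variable [hC : Fact (HasExactConstants F K)]

lemma L_inf (D E : Divisor F K) : L D ⊓ L E = L (D ⊓ E) := by
  ext f
  rw [Submodule.mem_inf, mem_L, mem_L, mem_L, ← forall_and]
  refine forall_congr' fun p => ?_
  rw [Finsupp.inf_apply]
  rcases le_total (D p) (E p) with h | h
  · rw [inf_eq_left.2 h]
    exact ⟨fun h => h.1, fun h1 => ⟨h1, p.V_anti (by omega) h1⟩⟩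
  · rw [inf_eq_right.2 h]
    exact ⟨fun h => h.2, fun h1 => ⟨p.V_anti (by omega) h1, h1⟩⟩

lemma exists_dv_of_ell_pos {D : Divisor F K} (h : 0 < ell F D) :
    ∃ f : K, f ≠ 0 ∧ f ∈ L D ∧ 0 ≤ D + dv f := by
  rw [ell_eq, Module.finrank_pos_iff] at h
  obtain ⟨⟨f, hf⟩, h0⟩ := exists_ne (0 : L D)
  have h0' : f ≠ 0 := fun h => h0 (Subtype.ext h)
  exact ⟨f, h0', hf, (mem_L' h0').1 hf⟩

/-- Riemann's inequality together with a divisor for which it is sharp. -/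
structure IsRiemann (F K : Type*) [Field F] [Field K] [Algebra F K] (g : ℕ) (D0 : Divisor F K) :
    Prop where
  le : ∀ D : Divisor F K, degHom F K D + 1 - g ≤ ell F D
  eq : degHom F K D0 + 1 - g = ell F D0

variable {g : ℕ} {D0 : Divisor F K}

lemma IsRiemann.ell_eq_of_large (h : IsRiemann F K g D0) {D : Divisor F K}
    (hD : degHom F K D0 + g ≤ degHom F K D) : (ell F D : ℤ) = degHom F K D + 1 - g := by
  have h1 := h.le (D - D0)
  rw [map_sub] at h1
  obtain ⟨f, h0, -, hf⟩ := exists_dv_of_ell_pos (D := D - D0) (by omega)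
  have h2 : D0 ≤ D - dv f⁻¹ := by
    rw [dv_inv, sub_neg_eq_add, ← sub_nonneg]
    convert hf using 1
    abel
  have h3 := ell_le_add h2
  rw [ell_sub_dv _ (inv_ne_zero h0), map_sub, degHom_dv] at h3
  have := h.le D
  have := h.eq
  omega

/-- The speciality index of a divisor. -/
def spec (g : ℕ) (D : Divisor F K) : ℕ := ((ell F D : ℤ) - degHom F K D - 1 + g).toNat

lemma IsRiemann.spec_eq (h : IsRiemann F K g D0) (D : Divisor F K) :
    (spec g D : ℤ) = (ell F D : ℤ) - degHom F K D - 1 + g :=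
  Int.toNat_of_nonneg (by have := h.le D; omega)

lemma exists_large (S : Place F K) (D : Divisor F K) (N : ℤ) :
    ∃ n0 : ℕ, ∀ n : ℕ, n0 ≤ n → N ≤ degHom F K (D + single S (n : ℤ)) := by
  refine ⟨(N - degHom F K D).toNat, fun n hn => ?_⟩
  rw [map_add, degHom_single]
  have := S.one_le_degree
  nlinarith [Int.self_le_toNat (N - degHom F K D)]

lemma IsRiemann.relDim_V_sup_Lam (h : IsRiemann F K g D0) (S : Place F K) (D : Divisor F K) {n : ℕ}
    (hn : degHom F K D0 + g ≤ degHom F K (D + single S (n : ℤ))) :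
    RelDim (S.V (-D S - n) ⊔ Lam S D) (Lam S D) (spec g D) := by
  have hle : S.V (-D S) ≤ S.V (-D S - n) := S.V_anti (by omega)
  have h1 : S.V (-D S - n) ⊓ Lam S D = L (D + single S (n : ℤ)) ⊔ S.V (-D S) := by
    rw [Lam, sup_comm, inf_comm, sup_inf_assoc_of_le _ hle, LAway_inf_V, sup_comm]
  have h2 : L (D + single S (n : ℤ)) ⊓ S.V (-D S) = L D := by
    rw [← LAway_inf_V, inf_assoc, inf_eq_right.2 hle]
    have := LAway_inf_V S D 0
    rwa [sub_zero, Finsupp.single_zero, add_zero] at this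
  have hDn : D ≤ D + single S (n : ℤ) := by simp
  have h3 := (L_relDim_ell hDn).1
  rw [← h2] at h3
  have h4 := relDim_sup_of_inf h3
  have h5 : RelDim (S.V (-D S - n)) (S.V (-D S)) (n * placeDegree F S) := by
    simpa using S.relDim_add (-D S - n) n
  rw [← h1] at h4
  obtain ⟨m, hm1, hm2, hm3⟩ := h5.exists_le h4.le inf_le_left |>.imp fun _ h => h
  have h6 := hm1.unique h4
  have h7 := relDim_sup_of_inf hm2
  convert h7 using 1
  have h8 := h.ell_eq_of_large hn
  have h9 := h.spec_eq D
  have h10 := ell_mono hDn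
  rw [map_add, degHom_single] at h8
  zify [hm3]
  rw [h6, Nat.cast_sub h10]
  linarith

lemma IsRiemann.relDim_top_Lam (h : IsRiemann F K g D0) (S : Place F K) (D : Divisor F K) :
    RelDim ⊤ (Lam S D) (spec g D) := by
  obtain ⟨n0, hn0⟩ := exists_large S D (degHom F K D0 + g)
  have h0 := h.relDim_V_sup_Lam S D (hn0 n0 le_rfl)
  convert h0 using 1
  rw [eq_comm, eq_top_iff]
  intro f _
  set n := n0 + (-D S - S.ord f).toNat
  have h1 := h.relDim_V_sup_Lam S D (hn0 n (by omega))
  have hle : S.V (-D S - n0) ⊔ Lam S D ≤ S.V (-D S - n) ⊔ Lam S D :=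
    sup_le_sup_right (S.V_anti (by omega)) _
  obtain ⟨m, hm1, hm2, -⟩ := h1.exists_le h0.le hle
  rw [hm1.unique h0, Nat.sub_self] at hm2
  rw [← hm2.eq_of_zero]
  exact Submodule.mem_sup_left fun _ => by omega

lemma IsRiemann.finrank_Omega (h : IsRiemann F K g D0) (S : Place F K) (D : Divisor F K) :
    FiniteDimensional F (Omega S D) ∧ finrank F (Omega S D) = spec g D := by
  have h1 := h.relDim_top_Lam S D
  have h2 : (⊤ : Submodule F K).map (Lam S D).mkQ = ⊤ := by
    rw [Submodule.map_top, Submodule.range_mkQ]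
  have hfin := h1.fin
  have heq := h1.eq
  rw [h2] at hfin heq
  have hfin' : FiniteDimensional F (K ⧸ Lam S D) := Module.Finite.equiv Submodule.topEquiv
  rw [finrank_top] at heq
  let e := (Lam S D).dualQuotEquivDualAnnihilator
  exact ⟨Module.Finite.equiv e, by rw [Omega, ← e.finrank_eq, Subspace.dual_finrank_eq, heq]⟩

lemma IsRiemann.exists_smulDual_eq (h : IsRiemann F K g D0) {S : Place F K} {D1 D2 : Divisor F K}
    {ω1 ω2 : Module.Dual F K} (h1 : ω1 ∈ Omega S D1) (h2 : ω2 ∈ Omega S D2) (hω1 : ω1 ≠ 0)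
    (hω2 : ω2 ≠ 0) : ∃ x : K, x ≠ 0 ∧ ω2 = smulDual ω1 x := by
  set n : ℕ := (3 * g - degHom F K D1 - degHom F K D2).toNat + 1 with hn
  set E : Divisor F K := -single S (n : ℤ) with hE
  have hdE : degHom F K E = -(n * placeDegree F S) := by rw [hE, map_neg, degHom_single]
  have hS : (1 : ℤ) ≤ placeDegree F S := by exact_mod_cast S.one_le_degree
  have hnS : (n : ℤ) ≤ n * placeDegree F S := by nlinarith
  let φ : (L (D1 - E) × L (D2 - E)) →ₗ[F] Omega S E :=
    (LinearMap.coprod ((smulDual ω1).domRestrict _) (-(smulDual ω2).domRestrict _)).codRestrict _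
      fun xy => by
        rw [LinearMap.coprod_apply]
        exact add_mem (smulDual_mem_Omega' h1 xy.1.2) (neg_mem (smulDual_mem_Omega' h2 xy.2.2))
  have hfin := (h.finrank_Omega S E).1
  have hlt : finrank F (Omega S E) < finrank F (L (D1 - E) × L (D2 - E)) := by
    rw [(h.finrank_Omega S E).2, Module.finrank_prod, ← ell_eq, ← ell_eq]
    have e1 := h.spec_eq E
    have e2 := h.le (D1 - E)
    have e3 := h.le (D2 - E)
    have e4 := ell_eq_zero (D := E) (by rw [hdE]; omega)
    rw [map_sub, hdE] at e2 e3
    rw [e4, hdE] at e1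
    zify
    rw [e1]
    push_cast
    omega
  have hker : ¬ Function.Injective φ := fun hi =>
    absurd (LinearMap.finrank_le_finrank_of_injective hi) (by omega)
  rw [injective_iff_map_eq_zero] at hker
  push Not at hker
  obtain ⟨⟨⟨x, hx⟩, ⟨y, hy⟩⟩, hxy, h0⟩ := hker
  have hxy' : smulDual ω1 x = smulDual ω2 y := by
    have := congrArg Subtype.val hxy
    have h3 : smulDual ω1 x + -smulDual ω2 y = 0 := this
    rwa [add_neg_eq_zero] at h3
  have hx0 : x ≠ 0 := by
    rintro rfl
    rw [map_zero] at hxy'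
    by_cases hy0 : y = 0
    · subst hy0; exact h0 rfl
    · exact hω2 (eq_zero_of_smulDual_eq_zero hy0 hxy'.symm)
  have hy0 : y ≠ 0 := by
    rintro rfl
    rw [map_zero] at hxy'
    exact hω1 (eq_zero_of_smulDual_eq_zero hx0 hxy')
  refine ⟨x / y, div_ne_zero hx0 hy0, ?_⟩
  ext f
  have := LinearMap.congr_fun hxy' (y⁻¹ * f)
  simp only [smulDual_apply, mul_inv_cancel_left₀ hy0] at this
  rw [← this, smulDual_apply, div_eq_mul_inv, mul_assoc]

lemma IsRiemann.L_sup_large (h : IsRiemann F K g D0) {D E : Divisor F K}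
    (hDE : degHom F K D0 + g ≤ degHom F K (D ⊓ E)) : L D ⊔ L E = L (D ⊔ E) := by
  have hd : degHom F K (D ⊓ E) + degHom F K (D ⊔ E) = degHom F K D + degHom F K E := by
    rw [← map_add, ← map_add]
    congr 1
    ext p
    simp only [Finsupp.add_apply, Finsupp.inf_apply, Finsupp.sup_apply]
    exact inf_add_sup (D p) (E p)
  have h1 := degHom_mono (inf_le_left : D ⊓ E ≤ D)
  have h2 := degHom_mono (inf_le_right : D ⊓ E ≤ E)
  have h3 := degHom_mono (le_sup_left : D ≤ D ⊔ E)
  apply Submodule.eq_of_le_of_finrank_le (sup_le (L_mono le_sup_left) (L_mono le_sup_right))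
  have h4 := Submodule.finrank_sup_add_finrank_inf_eq (L D) (L E)
  rw [L_inf, ← ell_eq, ← ell_eq, ← ell_eq] at h4
  rw [← ell_eq]
  have e1 := h.ell_eq_of_large hDE
  have e2 := h.ell_eq_of_large (hDE.trans h1)
  have e3 := h.ell_eq_of_large (hDE.trans h2)
  have e4 := h.ell_eq_of_large (hDE.trans (h1.trans h3))
  omega

lemma IsRiemann.Omega_sup (h : IsRiemann F K g D0) {S : Place F K} {D E : Divisor F K}
    {ω : Module.Dual F K} (h1 : ω ∈ Omega S D) (h2 : ω ∈ Omega S E) : ω ∈ Omega S (D ⊔ E) := by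
  rw [mem_Omega]
  intro f hf
  obtain ⟨a, ha, b, hb, rfl⟩ := Submodule.mem_sup.1 hf
  rw [map_add]
  have hb0 : ω b = 0 := by
    rw [Finsupp.sup_apply] at hb
    rcases le_total (D S) (E S) with h | h
    · rw [sup_eq_right.2 h] at hb
      exact mem_Omega.1 h2 b (Submodule.mem_sup_right hb)
    · rw [sup_eq_left.2 h] at hb
      exact mem_Omega.1 h1 b (Submodule.mem_sup_right hb)
  have ha0 : ω a = 0 := by
    obtain ⟨n1, hn1⟩ := exists_single_of_mem_LAway ha
    obtain ⟨n2, hn2⟩ := exists_large S (D ⊓ E) (degHom F K D0 + g)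
    set T : Divisor F K := single S ((n1 + n2 : ℕ) : ℤ)
    have e1 : D ⊔ E + T = (D + T) ⊔ (E + T) := sup_add D E T
    have e2 : D ⊓ E + T = (D + T) ⊓ (E + T) := inf_add D E T
    have h3 := hn1 (n1 + n2) (by omega)
    have h4 := hn2 (n1 + n2) (by omega)
    rw [e1, ← h.L_sup_large (by rwa [e2] at h4)] at h3
    obtain ⟨c, hc, d, hd, rfl⟩ := Submodule.mem_sup.1 h3
    have hin : ∀ D : Divisor F K, L (D + T) ≤ Lam S D := fun D => by
      rw [← LAway_inf_V]; exact inf_le_left.trans le_sup_left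
    rw [map_add, mem_Omega.1 h1 c (hin _ hc), mem_Omega.1 h2 d (hin _ hd), add_zero]
  rw [ha0, hb0, add_zero]

theorem IsRiemann.riemann_roch (h : IsRiemann F K g D0) : ∃ W : Divisor F K, ∀ D : Divisor F K,
    (ell F D : ℤ) = degHom F K D + 1 - g + ell F (W - D) := by
  obtain ⟨S⟩ := exists_place (F := F) (K := K)
  obtain ⟨ω, D1, hω, hω0⟩ : ∃ ω : Module.Dual F K, ∃ D : Divisor F K, ω ∈ Omega S D ∧ ω ≠ 0 := by
    set E : Divisor F K := -single S 2 with hE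
    have hdE : degHom F K E = -(2 * placeDegree F S) := by rw [hE, map_neg, degHom_single]
    have hS := S.one_le_degree
    have e1 := h.spec_eq E
    have e4 := ell_eq_zero (D := E) (by rw [hdE]; omega)
    have := h.finrank_Omega S E
    have hpos : 0 < finrank F (Omega S E) := by
      rw [this.2]; zify; rw [e1, e4, hdE]; push_cast; omega
    have hne : Omega S E ≠ ⊥ := fun hb => by rw [hb, finrank_bot] at hpos; omega
    obtain ⟨ω, hω, h0⟩ := Submodule.exists_mem_ne_zero_of_ne_bot hne
    exact ⟨ω, E, hω, h0⟩
  have hbound : ∀ D : Divisor F K, ω ∈ Omega S D → degHom F K D ≤ degHom F K D0 + g := by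
    intro D hD
    by_contra! hlt
    have e1 := h.spec_eq D
    rw [h.ell_eq_of_large hlt.le] at e1
    obtain ⟨hf, hr⟩ := h.finrank_Omega S D
    have : spec g D = 0 := by omega
    rw [this, Submodule.finrank_eq_zero] at hr
    rw [hr] at hD
    exact hω0 hD
  obtain ⟨W, hW, hmax⟩ : ∃ W : Divisor F K, ω ∈ Omega S W ∧
      ∀ D : Divisor F K, ω ∈ Omega S D → degHom F K D ≤ degHom F K W := by
    obtain ⟨d, ⟨W, hW, rfl⟩, hd⟩ := Int.exists_greatest_of_bdd
      (P := fun d => ∃ D : Divisor F K, ω ∈ Omega S D ∧ degHom F K D = d)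
      ⟨_, by rintro _ ⟨D, hD, rfl⟩; exact hbound D hD⟩ ⟨_, D1, hω, rfl⟩
    exact ⟨W, hW, fun D hD => hd _ ⟨D, hD, rfl⟩⟩
  have hle : ∀ D : Divisor F K, ω ∈ Omega S D → D ≤ W := by
    intro D hD
    have h1 := hmax _ (h.Omega_sup hW hD)
    have h2 : W ≤ W ⊔ D := le_sup_left
    have h3 := eq_zero_of_degHom_eq_zero (sub_nonneg.2 h2) (by
      have := degHom_mono h2
      rw [map_sub]; omega)
    rw [sub_eq_zero] at h3
    rw [← h3]; exact le_sup_right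
  refine ⟨W, fun D => ?_⟩
  have e1 := h.spec_eq D
  suffices ell F (W - D) = spec g D by rw [this, e1]; ring
  rw [← (h.finrank_Omega S D).2, ell_eq]
  refine LinearEquiv.finrank_eq (LinearEquiv.ofBijective
    (((smulDual ω).domRestrict (L (W - D))).codRestrict (Omega S D)
      fun x => smulDual_mem_Omega' hW x.2) ⟨?_, ?_⟩)
  · refine (injective_iff_map_eq_zero _).2 ?_
    rintro ⟨x, hx⟩ hx'
    have : smulDual ω x = 0 := congrArg Subtype.val hx'
    by_contra h0
    exact hω0 (eq_zero_of_smulDual_eq_zero (fun h => h0 (Subtype.ext h)) this)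
  · rintro ⟨η, hη⟩
    by_cases h0 : η = 0
    · subst h0; exact ⟨0, by simp; rfl⟩
    obtain ⟨x, hx0, rfl⟩ := h.exists_smulDual_eq hW hη hω0 h0
    refine ⟨⟨x, ?_⟩, rfl⟩
    have h1 := smulDual_mem_Omega hη (inv_ne_zero hx0)
    have h2 : smulDual (smulDual ω x) x⁻¹ = ω := by
      ext f
      simp only [smulDual_apply]
      rw [mul_inv_cancel_left₀ hx0]
    rw [h2] at h1
    have h3 := hle _ h1
    rw [dv_inv] at h3
    rw [mem_L' hx0]
    rw [← sub_nonneg] at h3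
    convert h3 using 1
    abel

end RiemannRoch

section PolyIndepEll

variable {F K : Type*} [Field F] [Field K] [Algebra F K] [hF : Fact (IsFunctionField F K)]
  [hC : Fact (HasExactConstants F K)]

lemma PolyIndep.sum_le_ell {x : K} {ι : Type*} [Fintype ι] {f : ι → K} (hf : PolyIndep F x f)
    (n : ι → ℕ) {D : Divisor F K} (h : ∀ i, ∀ j < n i, x ^ j * f i ∈ L D) :
    ∑ i, n i ≤ ell F D ∧ (ell F D ≤ ∑ i, n i → ∀ g ∈ L D, ∃ r : ι → F[X],
      (∀ i, r i ∈ degreeLT F (n i)) ∧ g = ∑ i, aeval x (r i) * f i) := by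
  let Φ : (∀ i, degreeLT F (n i)) →ₗ[F] K :=
    ∑ i, (LinearMap.mulRight F (f i)) ∘ₗ (aeval x).toLinearMap ∘ₗ (degreeLT F (n i)).subtype ∘ₗ
      LinearMap.proj i
  have hΦ : ∀ r, Φ r = ∑ i, aeval x (r i : F[X]) * f i := fun r => by
    simp only [Φ, LinearMap.sum_apply]; rfl
  have hmem : ∀ r, Φ r ∈ L D := by
    intro r
    rw [hΦ]
    refine sum_mem fun i _ => ?_
    have hr : (r i : F[X]) ∈ degreeLT F (n i) := (r i).2
    rw [mem_degreeLT] at hr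
    rw [aeval_eq_sum_range' (show (r i : F[X]).natDegree < n i + 1 by
      rw [Nat.lt_succ_iff]; exact natDegree_le_of_degree_le hr.le), Finset.sum_mul]
    refine sum_mem fun j hj => ?_
    rw [Algebra.smul_mul_assoc]
    by_cases hjn : j < n i
    · exact Submodule.smul_mem _ _ (h i j hjn)
    · rw [coeff_eq_zero_of_degree_lt, zero_smul]
      · exact zero_mem _
      · exact hr.trans_le (by exact_mod_cast not_lt.1 hjn)
  let Ψ : (∀ i, degreeLT F (n i)) →ₗ[F] L D := Φ.codRestrict _ hmem
  have hinj : Function.Injective Ψ := by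
    refine (injective_iff_map_eq_zero _).2 fun r hr => ?_
    have h1 : Φ r = 0 := congrArg Subtype.val hr
    rw [hΦ] at h1
    funext i
    exact Subtype.ext (hf _ h1 i)
  have : ∀ i, finrank F (degreeLT F (n i)) = n i := fun i => by
    rw [(degreeLTEquiv F (n i)).finrank_eq, Module.finrank_fin_fun]
  have hfin : ∀ i, Module.Finite F (degreeLT F (n i)) := fun i =>
    Module.Finite.equiv (degreeLTEquiv F (n i)).symm
  have hr : finrank F (∀ i, degreeLT F (n i)) = ∑ i, n i := by
    rw [Module.finrank_pi_fintype]
    exact Finset.sum_congr rfl fun i _ => this i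
  have hle := LinearMap.finrank_le_finrank_of_injective hinj
  rw [hr, ← ell_eq] at hle
  refine ⟨hle, fun hge g hg => ?_⟩
  have hs : Function.Surjective Ψ :=
    (LinearMap.injective_iff_surjective_of_finrank_eq_finrank (by
      rw [hr, ← ell_eq]; omega)).1 hinj
  obtain ⟨r, hr⟩ := hs ⟨g, hg⟩
  refine ⟨fun i => r i, fun i => (r i).2, ?_⟩
  rw [← hΦ]
  exact (congrArg Subtype.val hr).symm

lemma transcendental_of_not_mem {x : K} (hx : x ∉ (algebraMap F K).range) : Transcendental F x :=
  fun h => hx (hC.out x h)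

lemma polyIndep_one {x : K} (hx : Transcendental F x) : PolyIndep F x (fun _ : Fin 1 => (1 : K)) := by
  intro r hr i
  simp only [Finset.univ_unique, Fin.default_eq_zero, mul_one, Finset.sum_singleton] at hr
  rw [Subsingleton.elim i 0]
  by_contra h
  exact hx ⟨r 0, h, hr⟩

lemma exists_not_mem_of_two_le_ell {D : Divisor F K} (hD : 2 ≤ ell F D) :
    ∃ x ∈ L D, x ∉ (algebraMap F K).range := by
  by_contra! h
  have h1 : L D ≤ Submodule.span F {(1 : K)} := by
    intro x hx
    obtain ⟨c, rfl⟩ := h x hx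
    rw [Algebra.algebraMap_eq_smul_one]
    exact Submodule.smul_mem _ _ (Submodule.mem_span_singleton_self _)
  have h2 := Submodule.finrank_mono h1
  rw [← ell_eq, finrank_span_singleton one_ne_zero] at h2
  omega

lemma pow_mem_L {D : Divisor F K} {x : K} (hx : x ∈ L D) (n : ℕ) : x ^ n ∈ L (n • D) := by
  induction n with
  | zero => rw [pow_zero, zero_smul]; exact one_mem_L le_rfl
  | succ n ih => rw [pow_succ, succ_nsmul]; exact mul_mem_L ih hx

lemma pow_mem_L_of_le {D : Divisor F K} (hD : 0 ≤ D) {x : K} (hx : x ∈ L D) {m n : ℕ} (h : m ≤ n) :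
    x ^ m ∈ L (n • D) := L_mono (nsmul_le_nsmul_left hD h) (pow_mem_L hx m)

lemma succ_le_ell_nsmul {D : Divisor F K} (hD : 0 ≤ D) {x : K} (hx : x ∈ L D)
    (ht : Transcendental F x) (n : ℕ) : n + 1 ≤ ell F (n • D) := by
  have := ((polyIndep_one ht).sum_le_ell (fun _ => n + 1) (D := n • D) (fun i j hj => by
    rw [mul_one]; exact pow_mem_L_of_le hD hx (by omega))).1
  simpa using this

/-- The pole divisor of `x`. -/
def poles (x : K) : Divisor F K := -dv x ⊔ 0

lemma poles_apply (x : K) (p : Place F K) : poles x p = max (-p.ord x) 0 := rfl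

lemma poles_nonneg (x : K) : (0 : Divisor F K) ≤ poles x := le_sup_right

lemma mem_L_poles (x : K) : x ∈ L (poles x : Divisor F K) := by
  by_cases h : x = 0
  · rw [h]; exact zero_mem _
  rw [mem_L' h]
  have : -dv x ≤ (poles x : Divisor F K) := le_sup_left
  rwa [neg_le_iff_add_nonneg] at this

lemma poles_le {D : Divisor F K} (hD : 0 ≤ D) {x : K} (hx : x ∈ L D) : poles x ≤ D := by
  by_cases h : x = 0
  · subst h
    have : (poles (0:K) : Divisor F K) = 0 := by
      ext p; rw [poles_apply, p.ord_zero]; rfl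
    rw [this]; exact hD
  rw [mem_L' h] at hx
  exact sup_le (by rwa [neg_le_iff_add_nonneg]) hD

lemma two_le_ell_poles {x : K} (ht : Transcendental F x) : 2 ≤ ell F (poles x : Divisor F K) := by
  have := succ_le_ell_nsmul (poles_nonneg x) (mem_L_poles x) ht 1
  rwa [one_smul] at this

lemma transcendental_of_ell {x : K} (hx : x ∉ (algebraMap F K).range) {r : F[X]}
    (hr : ∀ c, r ≠ C c) : Transcendental F (aeval x r) := by
  refine transcendental_of_not_mem fun ⟨c, hc⟩ => ?_
  refine transcendental_of_not_mem hx ⟨r - C c, sub_ne_zero.2 (hr c), ?_⟩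
  rw [map_sub, aeval_C, ← hc, sub_self]

lemma Place.ord_aeval (p : Place F K) {x : K} (hx : p.ord x < 0) {r : F[X]} (hr : r ≠ 0) :
    p.ord (aeval x r) = r.natDegree * p.ord x := by
  have hx0 : x ≠ 0 := by rintro rfl; rw [p.ord_zero] at hx; omega
  have h1 : p.ord (algebraMap F K r.leadingCoeff * x ^ r.natDegree) = r.natDegree * p.ord x := by
    rw [p.ord_mul ((_root_.map_ne_zero _).2 (leadingCoeff_ne_zero.2 hr)) (pow_ne_zero _ hx0), p.ord_const,
      p.ord_pow, zero_add]
  rw [aeval_eq_sum_range, Finset.sum_range_succ, add_comm, Algebra.smul_def]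
  rw [coeff_natDegree, (p.ord_add_eq_left ?_ ?_).2, h1]
  · exact mul_ne_zero ((_root_.map_ne_zero _).2 (leadingCoeff_ne_zero.2 hr)) (pow_ne_zero _ hx0)
  · refine sum_mem fun i hi => ?_
    rw [Finset.mem_range] at hi
    refine Submodule.smul_mem _ _ ?_
    rw [p.mem_V' (pow_ne_zero _ hx0), h1, p.ord_pow]
    have : (i : ℤ) + 1 ≤ r.natDegree := by exact_mod_cast hi
    nlinarith

lemma aeval_mem_place (p : Place F K) {x : K} (hx : x ∈ p.1) (r : F[X]) : aeval x r ∈ p.1 := by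
  rw [aeval_eq_sum_range]
  refine sum_mem fun i _ => ?_
  rw [Algebra.smul_def]
  exact mul_mem (p.2.2 _) (pow_mem hx _)

lemma exists_dep_of_not_polyIndep {x y : K} (hx : Transcendental F x)
    (h : ¬ PolyIndep F x ![1, y]) : ∃ r s : F[X], IsCoprime r s ∧ s ≠ 0 ∧
      aeval x s * y = aeval x r := by
  simp only [PolyIndep, not_forall] at h
  obtain ⟨r, hr, i, hi⟩ := h
  rw [Fin.sum_univ_two] at hr
  simp only [Matrix.cons_val_zero, Matrix.cons_val_one, mul_one] at hr
  have h1 : r 1 ≠ 0 := by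
    intro h1
    rw [h1, map_zero, zero_mul, add_zero] at hr
    have h0 : r 0 = 0 := by
      by_contra h0; exact hx ⟨_, h0, hr⟩
    fin_cases i
    · exact hi h0
    · exact hi h1
  obtain ⟨d, a, b, hab, e0, e1⟩ : ∃ d a b : F[X], IsCoprime a b ∧ -(r 0) = d * a ∧ r 1 = d * b := by
    have hg : GCDMonoid.gcd (-(r 0)) (r 1) ≠ 0 := fun h => h1 ((gcd_eq_zero_iff _ _).1 h).2
    exact ⟨_, _, _, isCoprime_div_gcd_div_gcd h1,
      (EuclideanDomain.mul_div_cancel' hg (GCDMonoid.gcd_dvd_left _ _)).symm,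
      (EuclideanDomain.mul_div_cancel' hg (GCDMonoid.gcd_dvd_right _ _)).symm⟩
  have hd : d ≠ 0 := by rintro rfl; rw [zero_mul] at e1; exact h1 e1
  have hb : b ≠ 0 := by rintro rfl; rw [mul_zero] at e1; exact h1 e1
  refine ⟨a, b, hab, hb, ?_⟩
  have hdx : aeval x d ≠ 0 := fun h => hx ⟨d, hd, h⟩
  apply mul_left_cancel₀ hdx
  have e0' := congrArg (aeval x) e0
  have e1' := congrArg (aeval x) e1
  rw [map_neg, map_mul] at e0'
  rw [map_mul] at e1'
  rw [← e0', ← mul_assoc, ← e1']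
  linear_combination hr

lemma polyIndep_one_of_mem_L_poles {x y : K} (hx : x ∉ (algebraMap F K).range)
    (hy : y ∈ L (poles x : Divisor F K)) (hxy : ∀ a b : F, y ≠ algebraMap F K a + algebraMap F K b * x) :
    PolyIndep F x ![1, y] := by
  have ht := transcendental_of_not_mem hx
  by_contra h
  obtain ⟨r, s, hrs, hs0, e⟩ := exists_dep_of_not_polyIndep ht h
  have hsx : aeval x s ≠ 0 := fun h => ht ⟨_, hs0, h⟩
  have hsc : ∃ c, s = C c := by
    by_contra! hc
    obtain ⟨p, hp⟩ := exists_zero_of_transcendental (F := F) (transcendental_of_ell hx hc)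
    rw [p.val_lt_one_iff hsx] at hp
    have hxp : 0 ≤ p.ord x := by
      by_contra! hlt
      rw [p.ord_aeval hlt hs0] at hp
      nlinarith [Int.natCast_nonneg s.natDegree]
    have hyp : y ∈ p.V 0 := by
      have := mem_L.1 hy p
      rwa [poles_apply, max_eq_right (by omega), neg_zero] at this
    have h1 : aeval x r ∈ p.V 1 := by
      rw [← e]
      have := p.mul_mem_V ((p.mem_V' hsx).2 (show (1:ℤ) ≤ _ by omega)) hyp
      simpa using this
    obtain ⟨a, b, hab⟩ := hrs
    have h2 : (1 : K) ∈ p.V 1 := by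
      have h3 := congrArg (aeval x) hab
      rw [map_add, map_mul, map_mul, map_one] at h3
      rw [← h3]
      have hxm := p.mem_iff.2 hxp
      refine add_mem ?_ ?_
      · have := p.mul_mem_V (p.mem_V_zero.2 (aeval_mem_place p hxm a)) h1
        simpa using this
      · have := p.mul_mem_V (p.mem_V_zero.2 (aeval_mem_place p hxm b))
          ((p.mem_V' hsx).2 (show (1:ℤ) ≤ _ by omega))
        simpa using this
    rw [p.mem_V' one_ne_zero, p.ord_one] at h2
    omega
  obtain ⟨c, rfl⟩ := hsc
  have hc0 : c ≠ 0 := fun h => hs0 (by rw [h, C_0])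
  rw [aeval_C] at e
  have hcK : algebraMap F K c ≠ 0 := (_root_.map_ne_zero _).2 hc0
  have e2 : y = aeval x (C c⁻¹ * r) := by
    rw [map_mul, aeval_C, ← e, map_inv₀, inv_mul_cancel_left₀ hcK]
  set t := C c⁻¹ * r with ht'
  obtain ⟨p, hp⟩ := exists_pole_of_transcendental ht
  have hdeg : t.natDegree ≤ 1 := by
    by_cases ht0 : t = 0
    · rw [ht0, natDegree_zero]; omega
    have h0 : y ≠ 0 := by rw [e2]; exact fun h => ht ⟨_, ht0, h⟩
    have := (p.mem_V' h0).1 (mem_L.1 hy p)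
    rw [poles_apply, max_eq_left (by omega), neg_neg, e2, p.ord_aeval hp ht0] at this
    by_contra! hlt
    have : (2:ℤ) ≤ t.natDegree := by exact_mod_cast hlt
    nlinarith
  obtain ⟨a, b, hab⟩ := exists_eq_X_add_C_of_natDegree_le_one hdeg
  refine hxy b a ?_
  rw [e2, hab]
  simp [add_comm]

end PolyIndepEll

section ClassNumberOne

variable (K : Type*) [Field K] [Algebra F₂ K] [hF : Fact (IsFunctionField F₂ K)]
  [hC : Fact (HasExactConstants F₂ K)]

/-- The two properties of a function field of genus four and class number one that are used:
the Riemann-Roch theorem and the principality of divisors of degree zero. -/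
structure GenusFourClassOne : Prop where
  rr : ∃ W : Divisor F₂ K, ∀ D : Divisor F₂ K,
    (ell F₂ D : ℤ) = degHom F₂ K D - 3 + ell F₂ (W - D)
  pr : ∀ D : Divisor F₂ K, degHom F₂ K D = 0 → ∃ f : K, f ≠ 0 ∧ D = dv f

lemma isRiemann_of_genus {g : ℕ} (hg : g ≠ 0) (h : genus F₂ K = g) :
    ∃ D0, IsRiemann F₂ K g D0 := by
  have hb : BddAbove {g : ℕ | ∃ D : Divisor F₂ K,
      (g : ℤ) = degHom F₂ K D + 1 - ell F₂ D} := by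
    by_contra hb
    rw [genus, Nat.sSup_of_not_bddAbove hb] at h
    exact hg h.symm
  have hne : {g : ℕ | ∃ D : Divisor F₂ K,
      (g : ℤ) = degHom F₂ K D + 1 - ell F₂ D}.Nonempty := by
    refine ⟨0, 0, ?_⟩
    rw [map_zero, ell_zero]; rfl
  obtain ⟨D0, hD0⟩ := Nat.sSup_mem hne hb
  refine ⟨D0, fun D => ?_, ?_⟩
  · by_contra! hlt
    have hnn : 0 ≤ degHom F₂ K D + 1 - ell F₂ D := by omega
    have := le_csSup hb (show (degHom F₂ K D + 1 - ell F₂ D).toNat ∈ _ from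
      ⟨D, Int.toNat_of_nonneg hnn⟩)
    rw [genus] at h
    rw [h] at this
    omega
  · rw [genus] at h
    rw [h] at hD0
    omega

lemma exists_dv_of_classNumber (h : classNumber F₂ K = 1) (D : Divisor F₂ K)
    (hD : degHom F₂ K D = 0) : ∃ f : K, f ≠ 0 ∧ D = dv f := by
  have hm : D ∈ principalDivisors F₂ K := by
    have h1 := (Nat.card_eq_one_iff_unique.1 h).1
    have h2 := h1.elim (QuotientAddGroup.mk (⟨D, hD⟩ : zeroDivisors F₂ K) :
      ClassGroup0 F₂ K) (QuotientAddGroup.mk 0)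
    have h3 := QuotientAddGroup.eq.1 h2
    rw [AddSubgroup.mem_addSubgroupOf] at h3
    simpa using h3
  rw [principalDivisors] at hm
  induction hm using AddSubgroup.closure_induction with
  | mem D h =>
    obtain ⟨f, hf, h⟩ := h
    exact ⟨f, hf, Finsupp.ext fun p => h p⟩
  | zero => exact ⟨1, one_ne_zero, dv_one.symm⟩
  | add D E h1 h2 ih1 ih2 =>
    have hz : ∀ D ∈ AddSubgroup.closure {D : Divisor F₂ K | ∃ f : K, f ≠ 0 ∧
        ∀ p : Place F₂ K, D p = ordAt p.1 f}, degHom F₂ K D = 0 := by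
      intro D hD
      induction hD using AddSubgroup.closure_induction with
      | mem D h =>
        obtain ⟨f, hf, h⟩ := h
        rw [show D = dv f from Finsupp.ext fun p => h p]
        exact degHom_dv f
      | zero => exact map_zero _
      | add D E _ _ ih1 ih2 => rw [map_add, ih1, ih2, add_zero]
      | neg D _ ih => rw [map_neg, ih, neg_zero]
    obtain ⟨f, hf, rfl⟩ := ih1 (hz D h1)
    obtain ⟨g, hg, rfl⟩ := ih2 (hz E h2)
    exact ⟨f * g, mul_ne_zero hf hg, (dv_mul hf hg).symm⟩
  | neg D _ ih =>
    rw [map_neg, neg_eq_zero] at hD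
    obtain ⟨f, hf, rfl⟩ := ih hD
    exact ⟨f⁻¹, inv_ne_zero hf, (dv_inv f).symm⟩

lemma genusFourClassOne_of (hg : genus F₂ K = 4) (hh : classNumber F₂ K = 1) :
    GenusFourClassOne K := by
  refine ⟨?_, exists_dv_of_classNumber K hh⟩
  obtain ⟨D0, h⟩ := isRiemann_of_genus K (g := 4) (by norm_num) hg
  obtain ⟨W, hW⟩ := h.riemann_roch
  refine ⟨W, fun D => ?_⟩
  rw [hW D]; push_cast; ring

variable {K}
variable [hG : Fact (GenusFourClassOne K)]

/-- The degree of a divisor. -/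
abbrev deg (D : Divisor F₂ K) : ℤ := degHom F₂ K D

/-- The dimension of the Riemann-Roch space of a divisor. -/
abbrev el (D : Divisor F₂ K) : ℕ := ell F₂ D

lemma exists_eq_add_dv {D E : Divisor F₂ K} (h : deg D = deg E) :
    ∃ f : K, f ≠ 0 ∧ D = E + dv f := by
  obtain ⟨f, hf, e⟩ := hG.out.pr (D - E) (by rw [map_sub]; exact sub_eq_zero.2 h)
  exact ⟨f, hf, by rw [← e]; abel⟩

lemma el_congr {D E : Divisor F₂ K} (h : deg D = deg E) : el D = el E := by
  obtain ⟨f, hf, rfl⟩ := exists_eq_add_dv h.symm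
  have := ell_sub_dv (D + dv f) hf
  rwa [add_sub_cancel_right] at this

lemma riemann_roch {D E : Divisor F₂ K} (h : deg D + deg E = 6) :
    (el D : ℤ) = deg D - 3 + el E := by
  obtain ⟨W, hW⟩ := hG.out.rr
  have h0 := hW 0
  have h1 := hW W
  rw [sub_zero, map_zero, ell_zero] at h0
  rw [sub_self, ell_zero] at h1
  have : el (W - D) = el E := el_congr (by simp only [map_sub, deg] at *; omega)
  rw [← this]; exact hW D

lemma el_of_deg_eq_zero {D : Divisor F₂ K} (h : deg D = 0) : el D = 1 := by
  have := el_congr (E := 0) (h.trans (map_zero _).symm)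
  rw [this]; exact ell_zero

lemma el_of_deg_eq_six {D : Divisor F₂ K} (h : deg D = 6) : el D = 4 := by
  have := riemann_roch (D := D) (E := 0) (by rw [h]; simp [deg])
  rw [el_of_deg_eq_zero (map_zero _), h] at this
  omega

lemma exists_deg_six : ∃ W : Divisor F₂ K, deg W = 6 := by
  obtain ⟨W, hW⟩ := hG.out.rr
  have h0 := hW 0
  have h1 := hW W
  rw [sub_zero, map_zero, ell_zero] at h0
  rw [sub_self, ell_zero] at h1
  exact ⟨W, by simp only [deg]; omega⟩

lemma el_of_seven_le {D : Divisor F₂ K} (h : 7 ≤ deg D) : (el D : ℤ) = deg D - 3 := by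
  obtain ⟨W, hW⟩ := exists_deg_six (K := K)
  have := riemann_roch (D := D) (E := W - D) (by simp only [deg, map_sub] at *; omega)
  rw [this, show el (W - D) = 0 from ell_eq_zero (by simp only [deg, map_sub] at *; omega)]
  simp

lemma eq_of_el_eq_one {D E : Divisor F₂ K} (hD : 0 ≤ D) (hE : 0 ≤ E) (h : deg D = deg E)
    (h1 : el E ≤ 1) : D = E := by
  obtain ⟨f, hf, rfl⟩ := exists_eq_add_dv h
  have hfm : f ∈ L E := (mem_L' hf).2 hD
  by_cases hc : f ∈ (algebraMap F₂ K).range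
  · obtain ⟨c, rfl⟩ := hc
    have : (dv (algebraMap F₂ K c) : Divisor F₂ K) = 0 := by
      ext p; exact p.ord_const c
    rw [this, add_zero]
  · have := succ_le_ell_nsmul hE hfm (transcendental_of_not_mem hc) 1
    rw [one_smul] at this
    have : 1 + 1 ≤ el E := this
    omega

lemma exists_eq_add_dv_mem {D E : Divisor F₂ K} (hD : 0 ≤ D) (h : deg D = deg E) :
    ∃ f : K, f ≠ 0 ∧ f ∈ L E ∧ D = E + dv f := by
  obtain ⟨f, hf, rfl⟩ := exists_eq_add_dv h
  exact ⟨f, hf, (mem_L' hf).2 hD, rfl⟩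

lemma exists_effective {D : Divisor F₂ K} (h : 0 < el D) : ∃ E : Divisor F₂ K,
    0 ≤ E ∧ deg E = deg D := by
  obtain ⟨f, hf, -, h⟩ := exists_dv_of_ell_pos h
  exact ⟨_, h, by simp only [deg]; rw [map_add, degHom_dv, add_zero]⟩

lemma el_le_one_of_deg_one {D : Divisor F₂ K} (h : deg D = 1) : el D ≤ 1 := by
  by_contra! h2
  obtain ⟨E, hE, hd⟩ := exists_effective (D := D) (by omega)
  rw [el_congr hd.symm] at h2
  obtain ⟨x, hx, hxc⟩ := exists_not_mem_of_two_le_ell h2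
  have h3 := succ_le_ell_nsmul hE hx (transcendental_of_not_mem hxc) 6
  have h4 : deg (6 • E) = 6 := by
    have : deg (6 • E) = 6 • deg E := map_nsmul _ _ _
    rw [this, hd, h]; rfl
  have h5 := el_of_deg_eq_six h4
  simp only [el] at h5
  omega

lemma deg_single (p : Place F₂ K) (n : ℤ) :
    deg (single p n) = n * deg₂ p := degHom_single p n

lemma single_nonneg' (p : Place F₂ K) {n : ℤ} (hn : 0 ≤ n) :
    (0 : Divisor F₂ K) ≤ single p n := Finsupp.single_nonneg.2 hn

lemma deg_poles_pos {x : K} (hx : x ∉ (algebraMap F₂ K).range) :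
    1 < deg (poles x) := by
  have ht := transcendental_of_not_mem (F := F₂) hx
  have h2 := two_le_ell_poles ht
  by_contra! hle
  have h0 := degHom_nonneg (poles_nonneg (F := F₂) x)
  have h1 := ell_le_of_nonneg (poles_nonneg (F := F₂) x)
  have h3 : deg (poles x) = 1 := by
    simp only [deg] at *
    omega
  have := el_le_one_of_deg_one h3
  simp only [el] at this
  omega

/-- If `d` divides six and no divisor of smaller degree has two independent sections, then nor
has a divisor of degree `d` three of them. -/
lemma el_le_two {d n : ℕ} (hdn : n * d = 6) (hn : 2 ≤ n)
    (hmin : ∀ D : Divisor F₂ K, deg D < d → el D < 2) {D : Divisor F₂ K}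
    (h : deg D = d) (hD : 0 ≤ D) {x : K} (hx : x ∈ L D) (hxc : x ∉ (algebraMap F₂ K).range) :
    poles x = D ∧ ∀ y ∈ L D, ∃ a b : F₂, y = algebraMap F₂ K a + algebraMap F₂ K b * x := by
  have ht := transcendental_of_not_mem hxc
  have hp : poles x = D := by
    have h1 := poles_le hD hx
    have h2 := two_le_ell_poles ht
    have h3 : (d : ℤ) ≤ deg (poles x) := by
      by_contra! hlt
      have := hmin _ hlt
      simp only [el] at this
      omega
    have h4 := eq_zero_of_degHom_eq_zero (sub_nonneg.2 h1) (by
      have := degHom_mono h1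
      simp only [deg, map_sub] at *; omega)
    exact (sub_eq_zero.1 h4).symm
  refine ⟨hp, fun y hy => ?_⟩
  by_contra! hxy
  have h1 := polyIndep_one_of_mem_L_poles hxc (hp ▸ hy) hxy
  have h2 := (h1.sum_le_ell ![n + 1, n] (D := n • D) (fun i j hj => by
    fin_cases i
    · simp only [Fin.zero_eta, Matrix.cons_val_zero, mul_one] at hj ⊢
      exact pow_mem_L_of_le hD hx (by omega)
    · simp only [Fin.mk_one, Matrix.cons_val_one] at hj ⊢
      obtain ⟨m, rfl⟩ : ∃ m, n = m + 1 := ⟨n - 1, by omega⟩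
      rw [succ_nsmul]
      exact mul_mem_L (pow_mem_L_of_le hD hx (by simpa using hj |> Nat.lt_succ_iff.1)) hy)).1
  have h3 : deg (n • D) = 6 := by
    have : deg (n • D) = n • deg D := map_nsmul _ _ _
    rw [this, h, nsmul_eq_mul]
    exact_mod_cast hdn
  have h4 := el_of_deg_eq_six h3
  rw [Fin.sum_univ_two] at h2
  simp only [Matrix.cons_val_zero, Matrix.cons_val_one, el] at h2 h4
  omega

lemma el_eq_two {d n : ℕ} (hdn : n * d = 6) (hn : 2 ≤ n)
    (hmin : ∀ D : Divisor F₂ K, deg D < d → el D < 2) {D : Divisor F₂ K}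
    (h : deg D = d) (h2 : 2 ≤ el D) : el D = 2 := by
  obtain ⟨E, hE, hd⟩ := exists_effective (D := D) (by omega)
  rw [el_congr hd.symm] at h2 ⊢
  obtain ⟨x, hx, hxc⟩ := exists_not_mem_of_two_le_ell h2
  obtain ⟨-, h3⟩ := el_le_two hdn hn hmin (hd.trans h) hE hx hxc
  refine le_antisymm ?_ h2
  have h4 : L E ≤ Submodule.span F₂ ({1, x} : Set K) := by
    intro y hy
    obtain ⟨a, b, rfl⟩ := h3 y hy
    rw [Algebra.algebraMap_eq_smul_one, ← Algebra.smul_def, Submodule.mem_span_pair]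
    exact ⟨a, b, rfl⟩
  have : FiniteDimensional F₂ (Submodule.span F₂ ({1, x} : Set K)) :=
    FiniteDimensional.span_of_finite _ (Set.toFinite _)
  have h5 := Submodule.finrank_mono (hst := h4)
  rw [← ell_eq] at h5
  refine h5.trans ?_
  have := finrank_span_finset_le_card (R := F₂) ({1, x} : Finset K)
  rw [Set.finrank, Finset.coe_pair] at this
  exact this.trans Finset.card_le_two

lemma zmod_two_cases (a : F₂) : a = 0 ∨ a = 1 := by revert a; decide

/-- The bound on the number of effective divisors of fixed degree `d`, when the space of
sections has dimension two. -/
lemma effective_cases {D : Divisor F₂ K} {x : K}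
    (hL : ∀ y ∈ L D, ∃ a b : F₂, y = algebraMap F₂ K a + algebraMap F₂ K b * x)
    {E : Divisor F₂ K} (hE : 0 ≤ E) (h : deg E = deg D) :
    E = D ∨ E = D + dv x ∨ E = D + dv (x + 1) := by
  obtain ⟨f, hf, hfm, rfl⟩ := exists_eq_add_dv_mem hE h
  obtain ⟨a, b, rfl⟩ := hL f hfm
  rcases zmod_two_cases a with rfl | rfl <;> rcases zmod_two_cases b with rfl | rfl
  · simp at hf
  · right; left; simp
  · left; simp [dv_one]
  · right; right; simp [add_comm]

end ClassNumberOne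

section Evaluation

variable {A B : Type*} [CommRing A] [CommRing B] [Algebra F₂ A] [Algebra F₂ B]

/-- Evaluation of polynomials in two variables over the field with two elements. -/
def ev (a b : A) : F₂[X][X] →+* A :=
  eval₂RingHom (aeval a : F₂[X] →ₐ[F₂] A).toRingHom b

lemma ev_apply (a b : A) (r : F₂[X][X]) :
    ev a b r = r.eval₂ (aeval a : F₂[X] →ₐ[F₂] A).toRingHom b := rfl

@[simp] lemma ev_C (a b : A) (r : F₂[X]) : ev a b (C r) = aeval a r := by
  rw [ev_apply, eval₂_C]; rfl

@[simp] lemma ev_X (a b : A) : ev a b X = b := by rw [ev_apply, eval₂_X]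

lemma map_ev (φ : A →+* B) (a b : A) (r : F₂[X][X]) : φ (ev a b r) = ev (φ a) (φ b) r := by
  rw [ev_apply, ev_apply, hom_eval₂]
  congr 1
  refine Polynomial.ringHom_ext (fun c => ?_) ?_
  · have : (φ.comp (algebraMap F₂ A)) = algebraMap F₂ B := Subsingleton.elim _ _
    have h2 := congrArg (· c) this
    simpa using h2
  · simp

lemma ev_eq_sum_range (a b : A) {r : F₂[X][X]} {n : ℕ} (hn : r.natDegree < n) :
    ev a b r = ∑ i : Fin n, aeval a (r.coeff i) * b ^ (i : ℕ) := by
  rw [ev_apply, eval₂_eq_sum_range' _ hn, Finset.sum_range]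
  rfl

end Evaluation

section Points

variable {K : Type*} [Field K] [Algebra F₂ K] [hF : Fact (IsFunctionField F₂ K)]
  [hC : Fact (HasExactConstants F₂ K)] [hG : Fact (GenusFourClassOne K)]

lemma Place.exists_sub_mem {S p : Place F₂ K} (h : p ≠ S) {f : K} (hf : f ∈ p.1) :
    ∃ n : ℕ, ∃ g ∈ L (single S (n : ℤ)), f - g ∈ p.V 1 := by
  set n : ℕ := 7 + deg₂ p with hn
  refine ⟨n, ?_⟩
  set D : Divisor F₂ K := single S (n : ℤ) with hD
  set E : Divisor F₂ K := D - single p 1 with hE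
  have hS := S.one_le_degree
  have dD : deg D = n * deg₂ S := by rw [hD, deg_single]
  have dE : deg E = deg D - deg₂ p := by
    simp only [hE, deg, map_sub]
    rw [degHom_single p 1, one_mul]
  have hnS : (n : ℤ) ≤ n * deg₂ S := by
    have : (1 : ℤ) ≤ deg₂ S := by exact_mod_cast hS
    nlinarith
  have e1 := el_of_seven_le (D := D) (by omega)
  have e2 := el_of_seven_le (D := E) (by omega)
  have hDp : D p = 0 := by rw [hD, single_apply, if_neg (Ne.symm h)]
  have hED : E ≤ D := sub_le_self _ (single_nonneg' p zero_le_one)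
  have hinf : L E = L D ⊓ p.V 1 := by
    ext g
    rw [Submodule.mem_inf, mem_L, mem_L]
    constructor
    · refine fun hg => ⟨fun q => (q.V_anti (by have := hED q; omega)) (hg q), ?_⟩
      have := hg p
      rwa [hE, Finsupp.sub_apply, hDp, single_eq_same, zero_sub, neg_neg] at this
    · rintro ⟨hg, hp⟩ q
      by_cases hq : q = p
      · rw [hq, hE, Finsupp.sub_apply, hDp, single_eq_same, zero_sub, neg_neg]
        exact hp
      · rw [hE, Finsupp.sub_apply, single_eq_of_ne hq, sub_zero]
        exact hg q
  have h1 := (L_relDim_ell hED).1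
  have hd : ell F₂ D - ell F₂ E = deg₂ p := by
    simp only [el] at e1 e2
    omega
  rw [hd, hinf] at h1
  have h2 := relDim_sup_of_inf h1
  have hle : L D ⊔ p.V 1 ≤ p.V 0 := by
    refine sup_le (fun g hg => ?_) (p.V_anti (by omega))
    have := mem_L.1 hg p
    rwa [hDp, neg_zero] at this
  obtain ⟨m, hm1, hm2, hm3⟩ := p.relDim_zero_one.exists_le h2.le hle
  have := hm1.unique h2
  rw [this, Nat.sub_self] at hm2
  have hfm := p.mem_V_zero.2 hf
  rw [hm2.eq_of_zero] at hfm
  obtain ⟨g, hg, z, hz, rfl⟩ := Submodule.mem_sup.1 hfm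
  exact ⟨g, hg, by rwa [add_sub_cancel_left]⟩

/-- The place `p` is centred at the point `(a, b)` of the affine curve with coordinates `u, v`. -/
structure IsCentre (u v : K) {k : Type*} [Field k] [Algebra F₂ k] (a b : k)
    (p : Place F₂ K) : Prop where
  mem : ∀ r, ev u v r ∈ p.1
  deg_eq : deg₂ p = finrank F₂ k
  iff : ∀ r, ev u v r ∈ p.V 1 ↔ ev a b r = 0

lemma IsCentre.aeval_iff {u v : K} {k : Type*} [Field k] [Algebra F₂ k] {a b : k}
    {p : Place F₂ K} (h : IsCentre u v a b p) (r : F₂[X]) :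
    aeval u r ∈ p.V 1 ↔ aeval a r = 0 := by
  have := h.iff (C r)
  simpa using this

lemma exists_isCentre {S : Place F₂ K} {u v : K} (hu : S.ord u < 0)
    (hR : ∀ n : ℕ, ∀ f ∈ L (single S (n : ℤ)), ∃ r, f = ev u v r)
    {k : Type*} [Field k] [Algebra F₂ k] [Finite k] {a b : k}
    (hgen : ∀ c : k, ∃ r, ev a b r = c) (hrel : ∀ r, ev u v r = 0 → ev a b r = 0) :
    ∃ p : Place F₂ K, p ≠ S ∧ IsCentre u v a b p := by
  have hut : Transcendental F₂ u := fun h => by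
    rw [S.ord_eq_zero_of_isAlgebraic h] at hu; omega
  let A : Subring K := (ev u v).range
  let θ : F₂[X][X] →+* A := (ev u v).rangeRestrict
  have hθ : Function.Surjective θ := (ev u v).rangeRestrict_surjective
  have hk : RingHom.ker θ ≤ RingHom.ker (ev a b) := by
    intro r hr
    exact hrel r (congrArg Subtype.val hr)
  let ψ : A →+* k := θ.liftOfSurjective hθ ⟨ev a b, hk⟩
  have hψ : ∀ r, ψ (θ r) = ev a b r := fun r => θ.liftOfRightInverse_comp_apply _ _ ⟨ev a b, hk⟩ r
  obtain ⟨p, hpA, hpI⟩ := exists_place_of_ideal (F := F₂) A (fun c => ⟨C (C c), by simp⟩)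
    (RingHom.ker ψ) (RingHom.ker_ne_top ψ) (by
      have : FiniteDimensional F₂ k := Module.Finite.of_finite
      have hInt : IsIntegral F₂ a := Algebra.IsIntegral.isIntegral a
      intro hbot
      have h1 : θ (C (minpoly F₂ a)) ∈ RingHom.ker ψ := by
        rw [RingHom.mem_ker, hψ, ev_C, minpoly.aeval]
      rw [hbot, Ideal.mem_bot] at h1
      have h2 : ev u v (C (minpoly F₂ a)) = 0 := congrArg Subtype.val h1
      rw [ev_C] at h2
      exact hut ⟨_, minpoly.ne_zero hInt, h2⟩)
  have hmem : ∀ r, ev u v r ∈ p.1 := fun r => hpA _ ⟨r, rfl⟩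
  have hpS : p ≠ S := by
    rintro rfl
    have := hmem (C X)
    rw [ev_C, aeval_X, p.mem_iff] at this
    omega
  have hV1 : ∀ f : K, p.1.valuation f < 1 ↔ f ∈ p.V 1 := by
    intro f
    by_cases hf : f = 0
    · simp [hf]
    · rw [p.val_lt_one_iff hf, p.mem_V' hf]; rfl
  have hiff : ∀ r, ev u v r ∈ p.V 1 ↔ ev a b r = 0 := by
    intro r
    constructor
    · intro h
      by_contra h0
      obtain ⟨s, hs⟩ := hgen (ev a b r)⁻¹
      have h1 := hpI (θ (r * s - 1)) (by
        rw [RingHom.mem_ker, hψ, map_sub, map_mul, hs, mul_inv_cancel₀ h0, map_one, sub_self])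
      rw [hV1] at h1
      change ev u v (r * s - 1) ∈ p.V 1 at h1
      rw [map_sub, map_mul, map_one] at h1
      have h2 := p.mul_mem_V h (p.mem_V_zero.2 (hmem s))
      rw [add_zero] at h2
      have h3 := sub_mem h2 h1
      rw [sub_sub_cancel, p.mem_V' one_ne_zero, p.ord_one] at h3
      omega
    · intro h
      have := hpI (θ r) (by rw [RingHom.mem_ker, hψ, h])
      rwa [hV1] at this
  refine ⟨p, hpS, hmem, ?_, hiff⟩
  let η : F₂[X][X] →+* ResidueField p.1 :=
    (residue p.1).comp ((ev u v).codRestrict p.1.toSubring hmem)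
  have hη : ∀ r, η r = 0 ↔ ev u v r ∈ p.V 1 := fun r => p.residue_eq_zero_iff _
  have hηs : Function.Surjective η := by
    intro c
    obtain ⟨f, rfl⟩ := IsLocalRing.residue_surjective c
    obtain ⟨n, g, hg, hfg⟩ := Place.exists_sub_mem hpS f.2
    obtain ⟨r, rfl⟩ := hR n g hg
    refine ⟨r, ?_⟩
    symm
    rw [← sub_eq_zero]
    change residue p.1 f - residue p.1 _ = 0
    rw [← map_sub, p.residue_eq_zero_iff]
    exact hfg
  have hker : RingHom.ker η = RingHom.ker (ev a b) := by
    ext r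
    rw [RingHom.mem_ker, RingHom.mem_ker, hη, hiff]
  let e : ResidueField p.1 ≃+* k :=
    (RingHom.quotientKerEquivOfSurjective hηs).symm.trans
      ((Ideal.quotEquivOfEq hker).trans (RingHom.quotientKerEquivOfSurjective hgen))
  let := (residueHom F₂ p).toAlgebra
  let e' : ResidueField p.1 ≃ₗ[F₂] k := e.toAddEquiv.toLinearEquiv (by
    intro c x
    rcases zmod_two_cases c with rfl | rfl
    · rw [zero_smul, zero_smul]; exact map_zero e
    · rw [one_smul, one_smul])
  exact e'.finrank_eq

end Points

section BinaryCodes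

/-- Multiplication by the generator, on codes for the residue classes modulo the polynomial of
degree `d` with code `m`. -/
def mulX (d m n : ℕ) : ℕ := bif n.testBit (d - 1) then (2 * n) ^^^ m else 2 * n

/-- Multiplication of codes; the first argument bounds the length of the second factor. -/
def mulCode (d m : ℕ) : ℕ → ℕ → ℕ → ℕ
  | 0, _, _ => 0
  | f + 1, a, b => (bif b.testBit 0 then a else 0) ^^^ mulCode d m f (mulX d m a) (b / 2)

/-- Powers of codes. -/
def powCode (d m a : ℕ) : ℕ → ℕ
  | 0 => 1
  | n + 1 => mulCode d m d (powCode d m a n) a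

variable {k : Type*} [Field k] [CharP k 2]

/-- The element with a given code: its binary digits are the coefficients of the powers of `α`. -/
def psi (α : k) (n : ℕ) : k := ∑ i ∈ Finset.range 8, if n.testBit i then α ^ i else 0

lemma psi_zero (α : k) : psi α 0 = 0 := by simp [psi]

lemma psi_one (α : k) : psi α 1 = 1 := by
  rw [psi, Finset.sum_range_succ']
  rw [Finset.sum_eq_zero]
  · simp
  · intro i _
    rw [Nat.testBit_one_eq_true_iff_self_eq_zero.not.2 (by omega) |> fun h => if_neg h]

lemma psi_xor (α : k) (a b : ℕ) : psi α (a ^^^ b) = psi α a + psi α b := by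
  rw [psi, psi, psi, ← Finset.sum_add_distrib]
  refine Finset.sum_congr rfl fun i _ => ?_
  rw [Nat.testBit_xor]
  cases a.testBit i <;> cases b.testBit i <;> simp [CharTwo.add_self_eq_zero]

lemma psi_two_mul (α : k) {n : ℕ} (hn : n < 2 ^ 7) : psi α (2 * n) = α * psi α n := by
  have h7 : n.testBit 7 = false := Nat.testBit_lt_two_pow hn
  have h0 : (2 * n).testBit 0 = false := by simp
  rw [psi, psi, Finset.sum_range_succ' _ 7, Finset.sum_range_succ (fun i => if n.testBit i then _ else _) 7,
    h7, h0, Finset.sum_congr rfl (g := fun i => α * if n.testBit i then α ^ i else 0), ← Finset.mul_sum]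
  · simp
  · intro i _
    rw [Nat.testBit_succ, Nat.mul_div_cancel_left _ (by norm_num)]
    split_ifs
    · rw [pow_succ']
    · rw [mul_zero]

lemma psi_eq_bit (α : k) {n : ℕ} (hn : n < 2 ^ 8) :
    psi α n = psi α (bif n.testBit 0 then 1 else 0) + α * psi α (n / 2) := by
  rw [← psi_two_mul α (show n / 2 < 2 ^ 7 by omega), ← psi_xor]
  congr 1
  refine Nat.eq_of_testBit_eq fun i => ?_
  rw [Nat.testBit_xor]
  cases i with
  | zero => cases h : n.testBit 0 <;> simp
  | succ i =>
    rw [Nat.testBit_succ, Nat.testBit_succ, Nat.testBit_succ, Nat.mul_div_cancel_left _ (by norm_num)]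
    cases n.testBit 0 <;> simp

lemma psi_mulX {α : k} {d m n : ℕ} (hm : psi α m = 0) (hn : n < 2 ^ 7) :
    psi α (mulX d m n) = α * psi α n := by
  rw [mulX]
  cases n.testBit (d - 1)
  · exact psi_two_mul α hn
  · rw [cond_true, psi_xor, hm, add_zero, psi_two_mul α hn]

lemma mulX_lt {d m n : ℕ} (hd : 1 ≤ d) (hm : m < 2 ^ (d + 1)) (hmd : m.testBit d = true)
    (hn : n < 2 ^ d) : mulX d m n < 2 ^ d := by
  obtain ⟨d, rfl⟩ : ∃ e, d = e + 1 := ⟨d - 1, by omega⟩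
  rw [mulX, Nat.add_sub_cancel]
  refine Nat.lt_pow_two_of_testBit _ fun i hi => ?_
  have e2 : ∀ j, d + 1 ≤ j → (2 * n).testBit j = n.testBit (j - 1) := fun j hj => by
    obtain ⟨j, rfl⟩ : ∃ e, j = e + 1 := ⟨j - 1, by omega⟩
    rw [Nat.testBit_succ, Nat.mul_div_cancel_left _ (by norm_num), Nat.add_sub_cancel]
  have hb : ∀ j, d + 1 ≤ j → n.testBit j = false := fun j hj =>
    Nat.testBit_lt_two_pow (hn.trans_le (Nat.pow_le_pow_right (by norm_num) hj))
  cases h : n.testBit d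
  · rw [cond_false, e2 i hi]
    rcases eq_or_lt_of_le hi with rfl | hlt
    · simpa using h
    · exact hb _ (by omega)
  · rw [cond_true, Nat.testBit_xor, e2 i hi]
    rcases eq_or_lt_of_le hi with rfl | hlt
    · rw [Nat.add_sub_cancel, h, hmd]; rfl
    · rw [hb _ (by omega), Nat.testBit_lt_two_pow
        (hm.trans_le (Nat.pow_le_pow_right (by norm_num) hlt))]; rfl

/-- `α` is a root of the polynomial of degree `d` with code `m`. -/
structure IsCodeRoot (d m : ℕ) (α : k) : Prop where
  one_le : 1 ≤ d
  le : d ≤ 7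
  lt : m < 2 ^ (d + 1)
  top : m.testBit d = true
  root : psi α m = 0

variable {d m : ℕ} {α : k}

lemma IsCodeRoot.mulCode (h : IsCodeRoot d m α) {f a b : ℕ} (ha : a < 2 ^ d) (hb : b < 2 ^ f)
    (hf : f ≤ 8) : psi α (mulCode d m f a b) = psi α a * psi α b ∧ mulCode d m f a b < 2 ^ d := by
  induction f generalizing a b with
  | zero =>
    have : b = 0 := by simpa using hb
    rw [CFF.mulCode, this, psi_zero, mul_zero]
    exact ⟨rfl, by positivity⟩
  | succ f ih =>
    have hlt := mulX_lt h.one_le h.lt h.top ha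
    have ha7 : a < 2 ^ 7 := ha.trans_le (Nat.pow_le_pow_right (by norm_num) h.le)
    obtain ⟨h1, h2⟩ := ih hlt (b := b / 2) (by rw [pow_succ] at hb; omega) (by omega)
    rw [CFF.mulCode, psi_xor, h1, psi_mulX h.root ha7,
      psi_eq_bit α (n := b) (hb.trans_le (Nat.pow_le_pow_right (by norm_num) hf))]
    refine ⟨?_, Nat.xor_lt_two_pow ?_ h2⟩
    · cases b.testBit 0
      · simp [psi_zero]; ring
      · simp [psi_one]; ring
    · cases b.testBit 0
      · simp
      · exact ha

lemma IsCodeRoot.powCode (h : IsCodeRoot d m α) {a : ℕ} (ha : a < 2 ^ d) (n : ℕ) :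
    psi α (powCode d m a n) = psi α a ^ n ∧ powCode d m a n < 2 ^ d := by
  induction n with
  | zero =>
    rw [CFF.powCode, psi_one, pow_zero]
    exact ⟨rfl, Nat.one_lt_two_pow (by have := h.one_le; omega)⟩
  | succ n ih =>
    have := h.mulCode ih.2 ha (h.le.trans (by norm_num))
    rw [CFF.powCode, this.1, ih.1, pow_succ]
    exact ⟨rfl, this.2⟩

end BinaryCodes

section CodeFields

/-- Evaluation at the element with code `c` of the polynomial with code `n`, for codes `n` with at
most `f` digits. -/
def evalCode (d m c : ℕ) : ℕ → ℕ → ℕ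
  | 0, _ => 0
  | f + 1, n => (bif n.testBit 0 then 1 else 0) ^^^ mulCode d m d (evalCode d m c f (n / 2)) c

lemma IsCodeRoot.evalCode {k : Type*} [Field k] [CharP k 2] {d m : ℕ} {α : k}
    (h : IsCodeRoot d m α) {c f n : ℕ} (hc : c < 2 ^ d) (hn : n < 2 ^ f) (hf : f ≤ 8) :
    psi α (evalCode d m c f n) = psi (psi α c) n ∧ evalCode d m c f n < 2 ^ d := by
  induction f generalizing n with
  | zero =>
    have : n = 0 := by simpa using hn
    rw [CFF.evalCode, this, psi_zero, psi_zero]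
    exact ⟨rfl, by positivity⟩
  | succ f ih =>
    obtain ⟨h1, h2⟩ := ih (n := n / 2) (by rw [pow_succ] at hn; omega) (by omega)
    have h3 := h.mulCode h2 hc (h.le.trans (by norm_num))
    have h4 : 1 < 2 ^ d := Nat.one_lt_two_pow (by have := h.one_le; omega)
    rw [CFF.evalCode, psi_xor, h3.1, h1,
      psi_eq_bit (psi α c) (n := n) (hn.trans_le (Nat.pow_le_pow_right (by norm_num) hf))]
    refine ⟨?_, Nat.xor_lt_two_pow ?_ h3.2⟩
    · cases n.testBit 0
      · simp [psi_zero]; ring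
      · simp [psi_one]; ring
    · cases n.testBit 0
      · simp
      · exact h4

lemma exists_psi_eq_zero {k : Type*} [Field k] [CharP k 2] [IsAlgClosed k] {d m : ℕ} (hd : 1 ≤ d)
    (hd' : d ≤ 7) (hm : m.testBit d = true) : ∃ α : k, psi α m = 0 := by
  let P : k[X] := ∑ i ∈ Finset.range 8, if m.testBit i then X ^ i else 0
  have hP : P.coeff d = 1 := by
    simp only [P, finsetSum_coeff]
    rw [Finset.sum_eq_single d]
    · simp [hm]
    · intro i _ hi
      split_ifs
      · rw [coeff_X_pow, if_neg (Ne.symm hi)]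
      · simp
    · intro h
      exact absurd (Finset.mem_range.2 (by omega)) h
  have hdeg : P.degree ≠ 0 := by
    have : (d : WithBot ℕ) ≤ P.degree := le_degree_of_ne_zero (by rw [hP]; exact one_ne_zero)
    intro h
    rw [h] at this
    have : d ≤ 0 := by exact_mod_cast this
    omega
  obtain ⟨α, hα⟩ := IsAlgClosed.exists_root P hdeg
  refine ⟨α, ?_⟩
  rw [IsRoot.def, eval_finsetSum] at hα
  rw [← hα, psi]
  refine Finset.sum_congr rfl fun i _ => ?_
  split_ifs <;> simp

instance : CharP (AlgebraicClosure F₂) 2 :=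
  charP_of_injective_algebraMap (algebraMap F₂ _).injective 2

/-- A root of the polynomial with code `m`. -/
def rootOf (m : ℕ) : AlgebraicClosure F₂ :=
  if h : ∃ α : AlgebraicClosure F₂, psi α m = 0 then h.choose else 0

/-- The finite field generated by a root of the polynomial with code `m`. -/
abbrev CodeField (m : ℕ) : Type := F₂⟮rootOf m⟯

instance (m : ℕ) : CharP (CodeField m) 2 :=
  charP_of_injective_algebraMap (algebraMap F₂ _).injective 2

/-- The generator. -/
def gen (m : ℕ) : CodeField m := ⟨rootOf m, mem_adjoin_simple_self _ _⟩

lemma map_psi {k l : Type*} [Field k] [Field l] (φ : k →+* l) (α : k) (n : ℕ) :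
    φ (psi α n) = psi (φ α) n := by
  rw [psi, psi, map_sum]
  refine Finset.sum_congr rfl fun i _ => ?_
  split_ifs <;> simp

/-- Decidable conditions ensuring that `m` codes an irreducible polynomial of degree `d`. -/
def fieldCheck (d m : ℕ) : Bool :=
  decide (1 ≤ d ∧ d ≤ 7 ∧ m < 2 ^ (d + 1) ∧ m.testBit d = true) &&
    (List.range (2 ^ d)).all fun n =>
      n == 0 || mulCode d m d n (powCode d m n (2 ^ d - 2)) == 1

variable {d m : ℕ}

lemma isCodeRoot (h : fieldCheck d m = true) : IsCodeRoot d m (gen m) := by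
  rw [fieldCheck, Bool.and_eq_true, decide_eq_true_eq] at h
  obtain ⟨⟨h1, h2, h3, h4⟩, -⟩ := h
  refine ⟨h1, h2, h3, h4, ?_⟩
  have hex := exists_psi_eq_zero (k := AlgebraicClosure F₂) h1 h2 h4
  have : psi (rootOf m) m = 0 := by
    rw [rootOf, dif_pos hex]
    exact hex.choose_spec
  apply (algebraMap (CodeField m) (AlgebraicClosure F₂)).injective
  rw [map_psi, map_zero]
  exact this

lemma psi_ne_zero (h : fieldCheck d m = true) {n : ℕ} (hn : n < 2 ^ d) (h0 : n ≠ 0) : ∃ n' < 2 ^ d,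
    psi (gen m) n * psi (gen m) n' = 1 := by
  have hr := isCodeRoot h
  rw [fieldCheck, Bool.and_eq_true, List.all_eq_true] at h
  have h1 := h.2 n (List.mem_range.2 hn)
  rw [Bool.or_eq_true, beq_iff_eq, beq_iff_eq] at h1
  have h2 := hr.powCode hn (2 ^ d - 2)
  refine ⟨_, h2.2, ?_⟩
  rw [← (hr.mulCode hn h2.2 (hr.le.trans (by norm_num))).1, h1.resolve_left h0, psi_one]

lemma psi_eq_zero_iff (h : fieldCheck d m = true) {n : ℕ} (hn : n < 2 ^ d) : psi (gen m) n = 0 ↔ n = 0 := by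
  refine ⟨fun h0 => ?_, fun h0 => by rw [h0, psi_zero]⟩
  by_contra hne
  obtain ⟨n', -, h1⟩ := psi_ne_zero h hn hne
  rw [h0, zero_mul] at h1
  exact zero_ne_one h1

lemma psi_inj (h : fieldCheck d m = true) {a b : ℕ} (ha : a < 2 ^ d) (hb : b < 2 ^ d) :
    psi (gen m) a = psi (gen m) b ↔ a = b := by
  refine ⟨fun hab => ?_, fun hab => by rw [hab]⟩
  rw [← Nat.xor_eq_zero_iff, ← psi_eq_zero_iff h (Nat.xor_lt_two_pow ha hb), psi_xor, hab,
    CharTwo.add_self_eq_zero]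

lemma psi_surj (h : fieldCheck d m = true) (c : CodeField m) : ∃ n < 2 ^ d, psi (gen m) n = c := by
  have hr := isCodeRoot h
  have h1 : 1 < 2 ^ d := Nat.one_lt_two_pow (by have := hr.one_le; omega)
  have hg : psi (gen m) (mulX d m 1) = gen m := by
    rw [psi_mulX hr.root (by norm_num), psi_one, mul_one]
  let T : Subfield (AlgebraicClosure F₂) :=
    { carrier := {x | ∃ n < 2 ^ d, (psi (gen m) n : CodeField m) = x}
      mul_mem' := by
        rintro _ _ ⟨a, ha, rfl⟩ ⟨b, hb, rfl⟩
        have := hr.mulCode ha hb (hr.le.trans (by norm_num))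
        exact ⟨_, this.2, by rw [this.1]; rfl⟩
      one_mem' := ⟨1, h1, by rw [psi_one]; rfl⟩
      add_mem' := by
        rintro _ _ ⟨a, ha, rfl⟩ ⟨b, hb, rfl⟩
        exact ⟨_, Nat.xor_lt_two_pow ha hb, by rw [psi_xor]; rfl⟩
      zero_mem' := ⟨0, by positivity, by rw [psi_zero]; rfl⟩
      neg_mem' := by
        rintro _ ⟨a, ha, rfl⟩
        exact ⟨a, ha, by rw [CharTwo.neg_eq]⟩
      inv_mem' := by
        rintro _ ⟨a, ha, rfl⟩
        by_cases h0 : a = 0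
        · exact ⟨0, by positivity, by rw [h0, psi_zero]; simp⟩
        · obtain ⟨b, hb, hab⟩ := psi_ne_zero h ha h0
          refine ⟨b, hb, ?_⟩
          rw [eq_inv_of_mul_eq_one_right hab]; rfl }
  have hle : F₂⟮rootOf m⟯ ≤ T.toIntermediateField (K := F₂) (fun x => by
      rcases zmod_two_cases x with rfl | rfl
      · rw [map_zero]; exact T.zero_mem
      · rw [map_one]; exact T.one_mem) := by
    rw [adjoin_simple_le_iff]
    exact ⟨_, mulX_lt hr.one_le hr.lt hr.top h1, by rw [hg]; rfl⟩
  obtain ⟨n, hn, hc⟩ := hle c.2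
  exact ⟨n, hn, Subtype.ext hc⟩

/-- The bijection between codes and elements. -/
lemma card_codeField (h : fieldCheck d m = true) : Nat.card (CodeField m) = 2 ^ d ∧ Finite (CodeField m) := by
  let e : Fin (2 ^ d) → CodeField m := fun n => psi (gen m) n
  have he : Function.Bijective e := by
    constructor
    · intro a b hab
      exact Fin.ext ((psi_inj h a.2 b.2).1 hab)
    · intro c
      obtain ⟨n, hn, hc⟩ := psi_surj h c
      exact ⟨⟨n, hn⟩, hc⟩
  refine ⟨?_, Finite.of_surjective e he.2⟩
  rw [← Nat.card_congr (Equiv.ofBijective e he), Nat.card_eq_fintype_card, Fintype.card_fin]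

lemma finrank_codeField (h : fieldCheck d m = true) : finrank F₂ (CodeField m) = d := by
  have := (card_codeField h).2
  have h1 := Module.natCard_eq_pow_finrank (K := F₂) (V := CodeField m)
  rw [(card_codeField h).1, Nat.card_zmod] at h1
  exact (Nat.pow_right_injective le_rfl h1).symm

end CodeFields

section CodedPolynomials

/-- The norm form `Y² + X Y + X²`. -/
def normForm : F₂[X][X] := X ^ 2 + C X * X + C (X ^ 2)

/-- The monomial `N ^ k X ^ i Y ^ j` with `N = Y² + X Y + X²`. -/
def mon (t : ℕ³) : F₂[X][X] := normForm ^ t.1 * C (X ^ t.2.1) * X ^ t.2.2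

/-- The combination of the monomials in a list with given coefficients. -/
def polyL (l : List (ℕ³ × ℕ)) (ε : ℕ³ → F₂) : F₂[X][X] :=
  (l.map fun e => C (C (ε e.1)) * mon e.1).sum

/-- The exclusive or of the entries with nonzero coefficients. -/
def stateL (l : List (ℕ³ × ℕ)) (ε : ℕ³ → F₂) : ℕ :=
  l.foldr (fun e s => (if ε e.1 = 1 then e.2 else 0) ^^^ s) 0

/-- The code of the value at the point with coordinates `a`, `b` of a monomial. -/
def monCode (d m a b : ℕ) (t : ℕ³) : ℕ :=
  mulCode d m d (mulCode d m d
    (powCode d m (powCode d m b 2 ^^^ mulCode d m d a b ^^^ powCode d m a 2) t.1)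
    (powCode d m a t.2.1)) (powCode d m b t.2.2)

lemma ev_mon {A : Type*} [CommRing A] [Algebra F₂ A] (a b : A) (t : ℕ³) :
    ev a b (mon t) = (b ^ 2 + a * b + a ^ 2) ^ t.1 * a ^ t.2.1 * b ^ t.2.2 := by
  simp [mon, normForm]

lemma IsCodeRoot.monCode {k : Type*} [Field k] [CharP k 2] [Algebra F₂ k] {d m : ℕ} {α : k}
    (h : IsCodeRoot d m α) {a b : ℕ} (ha : a < 2 ^ d) (hb : b < 2 ^ d) (t : ℕ³) :
    psi α (monCode d m a b t) = ev (psi α a) (psi α b) (mon t) := by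
  have h8 : d ≤ 8 := h.le.trans (by norm_num)
  have hb2 := h.powCode hb 2
  have ha2 := h.powCode ha 2
  have hab := h.mulCode ha hb h8
  have hN := h.powCode (Nat.xor_lt_two_pow (Nat.xor_lt_two_pow hb2.2 hab.2) ha2.2) t.1
  have hi := h.powCode ha t.2.1
  have hj := h.powCode hb t.2.2
  have h1 := h.mulCode hN.2 hi.2 h8
  rw [CFF.monCode, (h.mulCode h1.2 hj.2 h8).1, h1.1, hN.1, hi.1, hj.1, psi_xor, psi_xor, hb2.1,
    hab.1, ha2.1, ev_mon]

/-- The block of length `d` at a given offset. -/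
def blk (s off d : ℕ) : ℕ := s / 2 ^ off % 2 ^ d

lemma blk_xor (s t off d : ℕ) : blk (s ^^^ t) off d = blk s off d ^^^ blk t off d := by
  rw [blk, blk, blk, ← Nat.shiftRight_eq_div_pow, ← Nat.shiftRight_eq_div_pow,
    ← Nat.shiftRight_eq_div_pow, Nat.shiftRight_xor_distrib, Nat.xor_mod_two_pow]

lemma blk_zero (off d : ℕ) : blk 0 off d = 0 := by simp [blk]

lemma psi_blk_stateL {k : Type*} [Field k] [CharP k 2] [Algebra F₂ k] {α : k} {a b : k}
    {d off : ℕ} (l : List (ℕ³ × ℕ))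
    (hl : ∀ e ∈ l, psi α (blk e.2 off d) = ev a b (mon e.1)) (ε : ℕ³ → F₂) :
    psi α (blk (stateL l ε) off d) = ev a b (polyL l ε) := by
  induction l with
  | nil => simp [stateL, polyL, blk_zero, psi_zero]
  | cons e l ih =>
    have h1 := ih fun e' he' => hl e' (List.mem_cons_of_mem _ he')
    have h2 := hl e List.mem_cons_self
    rw [stateL, List.foldr_cons, blk_xor, psi_xor]
    change _ + psi α (blk (stateL l ε) off d) = _
    rw [h1]
    conv_rhs => rw [polyL, List.map_cons, List.sum_cons, map_add]
    congr 1
    rcases zmod_two_cases (ε e.1) with h0 | h0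
    · simp [h0, blk_zero, psi_zero]
    · rw [if_pos h0, h2, h0, map_mul]
      simp

/-- Exhaustive search over all subsets of a list of codes. -/
def searchTree (f : ℕ → Bool) (l : List ℕ) : ℕ → Bool :=
  List.rec f (fun m _ ih s => cond (ih s) (ih (Nat.xor s m)) false) l

lemma searchTree_nil (f : ℕ → Bool) (s : ℕ) : searchTree f [] s = f s := rfl

lemma searchTree_cons (f : ℕ → Bool) (m : ℕ) (ms : List ℕ) (s : ℕ) :
    searchTree f (m :: ms) s = (searchTree f ms s && searchTree f ms (s ^^^ m)) := by
  change cond (searchTree f ms s) (searchTree f ms (s ^^^ m)) false = _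
  cases searchTree f ms s <;> rfl

lemma searchTree_sound (f : ℕ → Bool) (l : List (ℕ³ × ℕ)) (s : ℕ)
    (h : searchTree f (l.map Prod.snd) s = true) (ε : ℕ³ → F₂) :
    f (s ^^^ stateL l ε) = true := by
  induction l generalizing s with
  | nil => simpa [searchTree_nil, stateL] using h
  | cons e l ih =>
    rw [List.map_cons, searchTree_cons, Bool.and_eq_true] at h
    rw [stateL, List.foldr_cons, ← Nat.xor_assoc]
    rcases zmod_two_cases (ε e.1) with h0 | h0
    · rw [if_neg (by rw [h0]; exact zero_ne_one), Nat.xor_zero]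
      exact ih s h.1
    · rw [if_pos h0]
      exact ih _ h.2

/-- Whether more than a given number of the points have a vanishing block. -/
def exceeds (d s : ℕ) (ps : List ℕ³) : ℕ → Bool :=
  List.rec (fun _ => false) (fun P _ ih M =>
    cond (Nat.beq (Nat.mod (Nat.div s (Nat.pow 2 P.2.2)) (Nat.pow 2 d)) 0)
      (cond (Nat.beq M 0) true (ih (Nat.pred M))) (ih M)) ps

lemma exceeds_nil (d s M : ℕ) : exceeds d s [] M = false := rfl

lemma exceeds_cons (d s M : ℕ) (P : ℕ³) (ps : List ℕ³) :
    exceeds d s (P :: ps) M = cond (Nat.beq (blk s P.2.2 d) 0)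
      (cond (Nat.beq M 0) true (exceeds d s ps (M - 1))) (exceeds d s ps M) := rfl

lemma exceeds_sound {d s : ℕ} {ps : List ℕ³} (hps : ps.Nodup) {M : ℕ}
    (h : exceeds d s ps M = true) : ∃ T : Finset ℕ³, T.card = M + 1 ∧
      ∀ P ∈ T, P ∈ ps ∧ blk s P.2.2 d = 0 := by
  induction ps generalizing M with
  | nil => simp [exceeds_nil] at h
  | cons P ps ih =>
    rw [List.nodup_cons] at hps
    rw [exceeds_cons] at h
    have key : ∀ M', exceeds d s ps M' = true → ∃ T : Finset ℕ³, T.card = M' + 1 ∧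
        ∀ Q ∈ T, Q ∈ P :: ps ∧ blk s Q.2.2 d = 0 := fun M' h' => by
      obtain ⟨T, hT, hT'⟩ := ih hps.2 h'
      exact ⟨T, hT, fun Q hQ => ⟨List.mem_cons_of_mem _ (hT' Q hQ).1, (hT' Q hQ).2⟩⟩
    cases hb : Nat.beq (blk s P.2.2 d) 0 with
    | false =>
      rw [hb, cond_false] at h
      exact key M h
    | true =>
      rw [hb, cond_true] at h
      rw [Nat.beq_eq] at hb
      cases M with
      | zero => exact ⟨{P}, rfl, by simp [hb]⟩
      | succ M =>
        change exceeds d s ps M = true at h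
        obtain ⟨T, hT, hT'⟩ := ih hps.2 h
        refine ⟨insert P T, ?_, ?_⟩
        · rw [Finset.card_insert_of_notMem fun hP => hps.1 (hT' P hP).1, hT]
        · intro Q hQ
          rcases Finset.mem_insert.1 hQ with rfl | hQ
          · exact ⟨List.mem_cons_self, hb⟩
          · exact ⟨List.mem_cons_of_mem _ (hT' Q hQ).1, (hT' Q hQ).2⟩

/-- A family of pairwise non-conjugate points over a finite field: degree, code of the field,
coordinates and offsets, and a bound for the number of points on a curve. -/
structure PointClass where
  d : ℕ
  m : ℕ
  pts : List ℕ³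
  M : ℕ

/-- The points are defined over the field, generate it and are pairwise non-conjugate. -/
def PointClass.pointCheck (c : PointClass) : Bool :=
  fieldCheck c.d c.m &&
  (c.pts.all fun P => P.1 < 2 ^ c.d && P.2.1 < 2 ^ c.d &&
    ((List.range (2 ^ c.d)).any fun n =>
      evalCode c.d c.m P.1 c.d n == mulX c.d c.m 1 ||
      evalCode c.d c.m P.2.1 c.d n == mulX c.d c.m 1)) &&
  ((List.range (2 ^ c.d)).all fun n => evalCode c.d c.m n (c.d + 1) c.m != 0 ||
    c.pts.all fun P => c.pts.all fun Q => P == Q ||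
      evalCode c.d c.m n c.d P.1 != Q.1 || evalCode c.d c.m n c.d P.2.1 != Q.2.1)

/-- The blocks of a table are the values at the points. -/
def PointClass.tableCheck (c : PointClass) (l : List (ℕ³ × ℕ)) : Bool :=
  l.all fun e => c.pts.all fun P => blk e.2 P.2.2 c.d == monCode c.d c.m P.1 P.2.1 e.1

end CodedPolynomials

section ClassBound

variable {K : Type*} [Field K] [Algebra F₂ K] [hF : Fact (IsFunctionField F₂ K)]
  [hC : Fact (HasExactConstants F₂ K)] [hG : Fact (GenusFourClassOne K)]

/-- A place is centred at a coded point. -/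
def PointClass.CentredAt (c : PointClass) (u v : K) (P : ℕ³) (p : Place F₂ K) : Prop :=
  P ∈ c.pts ∧ IsCentre u v (psi (gen c.m) P.1) (psi (gen c.m) P.2.1) p

lemma exists_ev_eq_psi {k : Type*} [Field k] [CharP k 2] [Algebra F₂ k]
    (R : F₂[X][X]) (n : ℕ) : ∃ W, ∀ a b : k, ev a b W = psi (ev a b R) n := by
  refine ⟨∑ i ∈ Finset.range 8, if n.testBit i then R ^ i else 0, fun a b => ?_⟩
  rw [map_sum, psi]
  refine Finset.sum_congr rfl fun i _ => ?_
  split_ifs <;> simp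

lemma PointClass.generates {c : PointClass} (hc : c.pointCheck = true) {P : ℕ³}
    (hP : P ∈ c.pts) : fieldCheck c.d c.m = true ∧ P.1 < 2 ^ c.d ∧ P.2.1 < 2 ^ c.d ∧
      ∃ R, ev (psi (gen c.m) P.1) (psi (gen c.m) P.2.1) R = gen c.m := by
  rw [pointCheck, Bool.and_eq_true, Bool.and_eq_true, List.all_eq_true] at hc
  obtain ⟨⟨hf, h1⟩, -⟩ := hc
  have h2 := h1 P hP
  have hr := isCodeRoot hf
  rw [Bool.and_eq_true, Bool.and_eq_true, decide_eq_true_eq, decide_eq_true_eq,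
    List.any_eq_true] at h2
  obtain ⟨⟨hA, hB⟩, n, hn, h3⟩ := h2
  rw [List.mem_range] at hn
  rw [Bool.or_eq_true, beq_iff_eq, beq_iff_eq] at h3
  have hg : psi (gen c.m) (mulX c.d c.m 1) = gen c.m := by
    rw [psi_mulX hr.root (by norm_num), psi_one, mul_one]
  have h8 : c.d ≤ 8 := hr.le.trans (by norm_num)
  refine ⟨hf, hA, hB, ?_⟩
  rcases h3 with h3 | h3
  · obtain ⟨W, hW⟩ := exists_ev_eq_psi (k := CodeField c.m) (C X) n
    refine ⟨W, ?_⟩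
    rw [hW, ev_C, aeval_X, ← (hr.evalCode hA hn h8).1, h3, hg]
  · obtain ⟨W, hW⟩ := exists_ev_eq_psi (k := CodeField c.m) X n
    refine ⟨W, ?_⟩
    rw [hW, ev_X, ← (hr.evalCode hB hn h8).1, h3, hg]

lemma PointClass.centredAt_inj {c : PointClass} (hc : c.pointCheck = true) {u v : K}
    {P Q : ℕ³} {p : Place F₂ K} (hP : c.CentredAt u v P p)
    (hQ : c.CentredAt u v Q p) : P = Q := by
  obtain ⟨hf, hA, hB, R, hR⟩ := c.generates hc hP.1
  obtain ⟨-, hA', hB', -⟩ := c.generates hc hQ.1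
  have hr := isCodeRoot hf
  rw [pointCheck, Bool.and_eq_true, List.all_eq_true] at hc
  have hiff : ∀ r, ev (psi (gen c.m) P.1) (psi (gen c.m) P.2.1) r = 0 →
      ev (psi (gen c.m) Q.1) (psi (gen c.m) Q.2.1) r = 0 := fun r hr0 => by
    rw [← hQ.2.iff, hP.2.iff, hr0]
  obtain ⟨n, hn, hβ⟩ := psi_surj hf (ev (psi (gen c.m) Q.1) (psi (gen c.m) Q.2.1) R)
  have h8 : c.d + 1 ≤ 8 := by have := hr.le; omega
  have h1 := hc.2 n (List.mem_range.2 hn)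
  have h2 : evalCode c.d c.m n (c.d + 1) c.m = 0 := by
    have h3 := hr.evalCode hn hr.lt h8
    rw [← psi_eq_zero_iff hf h3.2, h3.1, hβ]
    obtain ⟨W, hW⟩ := exists_ev_eq_psi (k := CodeField c.m) R c.m
    rw [← hW]
    apply hiff
    rw [hW, hR, hr.root]
  have key : ∀ (Z : F₂[X][X]) (A A' : ℕ), A < 2 ^ c.d → A' < 2 ^ c.d →
      ev (psi (gen c.m) P.1) (psi (gen c.m) P.2.1) Z = psi (gen c.m) A →
      ev (psi (gen c.m) Q.1) (psi (gen c.m) Q.2.1) Z = psi (gen c.m) A' →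
      evalCode c.d c.m n c.d A = A' := by
    intro Z A A' hA hA' hZ hZ'
    have h3 := hr.evalCode hn hA (by omega)
    rw [← psi_inj hf h3.2 hA', h3.1, hβ, ← hZ', eq_comm, ← sub_eq_zero]
    obtain ⟨W, hW⟩ := exists_ev_eq_psi (k := CodeField c.m) R A
    rw [← hW, ← map_sub]
    apply hiff
    rw [map_sub, hW, hR, hZ, sub_self]
  have k1 := key (C X) P.1 Q.1 hA hA' (by simp) (by simp)
  have k2 := key X P.2.1 Q.2.1 hB hB' (by simp) (by simp)
  rw [Bool.or_eq_true, h2] at h1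
  have h4 := List.all_eq_true.1 (List.all_eq_true.1 (h1.resolve_left (by simp)) P hP.1) Q hQ.1
  simpa [k1, k2] using h4

lemma PointClass.exceeds_eq_false {c : PointClass} (hc : c.pointCheck = true) (hnd : c.pts.Nodup)
    {l : List (ℕ³ × ℕ)} (hl : c.tableCheck l = true)
    {S : Place F₂ K} {u v : K} (hu : S.ord u < 0)
    (hR : ∀ n : ℕ, ∀ f ∈ L (single S (n : ℤ)), ∃ r, f = ev u v r)
    {ε : ℕ³ → F₂} (hrel : ∀ r, ev u v r = 0 → polyL l ε ∣ r)
    (hM : ∀ T : Finset (Place F₂ K), (∀ p ∈ T, p ≠ S ∧ deg₂ p = c.d ∧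
      ∃ P, c.CentredAt u v P p) → T.card ≤ c.M) :
    exceeds c.d (stateL l ε) c.pts c.M = false := by
  by_contra hex
  rw [Bool.not_eq_false] at hex
  obtain ⟨T, hT, hTP⟩ := exceeds_sound hnd hex
  have hpl : ∀ P ∈ T, ∃ p : Place F₂ K, p ≠ S ∧ deg₂ p = c.d ∧
      c.CentredAt u v P p := by
    intro P hP
    obtain ⟨hPc, hblk⟩ := hTP P hP
    obtain ⟨hf, hA, hB, R, hRg⟩ := c.generates hc hPc
    have := (card_codeField hf).2
    have hr := isCodeRoot hf
    obtain ⟨p, hpS, hp⟩ := exists_isCentre (a := psi (gen c.m) P.1) (b := psi (gen c.m) P.2.1) hu hR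
      (fun x => by
        obtain ⟨n, -, rfl⟩ := psi_surj hf x
        obtain ⟨W, hW⟩ := exists_ev_eq_psi (k := CodeField c.m) R n
        exact ⟨W, by rw [hW, hRg]⟩)
      (fun r hr0 => by
        obtain ⟨q, rfl⟩ := hrel r hr0
        rw [map_mul, ← psi_blk_stateL (α := gen c.m) (off := P.2.2) (d := c.d) l _ ε, hblk,
          psi_zero, zero_mul]
        intro e he
        have h1 := List.all_eq_true.1 (List.all_eq_true.1 hl e he) P hPc
        rw [beq_iff_eq] at h1
        rw [h1, hr.monCode hA hB])
    exact ⟨p, hpS, by rw [hp.deg_eq, finrank_codeField hf], hPc, hp⟩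
  have : Nonempty (Place F₂ K) := ⟨S⟩
  choose! φ h1 h2 h3 using hpl
  have hinj : Set.InjOn φ T := fun P hP Q hQ hPQ =>
    centredAt_inj hc (h3 P hP) (hPQ ▸ h3 Q hQ)
  have := hM (T.image φ) fun p hp => by
    obtain ⟨P, hP, rfl⟩ := Finset.mem_image.1 hp
    exact ⟨h1 P hP, h2 P hP, P, h3 P hP⟩
  rw [Finset.card_image_of_injOn hinj, hT] at this
  omega

end ClassBound

section Search

lemma stateL_append (l l' : List (ℕ³ × ℕ)) (ε : ℕ³ → F₂) :
    stateL (l ++ l') ε = stateL l ε ^^^ stateL l' ε := by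
  induction l with
  | nil => simp [stateL]
  | cons e l ih =>
    change _ ^^^ stateL (l ++ l') ε = (_ ^^^ stateL l ε) ^^^ stateL l' ε
    rw [ih, Nat.xor_assoc]

lemma stateL_eq_foldr (l : List (ℕ³ × ℕ)) (ε : ℕ³ → F₂)
    (h : ∀ e ∈ l, ε e.1 = 1) : stateL l ε = (l.map Prod.snd).foldr (· ^^^ ·) 0 := by
  induction l with
  | nil => rfl
  | cons e l ih =>
    change _ ^^^ stateL l ε = _
    rw [if_pos (h e List.mem_cons_self), ih fun e he => h e (List.mem_cons_of_mem _ he)]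
    rfl

/-- Whether one of the classes contains more points than its bound. -/
def overfull (cs : List PointClass) (s : ℕ) : Bool :=
  List.rec false (fun c _ ih => cond (exceeds c.d s c.pts c.M) true ih) cs

lemma overfull_iff (cs : List PointClass) (s : ℕ) :
    overfull cs s = true ↔ ∃ c ∈ cs, exceeds c.d s c.pts c.M = true := by
  induction cs with
  | nil => exact ⟨fun h => absurd h Bool.false_ne_true, fun ⟨c, hc, _⟩ => absurd hc List.not_mem_nil⟩
  | cons c cs ih =>
    rw [List.exists_mem_cons_iff, ← ih]
    change cond (exceeds c.d s c.pts c.M) true (overfull cs s) = true ↔ _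
    cases exceeds c.d s c.pts c.M <;> simp

/-- The points and tables are consistent. -/
def classesCheck (cs : List PointClass) (l₀ l : List (ℕ³ × ℕ)) : Bool :=
  cs.all fun c => c.pointCheck && decide c.pts.Nodup && c.tableCheck (l₀ ++ l)

lemma overfull_eq_false {K : Type*} [Field K] [Algebra F₂ K]
    [hF : Fact (IsFunctionField F₂ K)] [hC : Fact (HasExactConstants F₂ K)]
    [hG : Fact (GenusFourClassOne K)] {cs : List PointClass} {l₀ l : List (ℕ³ × ℕ)}
    (hc : classesCheck cs l₀ l = true) {S : Place F₂ K} {u v : K} (hu : S.ord u < 0)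
    (hR : ∀ n : ℕ, ∀ f ∈ L (single S (n : ℤ)), ∃ r, f = ev u v r)
    {ε : ℕ³ → F₂} (hrel : ∀ r, ev u v r = 0 → polyL (l₀ ++ l) ε ∣ r)
    (hM : ∀ c ∈ cs, ∀ T : Finset (Place F₂ K), (∀ p ∈ T, p ≠ S ∧
      deg₂ p = c.d ∧ ∃ P, c.CentredAt u v P p) → T.card ≤ c.M) :
    overfull cs (stateL (l₀ ++ l) ε) = false := by
  by_contra h
  rw [Bool.not_eq_false, overfull_iff] at h
  obtain ⟨c, hcs, h⟩ := h
  have h1 := List.all_eq_true.1 hc c hcs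
  rw [Bool.and_eq_true, Bool.and_eq_true, decide_eq_true_eq] at h1
  rw [c.exceeds_eq_false h1.1.1 h1.1.2 h1.2 hu hR hrel (hM c hcs)] at h
  exact absurd h Bool.false_ne_true

lemma search_append {f : ℕ → Bool} {l₀ l : List (ℕ³ × ℕ)}
    (hs : searchTree f (l.map Prod.snd) ((l₀.map Prod.snd).foldr (· ^^^ ·) 0) = true)
    {ε : ℕ³ → F₂} (h1 : ∀ e ∈ l₀, ε e.1 = 1) : f (stateL (l₀ ++ l) ε) = true := by
  rw [stateL_append, stateL_eq_foldr l₀ ε h1]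
  exact searchTree_sound f l _ hs ε

/-- Affine points of degree two. -/
def quadraticPoints : List ℕ³ :=
  [(2, 0, 4), (2, 1, 6), (2, 2, 8), (2, 3, 10)]

/-- Affine points of degree three. -/
def cubicPoints : List ℕ³ :=
  [(2, 0, 12), (2, 1, 15), (2, 2, 18), (2, 3, 21), (2, 4, 24), (2, 5, 27), (2, 6, 30), (2, 7, 33),
    (3, 0, 36), (3, 1, 39), (3, 2, 42), (3, 3, 45), (3, 4, 48), (3, 5, 51), (3, 6, 54), (3, 7,
    57)]

/-- Affine points of degree four. -/
def quarticPoints : List ℕ³ :=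
  [(2, 0, 60), (2, 1, 64), (2, 2, 68), (2, 3, 72), (2, 4, 76), (2, 5, 80), (2, 6, 84), (2, 7, 88),
    (2, 8, 92), (2, 9, 96), (2, 10, 100), (2, 11, 104), (2, 12, 108), (2, 13, 112), (2, 14, 116),
    (2, 15, 120), (8, 0, 124), (8, 1, 128), (8, 2, 132), (8, 3, 136), (8, 4, 140), (8, 5, 144),
    (8, 6, 148), (8, 7, 152), (8, 8, 156), (8, 9, 160), (8, 10, 164), (8, 11, 168), (8, 12, 172),
    (8, 13, 176), (8, 14, 180), (8, 15, 184), (9, 0, 188), (9, 1, 192), (9, 2, 196), (9, 3, 200),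
    (9, 4, 204), (9, 5, 208), (9, 6, 212), (9, 7, 216), (9, 8, 220), (9, 9, 224), (9, 10, 228),
    (9, 11, 232), (9, 12, 236), (9, 13, 240), (9, 14, 244), (9, 15, 248)]

/-- Points for the search of hyperelliptic curves with a rational place. -/
def hyperWithClasses : List PointClass :=
  [⟨1, 2, [(0, 0, 0), (0, 1, 1), (1, 0, 2), (1, 1, 3)], 1⟩, ⟨2, 7, quadraticPoints, 0⟩, ⟨3, 11,
    cubicPoints, 0⟩, ⟨4, 19, quarticPoints, 0⟩, ⟨5, 37, [(2, 0, 252), (2, 1, 257), (2, 2, 262),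
    (2, 3, 267), (2, 8, 272), (2, 9, 277), (2, 10, 282), (2, 11, 287), (2, 16, 292), (2, 17, 297),
    (2, 18, 302), (2, 19, 307), (2, 24, 312), (2, 25, 317), (2, 26, 322), (2, 27, 327)], 0⟩]

/-- The monomials with coefficient one and their values. -/
def hyperWithFixed : List (ℕ³ × ℕ) :=
  [((0, 0, 2),
    574107084220231621260802434885544814199732517349997915242913161709688559532807749962080946557586250),
    ((0, 5, 1),
    6814530160455903419692089593286108614211145412065626602241987727944481789935134894577952247533504968),
    ((0, 10, 0),
    4797840299524026156688068327541051519858365579681248975546695710984764874709832802910704500223097516)]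

/-- The monomials with free coefficients and their values. -/
def hyperWithTable : List (ℕ³ × ℕ) :=
  [((0, 0, 1),
    7610994161347226493932170844390527035563712464519986809491375156243677251069076943401299817768980042),
    ((0, 1, 1),
    5346284562414869828602360825122763603592495454387711167536123285399485339520446811481628592326117256),
    ((0, 2, 1),
    883090380850833765135826741919585812503979642343595919846501054927548407828126847458576374162131400),
    ((0, 3, 1),
    1766180761701667530271651213594683564249926658691228428149206345725287906258586619185011686224006728),
    ((0, 4, 1),
    3522724543544798571864560662497273295580087577996994963772604934060837911068976610773956797776463752),
    ((0, 0, 0),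
    282225899972001538628710213804616170402979762203393021233234601407702893747369021272776689058092383),
    ((0, 1, 0),
    564451799944003077257423804878501762528326019072591565085945065367110098955784206545610466791074476),
    ((0, 2, 0),
    1128903599888006154514845197421811080969247406570919346618313042596701709114068715709575515585269756),
    ((0, 3, 0),
    2257807199776012309029685087706198784946204487674587436040673282221543189994532456042407956835054940),
    ((0, 4, 0),
    4515614399552024618059362455939781748812714358317337164777024677575045003604890904992515251393751724),
    ((0, 5, 0),
    1411129499860007693143552033957157829649860517180963460565052695482867079736103020867531120312319996),
    ((0, 6, 0),
    2822258999720015386287102138046161704029797569724749084110006321116823192758777802118513145132012892),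
    ((0, 7, 0),
    5644517999440030772574197039086746075797381453963431330448640142572697920465154828806900752276822700),
    ((0, 8, 0),
    3668936699636020002173231814525933237603775019397976972854981184645260164159602224120638956823457788),
    ((0, 9, 0),
    7337873399272040004346458804381481587032740854111198070936317736709321554308304461629950602826106204)]

/-- Points for the search of hyperelliptic curves without rational places. -/
def hyperWithoutClasses : List PointClass :=
  [⟨1, 2, [(0, 0, 0), (0, 1, 1), (1, 0, 2), (1, 1, 3)], 0⟩, ⟨2, 7, quadraticPoints, 0⟩, ⟨4, 19,
    [(2, 0, 12), (2, 1, 16), (2, 2, 20), (2, 3, 24), (2, 4, 28), (2, 5, 32), (2, 6, 36), (2, 7,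
    40), (2, 8, 44), (2, 9, 48), (2, 10, 52), (2, 11, 56), (2, 12, 60), (2, 13, 64), (2, 14, 68),
    (2, 15, 72), (8, 0, 76), (8, 1, 80), (8, 2, 84), (8, 3, 88), (8, 4, 92), (8, 5, 96), (8, 6,
    100), (8, 7, 104), (8, 8, 108), (8, 9, 112), (8, 10, 116), (8, 11, 120), (8, 12, 124), (8, 13,
    128), (8, 14, 132), (8, 15, 136), (9, 0, 140), (9, 1, 144), (9, 2, 148), (9, 3, 152), (9, 4,
    156), (9, 5, 160), (9, 6, 164), (9, 7, 168), (9, 8, 172), (9, 9, 176), (9, 10, 180), (9, 11,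
    184), (9, 12, 188), (9, 13, 192), (9, 14, 196), (9, 15, 200)], 0⟩]

/-- The monomials with coefficient one and their values. -/
def hyperWithoutFixed : List (ℕ³ × ℕ) :=
  [((0, 0, 2), 17268148813912645889085614692821665531641947203062380294638410), ((0, 5, 1),
    18913795881551351962660564550007476630932502236707981355256264), ((0, 10, 0),
    10284403483257537763003958532680719340723661508353399010589356)]

/-- The monomials with free coefficients and their values. -/
def hyperWithoutTable : List (ℕ³ × ℕ) :=
  [((0, 0, 1), 25596737558329871768341792519683049398136645293784330586361418), ((0, 1, 1),
    23296981627718064385006474816213153280300679011727058841765768), ((0, 2, 1),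
    12342124396131113016000115384752990135946749739714867538168264), ((0, 3, 1),
    16618720145307330451884371056176695201349987299443875604074056), ((0, 4, 1),
    9204006502798876618022427569088573807974103589477563783907208), ((0, 0, 0),
    1714067247209589627244759565163906776023683193368312357655903), ((0, 1, 0),
    15426605224886306645109916314814616721093193435355077316586156), ((0, 2, 0),
    22282874213724665154088954575470243825177851826998204837416956), ((0, 3, 0),
    25711008708143844408206794619155880324896512721347722590324060), ((0, 4, 0),
    23996941460934254781519553683955239127360850575645009721375404), ((0, 5, 0),
    11998470730467127390155798326184081853652575351337282240409596), ((0, 6, 0),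
    17140672472095896272261756108317979234077516378404631050241372), ((0, 7, 0),
    8570336236047948136874236227443343721741503892212078043970220), ((0, 8, 0),
    18854739719305485899599435445142430273145597013006762986790908), ((0, 9, 0),
    20568806966515075527215874096948514101528208844252548036207964)]

/-- Points for the search of trigonal curves with a rational place. -/
def trigonalWithClasses : List PointClass :=
  [⟨1, 2, [(0, 0, 0), (0, 1, 1), (1, 0, 2), (1, 1, 3)], 1⟩, ⟨2, 7, quadraticPoints, 0⟩, ⟨3, 11,
    cubicPoints, 0⟩, ⟨4, 19, quarticPoints, 0⟩]

/-- The monomials with coefficient one and their values. -/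
def trigonalWithFixed : List (ℕ³ × ℕ) :=
  [((0, 0, 3), 5672552214179872684794863528509563707885960071578540026116157233436946105674), ((0,
    4, 1), 2590697516020040174137862429328290941011948924549355679097493734364660303752), ((0, 6,
    0), 4824670384888174809263148527567107154193289155323641922567668496302060524892)]

/-- The monomials with free coefficients and their values. -/
def trigonalWithTable : List (ℕ³ × ℕ) :=
  [((0, 0, 1), 7204841108099674382329556960677470761815203831870653198871843053165265587786), ((0,
    1, 1), 6557517361090522883163761022329363097447729555174936949794286816229187454856), ((0, 2,
    1), 3473999176961024283888872345419156663310869078315621970176130492995776416200), ((0, 3, 1),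
    4677753865861290535151748727426769530857608347721846273276528844929452576328), ((0, 0, 0),
    482467038488817480931545770869532949388624936106835683497827775004750943583), ((0, 1, 0),
    4342203346399357328357757347261685374639801576525132413159655607098176776876), ((0, 2, 0),
    6272071500354627252083940430739817172191465634561467326621929568778356674556), ((0, 3, 0),
    7237005577332262213842413610222438391579959408894701048268482394482377864540), ((0, 4, 0),
    6754538538843444733067795382737572461273050776413017922529872488302479370924), ((0, 5, 0),
    3377269269421722366363892852702063626631569033145177675403642522698776575996)]

/-- Points for the search of trigonal curves without rational places. -/
def trigonalWithoutClasses : List PointClass :=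
  [⟨1, 2, [(0, 0, 0), (0, 1, 1), (1, 0, 2), (1, 1, 3)], 0⟩, ⟨2, 7, quadraticPoints, 1⟩, ⟨3, 11,
    cubicPoints, 0⟩, ⟨4, 19, quarticPoints ++ [(6, 2, 252), (6, 4, 256), (6, 8, 260), (6, 9, 264),
    (6, 10, 268), (6, 11, 272)], 2⟩]

/-- The monomials with coefficient one and their values. -/
def trigonalWithoutFixed : List (ℕ³ × ℕ) :=
  [((0, 0, 3),
    98641491716438702660183741573497122547192682137856950655011330339946305923698165066), ((0, 4,
    1), 118196369820915035596337331186524480728249260321690682850387550515351170250157524872),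
    ((0, 6, 0),
    8094458059810550861521752943367418808584233300714800555355457443840664124110853468)]

/-- The monomials with free coefficients and their values. -/
def trigonalWithoutTable : List (ℕ³ × ℕ) :=
  [((0, 0, 1),
    88498989146219132396870725550190185232450666594023673046568819600616995833172758090), ((0, 1,
    1), 118196373787734880666820040212423073729321416757471313475968821212144252114684675976),
    ((0, 2, 1),
    32099408809999868727040510122667646396620273721191209711313738852270138152899709384), ((0, 3,
    1), 88498986619131890158486878372381951981749435636428188897761894005302787597359746632), ((0,
    0, 0), 8094453717607204462164424611764662111010028496050581338549218373999942826801272159),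
    ((0, 1, 0),
    48566723753044342239438990439070694710547849284355447915413622416688614030478748332), ((0, 2,
    0), 56661178918052662168055857845472669430156725943445151183462070755134743532708974588), ((0,
    3, 0), 8094460472145743305609157522632501463915470687385054126414583144654562304428193116),
    ((0, 4, 0),
    48566726165379534683526395149108730186434935917604647803299131786905495234781342380), ((0, 5,
    0), 56661176023250431235150972125425091392403180383548549767172419536847697453128876028)]

lemma hyperWith_check : classesCheck hyperWithClasses hyperWithFixed hyperWithTable = true := by
  decide +kernel

lemma hyperWith_search : searchTree (overfull hyperWithClasses) (hyperWithTable.map Prod.snd)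
    ((hyperWithFixed.map Prod.snd).foldr (· ^^^ ·) 0) = true := by
  decide +kernel

lemma hyperWithout_check : classesCheck hyperWithoutClasses hyperWithoutFixed hyperWithoutTable = true := by
  decide +kernel

lemma hyperWithout_search : searchTree (overfull hyperWithoutClasses) (hyperWithoutTable.map Prod.snd)
    ((hyperWithoutFixed.map Prod.snd).foldr (· ^^^ ·) 0) = true := by
  decide +kernel

lemma trigonalWith_check : classesCheck trigonalWithClasses trigonalWithFixed trigonalWithTable = true := by
  decide +kernel

lemma trigonalWith_search : searchTree (overfull trigonalWithClasses) (trigonalWithTable.map Prod.snd)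
    ((trigonalWithFixed.map Prod.snd).foldr (· ^^^ ·) 0) = true := by
  decide +kernel

lemma trigonalWithout_check : classesCheck trigonalWithoutClasses trigonalWithoutFixed trigonalWithoutTable = true := by
  decide +kernel

lemma trigonalWithout_search : searchTree (overfull trigonalWithoutClasses) (trigonalWithoutTable.map Prod.snd)
    ((trigonalWithoutFixed.map Prod.snd).foldr (· ^^^ ·) 0) = true := by
  decide +kernel

end Search

section Graded

variable {F : Type*} [Field F] {K : Type*} [Field K] [Algebra F K]
  [hF : Fact (IsFunctionField F K)]

lemma Place.ne_zero_of_ord_ne_zero (p : Place F K) {f : K} (h : p.ord f ≠ 0) : f ≠ 0 := by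
  rintro rfl
  exact h p.ord_zero

lemma Place.aeval_mul_sub_mem (S : Place F K) {u : K} (hu : S.ord u = -1) {r : F[X]} {k : ℕ}
    (hr : r.natDegree ≤ k) :
    aeval u r * u⁻¹ ^ k - algebraMap F K (r.coeff k) ∈ S.V 1 := by
  have hu0 : u ≠ 0 := S.ne_zero_of_ord_ne_zero (by omega)
  have ht : u⁻¹ ∈ S.V 1 := by
    rw [S.mem_V' (inv_ne_zero hu0), S.ord_inv, hu]; norm_num
  rw [aeval_eq_sum_range' (Nat.lt_succ_of_le hr), Finset.sum_range_succ, add_mul, Finset.sum_mul]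
  have h1 : r.coeff k • u ^ k * u⁻¹ ^ k = algebraMap F K (r.coeff k) := by
    rw [Algebra.smul_def, mul_assoc, ← mul_pow, mul_inv_cancel₀ hu0, one_pow, mul_one]
  rw [h1, add_sub_cancel_right]
  refine sum_mem fun i hi => ?_
  rw [Finset.mem_range] at hi
  have h2 : r.coeff i • u ^ i * u⁻¹ ^ k = r.coeff i • u⁻¹ ^ (k - i) := by
    rw [smul_mul_assoc]
    congr 1
    obtain ⟨j, rfl⟩ := Nat.exists_eq_add_of_le hi.le
    rw [Nat.add_sub_cancel_left, pow_add, ← mul_assoc, ← mul_pow, mul_inv_cancel₀ hu0, one_pow,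
      one_mul]
  rw [h2]
  refine Submodule.smul_mem _ _ (S.V_anti ?_ (S.pow_mem_V ht (k - i)))
  have : 1 ≤ k - i := by omega
  have : (1 : ℤ) ≤ (k - i : ℕ) := by exact_mod_cast this
  omega

/-- A family whose leading terms at a place, with weights `m`, are independent constants. -/
structure IsGraded (S : Place F K) (u : K) {ι : Type*} [Fintype ι] (b : ι → K) (m : ι → ℕ) :
    Prop where
  ord_eq : S.ord u = -1
  mem : ∀ i, b i * u⁻¹ ^ m i ∈ S.V 0
  indep : ∀ c : ι → F, ∑ i, algebraMap F K (c i) * (b i * u⁻¹ ^ m i) ∈ S.V 1 → c = 0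

variable {S : Place F K} {u : K} {ι : Type*} [Fintype ι] {b : ι → K} {m : ι → ℕ}

lemma IsGraded.natDegree_add_le (h : IsGraded S u b m) {r : ι → F[X]} {n : ℤ}
    (hn : ∑ i, aeval u (r i) * b i ∈ S.V (-n)) (i : ι) (hi : r i ≠ 0) :
    ((r i).natDegree + m i : ℤ) ≤ n := by
  by_contra hlt
  have hu0 : u ≠ 0 := S.ne_zero_of_ord_ne_zero (by rw [h.ord_eq]; omega)
  have ht : u⁻¹ ∈ S.V 1 := by
    rw [S.mem_V' (inv_ne_zero hu0), S.ord_inv, h.ord_eq]; norm_num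
  obtain ⟨j, hj, hmax⟩ := Finset.exists_max_image (Finset.univ.filter fun i => r i ≠ 0)
    (fun i => (r i).natDegree + m i) ⟨i, by simpa using hi⟩
  rw [Finset.mem_filter] at hj
  set N := (r j).natDegree + m j with hN
  have hNn : n < N := by
    have := hmax i (by simpa using hi)
    omega
  let c : ι → F := fun i => if m i ≤ N then (r i).coeff (N - m i) else 0
  have hterm : ∀ i, aeval u (r i) * b i * u⁻¹ ^ N - algebraMap F K (c i) * (b i * u⁻¹ ^ m i) ∈
      S.V 1 := by
    intro i
    by_cases h0 : r i = 0
    · have : c i = 0 := by simp [c, h0]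
      rw [this, h0]; simp
    · have hle : (r i).natDegree + m i ≤ N := hmax i (by simpa using h0)
      have hc : c i = (r i).coeff (N - m i) := if_pos (by omega)
      have h1 := S.aeval_mul_sub_mem h.ord_eq (r := r i) (k := N - m i) (by omega)
      have h2 := S.mul_mem_V h1 (h.mem i)
      have h3 : u⁻¹ ^ N = u⁻¹ ^ (N - m i) * u⁻¹ ^ m i := by rw [← pow_add]; congr 1; omega
      rw [hc, h3]
      rw [add_zero] at h2
      convert h2 using 1
      ring
  have hsum : ∑ i, algebraMap F K (c i) * (b i * u⁻¹ ^ m i) ∈ S.V 1 := by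
    have h1 := sum_mem fun i (_ : i ∈ Finset.univ) => hterm i
    rw [Finset.sum_sub_distrib, ← Finset.sum_mul] at h1
    have h2 : (∑ i, aeval u (r i) * b i) * u⁻¹ ^ N ∈ S.V 1 := by
      refine S.V_anti ?_ (S.mul_mem_V hn (S.pow_mem_V ht N))
      omega
    have := sub_mem h2 h1
    rwa [sub_sub_cancel] at this
  have hc := congrFun (h.indep c hsum) j
  have : c j = (r j).leadingCoeff := by
    simp only [c]
    rw [if_pos (by omega), hN, Nat.add_sub_cancel]
    rfl
  rw [this, Pi.zero_apply, leadingCoeff_eq_zero] at hc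
  exact hj.2 hc

lemma IsGraded.polyIndep (h : IsGraded S u b m) : PolyIndep F u b := by
  intro r hr i
  by_contra hi
  have := h.natDegree_add_le (n := -1) (by rw [hr]; exact zero_mem _) i hi
  omega

variable [hC : Fact (HasExactConstants F K)]

lemma IsGraded.exists_repr (h : IsGraded S u b m) (hu : u ∈ L (single S 1))
    (hb : ∀ i, b i ∈ L (single S (m i : ℤ))) {N : ℕ}
    (hN : ∀ n, N ≤ n → ell F (single S (n : ℤ)) ≤ ∑ i, (n + 1 - m i)) {n : ℕ} {f : K}
    (hf : f ∈ L (single S (n : ℤ))) : ∃ r : ι → F[X],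
      f = ∑ i, aeval u (r i) * b i ∧ ∀ i, r i ≠ 0 → (r i).natDegree + m i ≤ n := by
  have hmono : ∀ {a b : ℕ}, a ≤ b → L (single S (a : ℤ)) ≤ L (single S (b : ℤ)) :=
    fun hab => L_mono (Finsupp.single_le_single.2 (by exact_mod_cast hab))
  have h1 := (h.polyIndep.sum_le_ell (fun i => max n N + 1 - m i)
    (D := single S ((max n N : ℕ) : ℤ)) (fun i j hj => by
      have h2 := mul_mem_L (pow_mem_L hu j) (hb i)
      rw [Finsupp.smul_single, ← Finsupp.single_add] at h2
      refine L_mono (Finsupp.single_le_single.2 ?_) h2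
      rw [nsmul_eq_mul, mul_one]
      have : j + m i ≤ max n N := by omega
      exact_mod_cast this)).2 (hN _ (le_max_right _ _)) f (hmono (le_max_left _ _) hf)
  obtain ⟨r, -, hr⟩ := h1
  refine ⟨r, hr, fun i hi => ?_⟩
  have h2 := mem_L.1 hf S
  rw [single_eq_same, hr] at h2
  exact_mod_cast h.natDegree_add_le h2 i hi

end Graded

section Relations

variable {K : Type*} [Field K] [Algebra F₂ K]

lemma dvd_of_ev_eq_zero {u v : K} {G : F₂[X][X]} (hG : G.Monic) (h0 : ev u v G = 0)
    (hker : ∀ r : F₂[X][X], r.degree < G.degree → ev u v r = 0 → r = 0)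
    (r : F₂[X][X]) (hr : ev u v r = 0) : G ∣ r := by
  rw [← modByMonic_eq_zero_iff_dvd hG]
  refine hker _ (degree_modByMonic_lt r hG) ?_
  have := congrArg (ev u v) (modByMonic_add_div r G)
  rwa [map_add, map_mul, h0, zero_mul, add_zero, hr] at this

lemma eq_zero_of_ev_eq_zero {u v : K} {e : ℕ}
    (h : PolyIndep F₂ u fun i : Fin e => v ^ (i : ℕ)) (r : F₂[X][X])
    (hr : r.degree < e) (h0 : ev u v r = 0) : r = 0 := by
  by_contra hr0
  have hd : r.natDegree < e := by rwa [natDegree_lt_iff_degree_lt hr0]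
  rw [ev_eq_sum_range u v hd] at h0
  have h1 := h (fun i => r.coeff i) h0
  apply hr0
  ext1 i
  by_cases hi : i < e
  · exact h1 ⟨i, hi⟩
  · rw [coeff_eq_zero_of_natDegree_lt (by omega), coeff_zero]

end Relations

section Residue

variable {F : Type*} [Field F] {K : Type*} [Field K] [Algebra F K]
  [hF : Fact (IsFunctionField F K)]

/-- The residue at a place of an element of its ring. -/
def Place.res (p : Place F K) (f : K) : ResidueField p.1 :=
  if h : f ∈ p.1 then residue p.1 ⟨f, h⟩ else 0

lemma Place.res_of_mem (p : Place F K) {f : K} (h : f ∈ p.1) :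
    p.res f = residue p.1 ⟨f, h⟩ := dif_pos h

lemma Place.res_add (p : Place F K) {f g : K} (hf : f ∈ p.1) (hg : g ∈ p.1) :
    p.res (f + g) = p.res f + p.res g := by
  rw [p.res_of_mem hf, p.res_of_mem hg, p.res_of_mem (add_mem hf hg), ← map_add]; rfl

lemma Place.res_sub (p : Place F K) {f g : K} (hf : f ∈ p.1) (hg : g ∈ p.1) :
    p.res (f - g) = p.res f - p.res g := by
  rw [p.res_of_mem hf, p.res_of_mem hg, p.res_of_mem (sub_mem hf hg), ← map_sub]; rfl

lemma Place.res_mul (p : Place F K) {f g : K} (hf : f ∈ p.1) (hg : g ∈ p.1) :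
    p.res (f * g) = p.res f * p.res g := by
  rw [p.res_of_mem hf, p.res_of_mem hg, p.res_of_mem (mul_mem hf hg), ← map_mul]; rfl

lemma Place.res_pow (p : Place F K) {f : K} (hf : f ∈ p.1) (n : ℕ) :
    p.res (f ^ n) = p.res f ^ n := by
  rw [p.res_of_mem hf, p.res_of_mem (pow_mem hf n), ← map_pow]; rfl

lemma Place.res_sum (p : Place F K) {ι : Type*} (s : Finset ι) {f : ι → K} (hf : ∀ i, f i ∈ p.1) :
    p.res (∑ i ∈ s, f i) = ∑ i ∈ s, p.res (f i) := by
  rw [p.res_of_mem (sum_mem fun i _ => hf i), Finset.sum_congr rfl fun i _ => p.res_of_mem (hf i),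
    ← map_sum]
  congr 1
  ext
  simp

lemma Place.res_const (p : Place F K) (c : F) : p.res (algebraMap F K c) = residueHom F p c :=
  p.res_of_mem (p.2.2 c)

lemma Place.res_eq_zero_iff (p : Place F K) {f : K} (hf : f ∈ p.1) : p.res f = 0 ↔ f ∈ p.V 1 := by
  rw [p.res_of_mem hf, p.residue_eq_zero_iff]

lemma Place.res_eq_iff (p : Place F K) {f g : K} (hf : f ∈ p.1) (hg : g ∈ p.1) :
    p.res f = p.res g ↔ f - g ∈ p.V 1 := by
  rw [← p.res_eq_zero_iff (sub_mem hf hg), p.res_sub hf hg, sub_eq_zero]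

lemma Place.mem_ring_of_mem_V_one (p : Place F K) {f : K} (hf : f ∈ p.V 1) : f ∈ p.1 :=
  p.mem_V_zero.1 (p.V_anti (by norm_num) hf)

end Residue

section ResidueTwo

variable {K : Type*} [Field K] [Algebra F₂ K] [hF : Fact (IsFunctionField F₂ K)]

lemma Place.charTwo_residueField (p : Place F₂ K) : CharP (ResidueField p.1) 2 :=
  charP_of_injective_ringHom (residueHom F₂ p).injective 2

lemma Place.residue_pow_eq (p : Place F₂ K) (z : ResidueField p.1) :
    z ^ 2 ^ deg₂ p = z := by
  let _ := (residueHom F₂ p).toAlgebra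
  have h1 : 0 < finrank F₂ (ResidueField p.1) := p.one_le_degree
  have : Module.Finite F₂ (ResidueField p.1) := Module.finite_of_finrank_pos h1
  have : Finite (ResidueField p.1) := Module.finite_of_finite F₂
  let _ := Fintype.ofFinite (ResidueField p.1)
  have h2 := Module.card_eq_pow_finrank (K := F₂) (V := ResidueField p.1)
  rw [ZMod.card] at h2
  have h3 := FiniteField.pow_card z
  rw [h2] at h3
  exact h3

lemma Place.residueHom_coeff (p : Place F₂ K) (c : F₂) :
    residueHom F₂ p c = if c = 1 then 1 else 0 := by
  rcases zmod_two_cases c with rfl | rfl <;> simp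

end ResidueTwo

section Effective

variable {K : Type*} [Field K] [Algebra F₂ K] [hF : Fact (IsFunctionField F₂ K)]

lemma exists_single_le {D : Divisor F₂ K} (hD : 0 ≤ D) (h : 0 < deg D) :
    ∃ p, 0 < D p ∧ 0 ≤ D - single p 1 ∧
      deg (D - single p 1) = deg D - deg₂ p := by
  have h1 : ∃ p, D p ≠ 0 := by
    by_contra! h0
    have : D = 0 := Finsupp.ext h0
    rw [this] at h
    simp [deg] at h
  obtain ⟨p, hp⟩ := h1
  have hp' : 0 < D p := lt_of_le_of_ne (hD p) (Ne.symm hp)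
  refine ⟨p, hp', fun q => ?_, ?_⟩
  · rw [Finsupp.sub_apply, single_apply]
    split_ifs with hq
    · subst hq
      rw [Finsupp.zero_apply]
      omega
    · simpa using hD q
  · have := degHom_single p 1
    simp only [deg, map_sub] at *
    omega

variable [hC : Fact (HasExactConstants F₂ K)]

/-- An effective divisor of degree two or three without rational places is a place. -/
lemma eq_single_of_no_rational {D : Divisor F₂ K} (hD : 0 ≤ D) (h : deg D = 2 ∨ deg D = 3)
    (h1 : ∀ p, deg₂ p = 1 → D p = 0) : ∃ S, D = single S 1 := by
  obtain ⟨p, hp, hE, hd⟩ := exists_single_le hD (by omega)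
  refine ⟨p, ?_⟩
  have hp1 := p.one_le_degree
  have hp2 : deg₂ p ≠ 1 := fun h2 => by rw [h1 p h2] at hp; omega
  by_cases h0 : deg (D - single p 1) = 0
  · exact sub_eq_zero.1 (eq_zero_of_degHom_eq_zero hE h0)
  · have h2 := degHom_nonneg hE
    obtain ⟨q, hq, hE', hd'⟩ := exists_single_le hE (by simp only [deg] at *; omega)
    have h3 := degHom_nonneg hE'
    have hq1 := q.one_le_degree
    have hq2 := h1 q (by simp only [deg] at *; omega)
    rw [Finsupp.sub_apply, hq2, single_apply] at hq
    split_ifs at hq <;> omega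

variable [hG : Fact (GenusFourClassOne K)]

lemma eq_of_degree_one {p q : Place F₂ K} (hp : deg₂ p = 1)
    (hq : deg₂ q = 1) : p = q := by
  have h1 : deg (single q 1) = 1 := by rw [deg_single, hq]; norm_num
  have h := eq_of_el_eq_one (single_nonneg' p zero_le_one) (single_nonneg' q zero_le_one)
    (by rw [deg_single, deg_single, hp, hq]) (el_le_one_of_deg_one h1)
  exact Finsupp.single_left_injective one_ne_zero h

/-- A divisor class of minimal degree two or three with a pencil contains a place. -/
lemma exists_place_of_pencil {d n : ℕ} (hdn : n * d = 6) (hn : 2 ≤ n) (hd : d = 2 ∨ d = 3)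
    (hmin : ∀ D : Divisor F₂ K, deg D < d → el D < 2) {D : Divisor F₂ K}
    (h : deg D = d) (h2 : 2 ≤ el D) : ∃ S : Place F₂ K, deg₂ S = d ∧
      ∃ u ∈ L (single S 1), S.ord u = -1 := by
  obtain ⟨E, hE, hdE⟩ := exists_effective (D := D) (by omega)
  rw [el_congr hdE.symm] at h2
  rw [h] at hdE
  obtain ⟨x, hx, hxc⟩ := exists_not_mem_of_two_le_ell h2
  have hx0 : x ≠ 0 := fun h0 => hxc ⟨0, by rw [h0, map_zero]⟩
  obtain ⟨hp, -⟩ := el_le_two hdn hn hmin hdE hE hx hxc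
  have hE' : 0 ≤ E + dv x := (mem_L' hx0).1 hx
  have hdE' : deg (E + dv x) = d := by
    simp only [deg] at *
    rw [map_add, degHom_dv, hdE, add_zero]
  have hval : ∀ p : Place F₂ K, (E + dv x : Divisor F₂ K) p = max (-p.ord x) 0 + p.ord x := fun p => by
    rw [Finsupp.add_apply, ← hp, poles_apply, dv_apply]
  have hA : ∃ A : Divisor F₂ K, 0 ≤ A ∧ deg A = d ∧
      ∀ p, deg₂ p = 1 → A p = 0 := by
    by_cases hP : ∃ P : Place F₂ K, deg₂ P = 1 ∧ E P ≠ 0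
    · obtain ⟨P, hP, hEP⟩ := hP
      refine ⟨_, hE', hdE', fun p hp1 => ?_⟩
      rw [eq_of_degree_one hp1 hP, hval]
      rw [← hp, poles_apply] at hEP
      omega
    · push Not at hP
      exact ⟨E, hE, hdE, hP⟩
  obtain ⟨A, hA, hdA, hA1⟩ := hA
  obtain ⟨S, rfl⟩ := eq_single_of_no_rational hA (by omega) hA1
  have hS : deg₂ S = d := by
    rw [deg_single] at hdA; omega
  refine ⟨S, hS, ?_⟩
  rw [el_congr (E := single S 1) (by rw [hdE, hdA])] at h2
  obtain ⟨u, hu, huc⟩ := exists_not_mem_of_two_le_ell h2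
  obtain ⟨hp, -⟩ := el_le_two hdn hn hmin hdA hA hu huc
  refine ⟨u, hu, ?_⟩
  have := congrArg (· S) hp
  simp only [poles_apply, single_eq_same] at this
  omega

/-- When the space of sections grows enough, there is one whose leading coefficient is not a
constant. -/
lemma exists_nonconstant_leading {S : Place F₂ K} {u : K} (hu : u ∈ L (single S 1))
    (hu1 : S.ord u = -1) {k : ℕ}
    (hk : el (single S ((k : ℤ) - 1)) + 1 < el (single S (k : ℤ))) :
    ∃ v ∈ L (single S (k : ℤ)), ∀ c : F₂,
      v * u⁻¹ ^ k - algebraMap F₂ K c ∉ S.V 1 := by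
  have hu0 : u ≠ 0 := S.ne_zero_of_ord_ne_zero (by omega)
  by_contra! hv
  set M := Submodule.span F₂ ({u ^ k} : Set K) with hM
  have hle : L (single S (k : ℤ)) ≤ L (single S ((k : ℤ) - 1)) ⊔ M := by
    intro v hvL
    obtain ⟨c, hc⟩ := hv v hvL
    have h1 : v - c • u ^ k ∈ L (single S ((k : ℤ) - 1)) := by
      have h2 : v - c • u ^ k ∈ L (single S (k : ℤ)) := by
        refine sub_mem hvL (Submodule.smul_mem _ _ ?_)
        have := pow_mem_L hu k
        rwa [Finsupp.smul_single, nsmul_eq_mul, mul_one] at this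
      rw [mem_L] at h2 ⊢
      intro p
      by_cases hp : p = S
      · subst hp
        rw [single_eq_same]
        have h3 : u ^ k ∈ p.V (-k) := by
          have : u ∈ p.V (-1) := by rw [p.mem_V' hu0, hu1]
          have := p.pow_mem_V this k
          rwa [mul_neg, mul_one] at this
        have h4 := p.mul_mem_V hc h3
        rw [sub_mul, mul_assoc, ← mul_pow, inv_mul_cancel₀ hu0, one_pow, mul_one,
          ← Algebra.smul_def] at h4
        convert h4 using 2
        ring
      · have := h2 p
        rw [single_eq_of_ne hp] at this ⊢
        exact this
    rw [← sub_add_cancel v (c • u ^ k)]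
    exact Submodule.add_mem_sup h1 (Submodule.smul_mem _ _ (Submodule.mem_span_singleton_self _))
  have : FiniteDimensional F₂ M := FiniteDimensional.span_of_finite _ (Set.toFinite _)
  have h1 := Submodule.finrank_mono hle
  have h2 := Submodule.finrank_add_le_finrank_add_finrank (L (single S ((k : ℤ) - 1))) M
  have h3 : finrank F₂ M ≤ 1 := by
    rw [hM, finrank_span_singleton (pow_ne_zero _ hu0)]
  simp only [el, ell_eq] at hk
  omega

end Effective

section PlaneModel

variable {K : Type*} [Field K] [Algebra F₂ K] [hF : Fact (IsFunctionField F₂ K)]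
  {S : Place F₂ K} {u v : K}

lemma Place.inv_mem_V (S : Place F₂ K) {u : K} (hu : S.ord u = -1) : u⁻¹ ∈ S.V 1 := by
  rw [S.mem_V' (inv_ne_zero (S.ne_zero_of_ord_ne_zero (by omega))), S.ord_inv, hu]; norm_num

lemma Place.mul_inv_pow_mem (S : Place F₂ K) {u f : K} (hu : S.ord u = -1) {k : ℕ}
    (hf : f ∈ S.V (-k)) : f * u⁻¹ ^ k ∈ S.1 := by
  have := S.mul_mem_V hf (S.pow_mem_V (S.inv_mem_V hu) k)
  rwa [mul_one, neg_add_cancel, S.mem_V_zero] at this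

lemma Place.res_aeval (S : Place F₂ K) {u : K} (hu : S.ord u = -1) {r : F₂[X]} {k : ℕ}
    (hr : r.natDegree ≤ k) : aeval u r * u⁻¹ ^ k ∈ S.1 ∧
      S.res (aeval u r * u⁻¹ ^ k) = if r.coeff k = 1 then 1 else 0 := by
  have h1 := S.aeval_mul_sub_mem hu hr
  have h2 : aeval u r * u⁻¹ ^ k ∈ S.1 := by
    have := add_mem (S.mem_ring_of_mem_V_one h1) (S.2.2 (r.coeff k))
    rwa [sub_add_cancel] at this
  refine ⟨h2, ?_⟩
  rw [← S.residueHom_coeff, ← S.res_const]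
  exact (S.res_eq_iff h2 (S.2.2 _)).2 h1

lemma isGraded_pow (hu : S.ord u = -1) {k e : ℕ} (hv : v ∈ S.V (-k))
    (hz : ∀ c : Fin e → F₂,
      ∑ i, residueHom F₂ S (c i) * S.res (v * u⁻¹ ^ k) ^ (i : ℕ) = 0 → c = 0) :
    IsGraded (F := F₂) S u (fun i : Fin e => v ^ (i : ℕ)) (fun i => k * i) := by
  have hη := S.mul_inv_pow_mem hu hv
  have hpow : ∀ i : Fin e, v ^ (i : ℕ) * u⁻¹ ^ (k * (i : ℕ)) = (v * u⁻¹ ^ k) ^ (i : ℕ) := fun i => by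
    rw [mul_pow, ← pow_mul]
  refine ⟨hu, fun i => ?_, fun c hc => hz c ?_⟩
  · rw [hpow, S.mem_V_zero]
    exact pow_mem hη _
  · have hm : ∀ i : Fin e, algebraMap F₂ K (c i) * (v ^ (i : ℕ) * u⁻¹ ^ (k * (i : ℕ))) ∈ S.1 :=
      fun i => by rw [hpow]; exact mul_mem (S.2.2 _) (pow_mem hη _)
    rw [← S.res_eq_zero_iff (sum_mem fun i _ => hm i), S.res_sum _ hm] at hc
    rw [← hc]
    refine Finset.sum_congr rfl fun i _ => ?_
    rw [hpow, S.res_mul (S.2.2 _) (pow_mem hη _), S.res_const, S.res_pow hη]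

variable [hC : Fact (HasExactConstants F₂ K)]

lemma mem_V_of_mem_L {k : ℕ} (hv : v ∈ L (single S (k : ℤ))) : v ∈ S.V (-k) := by
  have := mem_L.1 hv S
  rwa [single_eq_same] at this

lemma pow_mem_L_single {j k : ℕ} (hv : v ∈ L (single S (k : ℤ))) :
    v ^ j ∈ L (single S ((k * j : ℕ) : ℤ)) := by
  have := pow_mem_L hv j
  rwa [Finsupp.smul_single, nsmul_eq_mul, mul_comm, ← Nat.cast_mul] at this

lemma IsGraded.exists_ev {e k N : ℕ}
    (h : IsGraded (F := F₂) S u (fun i : Fin e => v ^ (i : ℕ)) (fun i => k * i))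
    (hu : u ∈ L (single S 1)) (hv : v ∈ L (single S (k : ℤ)))
    (hN : ∀ n, N ≤ n → ell F₂ (single S (n : ℤ)) ≤ ∑ i : Fin e, (n + 1 - k * i))
    {n : ℕ} {f : K} (hf : f ∈ L (single S (n : ℤ))) : ∃ r, f = ev u v r := by
  obtain ⟨r, hr, -⟩ := h.exists_repr hu (fun i => pow_mem_L_single hv) hN hf
  refine ⟨∑ i, C (r i) * X ^ (i : ℕ), ?_⟩
  rw [hr, map_sum]
  simp

lemma IsGraded.exists_relation {e k N : ℕ}
    (h : IsGraded (F := F₂) S u (fun i : Fin e => v ^ (i : ℕ)) (fun i => k * i))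
    (hu : u ∈ L (single S 1)) (hv : v ∈ L (single S (k : ℤ)))
    (hN : ∀ n, N ≤ n → ell F₂ (single S (n : ℤ)) ≤ ∑ i : Fin e, (n + 1 - k * i)) :
    ∃ r : Fin e → F₂[X],
    v ^ e = ∑ i, aeval u (r i) * v ^ (i : ℕ) ∧ ∀ i, r i ≠ 0 → (r i).natDegree + k * i ≤ k * e :=
  h.exists_repr hu (fun _ => pow_mem_L_single hv) hN (pow_mem_L_single hv)

/-- The places at a point whose first coordinate has the degree of the place are excluded when
they are equivalent to a multiple of the pole of the coordinate. -/
lemma exists_aeval_mem {p : Place F₂ K} (hp : p ≠ S) [hG : Fact (GenusFourClassOne K)] {m : ℕ}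
    (hm : deg₂ p = m * deg₂ S)
    (hL : ∀ f ∈ L (single S (m : ℤ)), ∃ r : F₂[X], f = aeval u r ∧ r.natDegree ≤ m) :
    ∃ r : F₂[X], r ≠ 0 ∧ r.natDegree ≤ m ∧ aeval u r ∈ p.V 1 := by
  obtain ⟨f, hf, hfL, h1⟩ := exists_eq_add_dv_mem (D := single p 1)
    (E := single S (m : ℤ)) (single_nonneg' p zero_le_one) (by
      rw [deg_single, deg_single, hm]; push_cast; ring)
  obtain ⟨r, rfl, hr⟩ := hL f hfL
  refine ⟨r, fun h0 => hf (by rw [h0, map_zero]), hr, ?_⟩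
  have h2 := DFunLike.congr_fun h1 p
  rw [Finsupp.add_apply, single_eq_same, single_eq_of_ne hp, zero_add, dv_apply] at h2
  rw [p.mem_V' hf, ← h2]

end PlaneModel

section Leaders

lemma exists_psi_of_natDegree_le {k : Type*} [Field k] [CharP k 2] [Algebra F₂ k] {m : ℕ}
    (hm : m ≤ 7) {r : F₂[X]} (hr : r.natDegree ≤ m) :
    ∃ n < 2 ^ (m + 1), (r ≠ 0 → n ≠ 0) ∧ ∀ a : k, aeval a r = psi a n := by
  refine ⟨∑ i ∈ Finset.range (m + 1), if r.coeff i = 1 then 2 ^ i else 0, ?_, ?_, ?_⟩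
  · calc _ ≤ ∑ i ∈ Finset.range (m + 1), 2 ^ i := Finset.sum_le_sum fun i _ => by split_ifs <;> simp
      _ < 2 ^ (m + 1) := by
        rw [Nat.geomSum_eq le_rfl]
        have := Nat.one_le_two_pow (n := m + 1)
        simp
  · intro h0 hs
    rw [Finset.sum_eq_zero_iff] at hs
    have h1 := hs r.natDegree (Finset.mem_range.2 (by omega))
    rcases zmod_two_cases r.leadingCoeff with h2 | h2
    · exact h0 (leadingCoeff_eq_zero.1 h2)
    · rw [leadingCoeff] at h2
      simp [h2] at h1
  · intro a
    have key : ∀ (j : ℕ), j ≤ 8 → ∀ c : ℕ → F₂,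
        (∑ i ∈ Finset.range j, if c i = 1 then 2 ^ i else 0) < 2 ^ j ∧
        ∑ i ∈ Finset.range j, c i • a ^ i =
          psi a (∑ i ∈ Finset.range j, if c i = 1 then 2 ^ i else 0) := by
      intro j
      induction j with
      | zero => intro _ _; simp [psi_zero]
      | succ j ih =>
        intro hj c
        obtain ⟨h1, h2⟩ := ih (by omega) fun i => c (i + 1)
        have h3 : (∑ i ∈ Finset.range j, if c (i + 1) = 1 then 2 ^ (i + 1) else 0) =
            2 * ∑ i ∈ Finset.range j, if c (i + 1) = 1 then 2 ^ i else 0 := by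
          rw [Finset.mul_sum]
          refine Finset.sum_congr rfl fun i _ => ?_
          split_ifs <;> ring
        have h4 : ∑ i ∈ Finset.range j, c (i + 1) • a ^ (i + 1) =
            a * ∑ i ∈ Finset.range j, c (i + 1) • a ^ i := by
          rw [Finset.mul_sum]
          refine Finset.sum_congr rfl fun i _ => ?_
          rw [pow_succ', mul_smul_comm]
        rw [Finset.sum_range_succ', Finset.sum_range_succ', h3, h4, h2, pow_zero, pow_zero]
        set n := ∑ i ∈ Finset.range j, if c (i + 1) = 1 then 2 ^ i else 0
        have h5 : (2 : ℕ) ^ j ≤ 2 ^ 7 := Nat.pow_le_pow_right (by norm_num) (by omega)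
        have h6 : (2 : ℕ) ^ (j + 1) = 2 * 2 ^ j := pow_succ' 2 j
        have h7 : (2 : ℕ) ^ (j + 1) ≤ 2 ^ 8 := Nat.pow_le_pow_right (by norm_num) (by omega)
        refine ⟨by split_ifs <;> omega, ?_⟩
        rcases zmod_two_cases (c 0) with h0 | h0
        · rw [h0, if_neg (by decide), add_zero, zero_smul, add_zero, psi_two_mul a (by omega)]
        · rw [h0, if_pos rfl, one_smul, psi_eq_bit a (n := 2 * n + 1) (by omega)]
          have h8 : (2 * n + 1).testBit 0 = true := by simp
          have h9 : (2 * n + 1) / 2 = n := by omega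
          rw [h8, cond_true, psi_one, h9, add_comm]
    rw [aeval_eq_sum_range' (Nat.lt_succ_of_le hr)]
    exact (key (m + 1) (by omega) r.coeff).2

/-- The first coordinates of the points are not roots of polynomials of degree at most `m`. -/
def PointClass.leaderCheck (c : PointClass) (m : ℕ) : Bool :=
  c.pts.all fun P => (List.range (2 ^ (m + 1))).all fun n =>
    n == 0 || evalCode c.d c.m P.1 (m + 1) n != 0

variable {K : Type*} [Field K] [Algebra F₂ K] [hF : Fact (IsFunctionField F₂ K)]
  [hC : Fact (HasExactConstants F₂ K)] [hG : Fact (GenusFourClassOne K)]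
  {S : Place F₂ K} {u v : K}

lemma PointClass.not_centredAt {c : PointClass} (hc : c.pointCheck = true) {m : ℕ} (hm : m ≤ 7)
    (hl : c.leaderCheck m = true) {P : ℕ³} {p : Place F₂ K}
    (h : ∃ r : F₂[X], r ≠ 0 ∧ r.natDegree ≤ m ∧ aeval u r ∈ p.V 1) :
    ¬ c.CentredAt u v P p := by
  rintro ⟨hP, hcen⟩
  obtain ⟨r, hr0, hr, hrp⟩ := h
  obtain ⟨hf, hA, -, -⟩ := c.generates hc hP
  obtain ⟨n, hn, hn0, hpsi⟩ := exists_psi_of_natDegree_le (k := CodeField c.m) hm hr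
  rw [hcen.aeval_iff, hpsi] at hrp
  have h1 := (isCodeRoot hf).evalCode hA hn (by omega)
  rw [hrp, psi_eq_zero_iff hf h1.2] at h1
  rw [leaderCheck, List.all_eq_true] at hl
  have h2 := hl P hP
  rw [List.all_eq_true] at h2
  have h3 := h2 n (List.mem_range.2 hn)
  simp [hn0 hr0, h1.1] at h3

end Leaders

section CoefficientFunctions

/-- The coefficients of `Y ^ e + a Y + b`. -/
def coeffFn (e : ℕ) (a b : F₂[X]) : ℕ³ → F₂ := fun t =>
  if t.2.2 = e then 1 else if t.2.2 = 1 then a.coeff t.2.1 else b.coeff t.2.1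

lemma polyL_eq_map (l : List (ℕ³ × ℕ)) (ε : ℕ³ → F₂) :
    polyL l ε = ((l.map Prod.fst).map fun t => C (C (ε t)) * mon t).sum := by
  rw [polyL, List.map_map]; rfl

lemma polyL_coeffFn_two {l : List (ℕ³ × ℕ)} (hl : l.map Prod.fst =
    [(0, 0, 2), (0, 5, 1), (0, 10, 0), (0, 0, 1), (0, 1, 1), (0, 2, 1), (0, 3, 1), (0, 4, 1),
      (0, 0, 0), (0, 1, 0), (0, 2, 0), (0, 3, 0), (0, 4, 0), (0, 5, 0), (0, 6, 0), (0, 7, 0),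
      (0, 8, 0), (0, 9, 0)]) {a b : F₂[X]} (ha : a.natDegree ≤ 5) (hb : b.natDegree ≤ 10) :
    polyL l (coeffFn 2 a b) = X ^ 2 + C a * X + C b := by
  rw [polyL_eq_map, hl]
  conv_rhs => rw [a.as_sum_range' 6 (by omega), b.as_sum_range' 11 (by omega)]
  simp only [List.map_cons, List.map_nil, List.sum_cons, List.sum_nil, mon, coeffFn,
    Finset.sum_range_succ, Finset.sum_range_zero, ← C_mul_X_pow_eq_monomial, map_add, map_mul,
    map_pow]
  simp
  ring

lemma polyL_coeffFn_three {l : List (ℕ³ × ℕ)} (hl : l.map Prod.fst =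
    [(0, 0, 3), (0, 4, 1), (0, 6, 0), (0, 0, 1), (0, 1, 1), (0, 2, 1), (0, 3, 1), (0, 0, 0),
      (0, 1, 0), (0, 2, 0), (0, 3, 0), (0, 4, 0), (0, 5, 0)]) {a b : F₂[X]}
    (ha : a.natDegree ≤ 4) (hb : b.natDegree ≤ 6) :
    polyL l (coeffFn 3 a b) = X ^ 3 + C a * X + C b := by
  rw [polyL_eq_map, hl]
  conv_rhs => rw [a.as_sum_range' 5 (by omega), b.as_sum_range' 7 (by omega)]
  simp only [List.map_cons, List.map_nil, List.sum_cons, List.sum_nil, mon, coeffFn,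
    Finset.sum_range_succ, Finset.sum_range_zero, ← C_mul_X_pow_eq_monomial, map_add, map_mul,
    map_pow]
  simp
  ring

end CoefficientFunctions

section EffectiveBounds

variable {K : Type*} [Field K] [Algebra F₂ K] [hF : Fact (IsFunctionField F₂ K)]
  [hC : Fact (HasExactConstants F₂ K)] [hG : Fact (GenusFourClassOne K)]

lemma eq_of_base_point {p P : Place F₂ K} {E : Divisor F₂ K}
    (h : deg (single p 1) = deg (E + single P 1))
    (hel : el (E + single P 1) ≤ el E) : p = P := by
  obtain ⟨f, hf, hfL, h1⟩ := exists_eq_add_dv_mem (single_nonneg' p zero_le_one) h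
  have hle : L E ≤ L (E + single P 1) := L_mono (by simp)
  have hEq : L E = L (E + single P 1) := Submodule.eq_of_le_of_finrank_le hle (by
    simpa only [el, ell_eq] using hel)
  rw [← hEq, mem_L' hf] at hfL
  have h2 := hfL P
  by_contra hne
  have h3 := DFunLike.congr_fun h1 P
  rw [single_eq_of_ne (Ne.symm hne)] at h3
  simp only [Finsupp.add_apply, single_eq_same, Finsupp.zero_apply] at h2 h3
  omega

lemma exists_smul_add_of_el_le_two {D : Divisor F₂ K} (hD : 0 ≤ D) (h : el D ≤ 2) {x : K}
    (hx : x ∈ L D) (hxc : x ∉ (algebraMap F₂ K).range) :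
    ∀ y ∈ L D, ∃ a b : F₂, y = algebraMap F₂ K a + algebraMap F₂ K b * x := by
  have h1 : (1 : K) ∈ L D := one_mem_L hD
  have hli : LinearIndependent F₂ ![(1 : K), x] := by
    rw [LinearIndependent.pair_iff]
    intro a b hab
    have hb : b = 0 := by
      rcases zmod_two_cases b with hb | hb
      · exact hb
      · exfalso
        apply hxc
        refine ⟨-a, ?_⟩
        rw [hb, one_smul, ← Algebra.algebraMap_eq_smul_one] at hab
        rw [map_neg]
        linear_combination -hab
    rw [hb, zero_smul, add_zero, ← Algebra.algebraMap_eq_smul_one] at hab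
    exact ⟨(map_eq_zero _).1 hab, hb⟩
  have hle : Submodule.span F₂ (Set.range ![(1 : K), x]) ≤ L D := by
    rw [Submodule.span_le]
    rintro _ ⟨i, rfl⟩
    fin_cases i
    · exact h1
    · exact hx
  have hEq := Submodule.eq_of_le_of_finrank_le hle (by
    rw [finrank_span_eq_card hli, Fintype.card_fin]
    simpa only [el, ell_eq] using h)
  intro y hy
  rw [← hEq, Matrix.range_cons, Matrix.range_cons, Matrix.range_empty, Set.union_empty,
    Set.singleton_union, Submodule.mem_span_pair] at hy
  obtain ⟨a, b, rfl⟩ := hy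
  exact ⟨a, b, by rw [Algebra.algebraMap_eq_smul_one, ← Algebra.smul_def]⟩

lemma card_effective_le_three {D : Divisor F₂ K} (hel : el D ≤ 2)
    {s : Finset (Divisor F₂ K)} (hs : ∀ E ∈ s, 0 ≤ E ∧ deg E = deg D) : s.card ≤ 3 := by
  rcases s.eq_empty_or_nonempty with rfl | ⟨E, hE⟩
  · simp
  obtain ⟨hE0, hEd⟩ := hs E hE
  rw [el_congr hEd.symm] at hel
  by_cases h1 : el E ≤ 1
  · have : s.card ≤ 1 := Finset.card_le_one.2 fun A hA B hB => by
      rw [eq_of_el_eq_one (hs A hA).1 hE0 ((hs A hA).2.trans hEd.symm) h1,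
        eq_of_el_eq_one (hs B hB).1 hE0 ((hs B hB).2.trans hEd.symm) h1]
    omega
  · obtain ⟨x, hx, hxc⟩ := exists_not_mem_of_two_le_ell (F := F₂) (D := E) (by
      simp only [el] at h1; omega)
    have h2 : s ⊆ {E, E + dv x, E + dv (x + 1)} := fun A hA => by
      have := effective_cases (exists_smul_add_of_el_le_two hE0 hel hx hxc) (hs A hA).1
        ((hs A hA).2.trans hEd.symm)
      simpa using this
    exact (Finset.card_le_card h2).trans Finset.card_le_three

lemma eq_of_el_le_one_of_place {p q : Place F₂ K}
    (h : deg₂ p = deg₂ q) (hel : el (single q 1) ≤ 1) :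
    p = q :=
  Finsupp.single_left_injective one_ne_zero (eq_of_el_eq_one (single_nonneg' p zero_le_one)
    (single_nonneg' q zero_le_one) (by rw [deg_single, deg_single, h]) hel)

lemma el_le_one_of_deg_lt_two {D : Divisor F₂ K} (h : deg D < 2) : el D < 2 := by
  rcases lt_trichotomy (deg D) 0 with h0 | h0 | h0
  · rw [show el D = 0 from ell_eq_zero h0]; norm_num
  · rw [el_of_deg_eq_zero h0]; norm_num
  · have := el_le_one_of_deg_one (D := D) (by omega)
    omega

end EffectiveBounds

section PlaneModelTwo

variable {K : Type*} [Field K] [Algebra F₂ K] [hF : Fact (IsFunctionField F₂ K)]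
  [hC : Fact (HasExactConstants F₂ K)] {S : Place F₂ K} {u v : K}

lemma IsGraded.exists_aeval {e k N : ℕ}
    (h : IsGraded (F := F₂) S u (fun i : Fin (e + 1) => v ^ (i : ℕ)) (fun i => k * i))
    (hu : u ∈ L (single S 1)) (hv : v ∈ L (single S (k : ℤ)))
    (hN : ∀ n, N ≤ n → ell F₂ (single S (n : ℤ)) ≤ ∑ i : Fin (e + 1), (n + 1 - k * i))
    {m : ℕ} (hm : m < k) (f : K) (hf : f ∈ L (single S (m : ℤ))) :
    ∃ r : F₂[X], f = aeval u r ∧ r.natDegree ≤ m := by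
  obtain ⟨r, hr, hd⟩ := h.exists_repr hu (fun _ => pow_mem_L_single hv) hN hf
  refine ⟨r 0, ?_, ?_⟩
  · rw [hr, Fin.sum_univ_succ, Finset.sum_eq_zero]
    · simp
    · intro i _
      have : r i.succ = 0 := by
        by_contra h0
        have h1 := hd _ h0
        rw [Fin.val_succ, mul_add, mul_one] at h1
        omega
      rw [this, map_zero, zero_mul]
  · by_cases h0 : r 0 = 0
    · rw [h0]; simp
    · have := hd 0 h0
      simpa using this

lemma dvd_of_plane_relation {e k : ℕ} (he : 2 ≤ e) {a b : F₂[X]}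
    (h : IsGraded (F := F₂) S u (fun i : Fin e => v ^ (i : ℕ)) (fun i => k * i))
    (hrel : v ^ e + aeval u a * v + aeval u b = 0) (r : F₂[X][X]) (hr : ev u v r = 0) :
    X ^ e + C a * X + C b ∣ r := by
  have hd : (C a * X + C b : F₂[X][X]).degree < ((e : ℕ) : WithBot ℕ) :=
    (degree_linear_le).trans_lt (by exact_mod_cast he)
  have hm : (X ^ e + C a * X + C b : F₂[X][X]).Monic := by
    rw [add_assoc]; exact monic_X_pow_add hd
  have hdeg : (X ^ e + C a * X + C b : F₂[X][X]).degree = ((e : ℕ) : WithBot ℕ) := by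
    rw [add_assoc, degree_add_eq_left_of_degree_lt (by rwa [degree_X_pow]), degree_X_pow]
  refine dvd_of_ev_eq_zero (u := u) (v := v) hm (by simpa using hrel) (fun s hs h0 => ?_) r hr
  exact eq_zero_of_ev_eq_zero h.polyIndep s (by rwa [hdeg] at hs) h0

end PlaneModelTwo

section LeadingResidue

lemma two_eq_zero (K : Type*) [Field K] [Algebra F₂ K] : (2 : K) = 0 := by
  have := charP_of_injective_algebraMap (algebraMap F₂ K).injective 2
  exact CharTwo.two_eq_zero

variable {K : Type*} [Field K] [Algebra F₂ K] [hF : Fact (IsFunctionField F₂ K)]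
  {S : Place F₂ K} {u v : K}

lemma Place.res_ne_residueHom {w : K} (hw : w ∈ S.1)
    (h : ∀ c : F₂, w - algebraMap F₂ K c ∉ S.V 1) (c : F₂) :
    S.res w ≠ residueHom F₂ S c := by
  rw [← S.res_const, Ne, S.res_eq_iff hw (S.2.2 c)]
  exact h c

lemma Place.res_ne_zero_one {w : K} (hw : w ∈ S.1)
    (h : ∀ c : F₂, w - algebraMap F₂ K c ∉ S.V 1) : S.res w ≠ 0 ∧ S.res w ≠ 1 := by
  have h0 := Place.res_ne_residueHom hw h 0
  have h1 := Place.res_ne_residueHom hw h 1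
  rw [map_zero] at h0
  rw [map_one] at h1
  exact ⟨h0, h1⟩

end LeadingResidue

section DegreeTwoPencil

variable {K : Type*} [Field K] [Algebra F₂ K] [hF : Fact (IsFunctionField F₂ K)]
  [hC : Fact (HasExactConstants F₂ K)] [hG : Fact (GenusFourClassOne K)]

lemma ell_single_eq {S : Place F₂ K} {n : ℕ} (h : 7 ≤ n * deg₂ S) :
    (ell F₂ (single S (n : ℤ) : Divisor F₂ K) : ℤ) =
      n * deg₂ S - 3 := by
  have := el_of_seven_le (K := K) (D := single S (n : ℤ)) (by rw [deg_single]; exact_mod_cast h)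
  rw [deg_single] at this
  exact this

lemma ell_single_le_sum_two {S : Place F₂ K} (hS : deg₂ S = 2) (n : ℕ)
    (hn : 5 ≤ n) : ell F₂ (single S (n : ℤ) : Divisor F₂ K) ≤
      ∑ i : Fin 2, (n + 1 - 5 * (i : ℕ)) := by
  have := ell_single_eq (S := S) (n := n) (by rw [hS]; omega)
  rw [hS] at this
  rw [Fin.sum_univ_two]
  simp only [Fin.val_zero, Fin.val_one]
  omega

/-- The hyperelliptic model at a prime divisor of degree two which moves in a pencil. -/
lemma exists_hyperelliptic_model {S : Place F₂ K} (hS : deg₂ S = 2) {u : K}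
    (hu : u ∈ L (single S 1)) (hu1 : S.ord u = -1) :
    ∃ v ∈ L (single S ((5 : ℕ) : ℤ)), ∃ a b : F₂[X],
      IsGraded (F := F₂) S u (fun i : Fin 2 => v ^ (i : ℕ)) (fun i => 5 * i) ∧
      v ^ 2 + aeval u a * v + aeval u b = 0 ∧ a.natDegree ≤ 5 ∧ b.natDegree ≤ 10 ∧
      a.coeff 5 = 1 ∧ b.coeff 10 = 1 := by
  have h4 := ell_single_eq (S := S) (n := 4) (by rw [hS]; norm_num)
  have h5 := ell_single_eq (S := S) (n := 5) (by rw [hS]; norm_num)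
  rw [hS] at h4 h5
  obtain ⟨v, hv, hvc⟩ := exists_nonconstant_leading hu hu1 (k := 5) (by
    have h4' : (((4 : ℕ) : ℤ)) = ((5 : ℕ) : ℤ) - 1 := by norm_num
    rw [h4'] at h4
    change ell _ _ + 1 < ell _ _
    omega)
  have hvV := mem_V_of_mem_L hv
  have hw := S.mul_inv_pow_mem hu1 hvV
  have := S.charTwo_residueField
  have hz := S.residue_pow_eq (S.res (v * u⁻¹ ^ 5))
  rw [hS] at hz
  obtain ⟨hz0, hz1⟩ := Place.res_ne_zero_one hw hvc
  set z := S.res (v * u⁻¹ ^ 5) with hzdef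
  have h2 : (2 : ResidueField S.1) = 0 := CharTwo.two_eq_zero
  have hzz : z ^ 2 + z + 1 = 0 := by
    have h0 : z * (z - 1) * (z ^ 2 + z + 1) = 0 := by linear_combination hz
    rcases mul_eq_zero.1 h0 with h0 | h0
    · rcases mul_eq_zero.1 h0 with h0 | h0
      · exact absurd h0 hz0
      · exact absurd (sub_eq_zero.1 h0) hz1
    · exact h0
  have hind : ∀ α β : F₂, residueHom F₂ S α + residueHom F₂ S β * z = 0 →
      α = 0 ∧ β = 0 := by
    intro α β h
    rcases zmod_two_cases β with rfl | rfl
    · rw [map_zero, zero_mul, add_zero, _root_.map_eq_zero] at h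
      exact ⟨h, rfl⟩
    · exfalso
      rw [map_one, one_mul] at h
      exact Place.res_ne_residueHom hw hvc (-α) (by rw [map_neg]; linear_combination h)
  have hgr : IsGraded (F := F₂) S u (fun i : Fin 2 => v ^ (i : ℕ)) (fun i => 5 * i) := by
    refine isGraded_pow hu1 hvV (fun c hc => ?_)
    rw [Fin.sum_univ_two] at hc
    rw [Fin.val_zero, Fin.val_one, pow_zero, pow_one, mul_one] at hc
    obtain ⟨ha, hb⟩ := hind (c 0) (c 1) hc
    funext i
    fin_cases i
    · exact ha
    · exact hb
  obtain ⟨r, hr, hrd⟩ := hgr.exists_relation hu hv (ell_single_le_sum_two hS)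
  have hd0 : (r 0).natDegree ≤ 10 := by
    by_cases h : r 0 = 0
    · rw [h]; simp
    · simpa using hrd 0 h
  have hd1 : (r 1).natDegree ≤ 5 := by
    by_cases h : r 1 = 0
    · rw [h]; simp
    · have := hrd 1 h
      simp only [Fin.val_one] at this
      omega
  rw [Fin.sum_univ_two] at hr
  simp only [Fin.val_zero, Fin.val_one, pow_zero, pow_one, mul_one] at hr
  obtain ⟨hm1, he1⟩ := S.res_aeval hu1 hd1
  obtain ⟨hm0, he0⟩ := S.res_aeval hu1 hd0
  have hkey : z ^ 2 = residueHom F₂ S ((r 1).coeff 5) * z +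
      residueHom F₂ S ((r 0).coeff 10) := by
    rw [S.residueHom_coeff, S.residueHom_coeff, ← he1, ← he0, hzdef, ← S.res_mul hm1 hw,
      ← S.res_add (mul_mem hm1 hw) hm0, ← S.res_pow hw]
    congr 1
    linear_combination u⁻¹ ^ 10 * hr
  obtain ⟨ha, hb⟩ := hind ((r 0).coeff 10 + 1) ((r 1).coeff 5 + 1) (by
    rw [map_add, map_add, map_one]
    linear_combination -hkey + hzz)
  refine ⟨v, hv, r 1, r 0, hgr, ?_, hd1, hd0, ?_, ?_⟩
  · have : (2 : K) = 0 := two_eq_zero K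
    linear_combination hr + (aeval u (r 1) * v + aeval u (r 0)) * this
  · generalize (r 1).coeff 5 = x at hb ⊢
    revert hb; revert x; decide
  · generalize (r 0).coeff 10 = x at ha ⊢
    revert ha; revert x; decide

lemma hyperWithClasses_spec : ∀ c ∈ hyperWithClasses, (c.d = 1 ∧ c.M = 1) ∨ c.M = 0 ∧
    (c.d = 3 ∨ c.d = 5 ∨ (c.d = 2 ∧ c.leaderCheck 1 = true) ∨
      (c.d = 4 ∧ c.leaderCheck 2 = true)) := by
  decide +kernel

lemma hyperWithoutClasses_spec : ∀ c ∈ hyperWithoutClasses, c.M = 0 ∧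
    (c.d = 1 ∨ (c.d = 2 ∧ c.leaderCheck 1 = true) ∨ (c.d = 4 ∧ c.leaderCheck 2 = true)) := by
  decide +kernel

lemma pointCheck_of_classesCheck {cs : List PointClass} {l₀ l : List (ℕ³ × ℕ)}
    (h : classesCheck cs l₀ l = true) {c : PointClass} (hc : c ∈ cs) : c.pointCheck = true := by
  have h1 := List.all_eq_true.1 h c hc
  rw [Bool.and_eq_true, Bool.and_eq_true] at h1
  exact h1.1.1

lemma card_le_zero_of_forall {α : Type*} {T : Finset α} (h : ∀ p ∈ T, False) : T.card ≤ 0 :=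
  Finset.card_eq_zero.2 (Finset.eq_empty_of_forall_notMem h) |>.le

/-- Without a prime divisor of degree one the degrees three and five may be arbitrary. -/
lemma false_of_hyperelliptic {S : Place F₂ K} (hS : deg₂ S = 2) {u : K}
    (hu : u ∈ L (single S 1)) (hu1 : S.ord u = -1)
    (h35 : ∀ P : Place F₂ K, deg₂ P = 1 → ∀ p : Place F₂ K,
      deg₂ p ≠ 3 ∧ deg₂ p ≠ 5) : False := by
  obtain ⟨v, hv, a, b, hgr, hrel, had, hbd, ha, hb⟩ := exists_hyperelliptic_model hS hu hu1
  have hN := ell_single_le_sum_two hS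
  have hR : ∀ n : ℕ, ∀ f ∈ L (single S (n : ℤ)), ∃ r, f = ev u v r :=
    fun n f hf => hgr.exists_ev hu hv hN hf
  have hdvd := dvd_of_plane_relation le_rfl hgr hrel
  have hlead : ∀ (c : PointClass) (m : ℕ), 2 * m = c.d → m < 5 → c.pointCheck = true →
      c.leaderCheck m = true → ∀ p, p ≠ S → deg₂ p = c.d → ∀ P,
      ¬ c.CentredAt u v P p := fun c m hm hm5 hc hl p hp hd P =>
    PointClass.not_centredAt hc (by omega) hl (exists_aeval_mem hp (by rw [hd, hS]; omega)
      (hgr.exists_aeval hu hv hN hm5))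
  have hone : ∀ l₀ l : List (ℕ³ × ℕ), l₀.map Prod.fst = [(0, 0, 2), (0, 5, 1), (0, 10, 0)] →
      ∀ e ∈ l₀, coeffFn 2 a b e.1 = 1 := by
    intro l₀ l h e he
    have := List.mem_map_of_mem (f := Prod.fst) he
    rw [h] at this
    simp only [List.mem_cons, List.not_mem_nil, or_false] at this
    rcases this with h | h | h <;> rw [h] <;> simp [coeffFn, ha, hb]
  by_cases h1 : ∃ P : Place F₂ K, deg₂ P = 1
  · obtain ⟨P, hP⟩ := h1
    refine absurd (search_append hyperWith_search (hone _ [] rfl)) ?_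
    rw [Bool.not_eq_true]
    refine overfull_eq_false hyperWith_check (S := S) (u := u) (v := v) (by omega) hR
      (fun r hr => ?_) (fun c hc T hT => ?_)
    · rw [polyL_coeffFn_two rfl had hbd]
      exact hdvd r hr
    · have hpc := pointCheck_of_classesCheck hyperWith_check hc
      rcases hyperWithClasses_spec c hc with ⟨hd, hM⟩ | ⟨hM, h⟩
      · rw [hM, Finset.card_le_one]
        intro p hp q hq
        exact eq_of_degree_one ((hT p hp).2.1.trans hd) ((hT q hq).2.1.trans hd)
      · rw [hM]
        refine card_le_zero_of_forall fun p hp => ?_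
        obtain ⟨hpS, hpd, Q, hQ⟩ := hT p hp
        rcases h with h | h | h | h
        · exact (h35 P hP p).1 (hpd.trans h)
        · exact (h35 P hP p).2 (hpd.trans h)
        · exact hlead c 1 (by omega) (by norm_num) hpc h.2 p hpS hpd Q hQ
        · exact hlead c 2 (by omega) (by norm_num) hpc h.2 p hpS hpd Q hQ
  · refine absurd (search_append hyperWithout_search (hone _ [] rfl)) ?_
    rw [Bool.not_eq_true]
    refine overfull_eq_false hyperWithout_check (S := S) (u := u) (v := v) (by omega) hR
      (fun r hr => ?_) (fun c hc T hT => ?_)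
    · rw [polyL_coeffFn_two rfl had hbd]
      exact hdvd r hr
    · have hpc := pointCheck_of_classesCheck hyperWithout_check hc
      obtain ⟨hM, h⟩ := hyperWithoutClasses_spec c hc
      rw [hM]
      refine card_le_zero_of_forall fun p hp => ?_
      obtain ⟨hpS, hpd, Q, hQ⟩ := hT p hp
      rcases h with h | h | h
      · exact h1 ⟨p, hpd.trans h⟩
      · exact hlead c 1 (by omega) (by norm_num) hpc h.2 p hpS hpd Q hQ
      · exact hlead c 2 (by omega) (by norm_num) hpc h.2 p hpS hpd Q hQ

/-- A function field of genus four and class number one is not hyperelliptic. -/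
lemma el_lt_two_of_deg_lt_three {D : Divisor F₂ K} (hD : deg D < 3) : el D < 2 := by
  by_contra hD2
  rcases (show deg D < 2 ∨ deg D = 2 by omega) with h | h
  · exact hD2 (el_le_one_of_deg_lt_two h)
  have hmin : ∀ D : Divisor F₂ K, deg D < ((2 : ℕ) : ℤ) → el D < 2 :=
    fun D hD => el_le_one_of_deg_lt_two hD
  obtain ⟨S, hS, u, hu, hu1⟩ := exists_place_of_pencil (n := 3) (by norm_num) (by norm_num)
    (Or.inl rfl) hmin h (not_lt.1 hD2)
  have htwo : ∀ E : Divisor F₂ K, deg E = 2 → el E = 2 := fun E hE =>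
    (el_congr (hE.trans h.symm)).trans
      (el_eq_two (n := 3) (d := 2) (by norm_num) (by norm_num) hmin h (not_lt.1 hD2))
  refine false_of_hyperelliptic hS hu hu1 fun P hP p => ?_
  have hn : ∀ n : ℤ, deg (single P n : Divisor F₂ K) = n := fun n => by
    rw [deg_single, hP]; simp
  have hone : ∀ E : Divisor F₂ K, deg E = 1 → el E ≤ 1 := fun E hE => el_le_one_of_deg_one hE
  have hadd : ∀ n : ℤ, (single P n : Divisor F₂ K) + single P 1 =
      single P (n + 1) := fun n => (Finsupp.single_add P n 1).symm
  constructor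
  · intro hp
    have hPp : p = P := by
      refine eq_of_base_point (E := single P 2) ?_ ?_
      · rw [hadd, hn, deg_single, hp]; norm_num
      · rw [hadd, htwo _ (hn 2)]
        by_contra! hlt
        obtain ⟨x, hx, hxc⟩ := exists_not_mem_of_two_le_ell (htwo _ (hn 2)).ge
        have h4 := riemann_roch (D := single P 4) (E := single P 2)
          (by rw [hn, hn]; norm_num)
        rw [htwo _ (hn 2), hn] at h4
        have hle : L (single P (2 + 1) : Divisor F₂ K) ≤ L (single P 4) :=
          L_mono (Finsupp.single_mono (by norm_num))
        have hEq := Submodule.eq_of_le_of_finrank_le hle (by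
          rw [el, ell_eq] at hlt h4
          omega)
        have hx2 := pow_mem_L hx 2
        rw [Finsupp.smul_single, show (2 : ℕ) • (2 : ℤ) = 4 from rfl, ← hEq] at hx2
        have hx0 : x ≠ 0 := fun h0 => hxc ⟨0, by rw [h0, map_zero]⟩
        have hx1 : x ∈ L (single P 1 : Divisor F₂ K) := by
          rw [mem_L' hx0] at hx ⊢
          rw [mem_L' (pow_ne_zero 2 hx0)] at hx2
          intro p
          have h1 := hx p
          have h2 := hx2 p
          rw [Finsupp.add_apply, Finsupp.zero_apply, dv_apply] at h1 h2 ⊢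
          rcases eq_or_ne p P with rfl | hp
          · rw [single_eq_same] at h1 h2 ⊢
            rw [Place.ord_pow] at h2
            omega
          · rw [single_eq_of_ne hp] at h1 ⊢
            exact h1
        have hd := deg_poles_pos hxc
        have h1 : deg (poles x) ≤ deg (single P 1 : Divisor F₂ K) :=
          degHom_mono (poles_le (single_nonneg' P zero_le_one) hx1)
        rw [hn] at h1
        omega
    rw [hPp, hP] at hp
    omega
  · intro hp
    have hPp : p = P := by
      refine eq_of_base_point (E := single P 4) ?_ ?_
      · rw [hadd, hn, deg_single, hp]; norm_num
      · rw [hadd]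
        have h4 := riemann_roch (D := single P 4) (E := single P 2)
          (by rw [hn, hn]; norm_num)
        have h5 := riemann_roch (D := single P (4 + 1)) (E := single P 1)
          (by rw [hn, hn]; norm_num)
        have := hone _ (hn 1)
        rw [htwo _ (hn 2), hn] at h4
        rw [hn] at h5
        omega
    rw [hPp, hP] at hp
    omega

end DegreeTwoPencil

section DegreeThreePencil

variable {K : Type*} [Field K] [Algebra F₂ K] [hF : Fact (IsFunctionField F₂ K)]

lemma Place.independent_of_degree_three {S : Place F₂ K} (hS : deg₂ S = 3)
    {z : ResidueField S.1} (hz0 : z ≠ 0) (hz1 : z ≠ 1) (a b c : F₂)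
    (h : residueHom F₂ S a + residueHom F₂ S b * z +
      residueHom F₂ S c * z ^ 2 = 0) : a = 0 ∧ b = 0 ∧ c = 0 := by
  have := S.charTwo_residueField
  have hz := S.residue_pow_eq z
  rw [hS] at hz
  have h2 : (2 : ResidueField S.1) = 0 := CharTwo.two_eq_zero
  have hz1' : z + 1 ≠ 0 := fun h => hz1 (by linear_combination h - h2)
  have hsq : z ^ 2 + z + 1 ≠ 0 := by
    intro h0
    have h3 : z ^ 3 = 1 := by linear_combination (z - 1) * h0
    apply hz1'
    have h8 : z ^ 8 = z ^ 2 := by linear_combination (z ^ 5 + z ^ 2) * h3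
    linear_combination (z + 1) * (h0 + h8 - hz - z * h2)
  rcases zmod_two_cases a with rfl | rfl <;> rcases zmod_two_cases b with rfl | rfl <;>
    rcases zmod_two_cases c with rfl | rfl <;>
    simp only [map_zero, map_one, zero_mul, one_mul, add_zero, zero_add] at h
  · exact ⟨rfl, rfl, rfl⟩
  · exact absurd (pow_eq_zero_iff two_ne_zero |>.1 h) hz0
  · exact absurd h hz0
  · have : z * (z + 1) = 0 := by linear_combination h
    exact absurd this (mul_ne_zero hz0 hz1')
  · exact absurd h one_ne_zero
  · have : (z + 1) ^ 2 = 0 := by linear_combination h + z * h2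
    exact absurd this (pow_ne_zero 2 hz1')
  · exact absurd (by linear_combination h) hz1'
  · exact absurd (by linear_combination h) hsq

variable [hC : Fact (HasExactConstants F₂ K)] [hG : Fact (GenusFourClassOne K)]

lemma deg_sub (D E : Divisor F₂ K) : deg (D - E) = deg D - deg E := map_sub _ _ _

lemma deg_add (D E : Divisor F₂ K) : deg (D + E) = deg D + deg E := map_add _ _ _

lemma deg_nsmul (n : ℕ) (D : Divisor F₂ K) : deg (n • D) = n • deg D := map_nsmul _ _ _

lemma isGraded_three {S : Place F₂ K} (hS : deg₂ S = 3) {u v : K}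
    (hu1 : S.ord u = -1) (hv : v ∈ S.V (-((2 : ℕ) : ℤ)))
    (hvc : ∀ c : F₂, v * u⁻¹ ^ 2 - algebraMap F₂ K c ∉ S.V 1) :
    IsGraded (F := F₂) S u (fun i : Fin 3 => v ^ (i : ℕ)) (fun i => 2 * i) := by
  obtain ⟨hz0, hz1⟩ := Place.res_ne_zero_one (S.mul_inv_pow_mem hu1 hv) hvc
  refine isGraded_pow hu1 hv (fun c hc => ?_)
  rw [Fin.sum_univ_three, Fin.val_zero, Fin.val_one, Fin.val_two, pow_zero, pow_one, mul_one] at hc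
  obtain ⟨h0, h1, h2⟩ := Place.independent_of_degree_three hS hz0 hz1 _ _ _ hc
  funext i
  fin_cases i
  · exact h0
  · exact h1
  · exact h2

lemma ell_single_le_sum_three {S : Place F₂ K} (hS : deg₂ S = 3) (n : ℕ)
    (hn : 3 ≤ n) : ell F₂ (single S (n : ℤ) : Divisor F₂ K) ≤
      ∑ i : Fin 3, (n + 1 - 2 * (i : ℕ)) := by
  have := ell_single_eq (S := S) (n := n) (by rw [hS]; omega)
  rw [hS] at this
  rw [Fin.sum_univ_three]
  simp only [Fin.val_zero, Fin.val_one, Fin.val_two]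
  omega

lemma aeval_mem_L_single {S : Place F₂ K} {u : K} (hu : u ∈ L (single S 1))
    {r : F₂[X]} {m : ℕ} (hr : r.natDegree ≤ m) :
    aeval u r ∈ L (single S (m : ℤ) : Divisor F₂ K) := by
  rw [aeval_eq_sum_range]
  refine Submodule.sum_mem _ fun i hi => Submodule.smul_mem _ _ ?_
  have h1 := pow_mem_L_single (S := S) (k := 1) (v := u) (by simpa using hu) (j := i)
  rw [one_mul] at h1
  refine L_mono (Finsupp.single_mono ?_) h1
  have := Finset.mem_range.1 hi
  omega

/-- The trigonal model at a prime divisor of degree three which moves in a pencil. -/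
lemma exists_trigonal_model {S : Place F₂ K} (hS : deg₂ S = 3) {u : K}
    (hu : u ∈ L (single S 1)) (hu1 : S.ord u = -1)
    (h3 : el (single S 1 : Divisor F₂ K) = 2) :
    ∃ v ∈ L (single S ((2 : ℕ) : ℤ)), ∃ a b : F₂[X],
      IsGraded (F := F₂) S u (fun i : Fin 3 => v ^ (i : ℕ)) (fun i => 2 * i) ∧
      v ^ 3 + aeval u a * v + aeval u b = 0 ∧ a.natDegree ≤ 4 ∧ b.natDegree ≤ 6 ∧
      a.coeff 4 = 1 ∧ b.coeff 6 = 1 := by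
  obtain ⟨w, hw, hwc⟩ := exists_nonconstant_leading hu hu1 (k := 2) (by
    have h6 := el_of_deg_eq_six (K := K) (D := single S 2) (by rw [deg_single, hS]; norm_num)
    rw [show ((2 : ℕ) : ℤ) - 1 = 1 from rfl, h3]
    change 2 + 1 < el (single S 2 : Divisor F₂ K)
    omega)
  have hwV := mem_V_of_mem_L hw
  obtain ⟨r, hr, hrd⟩ := (isGraded_three hS hu1 hwV hwc).exists_relation hu hw
    (ell_single_le_sum_three hS)
  have hd : ∀ i, (r i).natDegree ≤ 6 - 2 * i := by
    intro i
    by_cases h : r i = 0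
    · rw [h]; simp
    · have := hrd i h
      omega
  have hd0 : (r 0).natDegree ≤ 6 := hd 0
  have hd1 : (r 1).natDegree ≤ 4 := hd 1
  have hd2 : (r 2).natDegree ≤ 2 := hd 2
  rw [Fin.sum_univ_three] at hr
  simp only [Fin.val_zero, Fin.val_one, Fin.val_two, pow_zero, pow_one, mul_one] at hr
  have h2K : (2 : K) = 0 := two_eq_zero K
  set v := w + aeval u (r 2) with hvdef
  have hv : v ∈ L (single S ((2 : ℕ) : ℤ)) :=
    Submodule.add_mem _ hw (aeval_mem_L_single hu hd2)
  have hvV := mem_V_of_mem_L hv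
  have hwm := S.mul_inv_pow_mem hu1 hwV
  have hvm := S.mul_inv_pow_mem hu1 hvV
  obtain ⟨hm2, he2⟩ := S.res_aeval hu1 hd2
  have hvc : ∀ c : F₂, v * u⁻¹ ^ 2 - algebraMap F₂ K c ∉ S.V 1 := by
    intro c hc
    rw [← S.res_eq_iff hvm (S.2.2 c), S.res_const, hvdef, add_mul, S.res_add hwm hm2, he2,
      ← S.residueHom_coeff] at hc
    refine Place.res_ne_residueHom hwm hwc (c - (r 2).coeff 2) ?_
    rw [map_sub]
    linear_combination hc
  have hda : ((r 2) ^ 2 + r 1).natDegree ≤ 4 := by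
    refine natDegree_add_le_of_degree_le ?_ hd1
    exact natDegree_pow_le.trans (by omega)
  have hdb : (r 1 * r 2 + r 0).natDegree ≤ 6 := by
    refine natDegree_add_le_of_degree_le ?_ hd0
    exact natDegree_mul_le.trans (by omega)
  have hrel : v ^ 3 + aeval u ((r 2) ^ 2 + r 1) * v + aeval u (r 1 * r 2 + r 0) = 0 := by
    rw [map_add, map_add, map_mul, map_pow, hvdef]
    generalize aeval u (r 2) = R at *
    generalize aeval u (r 1) = Q at *
    generalize aeval u (r 0) = T at *
    linear_combination hr + (2 * R * w ^ 2 + 2 * R ^ 2 * w + R ^ 3 + Q * w + R * Q + T) * h2K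
  obtain ⟨hma, hea⟩ := S.res_aeval hu1 hda
  obtain ⟨hmb, heb⟩ := S.res_aeval hu1 hdb
  obtain ⟨hz0, hz1⟩ := Place.res_ne_zero_one hvm hvc
  have hkey : S.res (v * u⁻¹ ^ 2) ^ 3 +
      residueHom F₂ S (((r 2) ^ 2 + r 1).coeff 4) * S.res (v * u⁻¹ ^ 2) +
      residueHom F₂ S ((r 1 * r 2 + r 0).coeff 6) = 0 := by
    rw [S.residueHom_coeff, S.residueHom_coeff, ← hea, ← heb, ← S.res_mul hma hvm,
      ← S.res_pow hvm, ← S.res_add (pow_mem hvm 3) (mul_mem hma hvm),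
      ← S.res_add (add_mem (pow_mem hvm 3) (mul_mem hma hvm)) hmb, ← map_zero (residueHom _ S),
      ← S.res_const, map_zero]
    congr 1
    linear_combination u⁻¹ ^ 6 * hrel
  have hind := Place.independent_of_degree_three hS hz0 hz1
  have := S.charTwo_residueField
  have h2 : (2 : ResidueField S.1) = 0 := CharTwo.two_eq_zero
  set z := S.res (v * u⁻¹ ^ 2)
  have hz1' : z + 1 ≠ 0 := fun h => hz1 (by linear_combination h - h2)
  have hsq : z ^ 2 + z + 1 ≠ 0 := by
    intro h
    have := (hind 1 1 1 (by rw [map_one]; linear_combination h)).1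
    exact absurd this (by decide)
  refine ⟨v, hv, _, _, isGraded_three hS hu1 hvV hvc, hrel, hda, hdb, ?_⟩
  generalize ((r 2) ^ 2 + r 1).coeff 4 = α at *
  generalize (r 1 * r 2 + r 0).coeff 6 = β at *
  rcases zmod_two_cases α with rfl | rfl <;> rcases zmod_two_cases β with rfl | rfl <;>
    simp only [map_zero, map_one, zero_mul, one_mul, add_zero] at hkey
  · exact absurd (pow_eq_zero_iff three_ne_zero |>.1 hkey) hz0
  · have : (z + 1) * (z ^ 2 + z + 1) = 0 := by linear_combination hkey + (z ^ 2 + z) * h2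
    exact absurd this (mul_ne_zero hz1' hsq)
  · have : z * (z + 1) ^ 2 = 0 := by linear_combination hkey + z ^ 2 * h2
    exact absurd this (mul_ne_zero hz0 (pow_ne_zero 2 hz1'))
  · exact ⟨rfl, rfl⟩

lemma trigonalWithClasses_spec : ∀ c ∈ trigonalWithClasses, (c.d = 1 ∧ c.M = 1) ∨ c.M = 0 ∧
    (c.d = 2 ∨ c.d = 4 ∨ (c.d = 3 ∧ c.leaderCheck 1 = true)) := by
  decide +kernel

lemma trigonalWithoutClasses_spec : ∀ c ∈ trigonalWithoutClasses, (c.d = 1 ∧ c.M = 0) ∨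
    (c.d = 2 ∧ c.M = 1) ∨ (c.d = 4 ∧ c.M = 2) ∨ (c.M = 0 ∧ c.d = 3 ∧ c.leaderCheck 1 = true) := by
  decide +kernel

lemma card_places_le_two_of_degree_four (hmin : ∀ D : Divisor F₂ K, deg D = 2 → el D ≤ 1)
    (T : Finset (Place F₂ K)) (hT : ∀ p ∈ T, deg₂ p = 4) : T.card ≤ 2 := by
  have hdeg : ∀ p ∈ T, deg (single p 1 : Divisor F₂ K) = 4 := fun p hp => by
    rw [deg_single, hT p hp]; norm_num
  obtain ⟨W, hW⟩ := exists_deg_six (K := K)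
  have hrr : ∀ p ∈ T, (el (single p 1 : Divisor F₂ K) : ℤ) =
      1 + el (W - single p 1) ∧ deg (W - single p 1) = 2 := by
    intro p hp
    have h2 : deg (W - single p 1) = 2 := by rw [deg_sub, hW, hdeg p hp]; norm_num
    refine ⟨?_, h2⟩
    rw [riemann_roch (D := single p 1) (E := W - single p 1)
      (by rw [h2, hdeg p hp]; norm_num), hdeg p hp]
    norm_num
  by_cases hE : ∃ E : Divisor F₂ K, 0 ≤ E ∧ deg E = 2
  · obtain ⟨E, hE0, hE2⟩ := hE
    rcases T.eq_empty_or_nonempty with rfl | ⟨p, hp⟩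
    · simp
    have hel : el (single p 1 : Divisor F₂ K) ≤ 2 := by
      obtain ⟨h1, h2⟩ := hrr p hp
      have := hmin _ h2
      omega
    have h2E : ∀ q : Place F₂ K, single q 1 ≠ (2 : ℕ) • E := by
      intro q hq
      have := DFunLike.congr_fun hq q
      rw [single_eq_same, Finsupp.smul_apply, nsmul_eq_mul] at this
      push_cast at this
      omega
    have hcard := card_effective_le_three hel
      (s := insert ((2 : ℕ) • E) (T.image fun q => (single q 1 : Divisor F₂ K))) (by
        intro A hA
        rcases Finset.mem_insert.1 hA with rfl | hA
        · refine ⟨nsmul_nonneg hE0 2, ?_⟩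
          rw [deg_nsmul, hE2, hdeg p hp]; rfl
        · obtain ⟨q, hq, rfl⟩ := Finset.mem_image.1 hA
          exact ⟨single_nonneg' q zero_le_one, by rw [hdeg q hq, hdeg p hp]⟩)
    rw [Finset.card_insert_of_notMem (by
      intro hmem
      obtain ⟨q, -, hq⟩ := Finset.mem_image.1 hmem
      exact h2E q hq), Finset.card_image_of_injective _ (Finsupp.single_left_injective one_ne_zero)]
      at hcard
    omega
  · have : T.card ≤ 1 := by
      rw [Finset.card_le_one]
      intro p hp q hq
      refine eq_of_el_le_one_of_place ((hT p hp).trans (hT q hq).symm) ?_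
      obtain ⟨h1, h2⟩ := hrr q hq
      have : el (W - single q 1) = 0 := by
        by_contra h0
        obtain ⟨E, hE0, hE2⟩ := exists_effective (Nat.pos_of_ne_zero h0)
        exact hE ⟨E, hE0, hE2.trans h2⟩
      omega
    omega

/-- A function field of genus four and class number one is not trigonal over its constants. -/
lemma el_lt_two_of_deg_lt_four {D : Divisor F₂ K} (hD : deg D < 4) : el D < 2 := by
  by_contra hD2
  rcases (show deg D < 3 ∨ deg D = 3 by omega) with h | h
  · exact hD2 (el_lt_two_of_deg_lt_three h)
  have hmin : ∀ D : Divisor F₂ K, deg D < ((3 : ℕ) : ℤ) → el D < 2 :=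
    fun D hD => el_lt_two_of_deg_lt_three hD
  obtain ⟨S, hS, u, hu, hu1⟩ := exists_place_of_pencil (n := 2) (by norm_num) le_rfl
    (Or.inr rfl) hmin h (not_lt.1 hD2)
  have hthree : ∀ E : Divisor F₂ K, deg E = 3 → el E = 2 := fun E hE =>
    (el_congr (hE.trans h.symm)).trans
      (el_eq_two (n := 2) (d := 3) (by norm_num) le_rfl hmin h (not_lt.1 hD2))
  have htwo : ∀ E : Divisor F₂ K, deg E = 2 → el E ≤ 1 := fun E hE => by
    have := el_lt_two_of_deg_lt_three (D := E) (by omega)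
    omega
  obtain ⟨v, hv, a, b, hgr, hrel, had, hbd, ha, hb⟩ := exists_trigonal_model hS hu hu1
    (hthree _ (by rw [deg_single, hS]; norm_num))
  have hN := ell_single_le_sum_three hS
  have hR : ∀ n : ℕ, ∀ f ∈ L (single S (n : ℤ)), ∃ r, f = ev u v r :=
    fun n f hf => hgr.exists_ev hu hv hN hf
  have hdvd := dvd_of_plane_relation (by norm_num) hgr hrel
  have hlead : ∀ c : PointClass, c.d = 3 → c.pointCheck = true →
      c.leaderCheck 1 = true → ∀ p, p ≠ S → deg₂ p = c.d → ∀ P,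
      ¬ c.CentredAt u v P p := fun c hc3 hc hl p hp hd P =>
    PointClass.not_centredAt hc (by omega) hl (exists_aeval_mem hp (by rw [hd, hS]; omega)
      (hgr.exists_aeval hu hv hN (by norm_num)))
  have hone : ∀ l₀ l : List (ℕ³ × ℕ), l₀.map Prod.fst = [(0, 0, 3), (0, 4, 1), (0, 6, 0)] →
      ∀ e ∈ l₀, coeffFn 3 a b e.1 = 1 := by
    intro l₀ l h e he
    have := List.mem_map_of_mem (f := Prod.fst) he
    rw [h] at this
    simp only [List.mem_cons, List.not_mem_nil, or_false] at this
    rcases this with h | h | h <;> rw [h] <;> simp [coeffFn, ha, hb]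
  by_cases h1 : ∃ P : Place F₂ K, deg₂ P = 1
  · obtain ⟨P, hP⟩ := h1
    have hn : ∀ n : ℤ, deg (single P n : Divisor F₂ K) = n := fun n => by
      rw [deg_single, hP]; simp
    refine absurd (search_append trigonalWith_search (hone _ [] rfl)) ?_
    rw [Bool.not_eq_true]
    refine overfull_eq_false trigonalWith_check (S := S) (u := u) (v := v) (by omega) hR
      (fun r hr => ?_) (fun c hc T hT => ?_)
    · rw [polyL_coeffFn_three rfl had hbd]
      exact hdvd r hr
    · have hpc := pointCheck_of_classesCheck trigonalWith_check hc
      rcases trigonalWithClasses_spec c hc with ⟨hd, hM⟩ | ⟨hM, h⟩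
      · rw [hM, Finset.card_le_one]
        intro p hp q hq
        exact eq_of_degree_one ((hT p hp).2.1.trans hd) ((hT q hq).2.1.trans hd)
      · rw [hM]
        refine card_le_zero_of_forall fun p hp => ?_
        obtain ⟨hpS, hpd, Q, hQ⟩ := hT p hp
        rcases h with h | h | h
        · have hpP := eq_of_el_eq_one (single_nonneg' p zero_le_one)
            (single_nonneg' P (by norm_num : (0 : ℤ) ≤ 2))
            (by rw [deg_single, hn, hpd, h]; norm_num) (htwo _ (hn 2))
          have := DFunLike.congr_fun hpP p
          rw [single_eq_same] at this
          rcases eq_or_ne p P with rfl | hne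
          · rw [single_eq_same] at this
            omega
          · rw [single_eq_of_ne hne] at this
            omega
        · have hpP : p = P := by
            refine eq_of_base_point (E := single P 3) ?_ ?_
            · rw [← Finsupp.single_add, hn, deg_single, hpd, h]; norm_num
            · rw [← Finsupp.single_add, hthree _ (hn 3)]
              have h4 := riemann_roch (D := single P (3 + 1)) (E := single P 2)
                (by rw [hn, hn]; norm_num)
              have := htwo _ (hn 2)
              rw [hn] at h4
              omega
          rw [hpP, hP] at hpd
          omega
        · exact hlead c h.1 hpc h.2 p hpS hpd Q hQ
  · refine absurd (search_append trigonalWithout_search (hone _ [] rfl)) ?_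
    rw [Bool.not_eq_true]
    refine overfull_eq_false trigonalWithout_check (S := S) (u := u) (v := v) (by omega) hR
      (fun r hr => ?_) (fun c hc T hT => ?_)
    · rw [polyL_coeffFn_three rfl had hbd]
      exact hdvd r hr
    · have hpc := pointCheck_of_classesCheck trigonalWithout_check hc
      rcases trigonalWithoutClasses_spec c hc with ⟨hd, hM⟩ | ⟨hd, hM⟩ | ⟨hd, hM⟩ | ⟨hM, h3, hl⟩
      · rw [hM]
        exact card_le_zero_of_forall fun p hp => h1 ⟨p, (hT p hp).2.1.trans hd⟩
      · rw [hM, Finset.card_le_one]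
        intro p hp q hq
        have hpd := (hT p hp).2.1.trans hd
        have hqd := (hT q hq).2.1.trans hd
        exact eq_of_el_le_one_of_place (hpd.trans hqd.symm)
          (htwo _ (by rw [deg_single, hqd]; norm_num))
      · rw [hM]
        exact card_places_le_two_of_degree_four htwo T fun p hp => (hT p hp).2.1.trans hd
      · rw [hM]
        refine card_le_zero_of_forall fun p hp => ?_
        obtain ⟨hpS, hpd, Q, hQ⟩ := hT p hp
        exact hlead c h3 hpc hl p hpS hpd Q hQ

end DegreeThreePencil

section CanonicalQuadric

variable {K : Type*} [Field K] [Algebra F₂ K] [hF : Fact (IsFunctionField F₂ K)]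
  [hC : Fact (HasExactConstants F₂ K)]

lemma eq_of_dv_eq {f g : K} (hf : f ≠ 0) (hg : g ≠ 0)
    (h : (dv f : Divisor F₂ K) = dv g) : f = g := by
  have h1 : ∀ p : Place F₂ K, 0 ≤ p.ord (f / g) := fun p => by
    have := DFunLike.congr_fun h p
    rw [dv_apply, dv_apply] at this
    rw [Place.ord_div _ hf hg, this, sub_self]
  obtain ⟨c, hc⟩ := mem_const_of_ord_nonneg h1
  rcases zmod_two_cases c with rfl | rfl
  · rw [map_zero] at hc
    exact absurd hc.symm (div_ne_zero hf hg)
  · rw [map_one] at hc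
    exact ((div_eq_one_iff_eq hg).1 hc.symm)

lemma eq_zero_of_norm_eq_zero {f g : K} (h : f ^ 2 + f * g + g ^ 2 = 0) : f = 0 ∧ g = 0 := by
  by_cases hg : g = 0
  · subst hg
    simpa using h
  · exfalso
    have h1 : (f / g) ^ 2 + f / g + 1 = 0 := by
      have h2 : (f / g) ^ 2 + f / g + 1 = (f ^ 2 + f * g + g ^ 2) / g ^ 2 := by field_simp
      rw [h2, h, zero_div]
    obtain ⟨c, hc⟩ := hC.out (f / g) ⟨X ^ 2 + X + 1, by
      intro h0
      have := congrArg (fun q => coeff q 2) h0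
      simp [coeff_X, coeff_one] at this, by simpa using h1⟩
    rcases zmod_two_cases c with rfl | rfl
    · rw [← hc] at h1
      simp at h1
    · rw [← hc] at h1
      have := two_eq_zero K
      simp only [map_one] at h1
      exact one_ne_zero (α := K) (by linear_combination h1 - this)

variable [hG : Fact (GenusFourClassOne K)]

lemma eq_of_deg_lt_four {D E : Divisor F₂ K} (hD : 0 ≤ D) (hE : 0 ≤ E) (h : deg D = deg E)
    (h4 : deg E < 4) : D = E :=
  eq_of_el_eq_one hD hE h (by have := el_lt_two_of_deg_lt_four h4; omega)

lemma eq_or_eq_of_mul_eq_mul {W : Divisor F₂ K} (hW : deg W = 6) {a b c d : K}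
    (ha : a ∈ L W) (hb : b ∈ L W) (hc : c ∈ L W) (hd : d ∈ L W) (ha0 : a ≠ 0) (hb0 : b ≠ 0)
    (hc0 : c ≠ 0) (hd0 : d ≠ 0) (h : a * b = c * d) : a = c ∨ a = d := by
  rw [mem_L' ha0] at ha
  rw [mem_L' hb0] at hb
  rw [mem_L' hc0] at hc
  rw [mem_L' hd0] at hd
  have hdeg : ∀ f : K, deg (W + dv f) = 6 := fun f => by
    rw [deg_add, show deg (dv f : Divisor F₂ K) = 0 from degHom_dv f, hW, add_zero]
  have hsum : (W + dv a) + (W + dv b) = (W + dv c) + (W + dv d) := by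
    have := dv_mul (F := F₂) ha0 hb0
    rw [h, dv_mul hc0 hd0] at this
    calc (W + dv a) + (W + dv b) = W + W + (dv a + dv b) := by abel
      _ = W + W + (dv c + dv d) := by rw [this]
      _ = _ := by abel
  have hA := hdeg a
  have hB := hdeg b
  have hC' := hdeg c
  have hD := hdeg d
  have key : W + dv a = W + dv c ∨ W + dv a = W + dv d := by
    generalize W + (dv a : Divisor F₂ K) = A at *
    generalize W + (dv b : Divisor F₂ K) = B at *
    generalize W + (dv c : Divisor F₂ K) = C at *
    generalize W + (dv d : Divisor F₂ K) = D at *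
    have hp : ∀ p, A p + B p = C p + D p := fun p => DFunLike.congr_fun hsum p
    have hA1 : (0 : Divisor F₂ K) ≤ A - A ⊓ C := sub_nonneg.2 inf_le_left
    have hC1 : (0 : Divisor F₂ K) ≤ C - A ⊓ C := sub_nonneg.2 inf_le_right
    have hG0 : (0 : Divisor F₂ K) ≤ A ⊓ C := le_inf ha hc
    have hH : (0 : Divisor F₂ K) ≤ D - (A - A ⊓ C) := by
      intro p
      have h1 := hp p
      have h2 := hb p
      have h3 := hd p
      simp only [Finsupp.coe_sub, Finsupp.coe_zero, Pi.zero_apply, Pi.sub_apply, Finsupp.inf_apply]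
        at *
      omega
    have e1 := deg_sub A (A ⊓ C)
    have e2 := deg_sub C (A ⊓ C)
    have e3 := deg_sub D (A - A ⊓ C)
    by_cases hlt : deg (A ⊓ C) < 3
    · right
      have := eq_of_deg_lt_four hH hG0 (by omega) (by omega)
      rw [sub_eq_iff_eq_add] at this
      rw [this]
      abel
    · left
      have := eq_of_deg_lt_four hA1 hC1 (by omega) (by omega)
      exact sub_left_injective this
  exact key.imp (fun h => eq_of_dv_eq ha0 hc0 (add_left_cancel h))
    (fun h => eq_of_dv_eq ha0 hd0 (add_left_cancel h))

/-- Independence over `𝔽₂` of four functions. -/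
def Indep (x y z w : K) : Prop :=
  ∀ a b c d : F₂, algebraMap _ K a * x + algebraMap _ K b * y + algebraMap _ K c * z +
    algebraMap _ K d * w = 0 → a = 0 ∧ b = 0 ∧ c = 0 ∧ d = 0

lemma exists_quadric_relation {W : Divisor F₂ K} (hW : deg W = 6) :
    ∃ x ∈ L W, ∃ y ∈ L W, ∃ z ∈ L W, ∃ w ∈ L W, Indep x y z w ∧ ∃ g : Fin 10 → F₂,
      (∃ i, g i ≠ 0) ∧ algebraMap _ K (g 0) * x ^ 2 + algebraMap _ K (g 1) * y ^ 2 +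
        algebraMap _ K (g 2) * z ^ 2 + algebraMap _ K (g 3) * w ^ 2 +
        algebraMap _ K (g 4) * (x * y) + algebraMap _ K (g 5) * (x * z) +
        algebraMap _ K (g 6) * (x * w) + algebraMap _ K (g 7) * (y * z) +
        algebraMap _ K (g 8) * (y * w) + algebraMap _ K (g 9) * (z * w) = 0 := by
  have h4 : finrank F₂ (L W) = 4 := by
    rw [← el_of_deg_eq_six hW]
    exact (ell_eq W).symm
  let B := Module.finBasisOfFinrankEq F₂ (L W) h4
  have h9 : finrank F₂ (L (W + W)) = 9 := by
    have := el_of_seven_le (K := K) (D := W + W) (by rw [deg_add, hW]; norm_num)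
    rw [deg_add, hW] at this
    have h := ell_eq (W + W)
    simp only [el] at this
    omega
  have hm : ∀ i j, (B i : K) * B j ∈ L (W + W) := fun i j => mul_mem_L (B i).2 (B j).2
  let v : Fin 10 → L (W + W) := ![⟨_, hm 0 0⟩, ⟨_, hm 1 1⟩, ⟨_, hm 2 2⟩, ⟨_, hm 3 3⟩, ⟨_, hm 0 1⟩,
    ⟨_, hm 0 2⟩, ⟨_, hm 0 3⟩, ⟨_, hm 1 2⟩, ⟨_, hm 1 3⟩, ⟨_, hm 2 3⟩]
  have hv : ¬ LinearIndependent F₂ v := fun h => by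
    have := h.fintype_card_le_finrank
    rw [h9] at this
    simp at this
  obtain ⟨g, hg, hi⟩ := Fintype.not_linearIndependent_iff.1 hv
  refine ⟨B 0, (B 0).2, B 1, (B 1).2, B 2, (B 2).2, B 3, (B 3).2, ?_, g, hi, ?_⟩
  · intro a b c d h
    have := Fintype.linearIndependent_iff.1 B.linearIndependent ![a, b, c, d] (by
      apply Subtype.ext
      simpa [Fin.sum_univ_four, Algebra.smul_def] using h)
    exact ⟨this 0, this 1, this 2, this 3⟩
  · have := congrArg (Subtype.val) hg
    simp only [Fin.sum_univ_succ, v] at this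
    simp [Algebra.smul_def] at this
    linear_combination this

end CanonicalQuadric

section QuadricNormalForm

variable {K : Type*} [Field K] [Algebra F₂ K]

lemma Indep.eq_zero {x y z w : K} (hI : Indep x y z w) (a b c d : F₂)
    (h : algebraMap _ K a * x + algebraMap _ K b * y + algebraMap _ K c * z +
      algebraMap _ K d * w = 0) (h0 : a ≠ 0 ∨ b ≠ 0 ∨ c ≠ 0 ∨ d ≠ 0) : False := by
  obtain ⟨h1, h2, h3, h4⟩ := hI a b c d h
  simp [h1, h2, h3, h4] at h0

lemma Indep.map {x y z w x' y' z' w' : K} (hI : Indep x y z w)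
    (φ : F₂ → F₂ → F₂ → F₂ → F₂ × F₂ × F₂ × F₂)
    (hφ : ∀ a b c d, φ a b c d = 0 → a = 0 ∧ b = 0 ∧ c = 0 ∧ d = 0)
    (h : ∀ a b c d : F₂, algebraMap _ K a * x' + algebraMap _ K b * y' + algebraMap _ K c * z' +
      algebraMap _ K d * w' = algebraMap _ K (φ a b c d).1 * x + algebraMap _ K (φ a b c d).2.1 * y +
      algebraMap _ K (φ a b c d).2.2.1 * z + algebraMap _ K (φ a b c d).2.2.2 * w) :
    Indep x' y' z' w' := fun a b c d h0 => by
  rw [h] at h0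
  obtain ⟨h1, h2, h3, h4⟩ := hI _ _ _ _ h0
  exact hφ a b c d (Prod.ext h1 (Prod.ext h2 (Prod.ext h3 h4)))

lemma algebraMap_sq (c : F₂) : algebraMap F₂ K c ^ 2 = algebraMap F₂ K c := by
  rcases zmod_two_cases c with rfl | rfl <;> simp

/-- A quadratic relation with a hyperbolic or anisotropic plane split off. -/
def SplitRelation (x y z w : K) (a b c d e : F₂) : Prop :=
  x * y + algebraMap _ K a * x ^ 2 + algebraMap _ K b * y ^ 2 + algebraMap _ K c * z ^ 2 +
    algebraMap _ K d * (z * w) + algebraMap _ K e * w ^ 2 = 0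

lemma exists_splitRelation_of_cross {V : Submodule F₂ K} {x y z w : K} (hx : x ∈ V)
    (hy : y ∈ V) (hz : z ∈ V) (hw : w ∈ V) (hI : Indep x y z w)
    {a₀ a₁ a₂ a₃ b b₁ b₂ b₃ b₄ b₅ : F₂} (hb : b = 1)
    (h : algebraMap _ K a₀ * x ^ 2 + algebraMap _ K a₁ * y ^ 2 +
        algebraMap _ K a₂ * z ^ 2 + algebraMap _ K a₃ * w ^ 2 +
        algebraMap _ K b * (x * y) + algebraMap _ K b₁ * (x * z) +
        algebraMap _ K b₂ * (x * w) + algebraMap _ K b₃ * (y * z) +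
        algebraMap _ K b₄ * (y * w) + algebraMap _ K b₅ * (z * w) = 0) :
    ∃ x ∈ V, ∃ y ∈ V, ∃ z ∈ V, ∃ w ∈ V, Indep x y z w ∧ ∃ a b c d e, SplitRelation x y z w a b c d e := by
  subst hb
  have hs : ∀ (c : F₂) {f : K}, f ∈ V → algebraMap _ K c * f ∈ V := fun c f hf => by
    rw [← Algebra.smul_def]
    exact V.smul_mem c hf
  refine ⟨x + algebraMap _ K b₃ * z + algebraMap _ K b₄ * w,
    V.add_mem (V.add_mem hx (hs _ hz)) (hs _ hw), y + algebraMap _ K b₁ * z + algebraMap _ K b₂ * w,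
    V.add_mem (V.add_mem hy (hs _ hz)) (hs _ hw), z, hz, w, hw, ?_, a₀, a₁,
    a₂ + a₀ * b₃ ^ 2 + a₁ * b₁ ^ 2 + b₃ * b₁, b₅ + b₃ * b₂ + b₄ * b₁,
    a₃ + a₀ * b₄ ^ 2 + a₁ * b₂ ^ 2 + b₄ * b₂, ?_⟩
  · refine hI.map (fun a b c d => (a, b, c + a * b₃ + b * b₁, d + a * b₄ + b * b₂)) ?_ ?_
    · intro a b c d h
      simp only [Prod.mk_eq_zero] at h
      obtain ⟨rfl, rfl, h3, h4⟩ := h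
      exact ⟨rfl, rfl, by simpa using h3, by simpa using h4⟩
    · intro a b c d
      simp only [map_add, map_mul]
      ring
  · have h2 := two_eq_zero K
    simp only [SplitRelation, map_add, map_mul, map_pow]
    rw [map_one] at h
    generalize algebraMap F₂ K a₀ = a₀ at *
    generalize algebraMap F₂ K a₁ = a₁ at *
    generalize algebraMap F₂ K a₂ = a₂ at *
    generalize algebraMap F₂ K a₃ = a₃ at *
    generalize algebraMap F₂ K b₁ = b₁ at *
    generalize algebraMap F₂ K b₂ = b₂ at *
    generalize algebraMap F₂ K b₃ = b₃ at *
    generalize algebraMap F₂ K b₄ = b₄ at *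
    linear_combination h + ((b₃ * z + b₄ * w) * (b₁ * z + b₂ * w) +
      a₀ * (x * (b₃ * z + b₄ * w) + b₃ ^ 2 * z ^ 2 + b₄ ^ 2 * w ^ 2 + b₃ * b₄ * z * w) +
      a₁ * (y * (b₁ * z + b₂ * w) + b₁ ^ 2 * z ^ 2 + b₂ ^ 2 * w ^ 2 + b₁ * b₂ * z * w)) * h2

lemma exists_splitRelation {V : Submodule F₂ K} {x y z w : K} (hx : x ∈ V)
    (hy : y ∈ V) (hz : z ∈ V) (hw : w ∈ V) (hI : Indep x y z w) (g : Fin 10 → F₂)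
    (hg : ∃ i, g i ≠ 0) (h : algebraMap _ K (g 0) * x ^ 2 + algebraMap _ K (g 1) * y ^ 2 +
        algebraMap _ K (g 2) * z ^ 2 + algebraMap _ K (g 3) * w ^ 2 +
        algebraMap _ K (g 4) * (x * y) + algebraMap _ K (g 5) * (x * z) +
        algebraMap _ K (g 6) * (x * w) + algebraMap _ K (g 7) * (y * z) +
        algebraMap _ K (g 8) * (y * w) + algebraMap _ K (g 9) * (z * w) = 0) :
    ∃ x ∈ V, ∃ y ∈ V, ∃ z ∈ V, ∃ w ∈ V, Indep x y z w ∧ ∃ a b c d e, SplitRelation x y z w a b c d e := by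
  rcases zmod_two_cases (g 4) with h4 | h4
  swap
  · exact exists_splitRelation_of_cross hx hy hz hw hI h4 h
  rcases zmod_two_cases (g 5) with h5 | h5
  swap
  · exact exists_splitRelation_of_cross hx hz hy hw
      (fun a b c d h => by have := hI a c b d (by linear_combination h); tauto) h5
      (a₀ := g 0) (a₁ := g 2) (a₂ := g 1) (a₃ := g 3) (b₁ := g 4) (b₂ := g 6) (b₃ := g 7)
      (b₄ := g 9) (b₅ := g 8) (by linear_combination h)
  rcases zmod_two_cases (g 6) with h6 | h6
  swap
  · exact exists_splitRelation_of_cross hx hw hy hz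
      (fun a b c d h => by have := hI a c d b (by linear_combination h); tauto) h6
      (a₀ := g 0) (a₁ := g 3) (a₂ := g 1) (a₃ := g 2) (b₁ := g 4) (b₂ := g 5) (b₃ := g 8)
      (b₄ := g 9) (b₅ := g 7) (by linear_combination h)
  rcases zmod_two_cases (g 7) with h7 | h7
  swap
  · exact exists_splitRelation_of_cross hy hz hx hw
      (fun a b c d h => by have := hI c a b d (by linear_combination h); tauto) h7
      (a₀ := g 1) (a₁ := g 2) (a₂ := g 0) (a₃ := g 3) (b₁ := g 4) (b₂ := g 8) (b₃ := g 5)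
      (b₄ := g 9) (b₅ := g 6) (by linear_combination h)
  rcases zmod_two_cases (g 8) with h8 | h8
  swap
  · exact exists_splitRelation_of_cross hy hw hx hz
      (fun a b c d h => by have := hI c a d b (by linear_combination h); tauto) h8
      (a₀ := g 1) (a₁ := g 3) (a₂ := g 0) (a₃ := g 2) (b₁ := g 4) (b₂ := g 7) (b₃ := g 6)
      (b₄ := g 9) (b₅ := g 5) (by linear_combination h)
  rcases zmod_two_cases (g 9) with h9 | h9
  swap
  · exact exists_splitRelation_of_cross hz hw hx hy
      (fun a b c d h => by have := hI c d a b (by linear_combination h); tauto) h9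
      (a₀ := g 2) (a₁ := g 3) (a₂ := g 0) (a₃ := g 1) (b₁ := g 5) (b₂ := g 7) (b₃ := g 6)
      (b₄ := g 8) (b₅ := g 4) (by linear_combination h)
  · exfalso
    have h2 := two_eq_zero K
    rw [h4, h5, h6, h7, h8, h9, map_zero, ← algebraMap_sq (g 0), ← algebraMap_sq (g 1),
      ← algebraMap_sq (g 2), ← algebraMap_sq (g 3)] at h
    have h0 : (algebraMap _ K (g 0) * x + algebraMap _ K (g 1) * y + algebraMap _ K (g 2) * z +
        algebraMap _ K (g 3) * w) ^ 2 = 0 := by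
      generalize algebraMap F₂ K (g 0) = a₀ at *
      generalize algebraMap F₂ K (g 1) = a₁ at *
      generalize algebraMap F₂ K (g 2) = a₂ at *
      generalize algebraMap F₂ K (g 3) = a₃ at *
      linear_combination h + (a₀ * x * (a₁ * y + a₂ * z + a₃ * w) + a₁ * y * (a₂ * z + a₃ * w) +
        a₂ * z * (a₃ * w)) * h2
    obtain ⟨e0, e1, e2, e3⟩ := hI _ _ _ _ (pow_eq_zero_iff two_ne_zero |>.1 h0)
    obtain ⟨i, hi⟩ := hg
    fin_cases i
    exacts [hi e0, hi e1, hi e2, hi e3, hi h4, hi h5, hi h6, hi h7, hi h8, hi h9]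

variable [hF : Fact (IsFunctionField F₂ K)] [hC : Fact (HasExactConstants F₂ K)]
  [hG : Fact (GenusFourClassOne K)]

lemma SplitRelation.of_hyperbolic {W : Divisor F₂ K} (hW : deg W = 6) {x y z w : K}
    (hx : x ∈ L W) (hy : y ∈ L W) (hz : z ∈ L W) (hw : w ∈ L W) (hI : Indep x y z w)
    {c d e : F₂} (h : SplitRelation x y z w 0 0 c d e) : c = 1 ∧ d = 1 ∧ e = 1 := by
  have h2 := two_eq_zero K
  have hx0 : x ≠ 0 := fun h0 => hI.eq_zero 1 0 0 0 (by simp [h0]) (by simp)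
  have hy0 : y ≠ 0 := fun h0 => hI.eq_zero 0 1 0 0 (by simp [h0]) (by simp)
  have key : ∀ a b a' b' : F₂, x * y ≠ (algebraMap _ K a * z + algebraMap _ K b * w) *
      (algebraMap _ K a' * z + algebraMap _ K b' * w) := by
    intro a b a' b' h0
    have hm : ∀ a b : F₂, algebraMap _ K a * z + algebraMap _ K b * w ∈ L W := fun a b => by
      rw [← Algebra.smul_def, ← Algebra.smul_def]
      exact Submodule.add_mem _ (Submodule.smul_mem _ _ hz) (Submodule.smul_mem _ _ hw)
    have h1 := mul_ne_zero hx0 hy0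
    rw [h0] at h1
    rcases eq_or_eq_of_mul_eq_mul hW hx hy (hm a b) (hm a' b') hx0 hy0 (left_ne_zero_of_mul h1)
      (right_ne_zero_of_mul h1) h0 with h3 | h3
    · exact hI.eq_zero 1 0 a b (by rw [map_one, map_zero]; linear_combination x * h2 - h3) (by simp)
    · exact hI.eq_zero 1 0 a' b' (by rw [map_one, map_zero]; linear_combination x * h2 - h3) (by simp)
  rw [SplitRelation, map_zero] at h
  rcases zmod_two_cases d with rfl | rfl
  · exfalso
    apply key c e c e
    have hc := algebraMap_sq (K := K) c
    have he := algebraMap_sq (K := K) e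
    rw [map_zero] at h
    generalize algebraMap F₂ K c = c at *
    generalize algebraMap F₂ K e = e at *
    linear_combination h - z ^ 2 * hc - w ^ 2 * he - (c * z ^ 2 + e * w ^ 2 + c * e * z * w) * h2
  · rw [map_one] at h
    rcases zmod_two_cases c with rfl | rfl <;> rcases zmod_two_cases e with rfl | rfl
    · exact absurd (by simp only [map_zero, map_one] at *; linear_combination h - z * w * h2)
        (key 1 0 0 1)
    · exact absurd (by
        simp only [map_zero, map_one] at *
        linear_combination h - (z * w + w ^ 2) * h2) (key 0 1 1 1)
    · exact absurd (by
        simp only [map_zero, map_one] at *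
        linear_combination h - (z * w + z ^ 2) * h2) (key 1 0 1 1)
    · exact ⟨rfl, rfl, rfl⟩

/-- A basis of the differentials in which the canonical quadric has its standard elliptic form. -/
structure IsEllipticBasis (W : Divisor F₂ K) (x y z w : K) : Prop where
  mem₁ : x ∈ L W
  mem₂ : y ∈ L W
  mem₃ : z ∈ L W
  mem₄ : w ∈ L W
  indep : Indep x y z w
  rel : x * y = z ^ 2 + z * w + w ^ 2

lemma IsEllipticBasis.of_hyperbolic {W : Divisor F₂ K} (hW : deg W = 6) {x y z w : K}
    (hx : x ∈ L W) (hy : y ∈ L W) (hz : z ∈ L W) (hw : w ∈ L W) (hI : Indep x y z w)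
    {c d e : F₂} (h : SplitRelation x y z w 0 0 c d e) : IsEllipticBasis W x y z w := by
  obtain ⟨rfl, rfl, rfl⟩ := h.of_hyperbolic hW hx hy hz hw hI
  refine ⟨hx, hy, hz, hw, hI, ?_⟩
  rw [SplitRelation, map_zero, map_one] at h
  linear_combination h - (z ^ 2 + z * w + w ^ 2) * two_eq_zero K

lemma Indep.shear {x y z w : K} (hI : Indep x y z w) : Indep x (y + x) z w :=
  hI.map (fun a b c d => (a + b, b, c, d)) (by
    intro a b c d h
    simp only [Prod.mk_eq_zero] at h
    obtain ⟨h1, rfl, h3, h4⟩ := h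
    exact ⟨by simpa using h1, rfl, h3, h4⟩) (by
    intro a b c d
    simp only [map_add]
    ring)

lemma Indep.swap {x y z w : K} (hI : Indep x y z w) : Indep y x z w :=
  fun a b c d h => by have := hI b a c d (by linear_combination h); tauto

lemma Indep.swap_last {x y z w : K} (hI : Indep x y z w) : Indep x y w z :=
  fun a b c d h => by have := hI a b d c (by linear_combination h); tauto

lemma Indep.swap_pairs {x y z w : K} (hI : Indep x y z w) : Indep z w x y :=
  fun a b c d h => by have := hI c d a b (by linear_combination h); tauto

lemma exists_ellipticBasis_of_isotropic {W : Divisor F₂ K} (hW : deg W = 6) {x y z w : K}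
    (hx : x ∈ L W) (hy : y ∈ L W) (hz : z ∈ L W) (hw : w ∈ L W) (hI : Indep x y z w)
    {a b c d e : F₂} (hab : ¬ (a = 1 ∧ b = 1)) (h : SplitRelation x y z w a b c d e) :
    ∃ x y z w : K, IsEllipticBasis W x y z w := by
  rcases zmod_two_cases a with rfl | rfl <;> rcases zmod_two_cases b with rfl | rfl
  · exact ⟨_, _, _, _, .of_hyperbolic hW hx hy hz hw hI h⟩
  · refine ⟨_, _, _, _, .of_hyperbolic hW hy (Submodule.add_mem _ hx hy) hz hw hI.swap.shear
      (c := c) (d := d) (e := e) ?_⟩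
    simp only [SplitRelation, map_zero, map_one] at *
    linear_combination h
  · refine ⟨_, _, _, _, .of_hyperbolic hW hx (Submodule.add_mem _ hy hx) hz hw hI.shear
      (c := c) (d := d) (e := e) ?_⟩
    simp only [SplitRelation, map_zero, map_one] at *
    linear_combination h
  · exact absurd ⟨rfl, rfl⟩ hab

lemma exists_ellipticBasis {W : Divisor F₂ K} (hW : deg W = 6) :
    ∃ x y z w : K, IsEllipticBasis W x y z w := by
  have h2 := two_eq_zero K
  obtain ⟨x, hx, y, hy, z, hz, w, hw, hI, g, hg, h⟩ := exists_quadric_relation (K := K) hW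
  obtain ⟨x, hx, y, hy, z, hz, w, hw, hI, a, b, c, d, e, h⟩ :=
    exists_splitRelation hx hy hz hw hI g hg h
  by_cases hab : a = 1 ∧ b = 1
  swap
  · exact exists_ellipticBasis_of_isotropic hW hx hy hz hw hI hab h
  obtain ⟨rfl, rfl⟩ := hab
  have hx0 : x ≠ 0 := fun h0 => hI.eq_zero 1 0 0 0 (by simp [h0]) (by simp)
  have hy0 : y ≠ 0 := fun h0 => hI.eq_zero 0 1 0 0 (by simp [h0]) (by simp)
  rcases zmod_two_cases d with rfl | rfl
  · exfalso
    set m := x + y + algebraMap _ K c * z + algebraMap _ K e * w with hm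
    have hmW : m ∈ L W := by
      rw [hm, ← Algebra.smul_def, ← Algebra.smul_def]
      exact Submodule.add_mem _ (Submodule.add_mem _ (Submodule.add_mem _ hx hy)
        (Submodule.smul_mem _ _ hz)) (Submodule.smul_mem _ _ hw)
    have hmm : x * y = m * m := by
      have hc := algebraMap_sq (K := K) c
      have he := algebraMap_sq (K := K) e
      rw [SplitRelation, map_zero, map_one] at h
      rw [hm]
      generalize algebraMap F₂ K c = c at *
      generalize algebraMap F₂ K e = e at *
      linear_combination h - z ^ 2 * hc - w ^ 2 * he - (x ^ 2 + y ^ 2 + x * y + c * z ^ 2 + e * w ^ 2 +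
        c * e * z * w + (x + y) * (c * z + e * w)) * h2
    have hm0 : m ≠ 0 := fun h0 => mul_ne_zero hx0 hy0 (by rw [hmm, h0, zero_mul])
    have := eq_or_eq_of_mul_eq_mul hW hx hy hmW hmW hx0 hy0 hm0 hm0 hmm
    rw [or_self] at this
    exact hI.eq_zero 0 1 c e (by rw [map_zero, map_one]; linear_combination -this + hm) (by simp)
  · by_cases hce : c = 1 ∧ e = 1
    · exfalso
      obtain ⟨rfl, rfl⟩ := hce
      rw [SplitRelation, map_one] at h
      have hp : (x + z) * (x + y + z) = (y + w) * (y + w + z) := by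
        linear_combination h - (y ^ 2 + z * w + w ^ 2 - x * z + y * w) * h2
      rcases eq_or_eq_of_mul_eq_mul hW (Submodule.add_mem _ hx hz)
        (Submodule.add_mem _ (Submodule.add_mem _ hx hy) hz) (Submodule.add_mem _ hy hw)
        (Submodule.add_mem _ (Submodule.add_mem _ hy hw) hz)
        (fun h0 => hI.eq_zero 1 0 1 0 (by simp [h0]) (by simp))
        (fun h0 => hI.eq_zero 1 1 1 0 (by simp [h0]) (by simp))
        (fun h0 => hI.eq_zero 0 1 0 1 (by simp [h0]) (by simp))
        (fun h0 => hI.eq_zero 0 1 1 1 (by simp; linear_combination h0) (by simp)) hp with h3 | h3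
      · exact hI.eq_zero 1 1 1 1 (by simp; linear_combination h3 + (y + w) * h2) (by simp)
      · exact hI.eq_zero 1 1 0 1 (by simp; linear_combination h3 + (y + w) * h2) (by simp)
    · refine exists_ellipticBasis_of_isotropic hW hz hw hx hy hI.swap_pairs hce
        (c := 1) (d := 1) (e := 1) ?_
      simp only [SplitRelation, map_one] at *
      linear_combination h

end QuadricNormalForm

section TangentSections

variable {K : Type*} [Field K] [Algebra F₂ K]

lemma Indep.linearIndependent {x y z w : K} (hI : Indep x y z w) :
    LinearIndependent F₂ ![x, y, z, w] := by
  refine Fintype.linearIndependent_iff.2 fun g hg => ?_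
  obtain ⟨h0, h1, h2, h3⟩ := hI (g 0) (g 1) (g 2) (g 3) (by
    simpa [Fin.sum_univ_four, Algebra.smul_def] using hg)
  intro i
  fin_cases i
  exacts [h0, h1, h2, h3]

lemma card_le_finrank_of_forall_mem {n : ℕ} {v : Fin n → K} (hv : LinearIndependent F₂ v)
    {V : Submodule F₂ K} [FiniteDimensional F₂ V] (h : ∀ i, v i ∈ V) :
    n ≤ finrank F₂ V := by
  have h1 : LinearIndependent F₂ fun i => (⟨v i, h i⟩ : V) :=
    LinearIndependent.of_comp V.subtype hv
  simpa using h1.fintype_card_le_finrank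

variable [hF : Fact (IsFunctionField F₂ K)] [hC : Fact (HasExactConstants F₂ K)]
  [hG : Fact (GenusFourClassOne K)]

lemma IsEllipticBasis.swap {W : Divisor F₂ K} {x y z w : K} (h : IsEllipticBasis W x y z w) :
    IsEllipticBasis W y x z w :=
  ⟨h.mem₂, h.mem₁, h.mem₃, h.mem₄, h.indep.swap, by rw [mul_comm, h.rel]⟩

lemma IsEllipticBasis.swap_last {W : Divisor F₂ K} {x y z w : K}
    (h : IsEllipticBasis W x y z w) : IsEllipticBasis W x y w z :=
  ⟨h.mem₁, h.mem₂, h.mem₄, h.mem₃, h.indep.swap_last, by rw [h.rel]; ring⟩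

lemma IsEllipticBasis.move {W : Divisor F₂ K} {x y z w : K} (h : IsEllipticBasis W x y z w) :
    IsEllipticBasis W (x + y + w) x (x + z + w) w := by
  refine ⟨Submodule.add_mem _ (Submodule.add_mem _ h.mem₁ h.mem₂) h.mem₄, h.mem₁,
    Submodule.add_mem _ (Submodule.add_mem _ h.mem₁ h.mem₃) h.mem₄, h.mem₄,
    h.indep.map (fun a b c d => (a + b + c, a, c, a + c + d)) ?_ ?_, ?_⟩
  · intro a b c d h
    simp only [Prod.mk_eq_zero] at h
    obtain ⟨h1, rfl, rfl, h4⟩ := h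
    exact ⟨rfl, by simpa using h1, rfl, by simpa using h4⟩
  · intro a b c d
    simp only [map_add]
    ring
  · linear_combination h.rel - (x * z + x * w + z * w + w ^ 2) * two_eq_zero K

lemma eq_of_degree_le_three_of_rational {P p : Place F₂ K}
    (hP : deg₂ P = 1) (hp : deg₂ p ≤ 3) : p = P := by
  by_contra hne
  have h1 := eq_of_deg_lt_four (K := K) (single_nonneg' p zero_le_one)
    (single_nonneg' P (n := deg₂ p) (by positivity))
    (by rw [deg_single, deg_single, hP]; norm_num)
    (by rw [deg_single, hP]; push_cast; omega)
  have h2 := DFunLike.congr_fun h1 p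
  rw [single_eq_same, single_eq_of_ne hne] at h2
  exact one_ne_zero h2

lemma el_sub_single {W : Divisor F₂ K} (hW : deg W = 6) {p : Place F₂ K}
    (hp : deg₂ p ≤ 3) :
    el (W - single p 1) + deg₂ p ≤ 4 := by
  have h := riemann_roch (K := K) (D := W - single p 1) (E := single p 1)
    (by rw [deg_sub, hW]; ring)
  have h1 := el_lt_two_of_deg_lt_four (K := K) (D := single p 1)
    (by rw [deg_single]; omega)
  rw [deg_sub, hW, deg_single] at h
  omega

lemma eq_of_mem_of_degree_three {W : Divisor F₂ K} (hW : deg W = 6) {p : Place F₂ K}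
    (hp : deg₂ p = 3) {f g : K} (hf0 : f ≠ 0) (hg0 : g ≠ 0)
    (hf : f ∈ L (W - single p 1)) (hg : g ∈ L (W - single p 1)) : f = g := by
  rw [mem_L' hf0] at hf
  rw [mem_L' hg0] at hg
  have hd : ∀ f : K, deg (W - single p 1 + dv f) = 3 := fun f => by
    rw [deg_add, deg_sub, show deg (dv f : Divisor F₂ K) = 0 from degHom_dv f, hW, deg_single,
      hp]
    norm_num
  exact eq_of_dv_eq hf0 hg0 (add_left_cancel (eq_of_deg_lt_four hf hg ((hd f).trans (hd g).symm)
    (by rw [hd]; norm_num)))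

lemma exists_not_mem_of_linearIndependent {W : Divisor F₂ K} (hW : deg W = 6) {v : Fin 4 → K}
    (hv : LinearIndependent F₂ v) :
    ∃ i, ∀ p, deg₂ p ≤ 3 → v i ∉ L (W - single p 1) := by
  by_contra hcon
  push Not at hcon
  choose p hp hm using hcon
  by_cases h1 : ∃ i, deg₂ (p i) = 1
  · obtain ⟨i, hi⟩ := h1
    have h2 := card_le_finrank_of_forall_mem hv (V := L (W - single (p i) 1)) fun j => by
      have := eq_of_degree_le_three_of_rational hi (hp j)
      rw [← this]
      exact hm j
    have h3 := el_sub_single hW (hp i)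
    have h4 := ell_eq (W - single (p i) 1)
    simp only [el] at h3
    omega
  push Not at h1
  have h23 : ∀ i, deg₂ (p i) = 2 ∨ deg₂ (p i) = 3 := fun i => by
    have := h1 i
    have := hp i
    have := (p i).one_le_degree
    omega
  have hone : ∀ i, el (single (p i) 1 : Divisor F₂ K) ≤ 1 := fun i => by
    have := el_lt_two_of_deg_lt_four (K := K) (D := single (p i) 1)
      (by rw [deg_single]; have := hp i; omega)
    omega
  obtain ⟨i₀, hi₀⟩ : ∃ i₀, ∀ j, j ≠ i₀ → deg₂ (p j) = 2 := by
    by_cases h3 : ∃ i₀, deg₂ (p i₀) = 3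
    · obtain ⟨i₀, h3⟩ := h3
      refine ⟨i₀, fun j hj => (h23 j).resolve_right fun h4 => hj (hv.injective ?_)⟩
      have := eq_of_el_le_one_of_place (h4.trans h3.symm) (hone i₀)
      exact eq_of_mem_of_degree_three hW h3 (hv.ne_zero _) (hv.ne_zero _) (this ▸ hm j) (hm i₀)
    · push Not at h3
      exact ⟨0, fun j _ => (h23 j).resolve_right (h3 j)⟩
  have hne : ∀ j, Fin.succAbove i₀ j ≠ i₀ := Fin.succAbove_ne i₀
  have h2 := card_le_finrank_of_forall_mem
    (hv.comp (Fin.succAbove i₀) Fin.succAbove_right_injective)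
    (V := L (W - single (p (Fin.succAbove i₀ (0 : Fin 3))) 1)) fun j => by
      have := eq_of_el_le_one_of_place ((hi₀ _ (hne j)).trans (hi₀ _ (hne 0)).symm) (hone _)
      rw [← this]
      exact hm _
  have h3 := el_sub_single hW (hp (Fin.succAbove i₀ (0 : Fin 3)))
  have h4 := ell_eq (W - single (p (Fin.succAbove i₀ (0 : Fin 3))) 1)
  have h5 := hi₀ _ (hne 0)
  simp only [el] at h3
  omega

lemma exists_eq_single_of_not_mem {W : Divisor F₂ K} (hW : deg W = 6) {f : K} (hf0 : f ≠ 0)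
    (hf : f ∈ L W) (h : ∀ p, deg₂ p ≤ 3 → f ∉ L (W - single p 1)) :
    ∃ S, deg₂ S = 6 ∧ W + dv f = single S 1 := by
  have hE := (mem_L' hf0).1 hf
  have hd : deg (W + dv f) = 6 := by
    rw [deg_add, show deg (dv f : Divisor F₂ K) = 0 from degHom_dv f, hW, add_zero]
  have hbig : ∀ p, 0 ≤ W + dv f - single p 1 → 4 ≤ deg₂ p := by
    intro p hp
    by_contra hlt
    refine h p (by omega) ((mem_L' hf0).2 ?_)
    rwa [sub_add_eq_add_sub]
  obtain ⟨S, -, hS, hdS⟩ := exists_single_le hE (by rw [hd]; norm_num)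
  have h4 := hbig S hS
  have h0 : deg (W + dv f - single S 1) = 0 := by
    by_contra hne
    have hnn := degHom_nonneg hS
    obtain ⟨q, hq, hq', hdq⟩ := exists_single_le hS (by simp only [deg] at *; omega)
    have h5 := hbig q (hq'.trans (sub_le_sub_right
      (sub_le_self _ (single_nonneg' S zero_le_one)) _))
    have := degHom_nonneg hq'
    simp only [deg] at *
    omega
  refine ⟨S, ?_, ?_⟩
  · rw [hdS, hd] at h0
    omega
  · exact sub_eq_zero.1 (eq_zero_of_degHom_eq_zero hS h0)

/-- Affine coordinates on a tangent section of the canonical quadric which meets the curve in a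
single place. -/
structure IsTangentPair (S : Place F₂ K) (t s : K) : Prop where
  mem₁ : t ∈ L (single S 1 : Divisor F₂ K)
  mem₂ : s ∈ L (single S 1 : Divisor F₂ K)
  mem₃ : s ^ 2 + t * s + t ^ 2 ∈ L (single S 1 : Divisor F₂ K)
  indep : Indep 1 t s N(t, s)

lemma IsEllipticBasis.exists_tangentPair {W : Divisor F₂ K} (hW : deg W = 6) {x y z w : K}
    (h : IsEllipticBasis W x y z w)
    (hx : ∀ p, deg₂ p ≤ 3 → x ∉ L (W - single p 1)) :
    ∃ S : Place F₂ K, deg₂ S = 6 ∧ ∃ t s, IsTangentPair S t s := by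
  have hx0 : x ≠ 0 := fun h0 => h.indep.eq_zero 1 0 0 0 (by simp [h0]) (by simp)
  obtain ⟨S, hS, hWS⟩ := exists_eq_single_of_not_mem hW hx0 h.mem₁ hx
  have hdiv : ∀ f ∈ L W, f / x ∈ L (single S 1 : Divisor F₂ K) := by
    intro f hf
    by_cases hf0 : f = 0
    · rw [hf0, zero_div]
      exact Submodule.zero_mem _
    · rw [mem_L' hf0] at hf
      rw [mem_L' (div_ne_zero hf0 hx0), ← hWS, div_eq_mul_inv, dv_mul hf0 (inv_ne_zero hx0), dv_inv]
      have : W + dv x + (dv f + -dv x) = W + dv f := by abel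
      rwa [this]
  have hN : (z / x) ^ 2 + w / x * (z / x) + (w / x) ^ 2 = y / x := by
    have := h.rel
    field_simp
    linear_combination -this
  refine ⟨S, hS, w / x, z / x, hdiv _ h.mem₄, hdiv _ h.mem₃, ?_, ?_⟩
  · rw [hN]
    exact hdiv _ h.mem₂
  · rw [hN]
    intro a b c d h0
    have := h.indep a d c b (by
      field_simp at h0
      linear_combination h0)
    tauto

variable (K) in
lemma exists_tangentPair :
    ∃ S : Place F₂ K, deg₂ S = 6 ∧ ∃ t s, IsTangentPair S t s := by
  obtain ⟨W, hW⟩ := exists_deg_six (K := K)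
  obtain ⟨x, y, z, w, h⟩ := exists_ellipticBasis hW
  have hI : Indep x y (x + y + w) (x + y + z) :=
    h.indep.map (fun a b c d => (a + c + d, b + c + d, d, c)) (by
      intro a b c d h
      simp only [Prod.mk_eq_zero] at h
      obtain ⟨h1, h2, rfl, rfl⟩ := h
      exact ⟨by simpa using h1, by simpa using h2, rfl, rfl⟩) (by
      intro a b c d
      simp only [map_add]
      ring)
  obtain ⟨i, hi⟩ := exists_not_mem_of_linearIndependent hW hI.linearIndependent
  fin_cases i
  exacts [h.exists_tangentPair hW hi, h.swap.exists_tangentPair hW hi,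
    h.move.exists_tangentPair hW hi, h.swap_last.move.exists_tangentPair hW hi]

end TangentSections

section FieldOfOrderSixtyFour

variable {k : Type*} [Field k] [CharP k 2] {ζ θ : k}

lemma add_pow_four (x y : k) : (x + y) ^ 4 = x ^ 4 + y ^ 4 := by
  simpa using add_pow_char_pow (p := 2) (n := 2) x y

lemma pow_four_eq_of_quadratic (hθ : θ ^ 64 = θ) {a b : k} (ha : a ^ 4 = a) (hb : b ^ 4 = b)
    (h : θ ^ 2 = b * θ + a) : θ ^ 4 = θ := by
  have h2 : (2 : k) = 0 := CharTwo.two_eq_zero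
  have h4 : θ ^ 4 = b ^ 3 * θ + (b ^ 2 * a + a ^ 2) := by
    linear_combination (θ ^ 2 + b * θ + a + b ^ 2) * h + a * b * θ * h2
  by_cases hb0 : b = 0
  · have h16 : θ ^ 16 = θ ^ 4 := by
      rw [show θ ^ 16 = (θ ^ 4) ^ 4 by ring, h4, hb0]
      linear_combination (a ^ 4 + a) * ha
    have : θ ^ 64 = θ ^ 16 := by
      rw [show θ ^ 64 = (θ ^ 16) ^ 4 by ring, h16]
      linear_combination h16
    rw [← h16, ← this, hθ]
  · have hb3 : b ^ 3 = 1 := mul_left_cancel₀ hb0 (by linear_combination hb)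
    rw [hb3, one_mul] at h4
    have hd : (b ^ 2 * a + a ^ 2) ^ 4 = b ^ 2 * a + a ^ 2 := by
      rw [add_pow_four]
      linear_combination (b ^ 8) * ha + a * (b ^ 4 + b) * hb + (a ^ 4 + a) * ha
    have h16 : θ ^ 16 = θ := by
      rw [show θ ^ 16 = (θ ^ 4) ^ 4 by ring, h4, add_pow_four, hd]
      linear_combination h4 + (b ^ 2 * a + a ^ 2) * h2
    have h64 : θ ^ 64 = θ ^ 4 := by rw [show θ ^ 64 = (θ ^ 16) ^ 4 by ring, h16]
    rw [← h64, hθ]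

lemma eq_zero_of_quadratic (hθ : θ ^ 64 = θ) (h4 : θ ^ 4 ≠ θ) {α β γ : k} (hα : α ^ 4 = α)
    (hβ : β ^ 4 = β) (hγ : γ ^ 4 = γ) (h : α + β * θ + γ * θ ^ 2 = 0) : α = 0 ∧ β = 0 ∧ γ = 0 := by
  have hdiv : ∀ {x y : k}, x ^ 4 = x → y ^ 4 = y → (x / y) ^ 4 = x / y := fun hx hy => by
    rw [div_pow, hx, hy]
  have h2 : (2 : k) = 0 := CharTwo.two_eq_zero
  have hγ0 : γ = 0 := by
    by_contra hγ0
    refine h4 (pow_four_eq_of_quadratic hθ (hdiv hα hγ) (hdiv hβ hγ) ?_)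
    field_simp
    linear_combination h - (α + β * θ) * h2
  have hβ0 : β = 0 := by
    by_contra hβ0
    refine h4 ?_
    have : θ = α / β := by
      field_simp
      linear_combination h - θ ^ 2 * hγ0 - α * h2
    rw [this, hdiv hα hβ]
  exact ⟨by rw [hβ0, hγ0] at h; linear_combination h, hβ0, hγ0⟩

lemma pow_four_ne (hζ : ζ ^ 2 + ζ + 1 = 0) (h0 : θ ≠ 0) (h1 : θ ≠ 1) (h2 : θ ≠ ζ)
    (h3 : θ ≠ ζ + 1) : θ ^ 4 ≠ θ := by
  intro h
  have c2 : (2 : k) = 0 := CharTwo.two_eq_zero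
  have : θ * (θ - 1) * ((θ - ζ) * (θ - (ζ + 1))) = 0 := by
    linear_combination h + (θ ^ 2 - θ) * hζ - (θ ^ 2 * (θ - 1) * (ζ + 1) - θ + θ ^ 2) * c2
  simp only [mul_eq_zero, sub_eq_zero] at this
  tauto

end FieldOfOrderSixtyFour

section TangentPair

variable {K : Type*} [Field K] [Algebra F₂ K] [hF : Fact (IsFunctionField F₂ K)]
  {S : Place F₂ K} {t s f g : K}

/-- The leading coefficient at a place of a function relative to another one. -/
def Place.lead (S : Place F₂ K) (t f : K) : ResidueField S.1 := S.res (f * t⁻¹)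

lemma Place.mul_inv_mem (S : Place F₂ K) (ht : S.ord t = -1) (hf : f ∈ S.V (-1)) :
    f * t⁻¹ ∈ S.1 := by
  have := S.mul_mem_V hf (S.inv_mem_V ht)
  rwa [neg_add_cancel, S.mem_V_zero] at this

lemma Place.lead_add (S : Place F₂ K) (ht : S.ord t = -1) (hf : f ∈ S.V (-1))
    (hg : g ∈ S.V (-1)) : S.lead t (f + g) = S.lead t f + S.lead t g := by
  rw [lead, add_mul, S.res_add (S.mul_inv_mem ht hf) (S.mul_inv_mem ht hg), lead, lead]

lemma Place.lead_self (S : Place F₂ K) (ht : S.ord t = -1) : S.lead t t = 1 := by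
  rw [lead, mul_inv_cancel₀ (S.ne_zero_of_ord_ne_zero (by omega)), ← map_one (algebraMap F₂ K),
    S.res_const, map_one]

lemma Place.lead_const_mul (S : Place F₂ K) (ht : S.ord t = -1) (hf : f ∈ S.V (-1))
    (c : F₂) : S.lead t (algebraMap F₂ K c * f) = residueHom F₂ S c * S.lead t f := by
  rw [lead, mul_assoc, S.res_mul (S.2.2 c) (S.mul_inv_mem ht hf), S.res_const, lead]

lemma Place.lead_eq_zero_iff (S : Place F₂ K) (ht : S.ord t = -1) (hf : f ∈ S.V (-1)) :
    S.lead t f = 0 ↔ f ∈ S.V 0 := by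
  rw [lead, S.res_eq_zero_iff (S.mul_inv_mem ht hf), mul_comm,
    S.mul_mem_V_iff (inv_ne_zero (S.ne_zero_of_ord_ne_zero (by omega))), S.ord_inv, ht]
  norm_num

lemma Place.lead_mul_lead (S : Place F₂ K) (ht : S.ord t = -1) (hg : S.ord g = -1)
    (hf : f ∈ S.V (-1)) : S.lead g f * S.lead t g = S.lead t f := by
  have hg0 := S.ne_zero_of_ord_ne_zero (f := g) (by omega)
  rw [lead, lead, ← S.res_mul (S.mul_inv_mem hg hf) (S.mul_inv_mem ht
    ((S.mem_V' hg0).2 hg.ge)), lead]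
  congr 1
  field_simp

lemma Place.coeff_pow_four (S : Place F₂ K) (hz : S.lead t s ^ 2 + S.lead t s + 1 = 0)
    (a b : F₂) : (residueHom F₂ S a + residueHom F₂ S b * S.lead t s) ^ 4 =
      residueHom F₂ S a + residueHom F₂ S b * S.lead t s := by
  have := S.charTwo_residueField
  have hc : ∀ c : F₂, c ^ 4 = c := by decide
  rw [add_pow_four, mul_pow, ← map_pow, ← map_pow, hc, hc]
  linear_combination residueHom F₂ S b * (S.lead t s ^ 2 - S.lead t s) * hz

lemma Place.coeff_eq_zero (S : Place F₂ K) (hz : S.lead t s ^ 2 + S.lead t s + 1 = 0)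
    {a b : F₂}
    (h0 : residueHom F₂ S a + residueHom F₂ S b * S.lead t s = 0) : a = 0 ∧ b = 0 := by
  have := S.charTwo_residueField
  have h2 : (2 : ResidueField S.1) = 0 := CharTwo.two_eq_zero
  rcases zmod_two_cases a with rfl | rfl <;> rcases zmod_two_cases b with rfl | rfl <;>
    simp only [map_zero, map_one, zero_mul, one_mul, zero_add, add_zero] at h0
  · simp
  · simp [h0] at hz
  · simp at h0
  · exact absurd (show (1 : ResidueField S.1) = 0 by
      linear_combination hz - S.lead t s * h0) one_ne_zero

/-- An element of the residue field at a place of degree six that is not fixed by the square of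
Frobenius is independent over the field with four elements up to degree two. -/
lemma Place.lead_quadratic (S : Place F₂ K) (hS : deg₂ S = 6)
    {θ α β γ : ResidueField S.1} (h4 : θ ^ 4 ≠ θ) (hα : α ^ 4 = α) (hβ : β ^ 4 = β)
    (hγ : γ ^ 4 = γ) (h0 : α + β * θ + γ * θ ^ 2 = 0) : α = 0 ∧ β = 0 ∧ γ = 0 := by
  have := S.charTwo_residueField
  refine eq_zero_of_quadratic ?_ h4 hα hβ hγ h0
  have := S.residue_pow_eq θ
  rwa [hS] at this

/-- The basis of the function field over the rational function field. -/
def basis (t s : K) : Fin 6 → K :=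
  ![1, s, s ^ 2 + t * s + t ^ 2, N(t, s) * s, N(t, s) ^ 2,
    N(t, s) ^ 2 * s]

lemma isGraded_basis (hS : deg₂ S = 6) (ht : S.ord t = -1) (hs : s ∈ S.V (-1))
    (hN : s ^ 2 + t * s + t ^ 2 ∈ S.V (-1)) (hz : S.lead t s ^ 2 + S.lead t s + 1 = 0)
    (h4 : S.lead t N(t, s) ^ 4 ≠ S.lead t N(t, s)) :
    IsGraded (F := F₂) S t (basis t s) ![0, 1, 1, 2, 2, 3] := by
  have ht0 := S.ne_zero_of_ord_ne_zero (f := t) (by omega)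
  have hσ := S.mul_inv_mem ht hs
  have hη := S.mul_inv_mem ht hN
  have hb : ∀ i, basis t s i * t⁻¹ ^ (![0, 1, 1, 2, 2, 3] : Fin 6 → ℕ) i =
      (![1, s * t⁻¹, N(t, s) * t⁻¹, N(t, s) * t⁻¹ * (s * t⁻¹),
        (N(t, s) * t⁻¹) ^ 2,
        (N(t, s) * t⁻¹) ^ 2 * (s * t⁻¹)] : Fin 6 → K) i := by
    intro i
    fin_cases i
    · change 1 * t⁻¹ ^ 0 = 1; ring
    · change s * t⁻¹ ^ 1 = s * t⁻¹; ring
    · change N(t, s) * t⁻¹ ^ 1 = N(t, s) * t⁻¹; ring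
    · change N(t, s) * s * t⁻¹ ^ 2 = N(t, s) * t⁻¹ * (s * t⁻¹)
      ring
    · change N(t, s) ^ 2 * t⁻¹ ^ 2 = (N(t, s) * t⁻¹) ^ 2
      ring
    · change N(t, s) ^ 2 * s * t⁻¹ ^ 3 =
        (N(t, s) * t⁻¹) ^ 2 * (s * t⁻¹)
      ring
  have hmem : ∀ i, basis t s i * t⁻¹ ^ (![0, 1, 1, 2, 2, 3] : Fin 6 → ℕ) i ∈ S.1 := by
    intro i
    rw [hb]
    fin_cases i
    · exact one_mem _
    · exact hσ
    · exact hη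
    · exact mul_mem hη hσ
    · exact pow_mem hη 2
    · exact mul_mem (pow_mem hη 2) hσ
  refine ⟨ht, fun i => S.mem_V_zero.2 (hmem i), fun c hc => ?_⟩
  have hm : ∀ i, algebraMap F₂ K (c i) *
      (basis t s i * t⁻¹ ^ (![0, 1, 1, 2, 2, 3] : Fin 6 → ℕ) i) ∈ S.1 :=
    fun i => mul_mem (S.2.2 _) (hmem i)
  rw [← S.res_eq_zero_iff (sum_mem fun i _ => hm i), S.res_sum _ hm,
    Finset.sum_congr rfl fun i _ => by rw [S.res_mul (S.2.2 _) (hmem i), S.res_const, hb]] at hc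
  rw [Fin.sum_univ_six] at hc
  have h1 : S.res (1 : K) = 1 := by
    rw [← map_one (algebraMap F₂ K), S.res_const, map_one]
  change _ * S.res 1 + _ * S.res (s * t⁻¹) + _ * S.res (N(t, s) * t⁻¹) +
    _ * S.res (N(t, s) * t⁻¹ * (s * t⁻¹)) +
    _ * S.res ((N(t, s) * t⁻¹) ^ 2) +
    _ * S.res ((N(t, s) * t⁻¹) ^ 2 * (s * t⁻¹)) = 0 at hc
  rw [h1, S.res_mul (pow_mem hη 2) hσ, S.res_mul hη hσ, S.res_pow hη] at hc
  obtain ⟨h01, h23, h45⟩ := S.lead_quadratic hS h4 (S.coeff_pow_four hz (c 0) (c 1))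
    (S.coeff_pow_four hz (c 2) (c 3)) (S.coeff_pow_four hz (c 4) (c 5)) (by
      rw [← hc, Place.lead, Place.lead]
      ring)
  obtain ⟨h0, h1⟩ := S.coeff_eq_zero hz h01
  obtain ⟨h2, h3⟩ := S.coeff_eq_zero hz h23
  obtain ⟨h4, h5⟩ := S.coeff_eq_zero hz h45
  funext i
  fin_cases i <;> assumption

variable [hC : Fact (HasExactConstants F₂ K)] [hG : Fact (GenusFourClassOne K)]

namespace IsTangentPair

lemma mem_V (hf : f ∈ L (single S 1 : Divisor F₂ K)) : f ∈ S.V (-1) := by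
  simpa using mem_L.1 hf S

lemma eq_const (hf : f ∈ L (single S 1 : Divisor F₂ K)) (h0 : f ∈ S.V 0) :
    ∃ c, algebraMap F₂ K c = f := by
  refine mem_const_of_ord_nonneg fun p => ?_
  rw [← p.mem_iff, ← p.mem_V_zero]
  by_cases hp : p = S
  · rwa [hp]
  · simpa [single_eq_of_ne hp] using mem_L.1 hf p

lemma ord_eq (h : IsTangentPair S t s) : S.ord t = -1 := by
  have ht0 : t ≠ 0 := fun h0 => by
    have := h.indep 0 1 0 0 (by simp [h0])
    simp at this
  have h1 := (S.mem_V' ht0).1 (mem_V h.mem₁)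
  by_contra hne
  obtain ⟨c, hc⟩ := eq_const h.mem₁ ((S.mem_V' ht0).2 (by omega))
  have := h.indep c 1 0 0 (by
    simp only [map_one, map_zero, mul_one, one_mul, zero_mul, add_zero, hc]
    linear_combination t * two_eq_zero K)
  simp at this

lemma lead_indep (h : IsTangentPair S t s) {a b c : F₂}
    (h0 : residueHom F₂ S a + residueHom F₂ S b * S.lead t s +
      residueHom F₂ S c * S.lead t N(t, s) = 0) : a = 0 ∧ b = 0 ∧ c = 0 := by
  have ht := h.ord_eq
  have hc : ∀ (d : F₂) {x : K}, x ∈ L (single S 1 : Divisor F₂ K) →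
      algebraMap F₂ K d * x ∈ L (single S 1 : Divisor F₂ K) := fun d x hx => by
    rw [← Algebra.smul_def]; exact Submodule.smul_mem _ _ hx
  have h1 := S.lead_const_mul ht (mem_V h.mem₁) a
  rw [S.lead_self ht, mul_one] at h1
  rw [← h1, ← S.lead_const_mul ht (mem_V h.mem₂), ← S.lead_const_mul ht (mem_V h.mem₃),
    ← S.lead_add ht (mem_V (hc _ h.mem₁)) (mem_V (hc _ h.mem₂)),
    ← S.lead_add ht (mem_V (add_mem (hc _ h.mem₁) (hc _ h.mem₂))) (mem_V (hc _ h.mem₃))] at h0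
  have hL := add_mem (add_mem (hc a h.mem₁) (hc b h.mem₂)) (hc c h.mem₃)
  rw [S.lead_eq_zero_iff ht (mem_V hL)] at h0
  obtain ⟨e, he⟩ := eq_const hL h0
  have := h.indep e a b c (by
    rw [he]
    linear_combination (algebraMap F₂ K a * t + algebraMap F₂ K b * s +
      algebraMap F₂ K c * N(t, s)) * two_eq_zero K)
  exact this.2

lemma lead_sq (h : IsTangentPair S t s) : S.lead t s ^ 2 + S.lead t s + 1 = 0 := by
  have ht := h.ord_eq
  have ht0 := S.ne_zero_of_ord_ne_zero (f := t) (by omega)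
  have hm := S.mul_inv_mem ht (mem_V h.mem₂)
  have h1 := S.mul_mem_V (mem_V h.mem₃) (S.pow_mem_V (S.inv_mem_V ht) 2)
  have h2 : N(t, s) * t⁻¹ ^ 2 = (s * t⁻¹) ^ 2 + s * t⁻¹ + 1 := by field_simp
  rw [h2, show (-1 + (2 : ℕ) * 1 : ℤ) = 1 by norm_num,
    ← S.res_eq_zero_iff (add_mem (add_mem (pow_mem hm 2) hm) (one_mem _)),
    S.res_add (add_mem (pow_mem hm 2) hm) (one_mem _), S.res_add (pow_mem hm 2) hm,
    S.res_pow hm, ← map_one (algebraMap F₂ K), S.res_const, map_one] at h1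
  exact h1

lemma lead_ne (h : IsTangentPair S t s) (a b : F₂) : S.lead t N(t, s) ≠
    residueHom F₂ S a + residueHom F₂ S b * S.lead t s := by
  intro h0
  have := S.charTwo_residueField
  have h2 : (2 : ResidueField S.1) = 0 := CharTwo.two_eq_zero
  have := (h.lead_indep (a := a) (b := b) (c := 1) (by
    rw [h0, map_one]
    linear_combination (residueHom F₂ S a + residueHom F₂ S b * S.lead t s) * h2)).2.2
  simp at this

lemma lead_pow_four_ne (h : IsTangentPair S t s) : S.lead t N(t, s) ^ 4 ≠
    S.lead t N(t, s) := by
  have := S.charTwo_residueField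
  exact pow_four_ne h.lead_sq (by simpa using h.lead_ne 0 0) (by simpa using h.lead_ne 1 0)
    (by simpa using h.lead_ne 0 1) (by simpa [add_comm] using h.lead_ne 1 1)

lemma isGraded (h : IsTangentPair S t s) (hS : deg₂ S = 6) :
    IsGraded (F := F₂) S t (basis t s) ![0, 1, 1, 2, 2, 3] :=
  isGraded_basis hS h.ord_eq (mem_V h.mem₂) (mem_V h.mem₃) h.lead_sq h.lead_pow_four_ne

end IsTangentPair

end TangentPair

namespace IsTangentPair

variable {K : Type*} [Field K] [Algebra F₂ K] [hF : Fact (IsFunctionField F₂ K)]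
  [hC : Fact (HasExactConstants F₂ K)] [hG : Fact (GenusFourClassOne K)]
  {S : Place F₂ K} {t s f : K}

lemma exists_repr (h : IsTangentPair S t s) (hS : deg₂ S = 6) {n : ℕ}
    (hf : f ∈ L (single S (n : ℤ))) : ∃ r : Fin 6 → F₂[X],
      f = ∑ i, aeval t (r i) * basis t s i ∧
        ∀ i, r i ≠ 0 → (r i).natDegree + (![0, 1, 1, 2, 2, 3] : Fin 6 → ℕ) i ≤ n := by
  refine (h.isGraded hS).exists_repr h.mem₁ (fun i => ?_) (N := 2) (fun n hn => ?_) hf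
  · have h1 : ∀ {x y : K} {a b : ℕ}, x ∈ L (single S (a : ℤ)) →
        y ∈ L (single S (b : ℤ)) → x * y ∈ L (single S ((a + b : ℕ) : ℤ)) := by
      intro x y a b hx hy
      have := mul_mem_L hx hy
      rwa [← Finsupp.single_add, ← Nat.cast_add] at this
    have h2 : s ∈ L (single S ((1 : ℕ) : ℤ)) := h.mem₂
    have h3 : s ^ 2 + t * s + t ^ 2 ∈ L (single S ((1 : ℕ) : ℤ)) := h.mem₃
    have h4 : N(t, s) ^ 2 ∈ L (single S ((2 : ℕ) : ℤ)) := by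
      rw [pow_two N(t, s)]; exact h1 (a := 1) (b := 1) h3 h3
    have h0 : (1 : K) ∈ L (single S ((0 : ℕ) : ℤ)) := by
      rw [Nat.cast_zero, Finsupp.single_zero]; exact one_mem_L (le_refl 0)
    have h5 := h1 (a := 1) (b := 1) h3 h2
    have h6 := h1 (a := 2) (b := 1) h4 h2
    revert i
    refine Fin.forall_fin_succ.2 ⟨h0, Fin.forall_fin_succ.2 ⟨h2, Fin.forall_fin_succ.2 ⟨h3,
      Fin.forall_fin_succ.2 ⟨h5, Fin.forall_fin_succ.2 ⟨h4, Fin.forall_fin_succ.2 ⟨h6, ?_⟩⟩⟩⟩⟩⟩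
    exact fun i => i.elim0
  · have h1 := ell_single_eq (S := S) (n := n) (by rw [hS]; omega)
    rw [Fin.sum_univ_six]
    change _ ≤ (n + 1 - 0) + (n + 1 - 1) + (n + 1 - 1) + (n + 1 - 2) + (n + 1 - 2) + (n + 1 - 3)
    rw [hS] at h1
    omega

/-- The polynomials whose values form the basis. -/
def basisPoly : Fin 6 → F₂[X][X] :=
  ![1, X, normForm, normForm * X, normForm ^ 2, normForm ^ 2 * X]

lemma ev_normForm : ev t s normForm = s ^ 2 + t * s + t ^ 2 := by simp [normForm]

lemma ev_basisPoly (i : Fin 6) : ev t s (basisPoly i) = basis t s i := by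
  have h := ev_normForm (t := t) (s := s)
  fin_cases i
  · exact map_one _
  · exact ev_X _ _
  · exact h
  · change ev t s (normForm * X) = _; rw [map_mul, h, ev_X]; rfl
  · change ev t s (normForm ^ 2) = _; rw [map_pow, h]; rfl
  · change ev t s (normForm ^ 2 * X) = _; rw [map_mul, map_pow, h, ev_X]; rfl

lemma exists_ev (h : IsTangentPair S t s) (hS : deg₂ S = 6) {n : ℕ}
    (hf : f ∈ L (single S (n : ℤ))) : ∃ r, f = ev t s r := by
  obtain ⟨r, hr, -⟩ := h.exists_repr hS hf
  refine ⟨∑ i, C (r i) * basisPoly i, ?_⟩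
  rw [hr, map_sum]
  refine Finset.sum_congr rfl fun i _ => ?_
  rw [map_mul, ev_C, ev_basisPoly]

lemma eq_zero_of_ev (h : IsTangentPair S t s) (hS : deg₂ S = 6)
    (r : F₂[X][X]) (hr : r.degree < 6) (h0 : ev t s r = 0) : r = 0 := by
  refine eq_zero_of_ev_eq_zero (e := 6) (fun q hq => ?_) r hr h0
  have h2 : (2 : K) = 0 := two_eq_zero K
  have h1 := (h.isGraded hS).polyIndep ![q 0 + X ^ 2 * q 2 + X ^ 3 * q 3 + X ^ 5 * q 5,
    q 1 + X * q 2 + X ^ 3 * q 4 + X ^ 4 * q 5, q 2 + X * q 3 + X ^ 2 * q 4 + X ^ 3 * q 5,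
    q 3 + X ^ 2 * q 5, q 4, q 5] (by
    rw [Fin.sum_univ_six] at hq ⊢
    change aeval t (q 0) * s ^ 0 + aeval t (q 1) * s ^ 1 + aeval t (q 2) * s ^ 2
      + aeval t (q 3) * s ^ 3 + aeval t (q 4) * s ^ 4 + aeval t (q 5) * s ^ 5 = 0 at hq
    change aeval t (q 0 + X ^ 2 * q 2 + X ^ 3 * q 3 + X ^ 5 * q 5) * 1
      + aeval t (q 1 + X * q 2 + X ^ 3 * q 4 + X ^ 4 * q 5) * s
      + aeval t (q 2 + X * q 3 + X ^ 2 * q 4 + X ^ 3 * q 5) * N(t, s)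
      + aeval t (q 3 + X ^ 2 * q 5) * (N(t, s) * s)
      + aeval t (q 4) * N(t, s) ^ 2
      + aeval t (q 5) * (N(t, s) ^ 2 * s) = 0
    simp only [map_add, map_mul, map_pow, aeval_X]
    linear_combination hq + (aeval t (q 2) * (t ^ 2 + t * s)
      + aeval t (q 3) * (t ^ 3 + t * s ^ 2 + t ^ 2 * s)
      + aeval t (q 4) * (t ^ 4 + 2 * t ^ 3 * s + 2 * t ^ 2 * s ^ 2 + t * s ^ 3)
      + aeval t (q 5) * (t ^ 5 + 2 * t ^ 4 * s + 2 * t ^ 3 * s ^ 2 + 2 * t ^ 2 * s ^ 3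
        + t * s ^ 4)) * h2)
  have e5 : q 5 = 0 := h1 5
  have e4 : q 4 = 0 := h1 4
  have e3 : q 3 + X ^ 2 * q 5 = 0 := h1 3
  have e2 : q 2 + X * q 3 + X ^ 2 * q 4 + X ^ 3 * q 5 = 0 := h1 2
  have e1 : q 1 + X * q 2 + X ^ 3 * q 4 + X ^ 4 * q 5 = 0 := h1 1
  have e0 : q 0 + X ^ 2 * q 2 + X ^ 3 * q 3 + X ^ 5 * q 5 = 0 := h1 0
  simp only [e5, mul_zero, add_zero] at e3
  simp only [e5, e4, e3, mul_zero, add_zero] at e2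
  simp only [e5, e4, e2, mul_zero, add_zero] at e1
  simp only [e5, e3, e2, mul_zero, add_zero] at e0
  refine Fin.forall_fin_succ.2 ⟨e0, Fin.forall_fin_succ.2 ⟨e1, Fin.forall_fin_succ.2 ⟨e2,
    Fin.forall_fin_succ.2 ⟨e3, Fin.forall_fin_succ.2 ⟨e4, Fin.forall_fin_succ.2 ⟨e5, ?_⟩⟩⟩⟩⟩⟩
  exact fun i => i.elim0

lemma exists_relation (h : IsTangentPair S t s) (hS : deg₂ S = 6) :
    ∃ r : Fin 6 → F₂[X],
      N(t, s) ^ 3 = ∑ i, aeval t (r i) * basis t s i ∧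
        ∀ i, (r i).natDegree ≤ 3 - (![0, 1, 1, 2, 2, 3] : Fin 6 → ℕ) i := by
  have h3 : s ^ 2 + t * s + t ^ 2 ∈ L (single S ((1 : ℕ) : ℤ)) := h.mem₃
  obtain ⟨r, hr, hd⟩ := h.exists_repr hS (pow_mem_L_single (j := 3) h3)
  refine ⟨r, hr, fun i => ?_⟩
  rcases eq_or_ne (r i) 0 with h0 | h0
  · rw [h0, natDegree_zero]; exact Nat.zero_le _
  · have := hd i h0
    omega

lemma lead_cube (h : IsTangentPair S t s) {r : Fin 6 → F₂[X]}
    (hr : N(t, s) ^ 3 = ∑ i, aeval t (r i) * basis t s i)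
    (hd : ∀ i, (r i).natDegree ≤ 3 - (![0, 1, 1, 2, 2, 3] : Fin 6 → ℕ) i) :
    S.lead t N(t, s) ^ 3 =
      (residueHom F₂ S ((r 0).coeff 3) + residueHom F₂ S ((r 1).coeff 2) * S.lead t s)
      + (residueHom F₂ S ((r 2).coeff 2) + residueHom F₂ S ((r 3).coeff 1)
          * S.lead t s) * S.lead t N(t, s)
      + (residueHom F₂ S ((r 4).coeff 1) + residueHom F₂ S ((r 5).coeff 0)
          * S.lead t s) * S.lead t N(t, s) ^ 2 := by
  have ht := h.ord_eq
  have ht0 : t ≠ 0 := S.ne_zero_of_ord_ne_zero (by omega)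
  have hσ := S.mul_inv_mem ht (mem_V h.mem₂)
  have hτ := S.mul_inv_mem ht (mem_V h.mem₃)
  have hA : ∀ i k, 3 - (![0, 1, 1, 2, 2, 3] : Fin 6 → ℕ) i = k →
      aeval t (r i) * t⁻¹ ^ k ∈ S.1 ∧
        S.res (aeval t (r i) * t⁻¹ ^ k) = residueHom F₂ S ((r i).coeff k) := by
    intro i k hk
    have := S.res_aeval ht (hk ▸ hd i)
    rwa [← Place.residueHom_coeff] at this
  have a0 := hA 0 3 rfl
  have a1 := hA 1 2 rfl
  have a2 := hA 2 2 rfl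
  have a3 := hA 3 1 rfl
  have a4 := hA 4 1 rfl
  have a5 := hA 5 0 rfl
  rw [Fin.sum_univ_six] at hr
  change N(t, s) ^ 3 = aeval t (r 0) * 1 + aeval t (r 1) * s
    + aeval t (r 2) * N(t, s) + aeval t (r 3) * (N(t, s) * s)
    + aeval t (r 4) * N(t, s) ^ 2
    + aeval t (r 5) * (N(t, s) ^ 2 * s) at hr
  unfold Place.lead
  generalize s ^ 2 + t * s + t ^ 2 = N at *
  have e1 : (N * t⁻¹) ^ 3 = aeval t (r 0) * t⁻¹ ^ 3 + aeval t (r 1) * t⁻¹ ^ 2 * (s * t⁻¹)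
      + (aeval t (r 2) * t⁻¹ ^ 2 + aeval t (r 3) * t⁻¹ ^ 1 * (s * t⁻¹)) * (N * t⁻¹)
      + (aeval t (r 4) * t⁻¹ ^ 1 + aeval t (r 5) * t⁻¹ ^ 0 * (s * t⁻¹)) * (N * t⁻¹) ^ 2 := by
    linear_combination t⁻¹ ^ 3 * hr
  have b0 := mul_mem a1.1 hσ
  have b1 := mul_mem a3.1 hσ
  have b2 := mul_mem a5.1 hσ
  have c1 := add_mem a2.1 b1
  have c2 := add_mem a4.1 b2
  rw [← S.res_pow hτ, e1, S.res_add (add_mem (add_mem a0.1 b0) (mul_mem c1 hτ))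
    (mul_mem c2 (pow_mem hτ 2)), S.res_add (add_mem a0.1 b0) (mul_mem c1 hτ), S.res_add a0.1 b0,
    S.res_mul c1 hτ, S.res_mul c2 (pow_mem hτ 2), S.res_pow hτ, S.res_add a2.1 b1,
    S.res_add a4.1 b2, S.res_mul a1.1 hσ, S.res_mul a3.1 hσ, S.res_mul a5.1 hσ, a0.2, a1.2, a2.2,
    a3.2, a4.2, a5.2]

lemma norm_translate (t s : K) (a b : F₂) :
    (s + algebraMap _ K a) ^ 2 + (t + algebraMap _ K b) * (s + algebraMap _ K a)
      + (t + algebraMap _ K b) ^ 2 =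
    s ^ 2 + t * s + t ^ 2 + (algebraMap _ K a * t + algebraMap _ K b * s
      + algebraMap _ K (a + a * b + b)) := by
  simp only [map_add, map_mul]
  linear_combination algebraMap_sq (K := K) a + algebraMap_sq (K := K) b
    + (algebraMap _ K a * s + algebraMap _ K b * t) * two_eq_zero K

lemma norm_rotate (t s : K) : (s + t) ^ 2 + s * (s + t) + s ^ 2 = s ^ 2 + t * s + t ^ 2 := by
  linear_combination (s ^ 2 + s * t) * two_eq_zero K

lemma const_mul_mem {D : Divisor F₂ K} (a : F₂) (hf : f ∈ L D) :
    algebraMap _ K a * f ∈ L D := by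
  rw [← Algebra.smul_def]; exact Submodule.smul_mem _ a hf

lemma const_mem (S : Place F₂ K) (a : F₂) :
    algebraMap _ K a ∈ L (single S 1 : Divisor F₂ K) := by
  rw [← mul_one (algebraMap _ K a)]
  exact const_mul_mem a (one_mem_L (single_nonneg' S zero_le_one))

lemma translate (h : IsTangentPair S t s) (a b : F₂) :
    IsTangentPair S (t + algebraMap _ K b) (s + algebraMap _ K a) where
  mem₁ := add_mem h.mem₁ (const_mem S b)
  mem₂ := add_mem h.mem₂ (const_mem S a)
  mem₃ := by
    rw [norm_translate]
    exact add_mem h.mem₃ (add_mem (add_mem (const_mul_mem a h.mem₁) (const_mul_mem b h.mem₂))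
      (const_mem S _))
  indep := by
    refine h.indep.map (fun e₀ e₁ e₂ e₃ => (e₀ + e₁ * b + e₂ * a + e₃ * (a + a * b + b),
      e₁ + e₃ * a, e₂ + e₃ * b, e₃)) (fun e₀ e₁ e₂ e₃ h0 => ?_) fun e₀ e₁ e₂ e₃ => ?_
    · simp only [Prod.mk_eq_zero] at h0
      obtain ⟨h1, h2, h3, rfl⟩ := h0
      simp only [zero_mul, add_zero] at h2 h3
      subst h2 h3
      simpa using h1
    · rw [norm_translate]
      simp only [map_add, map_mul]
      ring

lemma rotate (h : IsTangentPair S t s) : IsTangentPair S s (s + t) where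
  mem₁ := h.mem₂
  mem₂ := add_mem h.mem₂ h.mem₁
  mem₃ := by rw [norm_rotate]; exact h.mem₃
  indep := by
    refine h.indep.map (fun e₀ e₁ e₂ e₃ => (e₀, e₂, e₁ + e₂, e₃)) (fun e₀ e₁ e₂ e₃ h0 => ?_)
      fun e₀ e₁ e₂ e₃ => ?_
    · simp only [Prod.mk_eq_zero] at h0
      obtain ⟨h1, h2, h3, h4⟩ := h0
      subst h2
      exact ⟨h1, by simpa using h3, rfl, h4⟩
    · rw [norm_rotate]
      simp only [map_add]
      ring

lemma lead_const (h : IsTangentPair S t s) (a : F₂) : S.lead t (algebraMap _ K a) = 0 :=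
  (S.lead_eq_zero_iff h.ord_eq (mem_V (const_mem S a))).2 (S.const_mem_V a)

lemma lead_translate (h : IsTangentPair S t s) (a b : F₂)
    (hf : f ∈ L (single S 1 : Divisor F₂ K)) :
    S.lead (t + algebraMap _ K b) f = S.lead t f := by
  have h1 := S.lead_mul_lead h.ord_eq (h.translate a b).ord_eq (mem_V hf)
  rwa [S.lead_add h.ord_eq (mem_V h.mem₁) (mem_V (const_mem S b)), h.lead_const,
    S.lead_self h.ord_eq, add_zero, mul_one] at h1

lemma lead_translate_norm (h : IsTangentPair S t s) (a b : F₂) :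
    S.lead (t + algebraMap _ K b) ((s + algebraMap _ K a) ^ 2
      + (t + algebraMap _ K b) * (s + algebraMap _ K a) + (t + algebraMap _ K b) ^ 2) =
    S.lead t N(t, s)
      + (residueHom F₂ S a + residueHom F₂ S b * S.lead t s) := by
  have ht := h.ord_eq
  have m1 := const_mul_mem a h.mem₁
  have m2 := const_mul_mem b h.mem₂
  rw [h.lead_translate a b (h.translate a b).mem₃, norm_translate,
    S.lead_add ht (mem_V h.mem₃) (mem_V (add_mem (add_mem m1 m2) (const_mem S _))),
    S.lead_add ht (mem_V (add_mem m1 m2)) (mem_V (const_mem S _)), h.lead_const,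
    S.lead_add ht (mem_V m1) (mem_V m2), S.lead_const_mul ht (mem_V h.mem₁),
    S.lead_const_mul ht (mem_V h.mem₂), S.lead_self ht, mul_one, add_zero]

lemma lead_ne_zero (h : IsTangentPair S t s) : S.lead t s ≠ 0 := fun h0 => by
  have := h.lead_sq
  simp [h0] at this

lemma lead_rotate_second (h : IsTangentPair S t s) : S.lead s (s + t) = S.lead t s := by
  have := S.charTwo_residueField
  have h1 := S.lead_mul_lead h.ord_eq h.rotate.ord_eq (mem_V h.rotate.mem₂)
  rw [S.lead_add h.ord_eq (mem_V h.mem₂) (mem_V h.mem₁), S.lead_self h.ord_eq] at h1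
  refine mul_right_cancel₀ h.lead_ne_zero ?_
  rw [h1]
  linear_combination -h.lead_sq + (S.lead t s + 1) *
    CharTwo.two_eq_zero (R := ResidueField S.1)

lemma lead_rotate_norm (h : IsTangentPair S t s) :
    S.lead s ((s + t) ^ 2 + s * (s + t) + s ^ 2) * S.lead t s =
      S.lead t N(t, s) := by
  rw [norm_rotate]
  exact S.lead_mul_lead h.ord_eq h.rotate.ord_eq (mem_V h.mem₃)

end IsTangentPair

section FieldOfFour

variable {k : Type*} [Field k] [CharP k 2] {ζ θ A B r : k}

lemma eq_of_pow_four_eq (hζ : ζ ^ 2 + ζ + 1 = 0) (hA : A ^ 4 = A) :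
    A = 0 ∨ A = 1 ∨ A = ζ ∨ A = ζ + 1 := by
  have h2 : (2 : k) = 0 := CharTwo.two_eq_zero
  have h : A * ((A - 1) * ((A - ζ) * (A - (ζ + 1)))) = 0 := by
    linear_combination hA + (A ^ 2 - A) * hζ + (-A ^ 3 - ζ * A ^ 3 + ζ * A ^ 2 + A) * h2
  rcases mul_eq_zero.1 h with h | h
  · exact Or.inl h
  rcases mul_eq_zero.1 h with h | h
  · exact Or.inr (Or.inl (sub_eq_zero.1 h))
  rcases mul_eq_zero.1 h with h | h
  · exact Or.inr (Or.inr (Or.inl (sub_eq_zero.1 h)))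
  · exact Or.inr (Or.inr (Or.inr (sub_eq_zero.1 h)))

lemma cube_ne_of_cube_eq (hθ : θ ^ 64 = θ) (h4 : θ ^ 4 ≠ θ) (hB : B ^ 4 = B)
    (h : θ ^ 3 = A + B * θ) (hr : r ^ 4 = r) : r ^ 3 ≠ A + B * r := by
  intro h1
  have h2 : (2 : k) = 0 := CharTwo.two_eq_zero
  have h3 : (θ - r) * ((r ^ 2 + B) + r * θ + 1 * θ ^ 2) = 0 := by
    linear_combination h - h1 + B * (θ - r) * h2
  rcases mul_eq_zero.1 h3 with h3 | h3
  · rw [sub_eq_zero.1 h3] at h4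
    exact h4 hr
  · have h5 : (r ^ 2 + B) ^ 4 = r ^ 2 + B := by
      rw [add_pow_four, hB, ← pow_mul, mul_comm 2 4, pow_mul, hr]
    exact one_ne_zero (eq_zero_of_quadratic hθ h4 h5 hr (one_pow 4) h3).2.2

end FieldOfFour

namespace IsTangentPair

variable {K : Type*} [Field K] [Algebra F₂ K] [hF : Fact (IsFunctionField F₂ K)]
  [hC : Fact (HasExactConstants F₂ K)] [hG : Fact (GenusFourClassOne K)]
  {S : Place F₂ K} {t s f : K} {A B : ResidueField S.1}

lemma lead_second_pow_four (h : IsTangentPair S t s) : S.lead t s ^ 4 = S.lead t s := by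
  have := S.coeff_pow_four h.lead_sq 0 1
  simpa using this

/-- The three normal shapes of the leading equation. -/
def IsNormal (S : Place F₂ K) (t s : K) : Prop :=
  S.lead t N(t, s) ^ 3 = 1 + S.lead t N(t, s) ∨
  S.lead t N(t, s) ^ 3 = S.lead t s ∨
  S.lead t N(t, s) ^ 3 = 1 + S.lead t s

lemma isNormal_of_cube (h : IsTangentPair S t s) (hS : deg₂ S = 6)
    (hA : A ^ 4 = A) (hB : B = 0 ∨ B = 1)
    (h3 : S.lead t N(t, s) ^ 3 = A + B * S.lead t N(t, s)) :
    IsNormal S t s := by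
  have := S.charTwo_residueField
  have h2 : (2 : ResidueField S.1) = 0 := CharTwo.two_eq_zero
  have hB4 : B ^ 4 = B := by rcases hB with rfl | rfl <;> simp
  have h64 := S.residue_pow_eq (S.lead t N(t, s))
  rw [hS] at h64
  have hno : ∀ r : ResidueField S.1, r ^ 4 = r → r ^ 3 ≠ A + B * r := fun r hr =>
    cube_ne_of_cube_eq h64 h.lead_pow_four_ne hB4 h3 hr
  have h0 := hno 0 (by simp)
  have h1 := hno 1 (by simp)
  have hz := h.lead_sq
  have hζ := hno (S.lead t s) h.lead_second_pow_four
  have hζ2 := hno (S.lead t s + 1) (by rw [add_pow_four, h.lead_second_pow_four, one_pow])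
  rcases hB with rfl | rfl
  · rcases eq_of_pow_four_eq hz hA with rfl | rfl | rfl | rfl
    · simp at h0
    · simp at h1
    · exact Or.inr (Or.inl (by simpa using h3))
    · exact Or.inr (Or.inr (by simpa [add_comm] using h3))
  · rcases eq_of_pow_four_eq hz hA with rfl | rfl | rfl | rfl
    · simp at h0
    · exact Or.inl (by simpa using h3)
    · exact (hζ2 (by linear_combination (S.lead t s + 2) * hz - (S.lead t s + 1) * h2)).elim
    · exact (hζ (by linear_combination (S.lead t s - 1) * hz - S.lead t s * h2)).elim

lemma cube_rotate (h : IsTangentPair S t s)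
    (h3 : S.lead t N(t, s) ^ 3 = A + B * S.lead t N(t, s)) :
    S.lead s ((s + t) ^ 2 + s * (s + t) + s ^ 2) ^ 3 =
      A + B * S.lead t s * S.lead s ((s + t) ^ 2 + s * (s + t) + s ^ 2) := by
  rw [← h.lead_rotate_norm] at h3
  linear_combination h3 - S.lead s ((s + t) ^ 2 + s * (s + t) + s ^ 2) ^ 3 *
    (S.lead t s - 1) * h.lead_sq

lemma exists_isNormal_of_cube (h : IsTangentPair S t s) (hS : deg₂ S = 6)
    (hA : A ^ 4 = A) (hB : B ^ 4 = B)
    (h3 : S.lead t N(t, s) ^ 3 = A + B * S.lead t N(t, s)) :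
    ∃ t s, IsTangentPair S t s ∧ IsNormal S t s := by
  have := S.charTwo_residueField
  have h2 : (2 : ResidueField S.1) = 0 := CharTwo.two_eq_zero
  have hz := h.lead_sq
  rcases eq_of_pow_four_eq hz hB with hB | hB | rfl | rfl
  · exact ⟨t, s, h, h.isNormal_of_cube hS hA (Or.inl hB) h3⟩
  · exact ⟨t, s, h, h.isNormal_of_cube hS hA (Or.inr hB) h3⟩
  · have h4 := h.rotate.cube_rotate (h.cube_rotate h3)
    refine ⟨_, _, h.rotate.rotate, h.rotate.rotate.isNormal_of_cube hS hA (Or.inr ?_) h4⟩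
    rw [h.lead_rotate_second]
    linear_combination (S.lead t s - 1) * hz
  · refine ⟨_, _, h.rotate, h.rotate.isNormal_of_cube hS hA (Or.inr ?_) (h.cube_rotate h3)⟩
    linear_combination hz - h2

lemma exists_isNormal (h : IsTangentPair S t s) (hS : deg₂ S = 6) :
    ∃ t s, IsTangentPair S t s ∧ IsNormal S t s := by
  have := S.charTwo_residueField
  have h2 : (2 : ResidueField S.1) = 0 := CharTwo.two_eq_zero
  obtain ⟨r, hr, hd⟩ := h.exists_relation hS
  have h3 := h.lead_cube hr hd
  have hA := S.coeff_pow_four h.lead_sq ((r 0).coeff 3) ((r 1).coeff 2)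
  have hB := S.coeff_pow_four h.lead_sq ((r 2).coeff 2) ((r 3).coeff 1)
  have hc := S.coeff_pow_four h.lead_sq ((r 4).coeff 1) ((r 5).coeff 0)
  have h' := h.translate ((r 4).coeff 1) ((r 5).coeff 0)
  have hN := h.lead_translate_norm ((r 4).coeff 1) ((r 5).coeff 0)
  generalize residueHom F₂ S ((r 0).coeff 3) + residueHom F₂ S ((r 1).coeff 2) *
    S.lead t s = A at *
  generalize residueHom F₂ S ((r 2).coeff 2) + residueHom F₂ S ((r 3).coeff 1) *
    S.lead t s = B at *
  generalize residueHom F₂ S ((r 4).coeff 1) + residueHom F₂ S ((r 5).coeff 0) *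
    S.lead t s = D at *
  refine h'.exists_isNormal_of_cube hS (A := A + B * D) (B := B + D ^ 2) ?_ ?_ ?_
  · rw [add_pow_four, mul_pow, hA, hB, hc]
  · rw [add_pow_four, hB, ← pow_mul, mul_comm 2 4, pow_mul, hc]
  · rw [hN]
    generalize S.lead t N(t, s) = θ at *
    linear_combination h3 + (2 * θ ^ 2 * D + θ * D ^ 2 - B * D) * h2

end IsTangentPair

section SexticSearch

lemma testBit_stateL {l : List (ℕ³ × ℕ)} {t : ℕ³} {j : ℕ}
    (h : ∀ e ∈ l, e.2.testBit j = decide (e.1 = t)) (ε : ℕ³ → F₂) :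
    (stateL l ε).testBit j =
      (decide (ε t = 1) && decide ((l.map Prod.fst).count t % 2 = 1)) := by
  induction l with
  | nil => simp [stateL]
  | cons e l ih =>
    have h1 := ih fun e' he' => h e' (List.mem_cons_of_mem _ he')
    have h2 := h e List.mem_cons_self
    rw [stateL, List.foldr_cons, Nat.testBit_xor]
    change Bool.xor _ ((stateL l ε).testBit j) = _
    rw [h1, List.map_cons, List.count_cons]
    by_cases het : e.1 = t
    · rw [het, decide_eq_true rfl] at h2
      rw [het]
      by_cases hε : ε t = 1
      · simp only [hε, if_true, h2, decide_true, Bool.true_and, beq_self_eq_true]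
        rcases Nat.mod_two_eq_zero_or_one ((l.map Prod.fst).count t) with h3 | h3 <;>
          simp [h3, Nat.add_mod]
      · simp [hε]
    · rw [decide_eq_false het] at h2
      have : (if ε e.1 = 1 then e.2 else 0).testBit j = false := by
        split_ifs
        · exact h2
        · exact Nat.zero_testBit j
      simp [this, het]

lemma degree_polyL_lt {l : List (ℕ³ × ℕ)} {n : ℕ}
    (h : ∀ e ∈ l, 2 * e.1.1 + e.1.2.2 < n) (ε : ℕ³ → F₂) :
    (polyL l ε).degree < n := by
  induction l with
  | nil => simp [polyL]
  | cons e l ih =>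
    rw [polyL, List.map_cons, List.sum_cons]
    refine (degree_add_le _ _).trans_lt (max_lt ?_
      (ih fun e' he' => h e' (List.mem_cons_of_mem _ he')))
    refine degree_le_natDegree.trans_lt (WithBot.coe_lt_coe.2 ?_)
    refine lt_of_le_of_lt ?_ (h e List.mem_cons_self)
    have h1 : normForm.natDegree ≤ 2 := by unfold normForm; compute_degree
    have h2 : (normForm ^ e.1.1).natDegree ≤ 2 * e.1.1 :=
      natDegree_pow_le.trans (by rw [mul_comm]; exact Nat.mul_le_mul_right _ h1)
    refine (natDegree_C_mul_le _ _).trans (natDegree_mul_le.trans (add_le_add ?_ ?_))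
    · exact (natDegree_mul_C_le _ _).trans h2
    · exact natDegree_X_pow_le _

lemma monic_normForm_pow (k : ℕ) : (normForm ^ k).Monic ∧ (normForm ^ k).natDegree = 2 * k := by
  have h1 : normForm.Monic := by unfold normForm; monicity!
  have h2 : normForm.natDegree = 2 := by unfold normForm; compute_degree!
  refine ⟨h1.pow k, ?_⟩
  rw [h1.natDegree_pow, h2, mul_comm]

lemma monic_polyL_cons {l : List (ℕ³ × ℕ)} {k m : ℕ}
    (h : ∀ e ∈ l, 2 * e.1.1 + e.1.2.2 < 2 * k) {ε : ℕ³ → F₂} (hε : ε (k, 0, 0) = 1) :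
    (polyL (((k, 0, 0), m) :: l) ε).Monic ∧
      (polyL (((k, 0, 0), m) :: l) ε).degree = ((2 * k : ℕ) : WithBot ℕ) := by
  obtain ⟨h1, h2⟩ := monic_normForm_pow k
  have h3 : polyL (((k, 0, 0), m) :: l) ε = normForm ^ k + polyL l ε := by
    simp [polyL, mon, hε]
  have h4 : (polyL l ε).degree < (normForm ^ k).degree := by
    rw [degree_eq_natDegree h1.ne_zero, h2]
    exact degree_polyL_lt h ε
  rw [h3]
  refine ⟨h1.add_of_left h4, ?_⟩
  rw [degree_add_eq_left_of_degree_lt h4, degree_eq_natDegree h1.ne_zero, h2]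

/-- Points for the search of models of degree six. -/
def sexticClasses (M₁ M₂ M₃ M₄ : ℕ) : List PointClass :=
  [⟨1, 2, [(0, 0, 12), (0, 1, 13), (1, 0, 14), (1, 1, 15)], M₁⟩, ⟨2, 7, [(0, 2, 16), (1, 2, 18),
    (2, 0, 20), (2, 1, 22), (2, 2, 24), (2, 3, 26)], M₂⟩, ⟨3, 11, [(0, 2, 28), (0, 3, 31), (1,
    2, 34), (1, 3, 37), (2, 0, 40), (2, 1, 43), (2, 2, 46), (2, 3, 49), (2, 4, 52), (2, 5, 55),
    (2, 6, 58), (2, 7, 61), (3, 0, 64), (3, 1, 67), (3, 2, 70), (3, 3, 73), (3, 4, 76), (3, 5,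
    79), (3, 6, 82), (3, 7, 85)], M₃⟩, ⟨4, 19, [(0, 2, 88), (0, 8, 92), (0, 9, 96), (1, 2, 100),
    (1, 8, 104), (1, 9, 108), (2, 0, 112), (2, 1, 116), (2, 2, 120), (2, 3, 124), (2, 4, 128),
    (2, 5, 132), (2, 6, 136), (2, 7, 140), (2, 8, 144), (2, 9, 148), (2, 10, 152), (2, 11, 156),
    (2, 12, 160), (2, 13, 164), (2, 14, 168), (2, 15, 172), (6, 2, 176), (6, 4, 180), (6, 8,
    184), (6, 9, 188), (6, 10, 192), (6, 11, 196), (8, 0, 200), (8, 1, 204), (8, 2, 208), (8, 3,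
    212), (8, 4, 216), (8, 5, 220), (8, 6, 224), (8, 7, 228), (8, 8, 232), (8, 9, 236), (8, 10,
    240), (8, 11, 244), (8, 12, 248), (8, 13, 252), (8, 14, 256), (8, 15, 260), (9, 0, 264), (9,
    1, 268), (9, 2, 272), (9, 3, 276), (9, 4, 280), (9, 5, 284), (9, 6, 288), (9, 7, 292), (9,
    8, 296), (9, 9, 300), (9, 10, 304), (9, 11, 308), (9, 12, 312), (9, 13, 316), (9, 14, 320),
    (9, 15, 324)], M₄⟩]

/-- The leading monomial and its values. -/
def sexticFixed : List (ℕ³ × ℕ) :=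
  [((3, 0, 0),
    515946230038620877431515423755320169676603263695971294633230057085288966836847211338658710614564864)]

/-- The other monomials and their values. -/
def sexticTable : List (ℕ³ × ℕ) :=
  [((0, 3, 0),
    546812681195752981083244631831154359327850137554037466746226860688644189531673269326724731956936705),
    ((0, 2, 1),
    262487956396759591284045783360155766851834227657795810982399885811371625144860390610146118225920002),
    ((1, 2, 0),
    540814634476225035447963468395801592845563752205733346493006377652798044337585098563405734834388996),
    ((0, 0, 0),
    36454178746383532072875037118627022755886157181553540607096176773499216676902742325827701094871048),
    ((0, 1, 0),
    328087608717451788653899149077993008400865544725057467451999373971235174619485625345106913813381136),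
    ((0, 2, 0),
    473904323702985916945399297552501099424088785848805229912216892222564615166018846062909238505947168),
    ((0, 0, 1),
    544382402612660745653219514139233348919515276402889249712809312741250881834240370336871446099959872),
    ((0, 1, 1),
    495472003149595037089717518995769037610105548513432464173654682706366904595590988605535735173906560),
    ((1, 0, 0),
    311357684263210663935291251865477549821570789844821174257523984692257835959926891874018228893376768),
    ((1, 1, 0),
    464328987291021212106980680021571793832940143087754561706960724066846887534844346128339569696883200),
    ((1, 0, 1),
    508810813379042305840789146204168606708147390150131575761623876616060777824113536183560060667012096),
    ((2, 0, 0),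
    448455096013920578288367683722727727798456378548463061217529239128537576200927056025769400433043456)]

/-- The states which need not be considered or violate both systems of bounds. -/
def sexticBad (s : ℕ) : Bool :=
  cond (cond (s.testBit 0) (cond (s.testBit 1) (!s.testBit 2) (s.testBit 2))
      (cond (s.testBit 1) (!s.testBit 2) false))
    (cond (overfull (sexticClasses 1 0 0 2) s) (overfull (sexticClasses 0 1 1 2) s) false) true

lemma sexticWith_check : classesCheck (sexticClasses 1 0 0 2) sexticFixed sexticTable = true := by
  decide +kernel

lemma sexticWithout_check :
    classesCheck (sexticClasses 0 1 1 2) sexticFixed sexticTable = true := by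
  decide +kernel

lemma sextic_lowBits : ∀ p ∈ (sexticTable.map Prod.fst).zipIdx, ∀ e ∈ sexticFixed ++ sexticTable,
    e.2.testBit p.2 = decide (e.1 = p.1) := by
  decide +kernel

lemma sextic_search : searchTree (fun s => cond (sexticBad s) true
    ([797, 1035, 1546, 3149, 3677].elem (s % 4096))) (sexticTable.map Prod.snd)
    ((sexticFixed.map Prod.snd).foldr (· ^^^ ·) 0) = true := by
  decide +kernel

end SexticSearch

/-- The coefficients of a relation in terms of the basis of the function field. -/
def sexticCoeff (r : Fin 6 → F₂[X]) (e : ℕ³) : F₂ :=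
  if e.1 = 3 then 1 else (r (Fin.ofNat 6 (2 * e.1 + e.2.2))).coeff e.2.1

namespace IsTangentPair

variable {K : Type*} [Field K] [Algebra F₂ K] [hF : Fact (IsFunctionField F₂ K)]
  [hC : Fact (HasExactConstants F₂ K)] [hG : Fact (GenusFourClassOne K)]
  {S : Place F₂ K} {t s f : K}

lemma IsNormal.exists_coeff (hn : IsNormal S t s) : ∃ a b c : F₂,
    (a = 1 ∧ b = 0 ∧ c = 1 ∨ a = 0 ∧ b = 1 ∧ c = 0 ∨ a = 1 ∧ b = 1 ∧ c = 0) ∧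
      S.lead t N(t, s) ^ 3 = (residueHom F₂ S a + residueHom F₂ S b *
        S.lead t s) + residueHom F₂ S c * S.lead t N(t, s) := by
  rcases hn with hn | hn | hn
  · exact ⟨1, 0, 1, Or.inl ⟨rfl, rfl, rfl⟩, by rw [hn]; simp⟩
  · exact ⟨0, 1, 0, Or.inr (Or.inl ⟨rfl, rfl, rfl⟩), by rw [hn]; simp⟩
  · exact ⟨1, 1, 0, Or.inr (Or.inr ⟨rfl, rfl, rfl⟩), by rw [hn]; simp⟩

lemma zmod_two_eq_of_add_eq_zero {a b : F₂} (h : a + b = 0) : a = b := by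
  revert a b; decide

lemma coeff_of_isNormal (h : IsTangentPair S t s) (hS : deg₂ S = 6)
    (hn : IsNormal S t s) {r : Fin 6 → F₂[X]}
    (hr : N(t, s) ^ 3 = ∑ i, aeval t (r i) * basis t s i)
    (hd : ∀ i, (r i).natDegree ≤ 3 - (![0, 1, 1, 2, 2, 3] : Fin 6 → ℕ) i) :
    ((r 0).coeff 3 = 1 ∧ (r 1).coeff 2 = 0 ∧ (r 2).coeff 2 = 1 ∨
      (r 0).coeff 3 = 0 ∧ (r 1).coeff 2 = 1 ∧ (r 2).coeff 2 = 0 ∨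
      (r 0).coeff 3 = 1 ∧ (r 1).coeff 2 = 1 ∧ (r 2).coeff 2 = 0) ∧
    (r 3).coeff 1 = 0 ∧ (r 4).coeff 1 = 0 ∧ (r 5).coeff 0 = 0 := by
  have := S.charTwo_residueField
  have h2 : (2 : ResidueField S.1) = 0 := CharTwo.two_eq_zero
  obtain ⟨a, b, c, habc, h3⟩ := hn.exists_coeff
  have h4 := h.lead_cube hr hd
  obtain ⟨hA, hB, hD⟩ := S.lead_quadratic hS h.lead_pow_four_ne (S.coeff_pow_four h.lead_sq ((r 0).coeff 3 + a)
    ((r 1).coeff 2 + b)) (S.coeff_pow_four h.lead_sq ((r 2).coeff 2 + c) ((r 3).coeff 1))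
    (S.coeff_pow_four h.lead_sq ((r 4).coeff 1) ((r 5).coeff 0)) (by
      simp only [map_add]
      generalize S.lead t N(t, s) = θ at *
      linear_combination h3 - h4 + (residueHom F₂ S a + residueHom F₂ S b *
        S.lead t s + residueHom F₂ S c * θ) * h2)
  obtain ⟨h5, h6⟩ := S.coeff_eq_zero h.lead_sq hA
  obtain ⟨h7, h8⟩ := S.coeff_eq_zero h.lead_sq hB
  obtain ⟨h9, h10⟩ := S.coeff_eq_zero h.lead_sq hD
  rw [zmod_two_eq_of_add_eq_zero h5, zmod_two_eq_of_add_eq_zero h6, zmod_two_eq_of_add_eq_zero h7]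
  exact ⟨habc, h8, h9, h10⟩

lemma aeval_eq_of_natDegree_le {n : ℕ} {p : F₂[X]} (hp : p.natDegree ≤ n) (x : K) :
    aeval x p = ∑ i ∈ Finset.range (n + 1), algebraMap F₂ K (p.coeff i) * x ^ i := by
  rw [aeval_eq_sum_range' (Nat.lt_succ_of_le hp)]
  simp only [Algebra.smul_def]

lemma ev_polyL_sextic {r : Fin 6 → F₂[X]}
    (hr : N(t, s) ^ 3 = ∑ i, aeval t (r i) * basis t s i)
    (hd : ∀ i, (r i).natDegree ≤ 3 - (![0, 1, 1, 2, 2, 3] : Fin 6 → ℕ) i)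
    (h3 : (r 3).coeff 1 = 0) (h4 : (r 4).coeff 1 = 0) (h5 : (r 5).coeff 0 = 0) :
    ev t s (polyL (sexticFixed ++ sexticTable) (sexticCoeff r)) = 0 := by
  have e0 := aeval_eq_of_natDegree_le (n := 3) (hd 0) t
  have e1 := aeval_eq_of_natDegree_le (n := 2) (hd 1) t
  have e2 := aeval_eq_of_natDegree_le (n := 2) (hd 2) t
  have e3 := aeval_eq_of_natDegree_le (n := 1) (hd 3) t
  have e4 := aeval_eq_of_natDegree_le (n := 1) (hd 4) t
  have e5 := aeval_eq_of_natDegree_le (n := 0) (hd 5) t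
  simp only [Finset.sum_range_succ, Finset.sum_range_zero, zero_add, h3, h4, h5, map_zero,
    zero_mul, add_zero, pow_zero, mul_one] at e0 e1 e2 e3 e4 e5
  rw [Fin.sum_univ_six] at hr
  change N(t, s) ^ 3 = aeval t (r 0) * 1 + aeval t (r 1) * s
    + aeval t (r 2) * N(t, s) + aeval t (r 3) * (N(t, s) * s)
    + aeval t (r 4) * N(t, s) ^ 2
    + aeval t (r 5) * (N(t, s) ^ 2 * s) at hr
  rw [e0, e1, e2, e3, e4, e5] at hr
  have hl : (sexticFixed ++ sexticTable).map Prod.fst = [(3, 0, 0), (0, 3, 0), (0, 2, 1),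
    (1, 2, 0), (0, 0, 0), (0, 1, 0), (0, 2, 0), (0, 0, 1), (0, 1, 1), (1, 0, 0), (1, 1, 0),
    (1, 0, 1), (2, 0, 0)] := rfl
  rw [polyL_eq_map, hl]
  have c0 : sexticCoeff r (3, 0, 0) = 1 := rfl
  have c1 : sexticCoeff r (0, 3, 0) = (r 0).coeff 3 := rfl
  have c2 : sexticCoeff r (0, 2, 1) = (r 1).coeff 2 := rfl
  have c3 : sexticCoeff r (1, 2, 0) = (r 2).coeff 2 := rfl
  have c4 : sexticCoeff r (0, 0, 0) = (r 0).coeff 0 := rfl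
  have c5 : sexticCoeff r (0, 1, 0) = (r 0).coeff 1 := rfl
  have c6 : sexticCoeff r (0, 2, 0) = (r 0).coeff 2 := rfl
  have c7 : sexticCoeff r (0, 0, 1) = (r 1).coeff 0 := rfl
  have c8 : sexticCoeff r (0, 1, 1) = (r 1).coeff 1 := rfl
  have c9 : sexticCoeff r (1, 0, 0) = (r 2).coeff 0 := rfl
  have c10 : sexticCoeff r (1, 1, 0) = (r 2).coeff 1 := rfl
  have c11 : sexticCoeff r (1, 0, 1) = (r 3).coeff 0 := rfl
  have c12 : sexticCoeff r (2, 0, 0) = (r 4).coeff 0 := rfl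
  simp only [List.map_cons, List.map_nil, List.sum_cons, List.sum_nil, c0, c1, c2, c3, c4, c5, c6,
    c7, c8, c9, c10, c11, c12, map_add, map_mul, ev_C, aeval_C, ev_mon, map_one, map_zero]
  linear_combination -hr + N(t, s) ^ 3 * two_eq_zero K

end IsTangentPair

lemma sexticWithClasses_spec : ∀ c ∈ sexticClasses 1 0 0 2, (c.d = 1 ∧ c.M = 1) ∨
    (c.d = 4 ∧ c.M = 2) ∨ (1 < c.d ∧ c.d ≤ 3 ∧ c.M = 0) := by
  decide +kernel

lemma sexticWithoutClasses_spec : ∀ c ∈ sexticClasses 0 1 1 2, (c.d = 1 ∧ c.M = 0) ∨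
    (c.d = 4 ∧ c.M = 2) ∨ (c.d ≤ 3 ∧ c.M = 1) := by
  decide +kernel

lemma degree_sexticTable : ∀ e ∈ sexticTable, 2 * e.1.1 + e.1.2.2 < 2 * 3 := by
  decide +kernel

namespace IsTangentPair

variable {K : Type*} [Field K] [Algebra F₂ K] [hF : Fact (IsFunctionField F₂ K)]
  [hC : Fact (HasExactConstants F₂ K)] [hG : Fact (GenusFourClassOne K)]
  {S : Place F₂ K} {t s f : K}

lemma overfull_eq_false (h : IsTangentPair S t s) (hS : deg₂ S = 6)
    {ε : ℕ³ → F₂} (hε : ε (3, 0, 0) = 1)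
    (h0 : ev t s (polyL (sexticFixed ++ sexticTable) ε) = 0) :
    overfull (sexticClasses 1 0 0 2) (stateL (sexticFixed ++ sexticTable) ε) = false ∨
      overfull (sexticClasses 0 1 1 2) (stateL (sexticFixed ++ sexticTable) ε) = false := by
  obtain ⟨hmon, hdeg⟩ := monic_polyL_cons (k := 3) (m := (sexticFixed.map Prod.snd).sum)
    degree_sexticTable hε
  have hdvd : ∀ r, ev t s r = 0 → polyL (sexticFixed ++ sexticTable) ε ∣ r :=
    dvd_of_ev_eq_zero hmon h0 fun r hr hr0 => h.eq_zero_of_ev hS r (lt_of_lt_of_eq hr hdeg) hr0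
  have ht : S.ord t < 0 := by rw [h.ord_eq]; norm_num
  have hR : ∀ n : ℕ, ∀ f ∈ L (single S (n : ℤ)), ∃ r, f = ev t s r :=
    fun n f hf => h.exists_ev hS hf
  have hmin : ∀ D : Divisor F₂ K, deg D = 2 → el D ≤ 1 := fun D hD => by
    have := el_lt_two_of_deg_lt_four (D := D) (by omega)
    omega
  by_cases h1 : ∃ P : Place F₂ K, deg₂ P = 1
  · obtain ⟨P, hP⟩ := h1
    refine Or.inl (CFF.overfull_eq_false sexticWith_check ht hR hdvd fun c hc T hT => ?_)
    rcases sexticWithClasses_spec c hc with ⟨hd, hM⟩ | ⟨hd, hM⟩ | ⟨hd, hd3, hM⟩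
    · rw [hM, Finset.card_le_one]
      intro p hp q hq
      exact eq_of_degree_one ((hT p hp).2.1.trans hd) ((hT q hq).2.1.trans hd)
    · rw [hM]
      exact card_places_le_two_of_degree_four hmin T fun p hp => (hT p hp).2.1.trans hd
    · rw [hM]
      refine card_le_zero_of_forall fun p hp => ?_
      have hpd := (hT p hp).2.1
      have := eq_of_degree_le_three_of_rational hP (hpd.trans_le hd3)
      rw [this, hP] at hpd
      omega
  · refine Or.inr (CFF.overfull_eq_false sexticWithout_check ht hR hdvd fun c hc T hT => ?_)
    rcases sexticWithoutClasses_spec c hc with ⟨hd, hM⟩ | ⟨hd, hM⟩ | ⟨hd, hM⟩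
    · rw [hM]
      exact card_le_zero_of_forall fun p hp => h1 ⟨p, (hT p hp).2.1.trans hd⟩
    · rw [hM]
      exact card_places_le_two_of_degree_four hmin T fun p hp => (hT p hp).2.1.trans hd
    · rw [hM, Finset.card_le_one]
      intro p hp q hq
      have hpd := (hT p hp).2.1
      have hqd := (hT q hq).2.1
      refine eq_of_el_le_one_of_place (hpd.trans hqd.symm) ?_
      have := el_lt_two_of_deg_lt_four (D := single q 1) (by
        rw [deg_single, hqd]; omega)
      omega

lemma exists_survivor (h : IsTangentPair S t s) (hS : deg₂ S = 6)
    (hn : IsNormal S t s) : ∃ ε : ℕ³ → F₂, ε (3, 0, 0) = 1 ∧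
      ev t s (polyL (sexticFixed ++ sexticTable) ε) = 0 ∧
      ∃ m ∈ [797, 1035, 1546, 3149, 3677], ∀ p ∈ (sexticTable.map Prod.fst).zipIdx,
        decide (ε p.1 = 1) = m.testBit p.2 := by
  obtain ⟨r, hr, hd⟩ := h.exists_relation hS
  obtain ⟨habc, h3, h4, h5⟩ := h.coeff_of_isNormal hS hn hr hd
  have h0 := ev_polyL_sextic hr hd h3 h4 h5
  refine ⟨sexticCoeff r, rfl, h0, ?_⟩
  have hof := h.overfull_eq_false hS (ε := sexticCoeff r) rfl h0
  have hs := search_append (ε := sexticCoeff r) sextic_search (by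
    intro e he
    rw [List.mem_singleton.1 he]
    rfl)
  have hbit : ∀ p ∈ (sexticTable.map Prod.fst).zipIdx,
      (stateL (sexticFixed ++ sexticTable) (sexticCoeff r)).testBit p.2 =
        decide (sexticCoeff r p.1 = 1) := by
    intro p hp
    have hcount : ∀ p ∈ (sexticTable.map Prod.fst).zipIdx,
        ((sexticFixed ++ sexticTable).map Prod.fst).count p.1 % 2 = 1 := by decide +kernel
    rw [testBit_stateL (sextic_lowBits p hp), hcount p hp, decide_eq_true rfl, Bool.and_true]
  have b0 := hbit ((0, 3, 0), 0) (by decide)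
  have b1 := hbit ((0, 2, 1), 1) (by decide)
  have b2 := hbit ((1, 2, 0), 2) (by decide)
  have c1 : sexticCoeff r (0, 3, 0) = (r 0).coeff 3 := rfl
  have c2 : sexticCoeff r (0, 2, 1) = (r 1).coeff 2 := rfl
  have c3 : sexticCoeff r (1, 2, 0) = (r 2).coeff 2 := rfl
  dsimp only at b0 b1 b2
  rw [c1] at b0
  rw [c2] at b1
  rw [c3] at b2
  generalize stateL (sexticFixed ++ sexticTable) (sexticCoeff r) = m at *
  have hbad : sexticBad m = false := by
    unfold sexticBad
    rw [b0, b1, b2]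
    rcases habc with ⟨h6, h7, h8⟩ | ⟨h6, h7, h8⟩ | ⟨h6, h7, h8⟩ <;> rw [h6, h7, h8] <;>
      rcases hof with hof | hof <;> simp [hof]
  rw [hbad, cond_false] at hs
  refine ⟨m % 4096, List.elem_iff.1 hs, fun p hp => ?_⟩
  have hp12 : ∀ p ∈ (sexticTable.map Prod.fst).zipIdx, p.2 < 12 := by decide +kernel
  rw [← hbit p hp, show 4096 = 2 ^ 12 by norm_num, Nat.testBit_mod_two_pow,
    decide_eq_true (hp12 p hp), Bool.true_and]

lemma norm_shear (t s : K) : (s + t) ^ 2 + t * (s + t) + t ^ 2 = s ^ 2 + t * s + t ^ 2 := by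
  linear_combination (t ^ 2 + s * t) * two_eq_zero K

lemma shear (h : IsTangentPair S t s) : IsTangentPair S t (s + t) where
  mem₁ := h.mem₁
  mem₂ := add_mem h.mem₂ h.mem₁
  mem₃ := by rw [norm_shear]; exact h.mem₃
  indep := by
    refine h.indep.map (fun e₀ e₁ e₂ e₃ => (e₀, e₁ + e₂, e₂, e₃)) (fun e₀ e₁ e₂ e₃ h0 => ?_)
      fun e₀ e₁ e₂ e₃ => ?_
    · simp only [Prod.mk_eq_zero] at h0
      obtain ⟨h1, h2, h3, h4⟩ := h0
      subst h3
      rw [add_zero] at h2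
      exact ⟨h1, h2, rfl, h4⟩
    · rw [norm_shear]
      simp only [map_add]
      ring

lemma ev_polyL_of_testBit {ε : ℕ³ → F₂} (hε : ε (3, 0, 0) = 1) {m : ℕ}
    (hm : ∀ p ∈ (sexticTable.map Prod.fst).zipIdx, decide (ε p.1 = 1) = m.testBit p.2) :
    ev t s (polyL (sexticFixed ++ sexticTable) ε) = N(t, s) ^ 3 +
      ((sexticTable.map Prod.fst).zipIdx.map fun p => cond (m.testBit p.2)
        (N(t, s) ^ p.1.1 * t ^ p.1.2.1 * s ^ p.1.2.2) 0).sum := by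
  rw [polyL_eq_map, map_list_sum, List.map_map, List.map_append, List.map_append, List.sum_append]
  congr 1
  · simp [sexticFixed, hε, ev_mon]
  · conv_lhs => rw [← List.zipIdx_map_fst 0 (sexticTable.map Prod.fst), List.map_map]
    congr 1
    refine List.map_congr_left fun p hp => ?_
    have h1 := hm p hp
    simp only [Function.comp_apply, map_mul, ev_C, aeval_C, ev_mon]
    rcases zmod_two_cases (ε p.1) with h | h
    · rw [← h1, h]; simp
    · rw [← h1, h]; simp

lemma not_norm_relation (h : IsTangentPair S t s) (hS : deg₂ S = 6)
    {r : F₂[X][X]} (hr : r.degree < 3) {g : K}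
    (hg : (s ^ 3 + t ^ 2 * s + t ^ 3 + ev t s r) ^ 2 + (s ^ 3 + t ^ 2 * s + t ^ 3 + ev t s r) * g
      + g ^ 2 = 0) : False := by
  obtain ⟨h1, -⟩ := eq_zero_of_norm_eq_zero hg
  have h2 : (X ^ 3 + (C (X ^ 2) * X + C (X ^ 3) + r) : F₂[X][X]) = 0 := by
    have hd : (C (X ^ 2) * X + C (X ^ 3) + r : F₂[X][X]).degree < 3 := by
      refine (degree_add_le _ _).trans_lt (max_lt (degree_linear_le.trans_lt (by decide)) hr)
    refine h.eq_zero_of_ev hS _ ?_ ?_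
    · refine (degree_add_le _ _).trans_lt (max_lt ?_ (hd.trans (by decide)))
      rw [degree_X_pow]; decide
    · rw [← h1]
      simp only [map_add, map_mul, map_pow, ev_C, ev_X, aeval_X]
      ring
  have hd : (C (X ^ 2) * X + C (X ^ 3) + r : F₂[X][X]).degree < 3 := by
    refine (degree_add_le _ _).trans_lt (max_lt (degree_linear_le.trans_lt (by decide)) hr)
  exact (monic_X_pow_add (n := 3) hd).ne_zero h2

end IsTangentPair

section

variable (K : Type*) [Field K] [Algebra F₂ K] [hF : Fact (IsFunctionField F₂ K)]
  [hC : Fact (HasExactConstants F₂ K)] [hG : Fact (GenusFourClassOne K)]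

lemma exists_model : ∃ (S : Place F₂ K) (t s : K), deg₂ S = 6 ∧
    IsTangentPair S t s ∧ N(t, s) ^ 3 = 1 + t ^ 3 + N(t, s) * t ^ 2
      + s + N(t, s) * s + N(t, s) ^ 2 := by
  obtain ⟨S, hS, t, s, h⟩ := exists_tangentPair K
  obtain ⟨t, s, h, hn⟩ := h.exists_isNormal hS
  obtain ⟨ε, hε, h0, m, hm, hb⟩ := h.exists_survivor hS hn
  rw [IsTangentPair.ev_polyL_of_testBit hε hb] at h0
  have h2 := two_eq_zero K
  simp only [List.mem_cons, List.not_mem_nil, or_false] at hm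
  rcases hm with rfl | rfl | rfl | rfl | rfl <;>
    simp [sexticTable, Nat.testBit] at h0
  · refine (h.not_norm_relation hS (r := X + 1) (by compute_degree!)
      (g := t * s ^ 2 + t ^ 2 * s + t) ?_).elim
    simp only [map_add, map_one, ev_X]
    linear_combination h0 + (-t ^ 4 * s ^ 2 - t ^ 3 * s ^ 3 + 2 * t ^ 3 * s - t ^ 2 * s ^ 4
      + 2 * t ^ 2 * s ^ 2 + t ^ 2 * s - t * s ^ 5 + t * s ^ 3 + s ^ 4 + s ^ 3 + s) * h2
  · refine (h.not_norm_relation hS (r := 1) (by compute_degree!)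
      (g := t * s ^ 2 + t ^ 2 * s + 1) ?_).elim
    simp only [map_one]
    linear_combination h0 + (-t ^ 4 * s ^ 2 - t ^ 3 * s ^ 3 + t ^ 3 - t ^ 2 * s ^ 4
      + 2 * t ^ 2 * s - t * s ^ 5 + t * s ^ 2 + s ^ 3 + 1) * h2
  · refine (h.not_norm_relation hS (r := 0) (by rw [degree_zero]; decide) (g := t * s ^ 2 + t ^ 2 * s + 1) ?_).elim
    simp only [map_zero]
    linear_combination h0 + (-t ^ 4 * s ^ 2 - t ^ 3 * s ^ 3 - t ^ 2 * s ^ 4 - t * s ^ 5) * h2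
  · refine ⟨S, t, s, hS, h, ?_⟩
    generalize s ^ 2 + t * s + t ^ 2 = N at *
    linear_combination h0 - (1 + t ^ 3 + N * t ^ 2 + s + N * s + N ^ 2) * h2
  · refine ⟨S, t, s + t, hS, h.shear, ?_⟩
    rw [IsTangentPair.norm_shear]
    generalize s ^ 2 + t * s + t ^ 2 = N at *
    linear_combination h0 - (1 + t ^ 3 + N * t ^ 2 + s + t + N * t + N * s + N ^ 2) * h2

end

/-- The plane model of the function field. -/
def modelPoly : F₂[X][X] :=
  normForm ^ 3 + (C (1 + X ^ 3) + normForm * C (X ^ 2) + X + normForm * X + normForm ^ 2)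

lemma modelPoly_spec : modelPoly.Monic ∧ modelPoly.degree = 6 := by
  have h1 : normForm.natDegree ≤ 2 := by unfold normForm; compute_degree
  obtain ⟨h2, h3⟩ := monic_normForm_pow 3
  have h4 : (C (1 + X ^ 3) + normForm * C (X ^ 2) + X + normForm * X + normForm ^ 2 :
      F₂[X][X]).degree < (normForm ^ 3).degree := by
    rw [degree_eq_natDegree h2.ne_zero, h3]
    have h5 : (C (1 + X ^ 3) + normForm * C (X ^ 2) + X + normForm * X + normForm ^ 2 :
        F₂[X][X]).natDegree ≤ 4 := by
      compute_degree
      omega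
    exact degree_le_natDegree.trans_lt (WithBot.coe_lt_coe.2 (Nat.lt_of_le_of_lt h5 (by norm_num)))
  refine ⟨h2.add_of_left h4, ?_⟩
  rw [modelPoly, degree_add_eq_left_of_degree_lt h4, degree_eq_natDegree h2.ne_zero, h3]
  rfl

lemma ev_modelPoly {A : Type*} [CommRing A] [Algebra F₂ A] (t s : A) :
    ev t s modelPoly = N(t, s) ^ 3 + (1 + t ^ 3 + N(t, s) * t ^ 2
      + s + N(t, s) * s + N(t, s) ^ 2) := by
  simp [modelPoly, normForm]

section

variable {K : Type*} [Field K] [Algebra F₂ K]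

lemma nonempty_ringEquiv_of_ev {t s : K} {G : F₂[X][X]} (h0 : ev t s G = 0)
    (hdvd : ∀ r, ev t s r = 0 → G ∣ r)
    (hfrac : ∀ f : K, ∃ a b, f = ev t s a / ev t s b) :
    Nonempty (FractionRing (F₂[X][X] ⧸ Ideal.span {G}) ≃+* K) := by
  have hz : ∀ a ∈ Ideal.span {G}, ev t s a = 0 := fun a ha => by
    obtain ⟨b, rfl⟩ := Ideal.mem_span_singleton'.1 ha
    rw [map_mul, h0, mul_zero]
  let φ : (F₂[X][X] ⧸ Ideal.span {G}) →+* K := Ideal.Quotient.lift (Ideal.span {G}) (ev t s) hz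
  have hinj : Function.Injective φ := by
    refine (injective_iff_map_eq_zero φ).2 fun a ha => ?_
    obtain ⟨a, rfl⟩ := Ideal.Quotient.mk_surjective a
    rw [Ideal.Quotient.lift_mk] at ha
    exact Ideal.Quotient.eq_zero_iff_mem.2 (Ideal.mem_span_singleton.2 (hdvd a ha))
  have : IsDomain (F₂[X][X] ⧸ Ideal.span {G}) := hinj.isDomain φ
  let _ : Algebra (F₂[X][X] ⧸ Ideal.span {G}) K := φ.toAlgebra
  have : FaithfulSMul (F₂[X][X] ⧸ Ideal.span {G}) K :=
    (faithfulSMul_iff_algebraMap_injective _ _).2 hinj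
  have : IsFractionRing (F₂[X][X] ⧸ Ideal.span {G}) K := by
    refine IsFractionRing.of_field (F₂[X][X] ⧸ Ideal.span {G}) K fun f => ?_
    obtain ⟨a, b, rfl⟩ := hfrac f
    exact ⟨Ideal.Quotient.mk _ a, Ideal.Quotient.mk _ b, rfl⟩
  exact ⟨(FractionRing.algEquiv (F₂[X][X] ⧸ Ideal.span {G}) K).toRingEquiv⟩

end

section

variable (K : Type*) [Field K] [Algebra F₂ K] [hF : Fact (IsFunctionField F₂ K)]
  [hC : Fact (HasExactConstants F₂ K)] [hG : Fact (GenusFourClassOne K)]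

lemma nonempty_ringEquiv_model :
    Nonempty (FractionRing (F₂[X][X] ⧸ Ideal.span {modelPoly}) ≃+* K) := by
  obtain ⟨S, t, s, hS, h, hr⟩ := exists_model K
  obtain ⟨hm, hd⟩ := modelPoly_spec
  have h0 : ev t s modelPoly = 0 := by
    rw [ev_modelPoly, hr]
    linear_combination (1 + t ^ 3 + N(t, s) * t ^ 2
      + s + N(t, s) * s + N(t, s) ^ 2) * two_eq_zero K
  refine nonempty_ringEquiv_of_ev h0 (dvd_of_ev_eq_zero hm h0 fun r hr hr0 =>
    h.eq_zero_of_ev hS r (lt_of_lt_of_eq hr hd) hr0) fun f => ?_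
  have hn : 0 ≤ deg (poles f) := degHom_nonneg (poles_nonneg f)
  obtain ⟨n, hn⟩ := Int.eq_ofNat_of_zero_le hn
  have h1 := el_of_seven_le (D := single S ((n + 7 : ℕ) : ℤ) - poles f) (by
    rw [deg_sub, deg_single, hS, hn]; push_cast; omega)
  rw [deg_sub, deg_single, hS, hn] at h1
  obtain ⟨g, hg, hg0⟩ : ∃ g ∈ L (single S ((n + 7 : ℕ) : ℤ) - poles f), g ≠ 0 := by
    by_contra! hcon
    have h2 : el (single S ((n + 7 : ℕ) : ℤ) - poles f) = 0 := by
      change ell F₂ _ = 0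
      rw [ell_eq, (Submodule.eq_bot_iff _).2 hcon, finrank_bot]
    rw [h2] at h1
    push_cast at h1
    omega
  obtain ⟨b, hb⟩ := h.exists_ev hS (L_mono (sub_le_self _ (poles_nonneg f)) hg)
  have hfg := mul_mem_L (mem_L_poles f) hg
  rw [add_sub_cancel] at hfg
  obtain ⟨a, ha⟩ := h.exists_ev hS hfg
  exact ⟨a, b, by rw [← ha, ← hb, mul_div_cancel_right₀ _ hg0]⟩

end

lemma nonempty_ringEquiv_of_genus {K K' : Type*} [Field K] [Algebra F₂ K] [Field K']
    [Algebra F₂ K'] (hF : IsFunctionField F₂ K) (hC : HasExactConstants F₂ K)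
    (hg : genus F₂ K = 4) (hh : classNumber F₂ K = 1)
    (hF' : IsFunctionField F₂ K') (hC' : HasExactConstants F₂ K')
    (hg' : genus F₂ K' = 4) (hh' : classNumber F₂ K' = 1) : Nonempty (K ≃+* K') := by
  have : Fact (IsFunctionField F₂ K) := ⟨hF⟩
  have : Fact (HasExactConstants F₂ K) := ⟨hC⟩
  have : Fact (GenusFourClassOne K) := ⟨genusFourClassOne_of K hg hh⟩
  have : Fact (IsFunctionField F₂ K') := ⟨hF'⟩
  have : Fact (HasExactConstants F₂ K') := ⟨hC'⟩
  have : Fact (GenusFourClassOne K') := ⟨genusFourClassOne_of K' hg' hh'⟩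
  obtain ⟨e⟩ := nonempty_ringEquiv_model K
  obtain ⟨e'⟩ := nonempty_ringEquiv_model K'
  exact ⟨e.symm.trans e'⟩

/-- A field generated by a point of the plane model with transcendental first coordinate. -/
structure IsModel {K : Type*} [Field K] [Algebra F₂ K] (t s : K) : Prop where
  trans : Transcendental F₂ t
  top : ∀ M : IntermediateField F₂ K, t ∈ M → s ∈ M → M = ⊤
  rel : ev t s modelPoly = 0

lemma exists_isModel :
    ∃ (K : Type) (_ : Field K) (_ : Algebra F₂ K) (t s : K), IsModel t s := by
  let Ω := AlgebraicClosure (RatFunc F₂)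
  let t : Ω := algebraMap (RatFunc F₂) Ω RatFunc.X
  have ht : Transcendental F₂ t :=
    (transcendental_algebraMap_iff (algebraMap (RatFunc F₂) Ω).injective).2
      RatFunc.transcendental_X
  obtain ⟨hm, hd⟩ := modelPoly_spec
  obtain ⟨s, hs⟩ := IsAlgClosed.exists_root
    (modelPoly.map (aeval t : F₂[X] →ₐ[F₂] Ω).toRingHom) (by
      rw [hm.degree_map, hd]; decide)
  rw [IsRoot, eval_map, ← ev_apply] at hs
  have h1 : t ∈ adjoin F₂ {t, s} := subset_adjoin _ _ (by simp)
  have h2 : s ∈ adjoin F₂ {t, s} := subset_adjoin _ _ (by simp)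
  refine ⟨adjoin F₂ {t, s}, inferInstance, inferInstance, ⟨t, h1⟩, ⟨s, h2⟩, ?_, ?_, ?_⟩
  · exact (transcendental_algebraMap_iff
      (algebraMap (adjoin F₂ {t, s}) Ω).injective).1 ht
  · intro M ht hs
    have h3 : adjoin F₂ {t, s} ≤ IntermediateField.lift M := by
      rw [adjoin_le_iff]
      rintro x (rfl | rfl)
      · exact ⟨_, ht, rfl⟩
      · exact ⟨_, hs, rfl⟩
    rw [eq_top_iff]
    intro x _
    obtain ⟨y, hy, h⟩ := h3 x.2
    rwa [← Subtype.ext h]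
  · apply (algebraMap (adjoin F₂ {t, s}) Ω).injective
    rw [map_ev, map_zero]
    exact hs

namespace IsModel

variable {K : Type*} [Field K] [Algebra F₂ K] {t s : K}

lemma finrank_le (h : IsModel t s) :
    FiniteDimensional F₂⟮t⟯ K ∧ finrank F₂⟮t⟯ K ≤ 6 := by
  obtain ⟨hm, hd⟩ := modelPoly_spec
  let T : F₂⟮t⟯ := ⟨t, mem_adjoin_simple_self _ t⟩
  set G := modelPoly.map (aeval T : F₂[X] →ₐ[F₂] F₂⟮t⟯).toRingHom with hGd
  have hG : G.Monic := hm.map _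
  have hs : aeval s G = 0 := by
    rw [← h.rel, ev_apply, aeval_def, hGd, eval₂_map]
    congr 1
    ext x
    · simp [T]
    · simp [T]
  have hInt : IsIntegral F₂⟮t⟯ s := ⟨G, hG, hs⟩
  have htop : F₂⟮t⟯⟮s⟯ = ⊤ := by
    apply restrictScalars_injective F₂
    rw [restrictScalars_top]
    exact h.top _ (_root_.algebraMap_mem F₂⟮t⟯⟮s⟯ T) (mem_adjoin_simple_self _ s)
  have h1 := adjoin.finrank hInt
  have h2 := adjoin.finiteDimensional hInt
  rw [htop] at h1 h2
  rw [IntermediateField.finrank_top'] at h1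
  refine ⟨(topEquiv (F := F₂⟮t⟯) (E := K)).toLinearEquiv.finiteDimensional, ?_⟩
  rw [h1, ← natDegree_eq_of_degree_eq_some hd, ← hm.natDegree_map (aeval T :
    F₂[X] →ₐ[F₂] F₂⟮t⟯).toRingHom]
  exact natDegree_le_natDegree (minpoly.min _ _ hG hs)

lemma isFunctionField (h : IsModel t s) : IsFunctionField F₂ K := ⟨t, h.trans, h.finrank_le.1⟩

end IsModel

lemma prime_pow_dvd_of_pow {M : Type*} [Monoid M] {c : M} {q k d : ℕ} (hq : q.Prime)
    (h1 : c ^ 2 ^ q ^ (k + 1) = c) (h2 : c ^ 2 ^ q ^ k ≠ c) (h : c ^ 2 ^ d = c) :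
    q ^ (k + 1) ∣ d := by
  have := Fact.mk hq
  have hper : ∀ n, Function.IsPeriodicPt (fun x : M => x ^ 2) n c ↔ c ^ 2 ^ n = c := fun n => by
    rw [Function.IsPeriodicPt, Function.IsFixedPt, pow_iterate]
  rw [← Function.minimalPeriod_eq_prime_pow (mt (hper _).1 h2) ((hper _).2 h1)]
  exact ((hper d).2 h).minimalPeriod_dvd

section Poles

variable {K : Type*} [Field K] [Algebra F₂ K] [hF : Fact (IsFunctionField F₂ K)]
  {S p : Place F₂ K} {t s : K}

lemma Place.res_coe (p : Place F₂ K) (x : p.1) : p.res (x : K) = residue p.1 x :=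
  p.res_of_mem x.2

lemma Place.mem_of_homogeneous (p : Place F₂ K) {z y : K} (hz : z ∈ p.1) (ht : t ∈ p.1)
    (h : (y ^ 2 + t * y + t ^ 2) ^ 3 + (z ^ 6 + t ^ 3 * z ^ 3 + (y ^ 2 + t * y + t ^ 2) * t ^ 2 * z ^ 2
      + y * z ^ 5 + (y ^ 2 + t * y + t ^ 2) * y * z ^ 3 + (y ^ 2 + t * y + t ^ 2) ^ 2 * z ^ 2) = 0) :
    y ∈ p.1 := by
  by_contra hy
  have hv := (p.1.mem_or_inv_mem y).resolve_left hy
  have hy0 : y ≠ 0 := by rintro rfl; exact hy (zero_mem _)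
  generalize hvy : y⁻¹ = v at hv
  have h1 : y * v = 1 := by rw [← hvy, mul_inv_cancel₀ hy0]
  lift v to p.1 using hv
  lift z to p.1 using hz
  lift t to p.1 using ht
  have h2 : y = ((-(v ^ 5 * z ^ 6 + v ^ 5 * t ^ 3 * z ^ 3 + v ^ 3 * (1 + t * v + t ^ 2 * v ^ 2) * t ^ 2 * z ^ 2 +
      v ^ 4 * z ^ 5 + v ^ 2 * (1 + t * v + t ^ 2 * v ^ 2) * z ^ 3 +
      v * (1 + t * v + t ^ 2 * v ^ 2) ^ 2 * z ^ 2) - (t + t ^ 2 * v) *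
      ((1 + t * v + t ^ 2 * v ^ 2) ^ 2 + (1 + t * v + t ^ 2 * v ^ 2) + 1) : p.1) : K) := by
    push_cast
    have h3 : (v : K) = y⁻¹ := hvy.symm
    rw [h3] at *
    field_simp
    linear_combination h
  rw [h2] at hy
  exact hy (Subtype.prop _)

/-- The place at infinity of the plane model. -/
structure IsPole (S : Place F₂ K) (t s : K) : Prop where
  deg_eq : deg₂ S = 6
  ord_eq : S.ord t = -1
  mem₂ : s ∈ S.V (-1)
  mem₃ : s ^ 2 + t * s + t ^ 2 ∈ S.V (-1)
  lead_sq : S.lead t s ^ 2 + S.lead t s + 1 = 0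
  lead_cube : S.lead t N(t, s) ^ 3 + S.lead t N(t, s) + 1 = 0
  regular : ∀ p, p ≠ S → t ∈ p.1 ∧ s ∈ p.1

namespace IsModel

lemma rel' (h : IsModel t s) : N(t, s) ^ 3 + (1 + t ^ 3 +
    N(t, s) * t ^ 2 + s + N(t, s) * s +
    N(t, s) ^ 2) = 0 := by
  rw [← ev_modelPoly, h.rel]

lemma mem_of_mem (h : IsModel t s) (p : Place F₂ K) (ht : t ∈ p.1) : s ∈ p.1 :=
  p.mem_of_homogeneous (one_mem _) ht (by linear_combination h.rel')

lemma lead_of_not_mem (h : IsModel t s) (ht : t ∉ p.1) :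
    s * t⁻¹ ∈ p.1 ∧ N(t, s) * t⁻¹ ∈ p.1 ∧
      p.lead t s ^ 2 + p.lead t s + 1 = 0 ∧
      p.lead t N(t, s) ^ 3 + p.lead t N(t, s) + 1 = 0 := by
  have ht0 : t ≠ 0 := by rintro rfl; exact ht (zero_mem _)
  have hx := (p.1.mem_or_inv_mem t).resolve_left ht
  have hx1 : t⁻¹ ∈ p.V 1 := by
    rw [p.mem_V' (inv_ne_zero ht0), p.ord_inv]
    rw [p.mem_iff] at ht
    omega
  have hr := h.rel'
  have h1 : s * t⁻¹ ∈ p.1 := p.mem_of_homogeneous (t := 1) hx (one_mem _) (by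
    field_simp
    linear_combination hr)
  set θ := N(t, s) * t⁻¹ with hθ
  have h2 : θ ^ 3 + t⁻¹ * θ ^ 2 + (1 + t⁻¹ * (s * t⁻¹)) * θ + (1 + t⁻¹ ^ 3 + s * t⁻¹ * t⁻¹ ^ 2) = 0 := by
    rw [hθ]
    field_simp
    linear_combination hr
  have h3 : (s * t⁻¹) ^ 2 + s * t⁻¹ + 1 = t⁻¹ * θ := by
    rw [hθ]; field_simp
  rw [Place.lead, Place.lead, ← hθ]
  generalize s * t⁻¹ = ω at *
  generalize hxt : t⁻¹ = x at *
  have h4 : θ ∈ p.1 := by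
    by_contra hy
    have hv := (p.1.mem_or_inv_mem θ).resolve_left hy
    have hy0 : θ ≠ 0 := by intro h0; rw [h0] at hy; exact hy (zero_mem _)
    have h5 : θ = -(x + (1 + x * ω) * θ⁻¹ + (1 + x ^ 3 + ω * x ^ 2) * θ⁻¹ ^ 2) := by
      field_simp
      linear_combination h2
    generalize θ⁻¹ = v at h5 hv
    lift v to p.1 using hv
    lift x to p.1 using hx
    lift ω to p.1 using h1
    rw [show θ = ((-(x + (1 + x * ω) * v + (1 + x ^ 3 + ω * x ^ 2) * v ^ 2) : p.1) : K) by
      rw [h5]; push_cast; ring] at hy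
    exact hy (Subtype.prop _)
  refine ⟨h1, h4, ?_⟩
  have hx0 := (p.res_eq_zero_iff hx).2 hx1
  clear_value θ
  lift x to p.1 using hx
  lift ω to p.1 using h1
  lift θ to p.1 using h4
  rw [p.res_coe] at hx0
  rw [p.res_coe, p.res_coe]
  constructor
  · have h5 : ω ^ 2 + ω + 1 = x * θ := Subtype.ext (by push_cast; exact h3)
    have h6 := congrArg (residue p.1) h5
    simpa [hx0] using h6
  · have h5 : θ ^ 3 + x * θ ^ 2 + (1 + x * ω) * θ + (1 + x ^ 3 + ω * x ^ 2) = 0 :=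
      Subtype.ext (by push_cast; exact h2)
    have h6 := congrArg (residue p.1) h5
    simpa [hx0, add_assoc] using h6

lemma six_dvd (h : IsModel t s) (ht : t ∉ p.1) : 6 ∣ deg₂ p := by
  obtain ⟨-, -, h1, h2⟩ := h.lead_of_not_mem ht
  generalize p.lead t s = ω at h1
  generalize p.lead t N(t, s) = θ at h2
  have := p.charTwo_residueField
  have c2 : (2 : ResidueField p.1) = 0 := CharTwo.two_eq_zero
  refine Nat.Coprime.mul_dvd_of_dvd_of_dvd (m := 2) (n := 3) (by norm_num)
    (prime_pow_dvd_of_pow (k := 0) Nat.prime_two ?_ ?_ (p.residue_pow_eq ω))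
    (prime_pow_dvd_of_pow (k := 0) Nat.prime_three ?_ ?_ (p.residue_pow_eq θ))
  · linear_combination (ω ^ 2 - ω) * h1
  · intro h3
    exact one_ne_zero (α := ResidueField p.1)
      (by linear_combination h1 - h3 - ω * c2)
  · linear_combination (θ ^ 5 - θ ^ 3 - θ ^ 2 + θ + 2) * h2 - (2 * θ + 1) * c2
  · intro h3
    norm_num at h3
    exact one_ne_zero (α := ResidueField p.1)
      (by linear_combination h2 - (θ + 1) * h3 - θ * c2)

lemma exists_isPole (h : IsModel t s) : ∃ S, IsPole S t s := by
  obtain ⟨S, hS⟩ := exists_pole_of_transcendental h.trans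
  have ht0 : t ≠ 0 := by rintro rfl; exact h.trans isAlgebraic_zero
  have hinv := transcendental_inv h.trans
  have hlt : ∀ p : Place F₂ K, p.ord t < 0 ↔ t ∉ p.1 := fun p => by rw [p.mem_iff, not_le]
  have h6 : ∀ p : Place F₂ K, p.ord t < 0 → 6 ≤ deg₂ p := fun p hp =>
    Nat.le_of_dvd p.one_le_degree (h.six_dvd ((hlt p).1 hp))
  have hle : ∀ T : Finset (Place F₂ K), (∀ p ∈ T, p.ord t < 0) →
      ∑ p ∈ T, -p.ord t * deg₂ p ≤ 6 := fun T hT => by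
    have h1 := sum_ord_le T hinv fun p hp => by rw [p.ord_inv]; have := hT p hp; omega
    rw [adjoin_inv] at h1
    simp only [Place.ord_inv] at h1
    have := h.finrank_le.2
    omega
  have h1 := hle {S} (by simpa using hS)
  rw [Finset.sum_singleton] at h1
  have h2 := h6 S hS
  have hord : S.ord t = -1 := by
    zify at h2; nlinarith
  have hdeg : deg₂ S = 6 := by
    rw [hord] at h1; omega
  obtain ⟨hs, hN, hz, hc⟩ := h.lead_of_not_mem ((hlt S).1 hS)
  have hV : ∀ f : K, f * t⁻¹ ∈ S.1 → f ∈ S.V (-1) := fun f hf => by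
    rwa [← S.mem_V_zero, mul_comm, S.mul_mem_V_iff (inv_ne_zero ht0), S.ord_inv, hord] at hf
  refine ⟨S, hdeg, hord, hV s hs, hV _ hN, hz, hc, fun p hp => ?_⟩
  have ht : t ∈ p.1 := by
    by_contra htp
    have h3 := hle {S, p} (by simpa using ⟨hS, (hlt p).2 htp⟩)
    rw [Finset.sum_pair hp.symm, hord, hdeg] at h3
    have h4 := h6 p ((hlt p).2 htp)
    have h5 := (hlt p).2 htp
    zify at h4
    push_cast at h3
    nlinarith
  exact ⟨ht, h.mem_of_mem p ht⟩

end IsModel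

end Poles

section Triple

variable {A : Type*} [CommRing A]

/-- A function with a triple zero at the place of degree four. -/
def triple (t s : A) : A :=
  1 + s + t * s + N(t, s) * t + N(t, s) ^ 2

/-- The quotient of the cube of a uniformizer by `triple`. -/
def tripleUnit (t s : A) : A :=
  t ^ 2 + t ^ 4 + s + t ^ 2 * s + N(t, s) * (s + t * s + t ^ 2 * s) +
    N(t, s) ^ 2 * (1 + t + t ^ 2 + s)

lemma cube_eq_triple_mul {t s : A} (c2 : (2 : A) = 0) (h : N(t, s) ^ 3 +
    (1 + t ^ 3 + N(t, s) * t ^ 2 + s + N(t, s) * s +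
    N(t, s) ^ 2) = 0) : (1 + t + t ^ 2) ^ 3 = triple t s * tripleUnit t s := by
  unfold triple tripleUnit
  linear_combination (1 - s ^ 2 - s ^ 3 - t - t * s - t ^ 2 - t ^ 2 * s - t ^ 2 * s ^ 2 - t ^ 3 * s - t ^ 4) * h + (-s - s ^ 4 - s ^ 5 + 2 * t + t * s - t * s ^ 2 - 3 * t * s ^ 3 - 3 * t * s ^ 4 - 2 * t * s ^ 5 -
    t * s ^ 6 - t * s ^ 7 - t * s ^ 8 + 3 * t ^ 2 - t ^ 2 * s - 4 * t ^ 2 * s ^ 2 - 4 * t ^ 2 *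
    s ^ 3 - 5 * t ^ 2 * s ^ 4 - 3 * t ^ 2 * s ^ 5 - 3 * t ^ 2 * s ^ 6 - 4 * t ^ 2 * s ^ 7 + 3 *
    t ^ 3 - 3 * t ^ 3 * s - 3 * t ^ 3 * s ^ 2 - 7 * t ^ 3 * s ^ 3 - 6 * t ^ 3 * s ^ 4 - 7 * t ^
    3 * s ^ 5 - 10 * t ^ 3 * s ^ 6 + 2 * t ^ 4 - t ^ 4 * s - 6 * t ^ 4 * s ^ 2 - 6 * t ^ 4 * s ^
    3 - 9 * t ^ 4 * s ^ 4 - 16 * t ^ 4 * s ^ 5 + 2 * t ^ 5 - 3 * t ^ 5 * s - 4 * t ^ 5 * s ^ 2 -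
    9 * t ^ 5 * s ^ 3 - 19 * t ^ 5 * s ^ 4 - t ^ 6 * s - 5 * t ^ 6 * s ^ 2 - 16 * t ^ 6 * s ^ 3
    - 2 * t ^ 7 * s - 10 * t ^ 7 * s ^ 2 - 4 * t ^ 8 * s - t ^ 9) * c2

lemma cube_eq_triple_mul' {t s : A} (c2 : (2 : A) = 0) (h : N(t, s) ^ 3 +
    (1 + t ^ 3 + N(t, s) * t ^ 2 + s + N(t, s) * s +
    N(t, s) ^ 2) = 0) : (s + N(t, s) * t) ^ 3 =
    triple t s * (t ^ 2 + s + s * t + t ^ 2 * s +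
      N(t, s) * (t ^ 2 + s + t ^ 2 * s) +
      N(t, s) ^ 2 * (t ^ 2 + t * s)) := by
  unfold triple
  linear_combination (-s + t * s - t * s ^ 3 - t ^ 2 - t ^ 4) * h + (-t * s - 2 * t * s ^ 2 + t * s ^ 4 - 2 * t * s ^ 5 - t ^ 2 * s - 2 * t ^ 2 * s ^ 2 - 5 * t ^ 2 *
    s ^ 4 - t ^ 2 * s ^ 6 - t ^ 2 * s ^ 7 - t ^ 2 * s ^ 8 - t ^ 3 * s - t ^ 3 * s ^ 2 - 9 * t ^
    3 * s ^ 3 - t ^ 3 * s ^ 4 - 3 * t ^ 3 * s ^ 5 - 3 * t ^ 3 * s ^ 6 - 4 * t ^ 3 * s ^ 7 - t ^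
    4 * s - 7 * t ^ 4 * s ^ 2 - 5 * t ^ 4 * s ^ 4 - 6 * t ^ 4 * s ^ 5 - 9 * t ^ 4 * s ^ 6 - 4 *
    t ^ 5 * s - t ^ 5 * s ^ 2 - 5 * t ^ 5 * s ^ 3 - 7 * t ^ 5 * s ^ 4 - 13 * t ^ 5 * s ^ 5 - 2 *
    t ^ 6 * s ^ 2 - 6 * t ^ 6 * s ^ 3 - 13 * t ^ 6 * s ^ 4 - 3 * t ^ 7 * s ^ 2 - 9 * t ^ 7 * s ^
    3 + t ^ 8 - t ^ 8 * s - 4 * t ^ 8 * s ^ 2 - t ^ 9 * s) * c2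

end Triple

lemma eq_of_triple_eq_zero {k : Type*} [Field k] [CharP k 2] {a b : k}
    (h : (b ^ 2 + a * b + a ^ 2) ^ 3 + (1 + a ^ 3 + (b ^ 2 + a * b + a ^ 2) * a ^ 2 + b +
      (b ^ 2 + a * b + a ^ 2) * b + (b ^ 2 + a * b + a ^ 2) ^ 2) = 0) (hz : triple a b = 0) :
    1 + a + a ^ 2 = 0 ∧ b ^ 4 + b + 1 = 0 ∧ tripleUnit a b = b := by
  have c2 : (2 : k) = 0 := CharTwo.two_eq_zero
  have h1 := cube_eq_triple_mul c2 h
  have h2 := cube_eq_triple_mul' c2 h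
  rw [hz, zero_mul] at h1 h2
  replace h1 := eq_zero_of_pow_eq_zero h1
  replace h2 := eq_zero_of_pow_eq_zero h2
  have h3 : a = b ^ 2 + b + 1 := by
    linear_combination ((a ^ 2 - a + 1) * b + (a - 1) * b ^ 2 + a ^ 3 - a ^ 2 + 1) * h1 -
      a ^ 2 * h2 - (b + 1) * c2
  have h4 : b ^ 4 + b + 1 = 0 := by
    rw [h3] at h1
    linear_combination h1 - (b ^ 3 + 2 * b ^ 2 + b + 1) * c2
  refine ⟨h1, h4, ?_⟩
  rw [h3, tripleUnit]
  linear_combination (1 + b + b ^ 2 + b ^ 4 + b ^ 6 + b ^ 8) * h4 + (2 + 15 * b + 55 * b ^ 2 +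
    129 * b ^ 3 + 213 * b ^ 4 + 265 * b ^ 5 + 254 * b ^ 6 + 191 * b ^ 7 + 112 * b ^ 8 +
    51 * b ^ 9 + 17 * b ^ 10 + 4 * b ^ 11) * c2

section QuarticPlace

variable {K : Type*} [Field K] [Algebra F₂ K] [hF : Fact (IsFunctionField F₂ K)]
  {S p : Place F₂ K} {t s : K}

lemma IsPole.lead_pow_four_ne (hS : IsPole S t s) :
    S.lead t N(t, s) ^ 4 ≠ S.lead t N(t, s) := by
  have := S.charTwo_residueField
  have c2 : (2 : ResidueField S.1) = 0 := CharTwo.two_eq_zero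
  have h := hS.lead_cube
  generalize S.lead t N(t, s) = θ at h
  intro h4
  have h0 : θ = 0 := eq_zero_of_pow_eq_zero (n := 2)
    (by linear_combination h4 - θ * h + (θ ^ 2 + θ) * c2)
  simp [h0] at h

lemma IsPole.isGraded (hS : IsPole S t s) :
    IsGraded (F := F₂) S t (basis t s) ![0, 1, 1, 2, 2, 3] :=
  isGraded_basis hS.deg_eq hS.ord_eq hS.mem₂ hS.mem₃ hS.lead_sq hS.lead_pow_four_ne

lemma IsPole.ord_triple (hS : IsPole S t s) : triple t s ≠ 0 ∧ S.ord (triple t s) = -2 := by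
  have ht0 := S.ne_zero_of_ord_ne_zero (f := t) (by rw [hS.ord_eq]; norm_num)
  have hV2 : triple t s ∈ S.V (-2) := by
    have h1 := S.V_anti (m := -2) (by norm_num) S.one_mem_V
    have h2 := S.V_anti (m := -2) (by norm_num) hS.mem₂
    have h3 := (S.mem_V' ht0).2 hS.ord_eq.ge
    exact add_mem (add_mem (add_mem (add_mem h1 h2) (S.mul_mem_V h3 hS.mem₂))
      (S.mul_mem_V hS.mem₃ h3)) (S.pow_mem_V hS.mem₃ 2)
  have hnot : triple t s ∉ S.V (-1) := fun hcon => by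
    have := hS.isGraded.natDegree_add_le (r := ![1, 1 + X, X, 0, 1, 0]) (n := 1) (by
      convert hcon using 1
      simp [Fin.sum_univ_six, basis, triple]
      ring) 4 one_ne_zero
    change ((1 : F₂[X]).natDegree + (2 : ℕ) : ℤ) ≤ 1 at this
    simp at this
  have hz0 : triple t s ≠ 0 := by intro h0; rw [h0] at hnot; exact hnot (zero_mem _)
  rw [S.mem_V' hz0] at hV2 hnot
  exact ⟨hz0, by omega⟩

lemma IsModel.of_triple_mem (h : IsModel t s) (hS : IsPole S t s) (hp : p ≠ S)
    (hz : triple t s ∈ p.V 1) :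
    4 ∣ deg₂ p ∧ 3 ≤ p.ord (triple t s) := by
  have hz0 := hS.ord_triple.1
  have hc := cube_eq_triple_mul (two_eq_zero K) h.rel'
  have hr := h.rel'
  obtain ⟨ht, hs⟩ := hS.regular p hp
  have := p.charTwo_residueField
  have c2 : (2 : ResidueField p.1) = 0 := CharTwo.two_eq_zero
  have hord := (p.mem_V' hz0).1 hz
  lift t to p.1 using ht
  lift s to p.1 using hs
  have e1 : triple (t : K) s = (triple t s : p.1) := rfl
  have e2 : tripleUnit (t : K) s = (tripleUnit t s : p.1) := rfl
  rw [e1, ← p.res_eq_zero_iff (Subtype.prop _), p.res_coe] at hz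
  set a := residue p.1 t with ha
  set b := residue p.1 s with hb
  obtain ⟨h1, h2, h3⟩ := eq_of_triple_eq_zero (a := a) (b := b) (by
    have e : N(t, s) ^ 3 + (1 + t ^ 3 + N(t, s) * t ^ 2 + s +
        N(t, s) * s + N(t, s) ^ 2) = (0 : p.1) :=
      Subtype.ext (by push_cast; exact hr)
    simpa using congrArg (residue p.1) e) (by rw [← hz]; simp [triple, a, b])
  have hb0 : b ≠ 0 := by intro h0; simp [h0] at h2
  refine ⟨prime_pow_dvd_of_pow (k := 1) Nat.prime_two ?_ ?_ (p.residue_pow_eq b), ?_⟩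
  · norm_num
    linear_combination (b ^ 12 - b ^ 9 - b ^ 8 + b ^ 6 + 2 * b ^ 5 + b ^ 4 - b ^ 3 - 3 * b ^ 2 -
      3 * b) * h2 + (2 * b ^ 3 + 3 * b ^ 2 + b) * c2
  · norm_num
    intro h4
    exact one_ne_zero (α := ResidueField p.1) (by linear_combination h2 - h4 - b * c2)
  · have hU : (tripleUnit t s : p.1) ∉ IsLocalRing.maximalIdeal p.1 := by
      rw [← IsLocalRing.residue_eq_zero_iff]
      rwa [show residue p.1 (tripleUnit t s) = b by
        rw [← h3]; simp [tripleUnit, a, b]]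
    have hU0 : ((tripleUnit t s : p.1) : K) ≠ 0 := fun h0 => hU (by
      rw [show (tripleUnit t s : p.1) = 0 from Subtype.ext h0]; exact zero_mem _)
    have hU1 : ((tripleUnit t s : p.1) : K) ∉ p.V 1 := by
      rwa [← p.res_eq_zero_iff (Subtype.prop _), p.res_coe, IsLocalRing.residue_eq_zero_iff]
    rw [p.mem_V' hU0] at hU1
    have hU2 := p.mem_iff.1 (Subtype.prop (tripleUnit t s))
    rw [e1, e2] at hc
    rw [e1] at hz0 hord ⊢
    have := congrArg p.ord hc
    rw [p.ord_mul hz0 hU0, p.ord_pow] at this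
    push_cast at this
    omega

lemma IsModel.exists_quartic (h : IsModel t s) (hS : IsPole S t s) :
    ∃ P, deg₂ P = 4 ∧ P ≠ S ∧
      ∀ p, p ≠ S → triple t s ∈ p.V 1 → p = P := by
  obtain ⟨hz0, hord⟩ := hS.ord_triple
  have htr : Transcendental F₂ (triple t s) := fun ha => by
    have := S.ord_eq_zero_of_isAlgebraic ha
    omega
  have hfin : finrank F₂⟮triple t s⟯ K ≤ 12 := by
    have h1 := degHom_mono (F := F₂) (show (-dv (triple t s) ⊔ 0 : Divisor F₂ K) ≤
        single S 2 from fun q => by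
      by_cases hq : q = S
      · subst hq
        simp; omega
      · obtain ⟨ht, hs⟩ := hS.regular q hq
        have : triple t s ∈ q.1 := by
          lift t to q.1 using ht
          lift s to q.1 using hs
          exact (triple t s).2
        rw [q.mem_iff] at this
        simp [single_eq_of_ne hq, this])
    rw [degHom_poles htr, degHom_single, hS.deg_eq] at h1
    omega
  have key : ∀ T : Finset (Place F₂ K), (∀ p ∈ T, p ≠ S ∧ triple t s ∈ p.V 1) →
      ∑ p ∈ T, p.ord (triple t s) * deg₂ p ≤ 12 ∧
      ∀ p ∈ T, 3 ≤ p.ord (triple t s) ∧ 4 ≤ deg₂ p := fun T hT => by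
    have h2 : ∀ p ∈ T, 3 ≤ p.ord (triple t s) ∧ 4 ≤ deg₂ p := fun p hp => by
      obtain ⟨h3, h4⟩ := h.of_triple_mem hS (hT p hp).1 (hT p hp).2
      exact ⟨h4, Nat.le_of_dvd p.one_le_degree h3⟩
    have := sum_ord_le T htr fun p hp => by have := (h2 p hp).1; omega
    exact ⟨by omega, h2⟩
  obtain ⟨P, hP⟩ := exists_zero_of_transcendental htr
  rw [P.val_lt_one_iff hz0] at hP
  have hPS : P ≠ S := by rintro rfl; omega
  have hP1 : triple t s ∈ P.V 1 := (P.mem_V' hz0).2 hP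
  refine ⟨P, ?_, hPS, fun p hp hpz => ?_⟩
  · obtain ⟨h1, h2⟩ := key {P} (by simpa using ⟨hPS, hP1⟩)
    rw [Finset.sum_singleton] at h1
    obtain ⟨h3, h4⟩ := h2 P (Finset.mem_singleton_self P)
    by_contra hne
    have h5 : (5 : ℤ) ≤ deg₂ P := by omega
    nlinarith
  · by_contra hne
    obtain ⟨h1, h2⟩ := key {p, P} (by simpa using ⟨⟨hp, hpz⟩, hPS, hP1⟩)
    rw [Finset.sum_pair hne] at h1
    obtain ⟨h3, h4⟩ := h2 p (by simp)
    obtain ⟨h5, h6⟩ := h2 P (by simp)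
    zify at h4 h6
    nlinarith

end QuarticPlace

section SmallPoints

/-- The sum of the monomials in a list, evaluated in a ring. -/
def monSum {A : Type*} [CommRing A] (a b : A) (l : List ℕ³) : A :=
  (l.map fun t => (b ^ 2 + a * b + a ^ 2) ^ t.1 * a ^ t.2.1 * b ^ t.2.2).sum

lemma map_monSum {A B : Type*} [CommRing A] [CommRing B] (φ : A →+* B) (a b : A)
    (l : List ℕ³) : φ (monSum a b l) = monSum (φ a) (φ b) l := by
  simp [monSum, map_list_sum, List.map_map, Function.comp_def]

/-- The code of `monSum`. -/
def sumCode (d m a b : ℕ) (l : List ℕ³) : ℕ :=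
  l.foldr (fun t c => monCode d m a b t ^^^ c) 0

variable {d m : ℕ}

lemma psi_sumCode (h : fieldCheck d m = true) {a b : ℕ} (ha : a < 2 ^ d) (hb : b < 2 ^ d)
    (l : List ℕ³) :
    psi (gen m) (sumCode d m a b l) = monSum (psi (gen m) a) (psi (gen m) b) l := by
  induction l with
  | nil => simp [sumCode, monSum, psi_zero]
  | cons t l ih =>
    rw [sumCode, List.foldr_cons, psi_xor, (isCodeRoot h).monCode ha hb, ev_mon]
    rw [sumCode] at ih
    rw [ih, monSum, monSum, List.map_cons, List.sum_cons]

/-- Every point over the field with `2 ^ d` elements at which `l` vanishes is a zero of `l'`. -/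
def vanishCheck (d m : ℕ) (l l' : List ℕ³) : Bool :=
  fieldCheck d m && (List.range (2 ^ d)).all fun a => (List.range (2 ^ d)).all fun b =>
    decide (0 < sumCode d m a b l ∧ sumCode d m a b l < 2 ^ d) || sumCode d m a b l' == 0

lemma monSum_eq_zero {l l' : List ℕ³} (hc : vanishCheck d m l l' = true) {k : Type*}
    [Field k] [CharP k 2] {a b : k} (ha : a ^ 2 ^ d = a) (hb : b ^ 2 ^ d = b)
    (hl : monSum a b l = 0) : monSum a b l' = 0 := by
  rw [vanishCheck, Bool.and_eq_true] at hc
  obtain ⟨hf, hc⟩ := hc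
  obtain ⟨hcard, _⟩ := card_codeField hf
  let _ : Algebra F₂ (AlgebraicClosure k) := ZMod.algebra _ 2
  let ψ : CodeField m →ₐ[F₂] AlgebraicClosure k := IsAlgClosed.lift
  let _ := Fintype.ofFinite (CodeField m)
  have lift : ∀ x : k, x ^ 2 ^ d = x →
      ∃ n < 2 ^ d, algebraMap k (AlgebraicClosure k) x = ψ (psi (gen m) n) := fun x hx => by
    have h1 := FiniteField.roots_X_pow_card_sub_X (CodeField m)
    rw [← Nat.card_eq_fintype_card, hcard] at h1
    have hd : 1 < 2 ^ d := Nat.one_lt_two_pow (by have := (isCodeRoot hf).one_le; omega)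
    have h2 : (X ^ 2 ^ d - X : (CodeField m)[X]).Splits := by
      rw [splits_iff_card_roots, h1, ← Finset.card_def, Finset.card_univ,
        FiniteField.X_pow_card_sub_X_natDegree_eq _ hd, ← Nat.card_eq_fintype_card, hcard]
    have h3 := h1 ▸ h2.roots_map ψ.toRingHom ▸
      Multiset.mem_map (b := algebraMap k (AlgebraicClosure k) x)
    have h4 : algebraMap k (AlgebraicClosure k) x ^ 2 ^ d = algebraMap k _ x := by rw [← map_pow, hx]
    obtain ⟨c, -, h3⟩ := h3.1 (by simp [FiniteField.X_pow_card_sub_X_ne_zero _ hd, h4])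
    obtain ⟨n, hn, rfl⟩ := psi_surj hf c
    exact ⟨n, hn, h3.symm⟩
  obtain ⟨i, hi, hia⟩ := lift a ha
  obtain ⟨j, hj, hjb⟩ := lift b hb
  have key : ∀ l, algebraMap k (AlgebraicClosure k) (monSum a b l) =
      ψ (psi (gen m) (sumCode d m i j l)) := fun l => by
    rw [psi_sumCode hf hi hj, map_monSum, hia, hjb]
    exact (map_monSum ψ.toRingHom _ _ _).symm
  have h1 := List.all_eq_true.1 (List.all_eq_true.1 hc i (List.mem_range.2 hi)) j
    (List.mem_range.2 hj)
  have h2 := key l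
  rw [hl, map_zero] at h2
  have h3 := key l'
  rcases Bool.or_eq_true _ _ ▸ h1 with h1 | h1
  · rw [decide_eq_true_eq] at h1
    exact absurd ((psi_eq_zero_iff hf h1.2).1 ((_root_.map_eq_zero ψ).1 h2.symm)) h1.1.ne'
  · rw [beq_iff_eq.1 h1, psi_zero, map_zero] at h3
    exact (_root_.map_eq_zero _).1 h3

/-- The monomials of `modelPoly`. -/
abbrev modelMons : List ℕ³ :=
  [(3, 0, 0), (0, 0, 0), (0, 3, 0), (1, 2, 0), (0, 0, 1), (1, 0, 1), (2, 0, 0)]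

lemma vanishCheck_cubic : vanishCheck 3 11 modelMons [(0, 0, 0)] = true := by decide +kernel

lemma vanishCheck_quartic : vanishCheck 4 19 modelMons
    [(0, 0, 0), (0, 0, 1), (0, 1, 1), (1, 1, 0), (2, 0, 0)] = true := by decide +kernel

variable {K : Type*} [Field K] [Algebra F₂ K] [hF : Fact (IsFunctionField F₂ K)]
  {S p : Place F₂ K} {t s : K}

lemma pow_two_pow_of_dvd {M : Type*} [Monoid M] {x : M} {d e : ℕ} (h : x ^ 2 ^ d = x)
    (hd : d ∣ e) : x ^ 2 ^ e = x := by
  obtain ⟨k, rfl⟩ := hd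
  induction k with
  | zero => simp
  | succ k ih => rw [Nat.mul_succ, pow_add, pow_mul, ih, h]

lemma IsModel.four_le_degree (h : IsModel t s) (hS : IsPole S t s) (hp : p ≠ S) :
    4 ≤ deg₂ p ∧ (deg₂ p = 4 → triple t s ∈ p.V 1) := by
  have hr := h.rel'
  obtain ⟨ht, hs⟩ := hS.regular p hp
  have := p.charTwo_residueField
  lift t to p.1 using ht
  lift s to p.1 using hs
  have e : monSum t s modelMons = 0 := Subtype.ext (by
    push_cast [monSum, modelMons]
    simp
    linear_combination hr)
  have h0 := congrArg (residue p.1) e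
  rw [map_monSum, map_zero] at h0
  have h4 : deg₂ p ∣ 4 → triple (t : K) s ∈ p.V 1 := fun hd => by
    have := monSum_eq_zero vanishCheck_quartic (pow_two_pow_of_dvd (p.residue_pow_eq _) hd)
      (pow_two_pow_of_dvd (p.residue_pow_eq _) hd) h0
    rw [show triple (t : K) s = (triple t s : p.1) from rfl,
      ← p.res_eq_zero_iff (Subtype.prop _), p.res_coe, ← this, ← map_monSum]
    congr 1
    simp [monSum, triple]
    ring
  refine ⟨?_, fun hd => h4 hd.dvd⟩
  by_contra hlt
  have h1 := p.one_le_degree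
  have h3 : ¬ deg₂ p ∣ 3 := fun hd => by
    have := monSum_eq_zero vanishCheck_cubic (pow_two_pow_of_dvd (p.residue_pow_eq _) hd)
      (pow_two_pow_of_dvd (p.residue_pow_eq _) hd) h0
    simp [monSum] at this
  have h2 : deg₂ p = 2 := by
    interval_cases deg₂ p <;> simp_all
  have h5 := (h.of_triple_mem hS hp (h4 (by rw [h2]; norm_num))).1
  omega

end SmallPoints

section Constants

variable {K : Type*} [Field K] [Algebra F₂ K] [hF : Fact (IsFunctionField F₂ K)]
  {S : Place F₂ K} {t s : K}

lemma Place.pow_eq_of_isAlgebraic (p : Place F₂ K) {a : K} (ha : IsAlgebraic F₂ a) :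
    a ^ 2 ^ deg₂ p = a := by
  have hm : a ∈ p.1 := p.mem_iff.2 (p.ord_eq_zero_of_isAlgebraic ha).ge
  by_contra hne
  have h0 : p.res (a ^ 2 ^ deg₂ p - a) = 0 := by
    rw [p.res_sub (pow_mem hm _) hm, p.res_pow hm, p.residue_pow_eq, sub_self]
  rw [p.res_eq_zero_iff (sub_mem (pow_mem hm _) hm), p.mem_V' (sub_ne_zero.2 hne),
    p.ord_eq_zero_of_isAlgebraic ((ha.pow _).sub ha)] at h0
  omega

lemma IsModel.pow_four_eq (h : IsModel t s) (hS : IsPole S t s) {a : K}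
    (ha : IsAlgebraic F₂ a) : a ^ 4 = a := by
  obtain ⟨P, hP, -⟩ := h.exists_quartic hS
  have h1 := S.pow_eq_of_isAlgebraic ha
  have h2 := P.pow_eq_of_isAlgebraic ha
  rw [hS.deg_eq] at h1
  rw [hP] at h2
  calc a ^ 4 = (a ^ 2 ^ 4) ^ 4 := by rw [h2]
    _ = a := by rw [← pow_mul]; exact h1

lemma IsModel.sq_add_ne (h : IsModel t s) (hS : IsPole S t s) {a : K}
    (ha : IsAlgebraic F₂ a) : a ^ 2 + a + 1 ≠ 0 := fun h0 => by
  have c2 := two_eq_zero K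
  have c2' : (2 : ResidueField S.1) = 0 := by
    have := S.charTwo_residueField
    exact CharTwo.two_eq_zero
  have hmem : ∀ {b : K}, IsAlgebraic F₂ b → ∀ p : Place F₂ K, b ∈ p.1 := fun hb p =>
    p.mem_iff.2 (p.ord_eq_zero_of_isAlgebraic hb).ge
  have ht0 := S.ne_zero_of_ord_ne_zero (f := t) (by rw [hS.ord_eq]; norm_num)
  have ht := (S.mem_V' ht0).2 hS.ord_eq.ge
  have ha1 : IsAlgebraic F₂ (a + 1) := ha.add isAlgebraic_one
  have hres : S.res a ^ 2 + S.res a + 1 = 0 := by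
    have := congrArg S.res h0
    rwa [S.res_add (add_mem (pow_mem (hmem ha S) 2) (hmem ha S)) (one_mem _),
      S.res_add (pow_mem (hmem ha S) 2) (hmem ha S), S.res_pow (hmem ha S),
      ← map_one (algebraMap F₂ K), S.res_const, map_one, ← map_zero (algebraMap F₂ K),
      S.res_const, map_zero] at this
  have hres1 : S.res (a + 1) = S.res a + 1 := by
    rw [S.res_add (hmem ha S) (one_mem _), ← map_one (algebraMap F₂ K), S.res_const, map_one]
  obtain ⟨b, hb, hb0, hbr⟩ : ∃ b, IsAlgebraic F₂ b ∧ b ^ 2 + b + 1 = 0 ∧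
      S.lead t s = S.res b := by
    have h1 : (S.lead t s - S.res a) * (S.lead t s - (S.res a + 1)) = 0 := by
      linear_combination hS.lead_sq + hres + (-S.lead t s - S.lead t s * S.res a - 1) * c2'
    rcases mul_eq_zero.1 h1 with h1 | h1
    · exact ⟨a, ha, h0, sub_eq_zero.1 h1⟩
    · exact ⟨a + 1, ha1, by linear_combination h0 + (a + 1) * c2,
        hres1 ▸ sub_eq_zero.1 h1⟩
  set y := s - b * t with hy
  have hbt : b * t ∈ S.V (-1) := by
    simpa using S.mul_mem_V (S.mem_V_zero.2 (hmem hb S)) ht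
  have hyS : y ∈ S.1 := by
    rw [← S.mem_V_zero, ← S.lead_eq_zero_iff hS.ord_eq (sub_mem hS.mem₂ hbt), Place.lead, sub_mul,
      S.res_sub (S.mul_inv_mem hS.ord_eq hS.mem₂) (S.mul_inv_mem hS.ord_eq hbt), mul_assoc,
      mul_inv_cancel₀ ht0, mul_one, ← hbr, Place.lead, sub_self]
  have hyalg : IsAlgebraic F₂ y := by
    by_contra hy
    obtain ⟨p, hp⟩ := exists_pole_of_transcendental hy
    have : y ∈ p.1 := by
      by_cases hpS : p = S
      · rwa [hpS]
      · obtain ⟨h1, h2⟩ := hS.regular p hpS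
        exact sub_mem h2 (mul_mem (hmem hb p) h1)
    rw [p.mem_iff] at this
    omega
  refine hS.lead_pow_four_ne ?_
  have hyt : y ^ 2 * t⁻¹ ∈ S.V 1 := by
    simpa using S.mul_mem_V (S.mem_V_zero.2 (pow_mem hyS 2)) (S.inv_mem_V hS.ord_eq)
  have hyt' := S.mem_V_zero.1 (S.V_anti zero_le_one hyt)
  have key : S.lead t N(t, s) = S.res y := by
    have e : N(t, s) * t⁻¹ = y ^ 2 * t⁻¹ + y := by
      field_simp
      rw [hy]
      linear_combination (-t ^ 2) * hb0 + (b * s * t + t ^ 2 + b * t ^ 2) * c2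
    rw [Place.lead, e, S.res_add hyt' hyS, (S.res_eq_zero_iff hyt').2 hyt, zero_add]
  rw [key, ← S.res_pow hyS, h.pow_four_eq hS hyalg]

lemma IsModel.hasExactConstants (h : IsModel t s) (hS : IsPole S t s) :
    HasExactConstants F₂ K := fun a ha => by
  have h1 : a * (a - 1) * (a ^ 2 + a + 1) = 0 := by linear_combination h.pow_four_eq hS ha
  rcases mul_eq_zero.1 h1 with h1 | h1
  · rcases mul_eq_zero.1 h1 with h1 | h1
    · exact ⟨0, by rw [h1, map_zero]⟩
    · exact ⟨1, by rw [map_one, sub_eq_zero.1 h1]⟩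
  · exact absurd h1 (h.sq_add_ne hS ha)

end Constants

section Invariants

variable {K : Type*} [Field K] [Algebra F₂ K] [hF : Fact (IsFunctionField F₂ K)]
  [hC : Fact (HasExactConstants F₂ K)] {S : Place F₂ K} {t s : K}

lemma IsPole.le_ell_single (hS : IsPole S t s) (n : ℕ) (hn : 2 ≤ n) :
    6 * n ≤ ell F₂ (single S (n : ℤ)) + 3 := by
  have hL : ∀ {f : K} {k : ℕ}, (∀ p, p ≠ S → f ∈ p.1) → f ∈ S.V (-k) →
      f ∈ L (single S (k : ℤ) : Divisor F₂ K) := fun h1 h2 => mem_L.2 fun p => by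
    by_cases hp : p = S
    · subst hp
      rwa [single_eq_same]
    · rw [single_eq_of_ne hp, neg_zero, p.mem_V_zero]
      exact h1 p hp
  have ht0 := S.ne_zero_of_ord_ne_zero (f := t) (by rw [hS.ord_eq]; norm_num)
  have h1 := (hS.isGraded.polyIndep.sum_le_ell (fun i => n + 1 - ![0, 1, 1, 2, 2, 3] i)
    (D := single S (n : ℤ)) fun i j hj => hL (fun p hp => ?_) ?_).1
  · simp [Fin.sum_univ_six] at h1
    omega
  · obtain ⟨h1, h2⟩ := hS.regular p hp
    have h3 := add_mem (add_mem (pow_mem h2 2) (mul_mem h1 h2)) (pow_mem h1 2)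
    refine mul_mem (pow_mem h1 j) ?_
    fin_cases i
    exacts [one_mem _, h2, h3, mul_mem h3 h2, pow_mem h3 2, mul_mem (pow_mem h3 2) h2]
  · have h2 := S.pow_mem_V ((S.mem_V' ht0).2 hS.ord_eq.ge) j
    have h3 := (S.mul_mem_V_iff (pow_ne_zero (![0, 1, 1, 2, 2, 3] i) (inv_ne_zero ht0))).1
      (mul_comm (basis t s i) _ ▸ hS.isGraded.mem i)
    rw [S.ord_pow, S.ord_inv, hS.ord_eq] at h3
    refine S.V_anti ?_ (S.mul_mem_V h2 h3)
    push_cast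
    omega

lemma IsPole.deg_le (hS : IsPole S t s) (D : Divisor F₂ K) :
    degHom F₂ K D + 1 - ell F₂ D ≤ 4 := by
  have hle := ell_le_add (le_sup_left : D ≤ D ⊔ 0)
  have h0 : 0 ≤ D ⊔ 0 := le_sup_right
  generalize D ⊔ 0 = E at hle h0
  obtain ⟨e, he⟩ := Int.eq_ofNat_of_zero_le (degHom_nonneg h0)
  have h1 := hS.le_ell_single (e + 2) (by omega)
  have hd : degHom F₂ K (single S ((e + 2 : ℕ) : ℤ)) = (e + 2 : ℕ) * 6 := by
    rw [degHom_single, hS.deg_eq]; rfl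
  generalize single S ((e + 2 : ℕ) : ℤ) = T at h1 hd
  have h2 := ell_le_add (sub_le_self T h0)
  rw [map_sub, hd, he] at h2
  obtain ⟨f, hf0, -, hf⟩ := exists_dv_of_ell_pos (F := F₂) (D := T - E) (by omega)
  have h3 := ell_le_add (show E ≤ T - dv f⁻¹ by
    rw [dv_inv, sub_neg_eq_add]
    exact sub_nonneg.1 (by convert hf using 1; abel))
  rw [ell_sub_dv _ (inv_ne_zero hf0), map_sub, degHom_dv, hd] at h3
  omega

lemma IsModel.eq_single (h : IsModel t s) (hS : IsPole S t s) {P : Place F₂ K}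
    (hP : ∀ p, p ≠ S → triple t s ∈ p.V 1 → p = P) {D : Divisor F₂ K} (hD : 0 ≤ D)
    (h4 : deg D = 4) : D = single P 1 := by
  obtain ⟨p, -, h1, h2⟩ := exists_single_le hD (by omega)
  have h3 : 0 ≤ deg (D - single p 1) := degHom_nonneg h1
  have hpS : p ≠ S := by
    rintro rfl
    have := hS.deg_eq
    omega
  obtain ⟨h5, h6⟩ := h.four_le_degree hS hpS
  rw [← hP p hpS (h6 (by omega))]
  exact sub_eq_zero.1 (eq_zero_of_degHom_eq_zero h1 (show deg _ = 0 by omega))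

lemma IsModel.genus_eq (h : IsModel t s) (hS : IsPole S t s) : genus F₂ K = 4 := by
  obtain ⟨P, h4, -, hP⟩ := h.exists_quartic hS
  have hd : degHom F₂ K (single P 1) = 4 := by rw [degHom_single, h4]; rfl
  have hle : ell F₂ (single P (1 : ℤ)) ≤ 1 := by
    by_contra hlt
    obtain ⟨x, hx, hxc⟩ := exists_not_mem_of_two_le_ell (not_le.1 hlt)
    have hx0 : x ≠ 0 := by rintro rfl; exact hxc (zero_mem _)
    have h1 := h.eq_single hS hP ((mem_L' hx0).1 hx) (by rw [deg, map_add, degHom_dv, hd]; rfl)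
    obtain ⟨c, hc⟩ := mem_const_of_ord_nonneg (F := F₂) (f := x) fun p => by
      rw [← dv_apply, add_eq_left.1 h1]; rfl
    exact hxc ⟨c, hc⟩
  have hge := hS.deg_le (single P 1)
  refine IsGreatest.csSup_eq ⟨⟨single P 1, ?_⟩, ?_⟩
  · rw [hd] at hge ⊢
    omega
  · rintro g ⟨D, hD⟩
    have := hS.deg_le D
    omega

lemma IsModel.classNumber_eq (h : IsModel t s) (hS : IsPole S t s) :
    classNumber F₂ K = 1 := by
  obtain ⟨P, h4, -, hP⟩ := h.exists_quartic hS
  refine AddSubgroup.index_eq_one.2 (eq_top_iff.2 fun D _ => ?_)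
  rw [AddSubgroup.mem_addSubgroupOf]
  have hD : degHom F₂ K D = 0 := D.2
  have hd : degHom F₂ K (D.1 + single P 1) = 4 := by
    rw [map_add, hD, degHom_single, h4]; rfl
  have h1 := hS.deg_le (D.1 + single P 1)
  obtain ⟨f, hf0, -, hf⟩ := exists_dv_of_ell_pos (F := F₂) (D := D.1 + single P 1)
    (by omega)
  have h2 := h.eq_single hS hP hf (by rw [deg, map_add, hd, degHom_dv]; rfl)
  have h3 : D.1 = dv f⁻¹ := by
    rw [dv_inv, eq_neg_iff_add_eq_zero]
    rwa [add_right_comm, add_eq_right] at h2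
  exact AddSubgroup.subset_closure ⟨f⁻¹, inv_ne_zero hf0, fun p => by rw [h3, dv_apply]; rfl⟩

end Invariants

lemma exists_genus_four_class_number_one : ∃ (K : Type) (_ : Field K) (_ : Algebra F₂ K),
    IsFunctionField F₂ K ∧ HasExactConstants F₂ K ∧
      genus F₂ K = 4 ∧ classNumber F₂ K = 1 := by
  obtain ⟨K, _, _, t, s, h⟩ := exists_isModel
  have : Fact (IsFunctionField F₂ K) := ⟨h.isFunctionField⟩
  obtain ⟨S, hS⟩ := h.exists_isPole
  have : Fact (HasExactConstants F₂ K) := ⟨h.hasExactConstants hS⟩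
  exact ⟨K, _, _, h.isFunctionField, h.hasExactConstants hS, h.genus_eq hS, h.classNumber_eq hS⟩

end CFF

open CFF in
/-- Up to isomorphism, there exists exactly one congruence function field with
exact field of constants `𝔽₂` having genus `4` and class number `1`. -/
theorem exists_unique_genus_four_class_number_one :
    (∃ (K : Type) (_ : Field K) (_ : Algebra (ZMod 2) K),
      IsFunctionField (ZMod 2) K ∧ HasExactConstants (ZMod 2) K ∧
        genus (ZMod 2) K = 4 ∧ classNumber (ZMod 2) K = 1) ∧
    (∀ (K K' : Type) (_ : Field K) (_ : Algebra (ZMod 2) K)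
        (_ : Field K') (_ : Algebra (ZMod 2) K'),
      IsFunctionField (ZMod 2) K → HasExactConstants (ZMod 2) K →
        genus (ZMod 2) K = 4 → classNumber (ZMod 2) K = 1 →
      IsFunctionField (ZMod 2) K' → HasExactConstants (ZMod 2) K' →
        genus (ZMod 2) K' = 4 → classNumber (ZMod 2) K' = 1 →
      Nonempty (K ≃+* K')) := by
  exact ⟨exists_genus_four_class_number_one, fun _ _ _ _ _ _ =>
    nonempty_ringEquiv_of_genus⟩
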